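/- Let c ∈ [1, 72/71) and h ∈ F_c. Then every A ⊆ P_h with positive relative upper density, i.e. limsup_{N→∞} |A ∩ [1,N]| / |P_h ∩ [1,N]| > 0, contains a nontrivial three-term arithmetic progression. -/

import Mathlib

open Filter Real Set
open scoped Classical

structure Fc (c : ℝ) where
  x₀ : ℝ
  one_le_x₀ : 1 ≤ x₀
  toFun : ℝ → ℝ
  vth : ℝ → ℝ
  Ch : ℝ
  Ch_pos : 0 < Ch
  one_le : ∀ x ≥ x₀, 1 ≤ toFun x
  contDiffOn : ContDiffOn ℝ 3 toFun (Set.Ici x₀)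
  deriv_pos : ∀ x ≥ x₀, 0 < deriv toFun x
  deriv2_pos : ∀ x ≥ x₀, 0 < iteratedDeriv 2 toFun x
  vth_contDiffOn : ContDiffOn ℝ 2 vth (Set.Ici x₀)
  eqn : ∀ x ≥ x₀, toFun x = Ch * x ^ c * Real.exp (∫ t in x₀..x, vth t / t)
  cond_gt : 1 < c →
    Filter.Tendsto vth Filter.atTop (nhds 0) ∧
    Filter.Tendsto (fun x => x * deriv vth x) Filter.atTop (nhds 0) ∧
    Filter.Tendsto (fun x => x ^ 2 * deriv (deriv vth) x) Filter.atTop (nhds 0)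
  cond_eq : c = 1 →
    (∀ x ≥ x₀, 0 < vth x) ∧
    (∀ x y, x₀ ≤ x → x ≤ y → vth y ≤ vth x) ∧
    (∀ ε : ℝ, 0 < ε → ∃ C > 0, ∀ x ≥ x₀, 1 / vth x ≤ C * x ^ ε) ∧
    Filter.Tendsto (fun x => x / toFun x) Filter.atTop (nhds 0) ∧
    Filter.Tendsto vth Filter.atTop (nhds 0) ∧
    Filter.Tendsto (fun x => x * deriv vth x / vth x) Filter.atTop (nhds 0) ∧
    Filter.Tendsto (fun x => x ^ 2 * deriv (deriv vth) x / vth x) Filter.atTop (nhds 0)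

def Ph {c : ℝ} (F : Fc c) : Set ℕ :=
  {p : ℕ | p.Prime ∧ ∃ n : ℕ, F.x₀ ≤ (n : ℝ) ∧ (p : ℤ) = ⌊F.toFun n⌋}

noncomputable def e (t : ℝ) : ℂ := Complex.exp (2 * Real.pi * Complex.I * t)

namespace RothPh

/-! ### The additive character `e` and elementary exponential sums -/

lemma e_add (s t : ℝ) : e (s + t) = e s * e t := by
  unfold e; rw [← Complex.exp_add]; congr 1; push_cast; ring

@[simp] lemma e_zero : e 0 = 1 := by simp [e]

lemma e_eq_exp_I (t : ℝ) : e t = Complex.exp (((2 * π * t : ℝ) : ℂ) * Complex.I) := by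
  unfold e; congr 1; push_cast; ring

@[simp] lemma norm_e (t : ℝ) : ‖e t‖ = 1 := by
  rw [e_eq_exp_I, Complex.norm_exp_ofReal_mul_I]

@[simp] lemma e_int (k : ℤ) : e (k : ℝ) = 1 := by
  unfold e
  rw [Complex.exp_eq_one_iff]
  exact ⟨k, by push_cast; ring⟩

@[simp] lemma e_nat (k : ℕ) : e (k : ℝ) = 1 := by
  have := e_int (k : ℤ); simpa using this

lemma e_neg (t : ℝ) : e (-t) = (e t)⁻¹ := by
  apply eq_inv_of_mul_eq_one_left; rw [← e_add]; simp

lemma e_sub (s t : ℝ) : e (s - t) = e s * (e t)⁻¹ := by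
  rw [sub_eq_add_neg, e_add, e_neg]

lemma conj_e (t : ℝ) : (starRingEnd ℂ) (e t) = e (-t) := by
  rw [e_neg, Complex.inv_eq_conj (norm_e t)]

lemma e_sub_int (t : ℝ) (k : ℤ) : e (t - k) = e t := by
  rw [e_sub, e_int]; simp

lemma e_nat_mul (k : ℕ) (t : ℝ) : e (k * t) = e t ^ k := by
  induction k with
  | zero => simp
  | succ k ih => push_cast; rw [add_mul, one_mul, e_add, ih, pow_succ]

/-- Distance to the nearest integer. -/
noncomputable def nd (t : ℝ) : ℝ := |t - round t|

lemma nd_nonneg (t : ℝ) : 0 ≤ nd t := abs_nonneg _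

lemma nd_le_half (t : ℝ) : nd t ≤ 1 / 2 := abs_sub_round t

lemma nd_le (t : ℝ) (k : ℤ) : nd t ≤ |t - k| := round_le t k

lemma norm_one_sub_e (t : ℝ) : ‖1 - e t‖ = 2 * |sin (π * t)| := by
  rw [norm_sub_rev]
  have := Complex.norm_exp_I_mul_ofReal_sub_one (2 * π * t)
  rw [e_eq_exp_I, mul_comm, this, norm_mul]
  simp only [Real.norm_eq_abs]
  rw [show 2 * π * t / 2 = π * t by ring]; norm_num

lemma four_mul_nd_le (t : ℝ) : 4 * nd t ≤ ‖1 - e t‖ := by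
  have h1 : e t = e (t - round t) := (e_sub_int t _).symm
  rw [h1, norm_one_sub_e]
  have h2 := Real.mul_abs_le_abs_sin (x := π * (t - round t)) (by
    rw [abs_mul, abs_of_pos pi_pos]
    have := abs_sub_round t
    nlinarith [pi_pos])
  rw [abs_mul, abs_of_pos pi_pos] at h2
  have h3 : 2 / π * (π * |t - round t|) = 2 * |t - round t| := by
    field_simp
  rw [h3] at h2
  unfold nd; linarith

/-- Geometric sums with frequency `θ` are bounded in terms of the distance to the integers. -/
lemma norm_geom_sum_mul_le (θ : ℝ) (a b : ℕ) :
    ‖∑ n ∈ Finset.Ico a b, e (n * θ)‖ * (2 * nd θ) ≤ 1 := by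
  rcases le_total b a with hab | hab
  · simp [Finset.Ico_eq_empty_of_le hab]
  have h1 : (∑ n ∈ Finset.Ico a b, e (n * θ)) * (1 - e θ) = e (a * θ) - e (b * θ) := by
    induction b, hab using Nat.le_induction with
    | base => simp
    | succ b hab ih =>
      rw [Finset.sum_Ico_succ_top hab, add_mul, ih]
      push_cast
      rw [add_mul (b : ℝ) 1 θ, one_mul, e_add]; ring
  have h2 : ‖∑ n ∈ Finset.Ico a b, e (n * θ)‖ * ‖1 - e θ‖ ≤ 2 := by
    rw [← norm_mul, h1]
    refine (norm_sub_le _ _).trans ?_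
    simp; norm_num
  have h3 := mul_le_mul_of_nonneg_left (four_mul_nd_le θ)
    (norm_nonneg (∑ n ∈ Finset.Ico a b, e (n * θ)))
  linarith

/-! ### The Kuzmin–Landau inequality -/

lemma inv_one_sub_e {x : ℝ} (h0 : 0 < x) (h1 : x < 1) :
    (1 - e x)⁻¹ = 1 / 2 + ((cos (π * x) / sin (π * x) / 2 : ℝ) : ℂ) * Complex.I := by
  have hs : 0 < sin (π * x) := sin_pos_of_pos_of_lt_pi (by positivity)
    (by nlinarith [pi_pos])
  have hs' : ((sin (π * x) : ℝ) : ℂ) ≠ 0 := by exact_mod_cast hs.ne'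
  have he : e x = ((cos (π * x) : ℝ) + (sin (π * x) : ℝ) * Complex.I) ^ 2 := by
    rw [e_eq_exp_I]
    have : ((2 * π * x : ℝ) : ℂ) * Complex.I = ((2 : ℕ) : ℂ) * (((π * x : ℝ) : ℂ) * Complex.I) := by
      push_cast; ring
    rw [this, Complex.exp_nat_mul, Complex.exp_mul_I]
    simp only [Complex.ofReal_cos, Complex.ofReal_sin]
  have hcs : ((cos (π * x) : ℝ) : ℂ) ^ 2 = 1 - ((sin (π * x) : ℝ) : ℂ) ^ 2 := by
    have := Real.cos_sq' (π * x)
    exact_mod_cast this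
  symm
  apply eq_inv_of_mul_eq_one_left
  rw [he]
  push_cast
  push_cast at hs' hcs
  generalize Complex.sin (π * x) = s at *
  generalize Complex.cos (π * x) = c at *
  have hI : Complex.I ^ 2 = -1 := Complex.I_sq
  have key : (s + c * Complex.I) * (1 - (c + s * Complex.I) ^ 2) = 2 * s := by
    linear_combination (-2 * c ^ 2 * s - c * s ^ 2 * Complex.I - s ^ 3) * hI +
      (s - c * Complex.I) * hcs
  have h2 : 1 / 2 + c / s / 2 * Complex.I = (s + c * Complex.I) / (2 * s) := by field_simp
  rw [h2, div_mul_eq_mul_div, key, div_self (mul_ne_zero two_ne_zero hs')]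

lemma cot_diff_nonneg {x y : ℝ} (h0 : 0 < x) (hxy : x ≤ y) (h1 : y < 1) :
    cos (π * y) / sin (π * y) ≤ cos (π * x) / sin (π * x) := by
  have hx : 0 < sin (π * x) := sin_pos_of_pos_of_lt_pi (by positivity) (by nlinarith [pi_pos])
  have hy : 0 < sin (π * y) := sin_pos_of_pos_of_lt_pi
    (mul_pos pi_pos (by linarith)) (by nlinarith [pi_pos])
  rw [div_le_div_iff₀ hy hx]
  have : 0 ≤ sin (π * y - π * x) := sin_nonneg_of_nonneg_of_le_pi
    (by nlinarith [pi_pos]) (by nlinarith [pi_pos])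
  rw [sin_sub] at this
  linarith

/-- **Kuzmin–Landau inequality** for sequences. -/
lemma kuzmin_landau (f : ℕ → ℝ) (a b : ℕ) (k : ℤ) {θ : ℝ} (hθ : 0 < θ)
    (hlo : ∀ n, a ≤ n → n < b → k + θ ≤ f (n + 1) - f n)
    (hhi : ∀ n, a ≤ n → n < b → f (n + 1) - f n ≤ k + 1 - θ)
    (hmono : ∀ n, a ≤ n → n + 1 < b → f (n + 1) - f n ≤ f (n + 2) - f (n + 1)) :
    ‖∑ n ∈ Finset.Ico a b, e (f n)‖ ≤ 1 / θ := by
  rcases le_or_gt b a with hab | hab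
  · simp [Finset.Ico_eq_empty_of_le hab]; exact hθ.le
  let g : ℕ → ℝ := fun n => f (n + 1) - f n - k
  let C : ℕ → ℂ := fun n => (1 - e (g n))⁻¹
  let c : ℕ → ℝ := fun n => cos (π * g n) / sin (π * g n) / 2
  have hg0 : ∀ n, a ≤ n → n < b → θ ≤ g n := fun n h1 h2 => by
    have := hlo n h1 h2; simp only [g]; linarith
  have hg1 : ∀ n, a ≤ n → n < b → g n ≤ 1 - θ := fun n h1 h2 => by
    have := hhi n h1 h2; simp only [g]; linarith
  have hC : ∀ n, a ≤ n → n < b → C n = 1 / 2 + (c n : ℂ) * Complex.I := fun n h1 h2 =>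
    inv_one_sub_e (by linarith [hg0 n h1 h2]) (by linarith [hg1 n h1 h2])
  have hCn : ∀ n, a ≤ n → n < b → ‖C n‖ ≤ 1 / (4 * θ) := fun n h1 h2 => by
    have h3 := four_mul_nd_le (g n)
    have h4 : θ ≤ nd (g n) := by
      unfold nd
      have l := hg0 n h1 h2
      have u := hg1 n h1 h2
      rcases le_or_gt (round (g n)) 0 with hr | hr
      · have : (round (g n) : ℝ) ≤ 0 := by exact_mod_cast hr
        rw [abs_of_nonneg (by linarith)]; linarith
      · have : (1 : ℝ) ≤ (round (g n) : ℝ) := by exact_mod_cast hr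
        rw [abs_of_nonpos (by linarith)]; linarith
    simp only [C, norm_inv]
    rw [← one_div]
    exact one_div_le_one_div_of_le (by linarith) (by linarith)
  have hcn : ∀ n, a ≤ n → n < b → |c n| ≤ 1 / (4 * θ) := fun n h1 h2 => by
    have h3 := Complex.abs_im_le_norm (C n)
    rw [hC n h1 h2] at h3
    have h4 : (1 / 2 + (c n : ℂ) * Complex.I).im = c n := by simp
    rw [h4, ← hC n h1 h2] at h3
    exact h3.trans (hCn n h1 h2)
  have hstep : ∀ n, a ≤ n → n < b → e (f n) = C n * (e (f n) - e (f (n + 1))) := fun n h1 h2 => by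
    have h3 : e (f (n + 1)) = e (f n) * e (g n) := by
      rw [← e_add]
      have : f n + g n = f (n + 1) - k := by simp only [g]; ring
      rw [this, e_sub_int]
    have h4 : 1 - e (g n) ≠ 0 := by
      intro h0
      have := four_mul_nd_le (g n)
      have h5 : C n = 0 := by simp [C, h0]
      rw [hC n h1 h2] at h5
      have := congrArg Complex.re h5
      simp at this
    rw [h3]; simp only [C]; field_simp
  have key : ∀ m, a + 1 ≤ m → m ≤ b →
      ‖(∑ n ∈ Finset.Ico a m, e (f n)) - (C a * e (f a) - C (m - 1) * e (f m))‖
        ≤ c a - c (m - 1) := by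
    intro m hm
    induction m, hm using Nat.le_induction with
    | base =>
      intro hb
      simp only [Nat.Ico_succ_singleton, Finset.sum_singleton, Nat.add_sub_cancel, sub_self]
      rw [hstep a le_rfl hab]
      rw [← hstep a le_rfl hab, ← mul_sub, ← hstep a le_rfl hab]; simp
    | succ m hm ih =>
      intro hb
      have ih' := ih (by omega)
      rw [Finset.sum_Ico_succ_top (by omega)]
      simp only [Nat.add_sub_cancel]
      have h1 : (∑ n ∈ Finset.Ico a m, e (f n)) + e (f m) - (C a * e (f a) - C m * e (f (m + 1)))
          = ((∑ n ∈ Finset.Ico a m, e (f n)) - (C a * e (f a) - C (m - 1) * e (f m)))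
            + (C m - C (m - 1)) * e (f m) := by
        have := hstep m (by omega) (by omega)
        linear_combination this
      have h2 : ‖C m - C (m - 1)‖ = c (m - 1) - c m := by
        rw [hC m (by omega) (by omega), hC (m - 1) (by omega) (by omega)]
        have : (1 / 2 + (c m : ℂ) * Complex.I) - (1 / 2 + (c (m - 1) : ℂ) * Complex.I)
          = ((c m - c (m - 1) : ℝ) : ℂ) * Complex.I := by push_cast; ring
        rw [this, norm_mul, Complex.norm_I, mul_one, Complex.norm_real, Real.norm_eq_abs,
          abs_sub_comm, abs_of_nonneg]
        have hmm : g (m - 1) ≤ g m := by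
          have := hmono (m - 1) (by omega) (by omega)
          simp only [g]
          rw [show m - 1 + 2 = m + 1 by omega] at this
          rw [show m - 1 + 1 = m by omega] at *
          linarith
        have := cot_diff_nonneg (x := g (m - 1)) (y := g m)
          (by linarith [hg0 (m - 1) (by omega) (by omega)]) hmm
          (by linarith [hg1 m (by omega) (by omega)])
        simp only [c]; linarith
      rw [h1]
      refine (norm_add_le _ _).trans ?_
      rw [norm_mul, norm_e, mul_one, h2]
      linarith
  have hk := key b (by omega) le_rfl
  have h1 := hcn a le_rfl hab
  have h2 := hcn (b - 1) (by omega) (by omega)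
  have h3 := hCn a le_rfl hab
  have h4 := hCn (b - 1) (by omega) (by omega)
  have h5 : ‖∑ n ∈ Finset.Ico a b, e (f n)‖ ≤
      (c a - c (b - 1)) + (‖C a‖ + ‖C (b - 1)‖) := by
    have h6 : ‖C a * e (f a) - C (b - 1) * e (f b)‖ ≤ ‖C a‖ + ‖C (b - 1)‖ := by
      refine (norm_sub_le _ _).trans ?_
      simp
    calc ‖∑ n ∈ Finset.Ico a b, e (f n)‖ = ‖((∑ n ∈ Finset.Ico a b, e (f n)) -
          (C a * e (f a) - C (b - 1) * e (f b))) + (C a * e (f a) - C (b - 1) * e (f b))‖ := by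
            rw [sub_add_cancel]
      _ ≤ _ := (norm_add_le _ _).trans (add_le_add hk h6)
  have h6 : 1 / θ = 4 * (1 / (4 * θ)) := by field_simp
  rw [h6]
  have := abs_le.1 h1
  have := abs_le.1 h2
  linarith

/-! ### Van der Corput's second derivative test -/

/-- The part of an interval where a monotone sequence lies in an order-connected set
is an interval. -/
lemma filter_Ico_eq_Ico {g : ℕ → ℝ} {a b : ℕ}
    (hg : ∀ m n, a ≤ m → m ≤ n → n < b → g m ≤ g n) (s : Set ℝ) (hs : s.OrdConnected) :
    ∃ a' b', a ≤ a' ∧ b' ≤ b ∧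
      (Finset.Ico a b).filter (fun n => g n ∈ s) = Finset.Ico a' b' := by
  set F := (Finset.Ico a b).filter (fun n => g n ∈ s) with hF
  rcases F.eq_empty_or_nonempty with h | h
  · exact ⟨b + a, b, by omega, le_rfl, by rw [h, Finset.Ico_eq_empty_of_le (by omega)]⟩
  have hmin := Finset.mem_filter.1 (F.min'_mem h)
  have hmax := Finset.mem_filter.1 (F.max'_mem h)
  rw [Finset.mem_Ico] at hmin hmax
  refine ⟨F.min' h, F.max' h + 1, hmin.1.1, by omega, ?_⟩
  ext n
  rw [Finset.mem_Ico]
  constructor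
  · intro hn
    exact ⟨F.min'_le n hn, Nat.lt_succ_of_le (F.le_max' n hn)⟩
  · rintro ⟨h1, h2⟩
    rw [hF, Finset.mem_filter, Finset.mem_Ico]
    refine ⟨⟨by omega, by omega⟩, hs.out hmin.2 hmax.2 ⟨?_, ?_⟩⟩
    · exact hg _ _ hmin.1.1 h1 (by omega)
    · exact hg _ _ (by omega) (by omega) hmax.1.2

lemma card_le_of_increments {g : ℕ → ℝ} {a b : ℕ} {lam x θ : ℝ} (hlam : 0 < lam) (hθ : 0 ≤ θ)
    (hg : ∀ n, a ≤ n → n + 1 < b → g n + lam ≤ g (n + 1))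
    (hx : ∀ n, a ≤ n → n < b → x ≤ g n ∧ g n ≤ x + θ) :
    ((Finset.Ico a b).card : ℝ) ≤ θ / lam + 1 := by
  rcases le_or_gt b a with hab | hab
  · rw [Finset.Ico_eq_empty_of_le hab]; simp; positivity
  have key : ∀ m, a ≤ m → m < b → g a + (m - a : ℝ) * lam ≤ g m := by
    intro m hm
    induction m, hm using Nat.le_induction with
    | base => intro _; simp
    | succ m hm ih =>
      intro hb
      have := ih (by omega)
      have := hg m hm hb
      push_cast; linarith
  have h1 := key (b - 1) (by omega) (by omega)
  have h2 := (hx a le_rfl hab).1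
  have h3 := (hx (b - 1) (by omega) (by omega)).2
  rw [Nat.card_Ico, Nat.cast_sub hab.le]
  rw [Nat.cast_sub (by omega)] at h1
  have h4 : ((b : ℝ) - 1 - a) ≤ θ / lam := by
    rw [le_div_iff₀ hlam]; push_cast at h1; linarith
  linarith

/-- **Van der Corput's second derivative test** for sequences whose second differences
lie in `[lam, h * lam]`. -/
theorem second_derivative_test (f : ℕ → ℝ) (a b : ℕ) {lam h : ℝ} (hlam : 0 < lam)
    (hlam1 : lam ≤ 1)
    (hlo : ∀ n, a ≤ n → n + 2 < b → lam ≤ f (n + 2) - 2 * f (n + 1) + f n)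
    (hhi : ∀ n, a ≤ n → n + 2 < b → f (n + 2) - 2 * f (n + 1) + f n ≤ h * lam)
    (hh : 0 ≤ h) :
    ‖∑ n ∈ Finset.Ico a b, e (f n)‖ ≤ 16 * (h * lam * (b - a : ℕ) + 1) / √lam := by
  have hsq : 0 < √lam := Real.sqrt_pos.2 hlam
  have hsq1 : √lam ≤ 1 := Real.sqrt_le_one.2 hlam1
  have hss : √lam * √lam = lam := Real.mul_self_sqrt hlam.le
  have hL : (0 : ℝ) ≤ h * lam * (b - a : ℕ) := by positivity
  have hinv : 1 ≤ 1 / √lam := by rw [le_div_iff₀ hsq]; linarith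
  have hdiv : 16 * (h * lam * (b - a : ℕ) + 1) / √lam
      = 16 * (h * lam * (b - a : ℕ) + 1) * (1 / √lam) := by ring
  rcases lt_or_ge b (a + 2) with hab | hab
  · have : ‖∑ n ∈ Finset.Ico a b, e (f n)‖ ≤ 1 := by
      refine (norm_sum_le _ _).trans ?_
      simp only [norm_e, Finset.sum_const, Nat.card_Ico, nsmul_eq_mul, mul_one]
      have : b - a ≤ 1 := by omega
      exact_mod_cast this
    rw [hdiv]; nlinarith
  obtain ⟨b, rfl⟩ : ∃ b', b = b' + 1 := ⟨b - 1, by omega⟩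
  have hab' : a < b := by omega
  let g : ℕ → ℝ := fun n => f (n + 1) - f n
  have hinc : ∀ n, a ≤ n → n + 1 < b → g n + lam ≤ g (n + 1) := fun n h1 h2 => by
    have := hlo n h1 (by omega); simp only [g]; linarith
  have hinc2 : ∀ n, a ≤ n → n + 1 < b → g (n + 1) ≤ g n + h * lam := fun n h1 h2 => by
    have := hhi n h1 (by omega); simp only [g]; linarith
  have hmono : ∀ m n, a ≤ m → m ≤ n → n < b → g m ≤ g n := by
    intro m n hm hmn
    induction n, hmn using Nat.le_induction with
    | base => intro _; exact le_rfl
    | succ n hmn ih =>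
      intro hb
      exact (ih (by omega)).trans (by linarith [hinc n (by omega) hb])
  have hrise : ∀ m, a ≤ m → m < b → g m ≤ g a + (m - a : ℝ) * (h * lam) := by
    intro m hm
    induction m, hm using Nat.le_induction with
    | base => intro _; simp
    | succ m hm ih =>
      intro hb
      have := ih (by omega)
      have := hinc2 m hm hb
      push_cast; linarith
  rw [Finset.sum_Ico_succ_top hab'.le]
  set θ : ℝ := √lam / 2 with hθ
  have hθ0 : 0 < θ := by positivity
  have hfib : ∀ k : ℤ, ‖∑ n ∈ (Finset.Ico a b).filter (fun n => ⌊g n⌋ = k), e (f n)‖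
      ≤ 5 / √lam := by
    intro k
    obtain ⟨a1, b1, ha1, hb1, h1⟩ := filter_Ico_eq_Ico hmono (Set.Ico (k : ℝ) (k + θ))
      Set.ordConnected_Ico
    obtain ⟨a2, b2, ha2, hb2, h2⟩ := filter_Ico_eq_Ico hmono (Set.Icc (k + θ : ℝ) (k + 1 - θ))
      Set.ordConnected_Icc
    obtain ⟨a3, b3, ha3, hb3, h3⟩ := filter_Ico_eq_Ico hmono (Set.Ioo (k + 1 - θ : ℝ) (k + 1))
      Set.ordConnected_Ioo
    have hsplit : (Finset.Ico a b).filter (fun n => ⌊g n⌋ = k) =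
        ((Finset.Ico a1 b1) ∪ (Finset.Ico a2 b2)) ∪ Finset.Ico a3 b3 := by
      rw [← h1, ← h2, ← h3]
      ext n
      simp only [Finset.mem_union, Finset.mem_filter, Int.floor_eq_iff, Set.mem_Ico, Set.mem_Icc,
        Set.mem_Ioo]
      constructor
      · rintro ⟨hn, hk1, hk2⟩
        rcases lt_or_ge (g n) (k + θ) with h | h
        · exact Or.inl (Or.inl ⟨hn, hk1, h⟩)
        · rcases le_or_gt (g n) (k + 1 - θ) with h' | h'
          · exact Or.inl (Or.inr ⟨hn, h, h'⟩)
          · exact Or.inr ⟨hn, h', hk2⟩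
      · rintro ((⟨hn, h, h'⟩ | ⟨hn, h, h'⟩) | ⟨hn, h, h'⟩)
        · exact ⟨hn, h, by linarith⟩
        · exact ⟨hn, by linarith, by linarith⟩
        · exact ⟨hn, by linarith, by linarith⟩
    have hm1 : ∀ n, a1 ≤ n → n < b1 → k ≤ g n ∧ g n < k + θ := fun n p q => by
      have : n ∈ Finset.Ico a1 b1 := Finset.mem_Ico.2 ⟨p, q⟩
      simp only [← h1, Finset.mem_filter, Set.mem_Ico] at this
      exact this.2
    have hm2 : ∀ n, a2 ≤ n → n < b2 → k + θ ≤ g n ∧ g n ≤ k + 1 - θ := fun n p q => by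
      have : n ∈ Finset.Ico a2 b2 := Finset.mem_Ico.2 ⟨p, q⟩
      simp only [← h2, Finset.mem_filter, Set.mem_Icc] at this
      exact this.2
    have hm3 : ∀ n, a3 ≤ n → n < b3 → k + 1 - θ < g n ∧ g n < k + 1 := fun n p q => by
      have : n ∈ Finset.Ico a3 b3 := Finset.mem_Ico.2 ⟨p, q⟩
      simp only [← h3, Finset.mem_filter, Set.mem_Ioo] at this
      exact this.2
    have hd1 : Disjoint (Finset.Ico a1 b1) (Finset.Ico a2 b2) := by
      rw [Finset.disjoint_left]
      intro n p q
      rw [Finset.mem_Ico] at p q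
      linarith [(hm1 n p.1 p.2).2, (hm2 n q.1 q.2).1]
    have hd2 : Disjoint ((Finset.Ico a1 b1) ∪ (Finset.Ico a2 b2)) (Finset.Ico a3 b3) := by
      rw [Finset.disjoint_left]
      intro n p q
      rw [Finset.mem_union, Finset.mem_Ico, Finset.mem_Ico] at p
      rw [Finset.mem_Ico] at q
      have q3 := (hm3 n q.1 q.2).1
      rcases p with p | p
      · have := (hm1 n p.1 p.2).2
        linarith
      · linarith [(hm2 n p.1 p.2).2]
    rw [hsplit, Finset.sum_union hd2, Finset.sum_union hd1]
    have htriv : ∀ s : Finset ℕ, ‖∑ n ∈ s, e (f n)‖ ≤ s.card := fun s => by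
      refine (norm_sum_le _ _).trans ?_
      simp
    have c1 : ‖∑ n ∈ Finset.Ico a1 b1, e (f n)‖ ≤ θ / lam + 1 :=
      (htriv _).trans (card_le_of_increments (x := k) hlam hθ0.le
        (fun n p q => hinc n (by omega) (by omega))
        (fun n p q => ⟨(hm1 n p q).1, (hm1 n p q).2.le⟩))
    have c3 : ‖∑ n ∈ Finset.Ico a3 b3, e (f n)‖ ≤ θ / lam + 1 :=
      (htriv _).trans (card_le_of_increments (x := k + 1 - θ) hlam hθ0.le
        (fun n p q => hinc n (by omega) (by omega))
        (fun n p q => ⟨(hm3 n p q).1.le, by linarith [(hm3 n p q).2]⟩))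
    have c2 : ‖∑ n ∈ Finset.Ico a2 b2, e (f n)‖ ≤ 1 / θ :=
      kuzmin_landau f a2 b2 k hθ0 (fun n p q => (hm2 n p q).1) (fun n p q => (hm2 n p q).2)
        (fun n p q => by
          have := hinc n (by omega) (by omega)
          simp only [g] at this
          linarith)
    have e1 : θ / lam = 1 / √lam / 2 := by
      rw [hθ, ← hss]; field_simp; simp [Real.sqrt_sq hsq.le]
    have e2 : 1 / θ = 2 * (1 / √lam) := by rw [hθ]; field_simp
    have e3 : 5 / √lam = 5 * (1 / √lam) := by ring
    rw [e1] at c1 c3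
    rw [e2] at c2
    rw [e3]
    refine (norm_add_le _ _).trans ?_
    have := norm_add_le (∑ n ∈ Finset.Ico a1 b1, e (f n)) (∑ n ∈ Finset.Ico a2 b2, e (f n))
    linarith
  have hmaps : ∀ n ∈ Finset.Ico a b, ⌊g n⌋ ∈ Finset.Icc ⌊g a⌋ ⌊g (b - 1)⌋ := by
    intro n hn
    rw [Finset.mem_Ico] at hn
    rw [Finset.mem_Icc]
    exact ⟨Int.floor_mono (hmono a n le_rfl hn.1 hn.2),
      Int.floor_mono (hmono n (b - 1) hn.1 (by omega) (by omega))⟩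
  have hsum := Finset.sum_fiberwise_of_maps_to hmaps (fun n => e (f n))
  have hmain : ‖∑ n ∈ Finset.Ico a b, e (f n)‖ ≤
      (h * lam * (b + 1 - a : ℕ) + 2) * (5 / √lam) := by
    rw [← hsum]
    refine (norm_sum_le _ _).trans ?_
    refine (Finset.sum_le_sum (fun k _ => hfib k)).trans ?_
    rw [Finset.sum_const, nsmul_eq_mul]
    refine mul_le_mul_of_nonneg_right ?_ (by positivity)
    rw [Int.card_Icc]
    have hle : ⌊g a⌋ ≤ ⌊g (b - 1)⌋ := Int.floor_mono (hmono a (b - 1) le_rfl (by omega) (by omega))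
    have h1 : (((⌊g (b - 1)⌋ + 1 - ⌊g a⌋).toNat : ℕ) : ℝ) = (⌊g (b - 1)⌋ : ℝ) + 1 - ⌊g a⌋ := by
      have : ((⌊g (b - 1)⌋ + 1 - ⌊g a⌋).toNat : ℤ) = ⌊g (b - 1)⌋ + 1 - ⌊g a⌋ :=
        Int.toNat_of_nonneg (by omega)
      exact_mod_cast this
    rw [h1]
    have h2 := Int.floor_le (g (b - 1))
    have h3 := Int.lt_floor_add_one (g a)
    have h4 := hrise (b - 1) (by omega) (by omega)
    have h5 : ((b - 1 : ℕ) - a : ℝ) * (h * lam) ≤ h * lam * (b + 1 - a : ℕ) := by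
      rw [mul_comm]
      refine mul_le_mul_of_nonneg_left ?_ (by positivity)
      rw [Nat.cast_sub (by omega), Nat.cast_sub (by omega)]
      push_cast; linarith
    linarith
  have hlast : ‖e (f b)‖ ≤ 1 / √lam := by rw [norm_e]; exact hinv
  refine (norm_add_le _ _).trans ((add_le_add hmain hlast).trans ?_)
  rw [hdiv, show 5 / √lam = 5 * (1 / √lam) by ring]
  nlinarith

/-! ### Vaughan's identity -/

open ArithmeticFunction ArithmeticFunction.Moebius ArithmeticFunction.zeta in
/-- Restriction of an arithmetic function to the integers satisfying a predicate. -/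
noncomputable def arithRestrict (f : ArithmeticFunction ℝ) (P : ℕ → Prop) : ArithmeticFunction ℝ :=
  ⟨fun n => if P n then f n else 0, by simp⟩

lemma arithRestrict_apply (f : ArithmeticFunction ℝ) (P : ℕ → Prop) (n : ℕ) :
    arithRestrict f P n = if P n then f n else 0 := rfl

lemma arithRestrict_add_not (f : ArithmeticFunction ℝ) (P : ℕ → Prop) :
    arithRestrict f P + arithRestrict f (fun n => ¬ P n) = f := by
  ext n
  simp only [ArithmeticFunction.add_apply, arithRestrict_apply]
  by_cases h : P n <;> simp [h]

open ArithmeticFunction ArithmeticFunction.Moebius ArithmeticFunction.zeta in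
/-- **Vaughan's identity**. -/
theorem vaughan_identity (P : ℕ → Prop) :
    Λ = arithRestrict Λ P + arithRestrict (μ : ArithmeticFunction ℝ) P * ArithmeticFunction.log
      - arithRestrict (μ : ArithmeticFunction ℝ) P * arithRestrict Λ P * ζ
      + arithRestrict (μ : ArithmeticFunction ℝ) (fun n => ¬ P n) *
        (arithRestrict Λ (fun n => ¬ P n) * ζ) := by
  have h1 := arithRestrict_add_not Λ P
  have h2 := arithRestrict_add_not (μ : ArithmeticFunction ℝ) P
  have h3 : (μ : ArithmeticFunction ℝ) * (ζ : ArithmeticFunction ℝ) = 1 := coe_moebius_mul_coe_zeta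
  have h4 : Λ * (ζ : ArithmeticFunction ℝ) = ArithmeticFunction.log := vonMangoldt_mul_zeta
  set L1 := arithRestrict Λ P
  set L2 := arithRestrict Λ (fun n => ¬ P n)
  set M1 := arithRestrict (μ : ArithmeticFunction ℝ) P
  set M2 := arithRestrict (μ : ArithmeticFunction ℝ) (fun n => ¬ P n)
  rw [← h4, ← h1]
  rw [← h2] at h3
  linear_combination (-L2) * h3

lemma sum_convolution_mul (f g : ArithmeticFunction ℝ) (F : ℕ → ℂ) (N : ℕ)
    (hF : ∀ n, N < n → F n = 0) :
    ∑ n ∈ Finset.Ioc 0 N, ((f * g) n : ℂ) * F n =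
      ∑ k ∈ Finset.Ioc 0 N, ∑ m ∈ Finset.Ioc 0 N, (f k : ℂ) * (g m : ℂ) * F (k * m) := by
  have : ∀ n ∈ Finset.Ioc 0 N, ((f * g) n : ℂ) * F n =
      ∑ x ∈ (Finset.Ioc 0 N ×ˢ Finset.Ioc 0 N), if x.1 * x.2 = n then
        (f x.1 : ℂ) * (g x.2 : ℂ) * F (x.1 * x.2) else 0 := by
    intro n hn
    rw [Finset.mem_Ioc] at hn
    rw [ArithmeticFunction.mul_apply,
      Nat.divisorsAntidiagonal_eq_prod_filter_of_le hn.1.ne' hn.2, ← Finset.sum_filter]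
    push_cast
    rw [Finset.sum_mul]
    refine Finset.sum_congr (by ext; simp) fun x hx => ?_
    rw [(Finset.mem_filter.1 hx).2]
  rw [Finset.sum_congr rfl this, Finset.sum_comm, Finset.sum_product]
  refine Finset.sum_congr rfl fun k hk => Finset.sum_congr rfl fun m hm => ?_
  rw [Finset.mem_Ioc] at hk hm
  rw [Finset.sum_ite_eq]
  split_ifs with h
  · rfl
  · rw [hF _ ?_, mul_zero]
    have : 0 < k * m := Nat.mul_pos hk.1 hm.1
    simp only [Finset.mem_Ioc, not_and, not_le] at h
    exact h this

/-- Partial summation against a nonnegative nondecreasing weight. -/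
lemma norm_sum_monotone_mul_le (w : ℕ → ℝ) (z : ℕ → ℂ) (N : ℕ) {B : ℝ}
    (hw : Monotone w) (hw0 : 0 ≤ w 0)
    (hB : ∀ c, ‖∑ m ∈ Finset.Ioc c N, z m‖ ≤ B) :
    ‖∑ m ∈ Finset.Ioc 0 N, (w m : ℂ) * z m‖ ≤ w N * B := by
  have key : ∀ c, c ≤ N → ∑ m ∈ Finset.Ioc c N, (w m : ℂ) * z m =
      (w c : ℂ) * ∑ m ∈ Finset.Ioc c N, z m +
      ∑ i ∈ Finset.Ico c N, ((w (i + 1) - w i : ℝ) : ℂ) * ∑ m ∈ Finset.Ioc i N, z m := by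
    intro c hc
    induction hc using Nat.decreasingInduction with
    | self => simp
    | of_succ c hc ih =>
      have hI : Finset.Ioc c N = insert (c + 1) (Finset.Ioc (c + 1) N) := by
        ext x; simp only [Finset.mem_Ioc, Finset.mem_insert]; omega
      have hnot : c + 1 ∉ Finset.Ioc (c + 1) N := by simp
      rw [Finset.sum_eq_sum_Ico_succ_bot hc, hI, Finset.sum_insert hnot, Finset.sum_insert hnot, ih]
      push_cast
      ring
  rw [key 0 (Nat.zero_le _)]
  have hBn : 0 ≤ B := (norm_nonneg _).trans (hB 0)
  refine (norm_add_le _ _).trans ?_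
  have h1 : ‖(w 0 : ℂ) * ∑ m ∈ Finset.Ioc 0 N, z m‖ ≤ w 0 * B := by
    rw [norm_mul, Complex.norm_real, Real.norm_of_nonneg hw0]
    exact mul_le_mul_of_nonneg_left (hB 0) hw0
  have h2 : ‖∑ i ∈ Finset.Ico 0 N, ((w (i + 1) - w i : ℝ) : ℂ) * ∑ m ∈ Finset.Ioc i N, z m‖
      ≤ ∑ i ∈ Finset.range N, (w (i + 1) - w i) * B := by
    rw [← Finset.range_eq_Ico]
    refine (norm_sum_le _ _).trans (Finset.sum_le_sum fun i _ => ?_)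
    have : 0 ≤ w (i + 1) - w i := sub_nonneg.2 (hw (Nat.le_succ i))
    rw [norm_mul, Complex.norm_real, Real.norm_of_nonneg this]
    exact mul_le_mul_of_nonneg_left (hB i) this
  rw [← Finset.sum_mul, Finset.sum_range_sub] at h2
  linarith

open ArithmeticFunction ArithmeticFunction.Moebius ArithmeticFunction.zeta in
/-- Reduction of a sum over primes to linear and bilinear sums. -/
theorem vaughan_bound (F : ℕ → ℂ) (N U s : ℕ) (hU : 1 ≤ U)
    (hF : ∀ n, n ≤ U ∨ N < n → F n = 0) (hUs : U ≤ s) (hsN : s ≤ N)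
    (hs : N < (s + 1) * (s + 1)) {B₁ B₂ : ℝ}
    (hI : ∀ k, 1 ≤ k → k ≤ U * U → ∀ c, ‖∑ m ∈ Finset.Ioc c N, F (k * m)‖ ≤ B₁)
    (hII : ∀ a b : ℕ → ℝ, (∀ k, |a k| ≤ 1) → (∀ m, |b m| ≤ 1) →
      ‖∑ k ∈ Finset.Ioc U s, ∑ m ∈ Finset.Ioc U N, (a k : ℂ) * (b m : ℂ) * F (k * m)‖ ≤ B₂) :
    ‖∑ n ∈ Finset.Ioc 0 N, (Λ n : ℂ) * F n‖ ≤ Real.log N * (2 * (U * U * B₁) + 2 * B₂) := by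
  set P : ℕ → Prop := fun n => n ≤ U with hP
  set L1 := arithRestrict Λ P with hL1
  set L2 := arithRestrict Λ (fun n => ¬ P n) with hL2
  set M1 := arithRestrict (μ : ArithmeticFunction ℝ) P with hM1
  set M2 := arithRestrict (μ : ArithmeticFunction ℝ) (fun n => ¬ P n) with hM2
  have hlogN : 0 ≤ Real.log N := Real.log_natCast_nonneg N
  have hB1 : 0 ≤ B₁ := (norm_nonneg _).trans (hI 1 le_rfl (Nat.mul_pos hU hU) 0)
  have hF' : ∀ n, N < n → F n = 0 := fun n hn => hF n (Or.inr hn)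
  have hmu : ∀ n : ℕ, |((μ : ArithmeticFunction ℝ) n)| ≤ 1 := fun n => by
    rw [ArithmeticFunction.intCoe_apply]
    exact_mod_cast abs_moebius_le_one
  have hM1le : ∀ n, |M1 n| ≤ 1 := fun n => by
    rw [hM1, arithRestrict_apply]; split_ifs
    · exact hmu n
    · simp
  have hM2le : ∀ n, |M2 n| ≤ 1 := fun n => by
    rw [hM2, arithRestrict_apply]; split_ifs
    · simp
    · exact hmu n
  have hL1le : ∀ n, |L1 n| ≤ Λ n := fun n => by
    rw [hL1, arithRestrict_apply]; split_ifs
    · rw [abs_of_nonneg vonMangoldt_nonneg]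
    · simp [vonMangoldt_nonneg]
  have hL2nn : ∀ n, 0 ≤ L2 n := fun n => by
    rw [hL2, arithRestrict_apply]; split_ifs
    · exact le_rfl
    · exact vonMangoldt_nonneg
  have hL2le : ∀ n, L2 n ≤ Λ n := fun n => by
    rw [hL2, arithRestrict_apply]; split_ifs
    · exact vonMangoldt_nonneg
    · exact le_rfl
  -- the coefficients of the triple convolution
  set g := M1 * L1 with hg
  have hgle : ∀ n ∈ Finset.Ioc 0 N, |g n| ≤ Real.log N := by
    intro n hn
    rw [Finset.mem_Ioc] at hn
    rw [hg, mul_apply]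
    calc |∑ x ∈ n.divisorsAntidiagonal, M1 x.1 * L1 x.2|
        ≤ ∑ x ∈ n.divisorsAntidiagonal, Λ x.2 := by
          refine (Finset.abs_sum_le_sum_abs _ _).trans (Finset.sum_le_sum fun x _ => ?_)
          rw [abs_mul]
          calc |M1 x.1| * |L1 x.2| ≤ 1 * Λ x.2 :=
                mul_le_mul (hM1le _) (hL1le _) (abs_nonneg _) zero_le_one
            _ = _ := one_mul _
      _ = Real.log n := by
          rw [Nat.sum_divisorsAntidiagonal' (fun _ y => Λ y), vonMangoldt_sum]
      _ ≤ Real.log N := Real.log_le_log (by exact_mod_cast hn.1) (by exact_mod_cast hn.2)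
  have hg0 : ∀ n, U * U < n → g n = 0 := by
    intro n hn
    rw [hg, mul_apply]
    refine Finset.sum_eq_zero fun x hx => ?_
    rw [Nat.mem_divisorsAntidiagonal] at hx
    rw [hM1, hL1, arithRestrict_apply, arithRestrict_apply]
    by_cases h1 : P x.1
    · by_cases h2 : P x.2
      · exact absurd (Nat.mul_le_mul h1 h2) (by rw [hx.1]; omega)
      · simp [h2]
    · simp [h1]
  -- the coefficients of the bilinear sum
  set b := L2 * (ζ : ArithmeticFunction ℝ) with hb
  have hb_eq : ∀ n, b n = ∑ i ∈ n.divisors, L2 i := fun n => by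
    rw [hb]; exact coe_mul_zeta_apply
  have hble : ∀ n ∈ Finset.Ioc 0 N, |b n| ≤ Real.log N := by
    intro n hn
    rw [Finset.mem_Ioc] at hn
    rw [hb_eq, abs_of_nonneg (Finset.sum_nonneg fun i _ => hL2nn i)]
    calc ∑ i ∈ n.divisors, L2 i ≤ ∑ i ∈ n.divisors, Λ i := Finset.sum_le_sum fun i _ => hL2le i
      _ = Real.log n := vonMangoldt_sum
      _ ≤ Real.log N := Real.log_le_log (by exact_mod_cast hn.1) (by exact_mod_cast hn.2)
  have hb0 : ∀ n, n ≤ U → b n = 0 := by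
    intro n hn
    rw [hb_eq]
    refine Finset.sum_eq_zero fun i hi => ?_
    rw [hL2, arithRestrict_apply, if_neg]
    exact not_not.2 ((Nat.divisor_le hi).trans hn)
  have hM20 : ∀ n, n ≤ U → M2 n = 0 := by
    intro n hn
    rw [hM2, arithRestrict_apply, if_neg]
    exact not_not.2 hn
  have hsub : ∀ (c d : ℕ) (z : ℕ → ℂ), d ≤ N → (∀ n, n ≤ c ∨ d < n → z n = 0) →
      ∑ n ∈ Finset.Ioc 0 N, z n = ∑ n ∈ Finset.Ioc c d, z n := by
    intro c d z hd hz
    symm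
    refine Finset.sum_subset (fun x => ?_) fun x hx hx' => hz x ?_
    · simp only [Finset.mem_Ioc]; omega
    · simp only [Finset.mem_Ioc] at hx hx'; omega
  -- the four pieces
  have hid : ∑ n ∈ Finset.Ioc 0 N, (Λ n : ℂ) * F n =
      ∑ n ∈ Finset.Ioc 0 N, (L1 n : ℂ) * F n +
      ∑ n ∈ Finset.Ioc 0 N, ((M1 * ArithmeticFunction.log) n : ℂ) * F n -
      ∑ n ∈ Finset.Ioc 0 N, ((g * (ζ : ArithmeticFunction ℝ)) n : ℂ) * F n +
      ∑ n ∈ Finset.Ioc 0 N, ((M2 * b) n : ℂ) * F n := by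
    rw [← Finset.sum_add_distrib, ← Finset.sum_sub_distrib, ← Finset.sum_add_distrib]
    refine Finset.sum_congr rfl fun n _ => ?_
    have := congrArg (fun f : ArithmeticFunction ℝ => f n) (vaughan_identity P)
    simp only [ArithmeticFunction.add_apply, sub_eq_add_neg, ArithmeticFunction.neg_apply] at this
    rw [this]
    push_cast
    ring
  have hT0 : ∑ n ∈ Finset.Ioc 0 N, (L1 n : ℂ) * F n = 0 := by
    refine Finset.sum_eq_zero fun n _ => ?_
    by_cases h : n ≤ U
    · rw [hF n (Or.inl h), mul_zero]
    · rw [hL1, arithRestrict_apply, if_neg h]; simp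
  have hT1 : ‖∑ n ∈ Finset.Ioc 0 N, ((M1 * ArithmeticFunction.log) n : ℂ) * F n‖ ≤ U * U * (Real.log N * B₁) := by
    rw [sum_convolution_mul _ _ _ _ hF', hsub 0 (min (U * U) N) _ (min_le_right _ _)]
    · refine (norm_sum_le_of_le (f := fun k => ∑ m ∈ Finset.Ioc 0 N,
        ((M1 k : ℝ) : ℂ) * ((ArithmeticFunction.log m : ℝ) : ℂ) * F (k * m)) _ (n := fun _ => Real.log N * B₁) ?_).trans ?_
      · intro k hk
        rw [Finset.mem_Ioc] at hk
        simp only [mul_assoc]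
        rw [← Finset.mul_sum, norm_mul, Complex.norm_real]
        have h1 := norm_sum_monotone_mul_le (fun m : ℕ => Real.log m) (fun m => F (k * m)) N
          (B := B₁) (fun m n hmn => by
            rcases Nat.eq_zero_or_pos m with rfl | hm
            · simpa using Real.log_natCast_nonneg n
            · exact Real.log_le_log (by exact_mod_cast hm) (by exact_mod_cast hmn))
          (by simp) (hI k hk.1 (by omega))
        calc ‖M1 k‖ * _ ≤ 1 * (Real.log N * B₁) :=
              mul_le_mul (hM1le k) h1 (norm_nonneg _) zero_le_one
          _ = _ := one_mul _
      · rw [Finset.sum_const, nsmul_eq_mul, Nat.card_Ioc]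
        refine mul_le_mul_of_nonneg_right ?_ (by positivity)
        have : min (U * U) N - 0 ≤ U * U := by omega
        exact_mod_cast this
    · rintro k (hk | hk)
      · obtain rfl : k = 0 := by omega
        simp
      · refine Finset.sum_eq_zero fun m hm => ?_
        rw [Finset.mem_Ioc] at hm
        rcases min_lt_iff.1 hk with hk | hk
        · have : ¬ P k := by
            simp only [hP, not_le]; exact lt_of_le_of_lt (Nat.le_mul_self U) hk
          rw [hM1, arithRestrict_apply, if_neg this]; simp
        · rw [hF' _ (hk.trans_le (Nat.le_mul_of_pos_right k hm.1)), mul_zero]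
  have hT2 : ‖∑ n ∈ Finset.Ioc 0 N, ((g * (ζ : ArithmeticFunction ℝ)) n : ℂ) * F n‖
      ≤ U * U * (Real.log N * B₁) := by
    rw [sum_convolution_mul _ _ _ _ hF', hsub 0 (min (U * U) N) _ (min_le_right _ _)]
    · refine (norm_sum_le_of_le (f := fun k => ∑ m ∈ Finset.Ioc 0 N,
        ((g k : ℝ) : ℂ) * (((ζ : ArithmeticFunction ℝ) m : ℝ) : ℂ) * F (k * m)) _
          (n := fun _ => Real.log N * B₁) ?_).trans ?_
      · intro k hk
        rw [Finset.mem_Ioc] at hk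
        have : ∀ m ∈ Finset.Ioc 0 N, ((g k : ℝ) : ℂ) * (((ζ : ArithmeticFunction ℝ) m : ℝ) : ℂ) *
            F (k * m) = ((g k : ℝ) : ℂ) * F (k * m) := by
          intro m hm
          rw [Finset.mem_Ioc] at hm
          rw [natCoe_apply, zeta_apply_ne hm.1.ne']
          simp
        rw [Finset.sum_congr rfl this, ← Finset.mul_sum, norm_mul, Complex.norm_real]
        exact mul_le_mul (hgle k (Finset.mem_Ioc.2 ⟨hk.1, hk.2.trans (min_le_right _ _)⟩))
          (hI k hk.1 (hk.2.trans (min_le_left _ _)) 0) (norm_nonneg _) hlogN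
      · rw [Finset.sum_const, nsmul_eq_mul, Nat.card_Ioc]
        refine mul_le_mul_of_nonneg_right ?_ (by positivity)
        have : min (U * U) N - 0 ≤ U * U := by omega
        exact_mod_cast this
    · rintro k (hk | hk)
      · obtain rfl : k = 0 := by omega
        simp
      · refine Finset.sum_eq_zero fun m hm => ?_
        rw [Finset.mem_Ioc] at hm
        rcases min_lt_iff.1 hk with hk | hk
        · rw [hg0 k hk]; simp
        · rw [hF' _ (hk.trans_le (Nat.le_mul_of_pos_right k hm.1)), mul_zero]
  have hT3 : ‖∑ n ∈ Finset.Ioc 0 N, ((M2 * b) n : ℂ) * F n‖ ≤ Real.log N * (2 * B₂) := by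
    rw [sum_convolution_mul _ _ _ _ hF']
    rcases hlogN.eq_or_lt with hl0 | hlpos
    · rw [← hl0, zero_mul]
      refine (norm_eq_zero.2 (Finset.sum_eq_zero fun k _ => Finset.sum_eq_zero fun m hm => ?_)).le
      have := hble m hm
      rw [← hl0] at this
      rw [abs_nonpos_iff.1 this]; simp
    set β : ℕ → ℝ := fun m => if m ≤ N then b m / Real.log N else 0 with hβ
    have hβ1 : ∀ m, |β m| ≤ 1 := by
      intro m
      simp only [hβ]
      split_ifs with h
      · rcases Nat.eq_zero_or_pos m with rfl | hm
        · simp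
        · rw [abs_div, abs_of_pos hlpos, div_le_one hlpos]
          exact hble m (Finset.mem_Ioc.2 ⟨hm, h⟩)
      · simp
    have hbβ : ∀ m, m ≤ N → (b m : ℂ) = (Real.log N : ℂ) * (β m : ℂ) := by
      intro m hm
      simp only [hβ, if_pos hm]
      rw [← Complex.ofReal_mul, mul_div_cancel₀ _ hlpos.ne']
    have e1 : ∑ k ∈ Finset.Ioc 0 N, ∑ m ∈ Finset.Ioc 0 N, ((M2 k : ℝ) : ℂ) * (b m : ℂ) * F (k * m) =
        (Real.log N : ℂ) * (∑ k ∈ Finset.Ioc U s, ∑ m ∈ Finset.Ioc U N,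
          ((M2 k : ℝ) : ℂ) * (β m : ℂ) * F (k * m) +
        ∑ m ∈ Finset.Ioc U s, ∑ k ∈ Finset.Ioc U N,
          (β m : ℂ) * ((if s < k then M2 k else 0 : ℝ) : ℂ) * F (m * k)) := by
      have i1 : ∀ k ∈ Finset.Ioc 0 N, ∑ m ∈ Finset.Ioc 0 N, ((M2 k : ℝ) : ℂ) * (b m : ℂ) * F (k * m)
          = (Real.log N : ℂ) * (∑ m ∈ Finset.Ioc U N, ((if k ≤ s then M2 k else 0 : ℝ) : ℂ)
              * (β m : ℂ) * F (k * m)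
            + ∑ m ∈ Finset.Ioc U s, ((if s < k then M2 k else 0 : ℝ) : ℂ)
              * (β m : ℂ) * F (k * m)) := by
        intro k hk
        rw [Finset.mem_Ioc] at hk
        rcases le_or_gt k s with h | h
        · simp only [if_pos h, if_neg (not_lt.2 h)]
          rw [hsub U N _ le_rfl]
          · simp only [Complex.ofReal_zero, zero_mul, Finset.sum_const_zero, add_zero]
            rw [Finset.mul_sum]
            refine Finset.sum_congr rfl fun m hm => ?_
            rw [Finset.mem_Ioc] at hm
            rw [hbβ m hm.2]; ring
          · rintro m (hm | hm)
            · rw [hb0 m hm]; simp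
            · rw [hF' _ (hm.trans_le (Nat.le_mul_of_pos_left m hk.1)), mul_zero]
        · simp only [if_neg (not_le.2 h), if_pos h]
          rw [hsub U s _ hsN]
          · simp only [Complex.ofReal_zero, zero_mul, Finset.sum_const_zero, zero_add]
            rw [Finset.mul_sum]
            refine Finset.sum_congr rfl fun m hm => ?_
            rw [Finset.mem_Ioc] at hm
            rw [hbβ m (by omega)]; ring
          · rintro m (hm | hm)
            · rw [hb0 m hm]; simp
            · rw [hF' _ (hs.trans_le (Nat.mul_le_mul h hm)), mul_zero]
      rw [Finset.sum_congr rfl i1, ← Finset.mul_sum, Finset.sum_add_distrib]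
      congr 2
      · rw [hsub U s _ hsN]
        · refine Finset.sum_congr rfl fun k hk => ?_
          rw [Finset.mem_Ioc] at hk
          simp only [if_pos hk.2]
        · rintro k (hk | hk)
          · simp only [if_pos (hk.trans hUs), hM20 k hk]; simp
          · simp only [if_neg (not_le.2 hk)]; simp
      · rw [hsub U N _ le_rfl, Finset.sum_comm]
        · refine Finset.sum_congr rfl fun m _ => Finset.sum_congr rfl fun k _ => ?_
          rw [mul_comm m k]; ring
        · rintro k (hk | hk)
          · simp only [hM20 k hk]; simp
          · refine Finset.sum_eq_zero fun m hm => ?_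
            rw [Finset.mem_Ioc] at hm
            rw [hF' _ (hk.trans_le (Nat.le_mul_of_pos_right k (by omega))), mul_zero]
    rw [e1, norm_mul, Complex.norm_real, Real.norm_of_nonneg hlogN]
    refine mul_le_mul_of_nonneg_left ?_ hlogN
    refine (norm_add_le _ _).trans ?_
    have h1 := hII (fun k => M2 k) β hM2le hβ1
    have h2 := hII β (fun k => if s < k then M2 k else 0) hβ1 (fun k => by
      split_ifs
      · exact hM2le k
      · simp)
    linarith
  rw [hid, hT0, zero_add]
  refine (norm_add_le _ _).trans ((add_le_add_left (norm_sub_le _ _) _).trans ?_)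
  linarith

/-! ### Linear and bilinear sums of a smooth phase -/

/-- Bounds on the second differences of the phases `f (k m)` and `f (k m) - f (l m)` on the block
`(N / 4, N]`. -/
structure PhaseCond (f : ℕ → ℝ) (N : ℕ) (lam C : ℝ) : Prop where
  lo : ∀ k m : ℕ, 1 ≤ k → N / 4 < k * m → k * (m + 2) ≤ N →
    lam * (k : ℝ) ^ 2 ≤ -(f (k * (m + 2)) - 2 * f (k * (m + 1)) + f (k * m))
  hi : ∀ k m : ℕ, 1 ≤ k → N / 4 < k * m → k * (m + 2) ≤ N →
    -(f (k * (m + 2)) - 2 * f (k * (m + 1)) + f (k * m)) ≤ C * (lam * (k : ℝ) ^ 2)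
  lo_sub : ∀ k l m : ℕ, 1 ≤ k → k < l → N / 4 < k * m → l * (m + 2) ≤ N →
    ((l : ℝ) - k) * k * lam ≤ C * ((f (k * (m + 2)) - 2 * f (k * (m + 1)) + f (k * m)) -
      (f (l * (m + 2)) - 2 * f (l * (m + 1)) + f (l * m)))
  hi_sub : ∀ k l m : ℕ, 1 ≤ k → k < l → N / 4 < k * m → l * (m + 2) ≤ N →
    (f (k * (m + 2)) - 2 * f (k * (m + 1)) + f (k * m)) -
      (f (l * (m + 2)) - 2 * f (l * (m + 1)) + f (l * m)) ≤ C * (((l : ℝ) - k) * k * lam)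

/-- The phase `e (j f n)` cut off to the block `(N / 4, N]`. -/
noncomputable def blockPhase (f : ℕ → ℝ) (N : ℕ) (j : ℝ) (n : ℕ) : ℂ :=
  if N / 4 < n ∧ n ≤ N then e (j * f n) else 0

lemma norm_blockPhase_le (f : ℕ → ℝ) (N : ℕ) (j : ℝ) (n : ℕ) : ‖blockPhase f N j n‖ ≤ 1 := by
  unfold blockPhase
  split_ifs
  · rw [norm_e]
  · simp

lemma blockPhase_eq_zero (f : ℕ → ℝ) (N : ℕ) (j : ℝ) {n : ℕ} (h : n ≤ N / 4 ∨ N < n) :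
    blockPhase f N j n = 0 := by
  unfold blockPhase
  rw [if_neg]
  omega

lemma blockPhase_eq (f : ℕ → ℝ) (N : ℕ) (j : ℝ) {n : ℕ} (h : N / 4 < n) (h' : n ≤ N) :
    blockPhase f N j n = e (j * f n) := if_pos ⟨h, h'⟩

lemma lt_mul_iff_div_lt (X k m : ℕ) (hk : 1 ≤ k) : X < k * m ↔ X / k < m := by
  rw [Nat.div_lt_iff_lt_mul hk, mul_comm]

lemma mul_le_iff_le_div (N k m : ℕ) (hk : 1 ≤ k) : k * m ≤ N ↔ m ≤ N / k := by
  rw [Nat.le_div_iff_mul_le hk, mul_comm]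

lemma linear_bound {f : ℕ → ℝ} {N : ℕ} {lam C j : ℝ} (hf : PhaseCond f N lam C) (hlam : 0 < lam)
    (hj : 0 < j) (hC : 0 ≤ C) (k : ℕ) (hk : 1 ≤ k) (hk1 : j * lam * (k : ℝ) ^ 2 ≤ 1) (c : ℕ) :
    ‖∑ m ∈ Finset.Ioc c N, blockPhase f N j (k * m)‖ ≤
      16 * (C * √(j * lam) * N + 1 / √(j * lam)) := by
  have hk0 : (0 : ℝ) < k := by exact_mod_cast hk
  have e1 : ∑ m ∈ Finset.Ioc c N, blockPhase f N j (k * m) =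
      ∑ m ∈ Finset.Ico (max c (N / 4 / k) + 1) (N / k + 1), e (j * f (k * m)) := by
    symm
    have hsub : Finset.Ico (max c (N / 4 / k) + 1) (N / k + 1) ⊆ Finset.Ioc c N := by
      intro m
      simp only [Finset.mem_Ico, Finset.mem_Ioc]
      have := Nat.div_le_self N k
      omega
    refine (Finset.sum_congr rfl fun m hm => ?_).trans (Finset.sum_subset hsub fun m hm hm' => ?_)
    · rw [Finset.mem_Ico] at hm
      rw [blockPhase_eq]
      · rw [lt_mul_iff_div_lt _ _ _ hk]; omega
      · rw [mul_le_iff_le_div _ _ _ hk]; omega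
    · rw [Finset.mem_Ico] at hm'
      rw [Finset.mem_Ioc] at hm
      refine blockPhase_eq_zero _ _ _ ?_
      by_contra hcon
      rw [not_or, not_le, not_lt, lt_mul_iff_div_lt _ _ _ hk, mul_le_iff_le_div _ _ _ hk] at hcon
      omega
  have e2 : ‖∑ m ∈ Finset.Ico (max c (N / 4 / k) + 1) (N / k + 1), e (j * f (k * m))‖ =
      ‖∑ m ∈ Finset.Ico (max c (N / 4 / k) + 1) (N / k + 1), e (-(j * f (k * m)))‖ := by
    rw [← Complex.norm_conj, map_sum]
    simp only [conj_e]
  set t := j * lam with ht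
  have ht0 : 0 < t := mul_pos hj hlam
  have hrange : ∀ m, max c (N / 4 / k) + 1 ≤ m → m + 2 < N / k + 1 →
      N / 4 < k * m ∧ k * (m + 2) ≤ N := fun m h1 h2 => by
    rw [lt_mul_iff_div_lt _ _ _ hk, mul_le_iff_le_div _ _ _ hk]; omega
  have h := second_derivative_test (fun m => -(j * f (k * m))) (max c (N / 4 / k) + 1) (N / k + 1)
    (lam := t * (k : ℝ) ^ 2) (h := C) (by positivity) hk1
    (fun m h1 h2 => by
      obtain ⟨h3, h4⟩ := hrange m h1 h2
      have := mul_le_mul_of_nonneg_left (hf.lo k m hk h3 h4) hj.le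
      rw [ht]; linarith)
    (fun m h1 h2 => by
      obtain ⟨h3, h4⟩ := hrange m h1 h2
      have := mul_le_mul_of_nonneg_left (hf.hi k m hk h3 h4) hj.le
      rw [ht]; linarith) hC
  rw [e1, e2]
  refine h.trans ?_
  have hst : 0 < √t := Real.sqrt_pos.2 ht0
  have hsq : √(t * (k : ℝ) ^ 2) = √t * k := by
    rw [Real.sqrt_mul ht0.le, Real.sqrt_sq hk0.le]
  have hlen : ((N / k + 1 - (max c (N / 4 / k) + 1) : ℕ) : ℝ) ≤ N / k := by
    refine le_trans ?_ (Nat.cast_div_le (α := ℝ))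
    exact Nat.cast_le.2 ((Nat.add_sub_add_right _ _ _).le.trans (Nat.sub_le _ _))
  have hk1' : (1 : ℝ) ≤ k := by exact_mod_cast hk
  rw [hsq, div_le_iff₀ (by positivity)]
  have h1 : C * (t * (k : ℝ) ^ 2) * ((N / k + 1 - (max c (N / 4 / k) + 1) : ℕ) : ℝ) ≤
      C * t * k * N := by
    calc _ ≤ C * (t * (k : ℝ) ^ 2) * (N / k) := mul_le_mul_of_nonneg_left hlen (by positivity)
      _ = _ := by field_simp
  have h2 : 16 * (C * √t * N + 1 / √t) * (√t * k) = 16 * (C * t * k * N + k) := by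
    have : √t * √t = t := Real.mul_self_sqrt ht0.le
    field_simp
    rw [Real.sq_sqrt ht0.le]
    ring
  rw [h2]
  linarith

lemma correlation_bound {f : ℕ → ℝ} {N : ℕ} {lam C j : ℝ} (hf : PhaseCond f N lam C)
    (hlam : 0 < lam) (hj : 0 < j) (hC : 1 ≤ C) {K H : ℕ} (hK : 1 ≤ K) (hHK : H ≤ K)
    (hsmall : 2 * (j * lam) * H * K ≤ 1) {k l : ℕ} (hk : K ≤ k) (hkl : k < l) (hl : l < K + H)
    (c : ℕ) :
    ‖∑ m ∈ Finset.Ioc c N, blockPhase f N j (k * m) *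
        (starRingEnd ℂ) (blockPhase f N j (l * m))‖ ≤
      16 * (C ^ 2 * √(2 * (j * lam) * H * K) * (N / K) + √C / √(j * lam * K)) := by
  have hk1 : 1 ≤ k := hK.trans hk
  have hl1 : 1 ≤ l := by omega
  have hC0 : 0 < C := by linarith
  set t := j * lam with ht
  have ht0 : 0 < t := mul_pos hj hlam
  have hKr : (0 : ℝ) < K := by exact_mod_cast hK
  have hkr : (K : ℝ) ≤ k := by exact_mod_cast hk
  have hlk : (1 : ℝ) ≤ (l : ℝ) - k := by
    have : (k : ℝ) + 1 ≤ l := by exact_mod_cast hkl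
    linarith
  have hlkH : (l : ℝ) - k ≤ H := by
    have : (l : ℝ) ≤ K + H := by exact_mod_cast hl.le
    linarith
  have hk2K : (k : ℝ) ≤ 2 * K := by
    have : k ≤ 2 * K := by omega
    exact_mod_cast this
  have e1 : ∑ m ∈ Finset.Ioc c N, blockPhase f N j (k * m) *
        (starRingEnd ℂ) (blockPhase f N j (l * m)) =
      ∑ m ∈ Finset.Ico (max c (N / 4 / k) + 1) (N / l + 1), e (j * (f (k * m) - f (l * m))) := by
    symm
    have hsub : Finset.Ico (max c (N / 4 / k) + 1) (N / l + 1) ⊆ Finset.Ioc c N := by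
      intro m
      simp only [Finset.mem_Ico, Finset.mem_Ioc]
      have := Nat.div_le_self N l
      omega
    have hmono : ∀ m, k * m ≤ l * m := fun m => Nat.mul_le_mul_right m hkl.le
    refine (Finset.sum_congr rfl fun m hm => ?_).trans (Finset.sum_subset hsub fun m hm hm' => ?_)
    · rw [Finset.mem_Ico] at hm
      have h1 : N / 4 < k * m := by rw [lt_mul_iff_div_lt _ _ _ hk1]; omega
      have h2 : l * m ≤ N := by rw [mul_le_iff_le_div _ _ _ hl1]; omega
      rw [blockPhase_eq _ _ _ h1 ((hmono m).trans h2),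
        blockPhase_eq _ _ _ (h1.trans_le (hmono m)) h2, conj_e, ← e_add]
      congr 1; ring
    · rw [Finset.mem_Ico] at hm'
      rw [Finset.mem_Ioc] at hm
      by_cases h1 : N / 4 < k * m
      · rw [blockPhase_eq_zero f N j (n := l * m), map_zero, mul_zero]
        right
        by_contra hcon
        rw [lt_mul_iff_div_lt _ _ _ hk1] at h1
        rw [not_lt, mul_le_iff_le_div _ _ _ hl1] at hcon
        omega
      · rw [blockPhase_eq_zero f N j (n := k * m) (Or.inl (not_lt.1 h1)), zero_mul]
  have hrange : ∀ m, max c (N / 4 / k) + 1 ≤ m → m + 2 < N / l + 1 →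
      N / 4 < k * m ∧ l * (m + 2) ≤ N := fun m h1 h2 => by
    rw [lt_mul_iff_div_lt _ _ _ hk1, mul_le_iff_le_div _ _ _ hl1]; omega
  set L : ℝ := t * (((l : ℝ) - k) * k) / C with hL
  have hLpos : 0 < L := by positivity
  have hLle : L ≤ 2 * t * H * K := by
    rw [hL, div_le_iff₀ hC0]
    have : ((l : ℝ) - k) * k ≤ H * (2 * K) := by gcongr
    calc t * (((l : ℝ) - k) * k) ≤ t * (H * (2 * K)) := by gcongr
      _ = 2 * t * H * K * 1 := by ring
      _ ≤ 2 * t * H * K * C := by gcongr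
  have hLge : t * K / C ≤ L := by
    rw [hL]
    have : (K : ℝ) ≤ ((l : ℝ) - k) * k := by nlinarith
    gcongr
  have h := second_derivative_test (fun m => j * (f (k * m) - f (l * m)))
    (max c (N / 4 / k) + 1) (N / l + 1) (lam := L) (h := C ^ 2) hLpos (hLle.trans hsmall)
    (fun m h1 h2 => by
      obtain ⟨h3, h4⟩ := hrange m h1 h2
      have := mul_le_mul_of_nonneg_left (hf.lo_sub k l m hk1 hkl h3 h4) hj.le
      rw [hL, ht, div_le_iff₀ hC0]; linarith)
    (fun m h1 h2 => by
      obtain ⟨h3, h4⟩ := hrange m h1 h2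
      have := mul_le_mul_of_nonneg_left (hf.hi_sub k l m hk1 hkl h3 h4) hj.le
      have e3 : C ^ 2 * L = j * (C * (((l : ℝ) - k) * k * lam)) := by
        rw [hL, ht]; field_simp
      rw [e3]; linarith) (by positivity)
  rw [e1]
  refine h.trans ?_
  have hsL : 0 < √L := Real.sqrt_pos.2 hLpos
  have hlen : ((N / l + 1 - (max c (N / 4 / k) + 1) : ℕ) : ℝ) ≤ N / K := by
    calc _ ≤ ((N / l : ℕ) : ℝ) :=
          Nat.cast_le.2 ((Nat.add_sub_add_right _ _ _).le.trans (Nat.sub_le _ _))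
      _ ≤ (N : ℝ) / l := Nat.cast_div_le
      _ ≤ N / K := by
        have : (K : ℝ) ≤ l := by linarith
        gcongr
  calc 16 * (C ^ 2 * L * ((N / l + 1 - (max c (N / 4 / k) + 1) : ℕ) : ℝ) + 1) / √L
      ≤ 16 * (C ^ 2 * L * (N / K) + 1) / √L := by gcongr
    _ = 16 * (C ^ 2 * √L * (N / K) + 1 / √L) := by
        have : L = √L * √L := (Real.mul_self_sqrt hLpos.le).symm
        rw [eq_comm]
        field_simp
        rw [Real.sq_sqrt hLpos.le]
        ring
    _ ≤ 16 * (C ^ 2 * √(2 * t * H * K) * (N / K) + √C / √(t * K)) := by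
        have h1 : √L ≤ √(2 * t * H * K) := Real.sqrt_le_sqrt hLle
        have h2 : 1 / √L ≤ √C / √(t * K) := by
          rw [← Real.sqrt_div' _ (by positivity), ← Real.sqrt_one, ← Real.sqrt_div' _ (by positivity)]
          refine Real.sqrt_le_sqrt ?_
          rw [div_le_div_iff₀ hLpos (by positivity)]
          rw [div_le_iff₀ hC0] at hLge
          linarith
        gcongr

/-- Cauchy-Schwarz for a bilinear form. -/
lemma bilinear_cauchy (F : ℕ → ℂ) (I J : Finset ℕ) (a b : ℕ → ℝ) (ha : ∀ k, |a k| ≤ 1)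
    (hb : ∀ m, |b m| ≤ 1) :
    ‖∑ k ∈ I, ∑ m ∈ J, (a k : ℂ) * (b m : ℂ) * F (k * m)‖ ^ 2 ≤
      J.card * ∑ k ∈ I, ∑ l ∈ I, ‖∑ m ∈ J, F (k * m) * (starRingEnd ℂ) (F (l * m))‖ := by
  have e1 : ∑ k ∈ I, ∑ m ∈ J, (a k : ℂ) * (b m : ℂ) * F (k * m) =
      ∑ m ∈ J, (b m : ℂ) * ∑ k ∈ I, (a k : ℂ) * F (k * m) := by
    rw [Finset.sum_comm]
    refine Finset.sum_congr rfl fun m _ => ?_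
    rw [Finset.mul_sum]
    exact Finset.sum_congr rfl fun k _ => by ring
  have h1 : ‖∑ m ∈ J, (b m : ℂ) * ∑ k ∈ I, (a k : ℂ) * F (k * m)‖ ≤
      ∑ m ∈ J, ‖∑ k ∈ I, (a k : ℂ) * F (k * m)‖ := by
    refine norm_sum_le_of_le _ fun m _ => ?_
    rw [norm_mul, Complex.norm_real]
    exact mul_le_of_le_one_left (norm_nonneg _) (hb m)
  have h2 : (∑ m ∈ J, ‖∑ k ∈ I, (a k : ℂ) * F (k * m)‖) ^ 2 ≤
      J.card * ∑ m ∈ J, ‖∑ k ∈ I, (a k : ℂ) * F (k * m)‖ ^ 2 := sq_sum_le_card_mul_sum_sq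
  have h3 : ∑ m ∈ J, ‖∑ k ∈ I, (a k : ℂ) * F (k * m)‖ ^ 2 ≤
      ∑ k ∈ I, ∑ l ∈ I, ‖∑ m ∈ J, F (k * m) * (starRingEnd ℂ) (F (l * m))‖ := by
    have e2 : ((∑ m ∈ J, ‖∑ k ∈ I, (a k : ℂ) * F (k * m)‖ ^ 2 : ℝ) : ℂ) =
        ∑ k ∈ I, ∑ l ∈ I, (a k : ℂ) * (a l : ℂ) *
          ∑ m ∈ J, F (k * m) * (starRingEnd ℂ) (F (l * m)) := by
      push_cast
      have : ∀ m ∈ J, (‖∑ k ∈ I, (a k : ℂ) * F (k * m)‖ : ℂ) ^ 2 =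
          ∑ k ∈ I, ∑ l ∈ I, (a k : ℂ) * (a l : ℂ) * (F (k * m) * (starRingEnd ℂ) (F (l * m))) := by
        intro m _
        rw [← Complex.mul_conj', map_sum, Finset.sum_mul_sum]
        refine Finset.sum_congr rfl fun k _ => Finset.sum_congr rfl fun l _ => ?_
        rw [map_mul, Complex.conj_ofReal]; ring
      rw [Finset.sum_congr rfl this, Finset.sum_comm]
      refine Finset.sum_congr rfl fun k _ => ?_
      rw [Finset.sum_comm]
      exact Finset.sum_congr rfl fun l _ => by rw [Finset.mul_sum]
    have hnn : 0 ≤ ∑ m ∈ J, ‖∑ k ∈ I, (a k : ℂ) * F (k * m)‖ ^ 2 :=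
      Finset.sum_nonneg fun _ _ => sq_nonneg _
    rw [← Real.norm_of_nonneg hnn, ← Complex.norm_real, e2]
    refine norm_sum_le_of_le _ fun k _ => norm_sum_le_of_le _ fun l _ => ?_
    rw [norm_mul, norm_mul, Complex.norm_real, Complex.norm_real]
    refine mul_le_of_le_one_left (norm_nonneg _) ?_
    exact mul_le_one₀ (ha k) (abs_nonneg _) (ha l)
  rw [e1]
  calc _ ≤ (∑ m ∈ J, ‖∑ k ∈ I, (a k : ℂ) * F (k * m)‖) ^ 2 := by gcongr
    _ ≤ _ := h2
    _ ≤ _ := by gcongr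

lemma bilinear_block_bound {f : ℕ → ℝ} {N : ℕ} {lam C j : ℝ} (hf : PhaseCond f N lam C)
    (hlam : 0 < lam) (hj : 0 < j) (hC : 1 ≤ C) {K H s : ℕ} (hK : 1 ≤ K) (hHK : H ≤ K)
    (hH : 1 ≤ H) (hKs : K ≤ s) (hN : 1 ≤ N)
    (hsmall : 2 * (j * lam) * H * s ≤ 1) {δ : ℝ} (hδH : 1 / H ≤ δ)
    (hδ : 16 * (C ^ 2 * √(2 * (j * lam) * H * s) + √C * √s / (N * √(j * lam))) ≤ δ)
    (I : Finset ℕ) (hI : ∀ k ∈ I, K ≤ k ∧ k < K + H) (a b : ℕ → ℝ) (ha : ∀ k, |a k| ≤ 1)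
    (hb : ∀ m, |b m| ≤ 1) (c : ℕ) :
    ‖∑ k ∈ I, ∑ m ∈ Finset.Ioc c N, (a k : ℂ) * (b m : ℂ) * blockPhase f N j (k * m)‖ ≤
      (N / K * H) * √(2 * δ) := by
  have hKr : (0 : ℝ) < K := by exact_mod_cast hK
  have hHr : (0 : ℝ) < H := by exact_mod_cast hH
  have hNr : (0 : ℝ) < N := by exact_mod_cast hN
  have hKsr : (K : ℝ) ≤ s := by exact_mod_cast hKs
  have hsr : (0 : ℝ) < s := hKr.trans_le hKsr
  set t := j * lam with ht
  have ht0 : 0 < t := mul_pos hj hlam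
  have hδ0 : 0 < δ := lt_of_lt_of_le (by positivity) hδH
  set J := Finset.Ioc c (N / K) with hJ
  have hJN : J ⊆ Finset.Ioc c N := Finset.Ioc_subset_Ioc_right (Nat.div_le_self N K)
  have hzero : ∀ k ∈ I, ∀ m ∈ Finset.Ioc c N, m ∉ J → blockPhase f N j (k * m) = 0 := by
    intro k hk m hm hm'
    rw [hJ, Finset.mem_Ioc] at hm'
    rw [Finset.mem_Ioc] at hm
    refine blockPhase_eq_zero _ _ _ (Or.inr ?_)
    have : N / K < m := by omega
    rw [← lt_mul_iff_div_lt _ _ _ hK] at this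
    exact this.trans_le (Nat.mul_le_mul_right m (hI k hk).1)
  have hJcard : (J.card : ℝ) ≤ N / K := by
    rw [hJ, Nat.card_Ioc]
    exact (Nat.cast_le.2 (Nat.sub_le _ _)).trans (Nat.cast_div_le (α := ℝ))
  have e1 : ∑ k ∈ I, ∑ m ∈ Finset.Ioc c N, (a k : ℂ) * (b m : ℂ) * blockPhase f N j (k * m) =
      ∑ k ∈ I, ∑ m ∈ J, (a k : ℂ) * (b m : ℂ) * blockPhase f N j (k * m) := by
    refine Finset.sum_congr rfl fun k hk => (Finset.sum_subset hJN fun m hm hm' => ?_).symm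
    rw [hzero k hk m hm hm', mul_zero]
  have hcorr : ∀ k ∈ I, ∀ l ∈ I, k < l →
      ‖∑ m ∈ J, blockPhase f N j (k * m) * (starRingEnd ℂ) (blockPhase f N j (l * m))‖ ≤
        δ * (N / K) := by
    intro k hk l hl hkl
    have e2 : ∑ m ∈ J, blockPhase f N j (k * m) * (starRingEnd ℂ) (blockPhase f N j (l * m)) =
        ∑ m ∈ Finset.Ioc c N,
          blockPhase f N j (k * m) * (starRingEnd ℂ) (blockPhase f N j (l * m)) :=
      Finset.sum_subset hJN fun m hm hm' => by rw [hzero k hk m hm hm', zero_mul]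
    rw [e2]
    have hmon : 2 * t * H * K ≤ 2 * t * H * s := by gcongr
    refine (correlation_bound hf hlam hj hC hK hHK (hmon.trans hsmall) (hI k hk).1 hkl
      (hI l hl).2 c).trans ?_
    have h1 : √(2 * t * H * K) ≤ √(2 * t * H * s) := Real.sqrt_le_sqrt hmon
    have h2 : √C / √(t * K) ≤ √C * √s / (N * √t) * (N / K) := by
      have : √C * √s / (N * √t) * (N / K) = √C * √s / (√t * K) := by field_simp
      rw [this, Real.sqrt_mul ht0.le, div_le_div_iff₀ (by positivity) (by positivity)]
      have h3 : √(K : ℝ) ≤ √s := Real.sqrt_le_sqrt hKsr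
      have h4 : (K : ℝ) = √K * √K := (Real.mul_self_sqrt hKr.le).symm
      calc √C * (√t * K) = √C * √t * √K * √K := by rw [mul_assoc (√C * √t), ← h4]; ring
        _ ≤ √C * √t * √K * √s := by gcongr
        _ = _ := by ring
    calc 16 * (C ^ 2 * √(2 * t * H * K) * (N / K) + √C / √(t * K))
        ≤ 16 * (C ^ 2 * √(2 * t * H * s) * (N / K) + √C * √s / (N * √t) * (N / K)) := by gcongr
      _ = 16 * (C ^ 2 * √(2 * t * H * s) + √C * √s / (N * √t)) * (N / K) := by ring
      _ ≤ δ * (N / K) := by gcongr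
  have hpair : ∀ k ∈ I, ∀ l ∈ I,
      ‖∑ m ∈ J, blockPhase f N j (k * m) * (starRingEnd ℂ) (blockPhase f N j (l * m))‖ ≤
        δ * (N / K) + (if k = l then (N / K : ℝ) else 0) := by
    intro k hk l hl
    rcases lt_trichotomy k l with h | h | h
    · rw [if_neg h.ne, add_zero]; exact hcorr k hk l hl h
    · rw [if_pos h]
      have : ‖∑ m ∈ J, blockPhase f N j (k * m) * (starRingEnd ℂ) (blockPhase f N j (l * m))‖
          ≤ ∑ m ∈ J, (1 : ℝ) := by
        refine norm_sum_le_of_le _ fun m _ => ?_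
        rw [norm_mul, Complex.norm_conj]
        exact mul_le_one₀ (norm_blockPhase_le _ _ _ _) (norm_nonneg _) (norm_blockPhase_le _ _ _ _)
      rw [Finset.sum_const, nsmul_eq_mul, mul_one] at this
      have : 0 ≤ δ * (N / K) := by positivity
      linarith
    · rw [if_neg h.ne', add_zero]
      have := hcorr l hl k hk h
      rw [← Complex.norm_conj, map_sum] at this
      simpa only [map_mul, Complex.conj_conj, mul_comm] using this
  have hIcard : (I.card : ℝ) ≤ H := by
    have : I ⊆ Finset.Ico K (K + H) := fun k hk => Finset.mem_Ico.2 (hI k hk)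
    have := Finset.card_le_card this
    rw [Nat.card_Ico] at this
    exact_mod_cast (by omega)
  have hsum : ∑ k ∈ I, ∑ l ∈ I,
      ‖∑ m ∈ J, blockPhase f N j (k * m) * (starRingEnd ℂ) (blockPhase f N j (l * m))‖ ≤
        (N / K) * (H ^ 2 * (2 * δ)) := by
    calc _ ≤ ∑ k ∈ I, ∑ l ∈ I, (δ * (N / K) + (if k = l then (N / K : ℝ) else 0)) :=
          Finset.sum_le_sum fun k hk => Finset.sum_le_sum fun l hl => hpair k hk l hl
      _ = I.card * (I.card * (δ * (N / K)) + N / K) := by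
          rw [← nsmul_eq_mul, ← Finset.sum_const]
          refine Finset.sum_congr rfl fun k hk => ?_
          rw [Finset.sum_add_distrib, Finset.sum_ite_eq, if_pos hk, Finset.sum_const, nsmul_eq_mul]
      _ ≤ H * (H * (δ * (N / K)) + N / K) := by gcongr
      _ ≤ H * (H * (δ * (N / K)) + (H * δ) * (N / K)) := by
          have : 1 ≤ H * δ := by rwa [div_le_iff₀ hHr, mul_comm] at hδH
          have h5 : (N / K : ℝ) ≤ (H * δ) * (N / K) := le_mul_of_one_le_left (by positivity) this
          gcongr
      _ = _ := by ring
  rw [e1]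
  refine le_of_sq_le_sq ?_ (by positivity)
  refine (bilinear_cauchy _ I J a b ha hb).trans ?_
  calc _ ≤ (N / K : ℝ) * ((N / K) * (H ^ 2 * (2 * δ))) := by gcongr
    _ = _ := by rw [mul_pow, Real.sq_sqrt (by positivity)]; ring

theorem bilinear_bound {f : ℕ → ℝ} {N : ℕ} {lam C j : ℝ} (hf : PhaseCond f N lam C)
    (hlam : 0 < lam) (hj : 0 < j) (hC : 1 ≤ C) {U s : ℕ} (hU : 1 ≤ U) (hsN : s ≤ N) (hN : 1 ≤ N)
    (hsmall : 2 * (j * lam) * U * s ≤ 1) {δ : ℝ} (hδU : 1 / U ≤ δ)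
    (hδ : 16 * (C ^ 2 * √(2 * (j * lam) * U * s) + √C * √s / (N * √(j * lam))) ≤ δ)
    (a b : ℕ → ℝ) (ha : ∀ k, |a k| ≤ 1) (hb : ∀ m, |b m| ≤ 1) (c : ℕ) :
    ‖∑ k ∈ Finset.Ioc U s, ∑ m ∈ Finset.Ioc c N,
        (a k : ℂ) * (b m : ℂ) * blockPhase f N j (k * m)‖ ≤
      N * √(2 * δ) * (1 + Real.log N) := by
  have hUr : (0 : ℝ) < U := by exact_mod_cast hU
  have hmaps : ∀ k ∈ Finset.Ioc U s, k / U ∈ Finset.Icc 1 N := by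
    intro k hk
    rw [Finset.mem_Ioc] at hk
    rw [Finset.mem_Icc, Nat.le_div_iff_mul_le hU]
    exact ⟨by omega, (Nat.div_le_self _ _).trans (hk.2.trans hsN)⟩
  rw [← Finset.sum_fiberwise_of_maps_to hmaps]
  have hblock : ∀ t ∈ Finset.Icc 1 N, ‖∑ k ∈ Finset.Ioc U s with k / U = t,
      ∑ m ∈ Finset.Ioc c N, (a k : ℂ) * (b m : ℂ) * blockPhase f N j (k * m)‖ ≤
        N * √(2 * δ) * (t : ℝ)⁻¹ := by
    intro t ht
    rw [Finset.mem_Icc] at ht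
    have htr : (0 : ℝ) < t := by exact_mod_cast ht.1
    rcases Finset.eq_empty_or_nonempty ((Finset.Ioc U s).filter (fun k => k / U = t)) with h | ⟨k0, hk0⟩
    · rw [h, Finset.sum_empty, norm_zero]; positivity
    rw [Finset.mem_filter, Finset.mem_Ioc] at hk0
    have hKs : t * U ≤ s := by
      rw [← hk0.2]; exact (Nat.div_mul_le_self _ _).trans hk0.1.2
    have := bilinear_block_bound hf hlam hj hC (K := t * U) (H := U) (s := s)
      (Nat.mul_pos ht.1 hU) (Nat.le_mul_of_pos_left U ht.1) hU hKs hN hsmall hδU hδ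
      ((Finset.Ioc U s).filter (fun k => k / U = t)) (fun k hk => by
        rw [Finset.mem_filter] at hk
        rw [← hk.2]
        refine ⟨Nat.div_mul_le_self _ _, ?_⟩
        have := Nat.lt_div_mul_add (a := k) hU
        omega) a b ha hb c
    refine this.trans (le_of_eq ?_)
    push_cast
    field_simp
  refine (norm_sum_le_of_le _ hblock).trans ?_
  rw [← Finset.mul_sum]
  have hh : ∑ t ∈ Finset.Icc 1 N, (t : ℝ)⁻¹ ≤ 1 + Real.log N := by
    have := harmonic_le_one_add_log N
    rw [harmonic_eq_sum_Icc] at this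
    push_cast at this
    exact this
  gcongr

/-! ### Exponential sums over primes -/

lemma eventually_log_sq_le (A : ℝ) {ε : ℝ} (hε : 0 < ε) :
    ∀ᶠ N : ℕ in atTop, A * (Real.log N * (1 + Real.log N)) ≤ (N : ℝ) ^ ε := by
  have h1 : (fun x : ℝ => Real.log x ^ (2 : ℝ)) =o[atTop] fun x => x ^ ε :=
    isLittleO_log_rpow_rpow_atTop 2 hε
  have h2 := (h1.bound (c := 1 / (2 * (|A| + 1))) (by positivity))
  have h3 := (tendsto_natCast_atTop_atTop (R := ℝ)).eventually h2
  filter_upwards [h3, eventually_ge_atTop 3] with N hN hN3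
  have hl : 1 ≤ Real.log N := by
    rw [Real.le_log_iff_exp_le (by positivity)]
    have : (3 : ℝ) ≤ N := by exact_mod_cast hN3
    linarith [Real.exp_one_lt_d9]
  rw [Real.norm_of_nonneg (by positivity), Real.norm_of_nonneg (by positivity), Real.rpow_two,
    div_mul_eq_mul_div, one_mul, le_div_iff₀ (by positivity)] at hN
  calc A * (Real.log N * (1 + Real.log N)) ≤ |A| * (Real.log N * (1 + Real.log N)) := by
        gcongr; exact le_abs_self A
    _ ≤ (|A| + 1) * (Real.log N * (Real.log N + Real.log N)) := by gcongr; linarith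
    _ = Real.log N ^ 2 * (2 * (|A| + 1)) := by ring
    _ ≤ _ := hN

set_option maxHeartbeats 1600000 in
open ArithmeticFunction in
/-- Exponential sums over primes with a smooth phase of small curvature exhibit a power saving. -/
theorem prime_sum_bound (C : ℝ) (hC : 1 ≤ C) : ∀ᶠ N : ℕ in atTop, ∀ (f : ℕ → ℝ) (lam : ℝ),
    PhaseCond f N lam C → (N : ℝ) ^ (-(61 / 60) : ℝ) ≤ lam → lam ≤ C / N →
    ∀ j : ℝ, 1 ≤ j → j ≤ (N : ℝ) ^ (1 / 60 : ℝ) →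
    ‖∑ n ∈ Finset.Ioc (N / 4) N, (Λ n : ℂ) * e (j * f n)‖ ≤ (N : ℝ) ^ (19 / 20 : ℝ) := by
  have hx : Tendsto (fun N : ℕ => (N : ℝ) ^ (1 / 120 : ℝ)) atTop atTop :=
    (tendsto_rpow_atTop (by norm_num)).comp tendsto_natCast_atTop_atTop
  filter_upwards [hx.eventually_ge_atTop (2 * C + 4), eventually_ge_atTop 1,
    eventually_log_sq_le (84 * C ^ 2) (show (0 : ℝ) < 1 / 60 by norm_num)] with N hxN hN1 hlog
  intro f lam hf hlo hhi j hj1 hj2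
  have hNr : (0 : ℝ) < N := by exact_mod_cast hN1
  set x : ℝ := (N : ℝ) ^ (1 / 120 : ℝ) with hxdef
  have hx0 : 0 < x := by positivity
  have hx4 : 4 ≤ x := by linarith
  have hx1 : 1 ≤ x := by linarith
  have hpow : ∀ k : ℕ, (N : ℝ) ^ ((k : ℝ) / 120) = x ^ k := fun k => by
    rw [hxdef, ← Real.rpow_natCast, ← Real.rpow_mul hNr.le]; congr 1; ring
  have hNx : (N : ℝ) = x ^ 120 := by rw [← hpow]; norm_num
  have hj2' : j ≤ x ^ 2 := by rw [← hpow]; convert hj2 using 2; norm_num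
  have hlo' : 1 / x ^ 122 ≤ lam := by
    rw [← hpow, one_div, ← Real.rpow_neg hNr.le]; convert hlo using 2; norm_num
  have hR : (N : ℝ) ^ (19 / 20 : ℝ) = x ^ 114 := by rw [← hpow]; congr 1; norm_num
  have hlogx : 84 * C ^ 2 * (Real.log N * (1 + Real.log N)) ≤ x ^ 2 := by
    rw [← hpow]; convert hlog using 2; norm_num
  rw [hNx] at hhi
  have hlam : 0 < lam := lt_of_lt_of_le (by positivity) hlo'
  have hj0 : 0 < j := by linarith
  set t := j * lam with ht
  have ht0 : 0 < t := mul_pos hj0 hlam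
  have htlo : 1 / x ^ 122 ≤ t := by
    rw [ht]; exact hlo'.trans (le_mul_of_one_le_left hlam.le hj1)
  have hthi : t ≤ C / x ^ 118 := by
    calc t ≤ x ^ 2 * (C / x ^ 120) := by rw [ht]; gcongr
      _ = _ := by field_simp
  have hsqt : √t ≤ C / x ^ 59 := by
    rw [Real.sqrt_le_left (by positivity)]
    refine hthi.trans ?_
    rw [div_pow, ← pow_mul]
    gcongr
    nlinarith
  have hsqt2 : 1 / x ^ 61 ≤ √t := by
    refine Real.le_sqrt_of_sq_le ?_
    rw [div_pow, ← pow_mul, one_pow]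
    exact htlo
  have hst0 : 0 < √t := Real.sqrt_pos.2 ht0
  set U := ⌊x ^ 24⌋₊ with hU
  set s := Nat.sqrt N with hs
  have hx24 : 1 ≤ x ^ 24 := one_le_pow₀ hx1
  have hUle : (U : ℝ) ≤ x ^ 24 := Nat.floor_le (by positivity)
  have hU1 : 1 ≤ U := Nat.one_le_floor_iff _ |>.2 hx24
  have hUge : x ^ 24 / 2 ≤ U := by
    have := Nat.lt_floor_add_one (x ^ 24)
    have h1 : (1 : ℝ) ≤ U := by exact_mod_cast hU1
    linarith
  have hsle : (s : ℝ) ≤ x ^ 60 := by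
    have h1 : (s : ℝ) * s ≤ N := by exact_mod_cast Nat.sqrt_le N
    refine le_of_sq_le_sq ?_ (by positivity)
    rw [← pow_mul, ← hNx]; nlinarith
  have hpm : ∀ a b : ℕ, a ≤ b → x ^ a ≤ x ^ b := fun a b h => pow_le_pow_right₀ hx1 h
  have hUN : U ≤ N / 4 := by
    rw [Nat.le_div_iff_mul_le (by norm_num)]
    have : (U : ℝ) * 4 ≤ N := by
      calc (U : ℝ) * 4 ≤ x ^ 24 * x := by gcongr
        _ = x ^ 25 := by ring
        _ ≤ x ^ 120 := hpm _ _ (by norm_num)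
        _ = N := hNx.symm
    exact_mod_cast this
  have hUs : U ≤ s := by
    rw [hs, Nat.le_sqrt]
    have : (U : ℝ) * U ≤ N := by
      calc (U : ℝ) * U ≤ x ^ 24 * x ^ 24 := by gcongr
        _ = x ^ 48 := by ring
        _ ≤ x ^ 120 := hpm _ _ (by norm_num)
        _ = N := hNx.symm
    exact_mod_cast this
  have hI : ∀ k, 1 ≤ k → k ≤ U * U → ∀ c,
      ‖∑ m ∈ Finset.Ioc c N, blockPhase f N j (k * m)‖ ≤ 32 * C ^ 2 * x ^ 61 := by
    intro k hk hkU c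
    have hkr : (k : ℝ) ≤ x ^ 48 := by
      calc (k : ℝ) ≤ U * U := by exact_mod_cast hkU
        _ ≤ x ^ 24 * x ^ 24 := by gcongr
        _ = _ := by ring
    have hk1 : t * (k : ℝ) ^ 2 ≤ 1 := by
      calc t * (k : ℝ) ^ 2 ≤ C / x ^ 118 * (x ^ 48) ^ 2 := by gcongr
        _ = C / x ^ 22 := by field_simp
        _ ≤ 1 := by
          rw [div_le_one (by positivity)]
          calc C ≤ x := by linarith
            _ = x ^ 1 := (pow_one x).symm
            _ ≤ _ := hpm _ _ (by norm_num)
    refine (linear_bound hf hlam hj0 (by linarith) k hk hk1 c).trans ?_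
    have h1 : 1 / √t ≤ x ^ 61 := by
      rw [div_le_iff₀ hst0]
      rwa [div_le_iff₀ (by positivity), mul_comm] at hsqt2
    calc 16 * (C * √t * N + 1 / √t) ≤ 16 * (C * (C / x ^ 59) * x ^ 120 + x ^ 61) := by
          rw [← hNx]; gcongr
      _ = 16 * C ^ 2 * x ^ 61 + 16 * 1 * x ^ 61 := by field_simp
      _ ≤ 16 * C ^ 2 * x ^ 61 + 16 * C ^ 2 * x ^ 61 := by gcongr; exact one_le_pow₀ hC
      _ = _ := by ring
  have hC3 : C ≤ C ^ 3 := le_self_pow₀ hC (by norm_num)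
  have hC3' : 1 ≤ C ^ 3 := one_le_pow₀ hC
  have hsmall : 2 * t * U * s ≤ 2 * C / x ^ 34 := by
    calc 2 * t * U * s ≤ 2 * (C / x ^ 118) * x ^ 24 * x ^ 60 := by gcongr
      _ = _ := by field_simp
  have hII : ∀ a b : ℕ → ℝ, (∀ k, |a k| ≤ 1) → (∀ m, |b m| ≤ 1) →
      ‖∑ k ∈ Finset.Ioc U s, ∑ m ∈ Finset.Ioc U N,
        (a k : ℂ) * (b m : ℂ) * blockPhase f N j (k * m)‖ ≤
        10 * C ^ 2 * x ^ 112 * (1 + Real.log N) := by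
    intro a b ha hb
    refine (bilinear_bound hf hlam hj0 hC hU1 (Nat.sqrt_le_self N) hN1 ?_
      (δ := 48 * C ^ 3 / x ^ 17) ?_ ?_ a b ha hb U).trans ?_
    · refine hsmall.trans ?_
      rw [div_le_one (by positivity)]
      calc 2 * C ≤ x := by linarith
        _ = x ^ 1 := (pow_one x).symm
        _ ≤ _ := hpm _ _ (by norm_num)
    · calc 1 / (U : ℝ) ≤ 1 / (x ^ 24 / 2) := by gcongr
        _ = 2 / x ^ 24 := by field_simp
        _ ≤ 48 * C ^ 3 / x ^ 17 := by
          gcongr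
          · linarith
          · norm_num
    · have h1 : √(2 * t * U * s) ≤ 2 * C / x ^ 17 := by
        rw [Real.sqrt_le_left (by positivity)]
        refine hsmall.trans ?_
        rw [div_pow, ← pow_mul]
        gcongr
        nlinarith
      have h2 : √C ≤ C := by
        rw [Real.sqrt_le_left (by linarith)]; nlinarith
      have h3 : √(s : ℝ) ≤ x ^ 30 := by
        rw [Real.sqrt_le_left (by positivity), ← pow_mul]; exact hsle
      have h4 : √C * √s / (N * √t) ≤ C / x ^ 17 := by
        calc √C * √s / (N * √t) ≤ C * x ^ 30 / (x ^ 120 * (1 / x ^ 61)) := by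
              rw [← hNx]; gcongr
          _ = C / x ^ 29 := by field_simp
          _ ≤ C / x ^ 17 := by gcongr; norm_num
      calc 16 * (C ^ 2 * √(2 * t * U * s) + √C * √s / (N * √t))
          ≤ 16 * (C ^ 2 * (2 * C / x ^ 17) + C / x ^ 17) := by gcongr
        _ = 16 * (2 * C ^ 3 + C) / x ^ 17 := by ring
        _ ≤ _ := by
          refine div_le_div_of_nonneg_right ?_ (by positivity)
          linarith
    · have h5 : √(2 * (48 * C ^ 3 / x ^ 17)) ≤ 10 * C ^ 2 / x ^ 8 := by
        rw [Real.sqrt_le_left (by positivity), div_pow, ← pow_mul]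
        calc 2 * (48 * C ^ 3 / x ^ 17) = 96 * C ^ 3 / x ^ 17 := by ring
          _ ≤ (10 * C ^ 2) ^ 2 / x ^ 16 := by
            gcongr
            · have : C ^ 3 ≤ C ^ 4 := pow_le_pow_right₀ hC (by norm_num)
              nlinarith
            · norm_num
      have hl := Real.log_natCast_nonneg N
      calc N * √(2 * (48 * C ^ 3 / x ^ 17)) * (1 + Real.log N)
          ≤ N * (10 * C ^ 2 / x ^ 8) * (1 + Real.log N) := by gcongr
        _ = _ := by
          rw [show (N : ℝ) * (10 * C ^ 2 / x ^ 8) = 10 * C ^ 2 * x ^ 112 by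
            rw [hNx]; field_simp]
  have hmain := vaughan_bound (blockPhase f N j) N U s hU1
    (fun n hn => blockPhase_eq_zero _ _ _ (hn.imp (fun h => h.trans hUN) id)) hUs
    (Nat.sqrt_le_self N) (Nat.lt_succ_sqrt N) hI hII
  have e1 : ∑ n ∈ Finset.Ioc (N / 4) N, (Λ n : ℂ) * e (j * f n) =
      ∑ n ∈ Finset.Ioc 0 N, (Λ n : ℂ) * blockPhase f N j n := by
    refine (Finset.sum_congr rfl fun n hn => ?_).trans
      (Finset.sum_subset (Finset.Ioc_subset_Ioc_left (Nat.zero_le _)) fun n hn hn' => ?_)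
    · rw [Finset.mem_Ioc] at hn
      rw [blockPhase_eq _ _ _ hn.1 hn.2]
    · rw [Finset.mem_Ioc] at hn hn'
      rw [blockPhase_eq_zero _ _ _ (by omega), mul_zero]
  rw [e1]
  refine hmain.trans ?_
  rw [hR]
  have hl := Real.log_natCast_nonneg N
  have hUU : (U : ℝ) * U ≤ x ^ 48 := by
    calc (U : ℝ) * U ≤ x ^ 24 * x ^ 24 := by gcongr
      _ = _ := by ring
  have hA : 2 * ((U : ℝ) * U * (32 * C ^ 2 * x ^ 61)) ≤ 64 * C ^ 2 * x ^ 112 * (1 + Real.log N) := by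
    calc 2 * ((U : ℝ) * U * (32 * C ^ 2 * x ^ 61)) ≤ 2 * (x ^ 48 * (32 * C ^ 2 * x ^ 61)) := by gcongr
      _ = 64 * C ^ 2 * x ^ 109 * 1 := by ring
      _ ≤ 64 * C ^ 2 * x ^ 112 * (1 + Real.log N) := by
        gcongr
        · norm_num
        · linarith
  calc Real.log N * (2 * ((U : ℝ) * U * (32 * C ^ 2 * x ^ 61)) +
        2 * (10 * C ^ 2 * x ^ 112 * (1 + Real.log N)))
      ≤ Real.log N * (64 * C ^ 2 * x ^ 112 * (1 + Real.log N) +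
        2 * (10 * C ^ 2 * x ^ 112 * (1 + Real.log N))) := by gcongr
    _ = 84 * C ^ 2 * (Real.log N * (1 + Real.log N)) * x ^ 112 := by ring
    _ ≤ x ^ 2 * x ^ 112 := by gcongr
    _ = x ^ 114 := by ring

/-! ### The Fejér kernel -/

/-- The normalised Fejér kernel. -/
noncomputable def fejer (M : ℕ) (x : ℝ) : ℝ := ‖∑ k ∈ Finset.range M, e (k * x)‖ ^ 2 / (M : ℝ) ^ 2

lemma fejer_nonneg (M : ℕ) (x : ℝ) : 0 ≤ fejer M x := by unfold fejer; positivity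

lemma fejer_le_one (M : ℕ) (x : ℝ) : fejer M x ≤ 1 := by
  unfold fejer
  refine div_le_one_of_le₀ ?_ (by positivity)
  have : ‖∑ k ∈ Finset.range M, e (k * x)‖ ≤ M := by
    refine (norm_sum_le _ _).trans ?_
    simp
  gcongr

lemma fejer_mul_sq_le (M : ℕ) (x : ℝ) : fejer M x * (2 * M * nd x) ^ 2 ≤ 1 := by
  have h := norm_geom_sum_mul_le x 0 M
  rw [← Finset.range_eq_Ico] at h
  rcases Nat.eq_zero_or_pos M with rfl | hM
  · simp [fejer]
  have hM0 : (0 : ℝ) < M := by exact_mod_cast hM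
  have : fejer M x * (2 * M * nd x) ^ 2 =
      (‖∑ k ∈ Finset.range M, e (k * x)‖ * (2 * nd x)) ^ 2 := by
    unfold fejer
    generalize ‖∑ k ∈ Finset.range M, e (k * x)‖ = s
    field_simp
  rw [this]
  exact pow_le_one₀ (by have := nd_nonneg x; positivity) h

lemma e_mul_sub_round (k : ℕ) (x : ℝ) : e (k * (x - round x)) = e (k * x) := by
  rw [mul_sub]
  have : (k : ℝ) * (round x : ℝ) = (((k : ℤ) * round x : ℤ) : ℝ) := by push_cast; ring
  rw [this, e_sub_int]

/-- The Fejér kernel is bounded below near the integers. -/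
lemma le_fejer {M : ℕ} (hM : 1 ≤ M) {x : ℝ} (hx : nd x * (2 * M) ≤ 1) :
    4 / π ^ 2 ≤ fejer M x := by
  have hM0 : (0 : ℝ) < M := by exact_mod_cast hM
  set t := x - round x with ht
  have htn : |t| = nd x := rfl
  have hsum : ∑ k ∈ Finset.range M, e (k * x) = ∑ k ∈ Finset.range M, e t ^ k :=
    Finset.sum_congr rfl fun k _ => by rw [← e_nat_mul, ht, e_mul_sub_round]
  have key : 2 / π * M ≤ ‖∑ k ∈ Finset.range M, e (k * x)‖ := by
    rw [hsum]
    rcases eq_or_ne t 0 with h0 | h0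
    · rw [h0]
      simp only [e_zero, one_pow, Finset.sum_const, Finset.card_range, nsmul_eq_mul, mul_one,
        Complex.norm_natCast]
      refine mul_le_of_le_one_left hM0.le ?_
      rw [div_le_one Real.pi_pos]; linarith [Real.pi_gt_three]
    · have htpos : 0 < |t| := abs_pos.2 h0
      have h1 : ‖∑ k ∈ Finset.range M, e t ^ k‖ * ‖1 - e t‖ = ‖1 - e (M * t)‖ := by
        rw [← norm_mul, geom_sum_mul_neg, e_nat_mul]
      have h2 : ‖1 - e t‖ ≤ 2 * (π * |t|) := by
        rw [norm_one_sub_e]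
        have := Real.abs_sin_le_abs (x := π * t)
        rw [abs_mul π t, abs_of_pos Real.pi_pos] at this
        linarith
      have h3 : 4 * (M * |t|) ≤ ‖1 - e (M * t)‖ := by
        refine le_trans ?_ (four_mul_nd_le _)
        have hr : round ((M : ℝ) * t) = 0 ∨ |(M : ℝ) * t| = 1 / 2 := by
          have hle : |(M : ℝ) * t| ≤ 1 / 2 := by
            rw [abs_mul, Nat.abs_cast, htn]; linarith
          rcases hle.eq_or_lt with h | h
          · exact Or.inr h
          · left
            rw [round_eq_zero_iff]
            rw [abs_lt] at h
            exact ⟨by linarith, by linarith⟩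
        have e1 : (M : ℝ) * |t| = |(M : ℝ) * t| := by rw [abs_mul, Nat.abs_cast]
        rw [e1]
        rcases hr with h | h
        · unfold nd; rw [h]; simp
        · have : nd ((M : ℝ) * t) = 1 / 2 := by
            refine le_antisymm (nd_le_half _) ?_
            unfold nd
            rcases (abs_eq (by norm_num)).1 h with h' | h' <;> rw [h']
            · have : (1 / 2 : ℝ) ≤ |1 / 2 - ((round (1 / 2 : ℝ) : ℤ) : ℝ)| := by norm_num
              exact this
            · rw [show (-(1 / 2) : ℝ) = 1 / 2 - ((1 : ℤ) : ℝ) by norm_num, round_sub_intCast]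
              norm_num
          rw [this, h]
      have h4 : 4 * (M * |t|) ≤ ‖∑ k ∈ Finset.range M, e t ^ k‖ * (2 * (π * |t|)) := by
        refine h3.trans ?_
        rw [← h1]
        gcongr
      have h5 : (4 * M - ‖∑ k ∈ Finset.range M, e t ^ k‖ * (2 * π)) * |t| ≤ 0 := by nlinarith
      have h6 := nonpos_of_mul_nonpos_left h5 htpos
      rw [div_mul_eq_mul_div, div_le_iff₀ Real.pi_pos]
      linarith
  unfold fejer
  rw [le_div_iff₀ (by positivity)]
  calc 4 / π ^ 2 * (M : ℝ) ^ 2 = (2 / π * M) ^ 2 := by ring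
    _ ≤ _ := by gcongr

/-- The frequency attached to a pair of indices. -/
def pairFreq (p : ℕ × ℕ) : ℤ := (p.1 : ℤ) - p.2

lemma ofReal_fejer (M : ℕ) (x : ℝ) : (fejer M x : ℂ) =
    (∑ p ∈ Finset.range M ×ˢ Finset.range M, e ((pairFreq p : ℤ) * x)) / (M : ℂ) ^ 2 := by
  unfold fejer
  push_cast
  rw [← Complex.mul_conj', map_sum, Finset.sum_mul_sum, Finset.sum_product]
  congr 1
  refine Finset.sum_congr rfl fun k _ => Finset.sum_congr rfl fun l _ => ?_
  rw [conj_e, ← e_add, pairFreq]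
  congr 1
  push_cast; ring

lemma ofReal_fejer_sq (M : ℕ) (x : ℝ) : ((fejer M x ^ 2 : ℝ) : ℂ) =
    (∑ q ∈ (Finset.range M ×ˢ Finset.range M) ×ˢ (Finset.range M ×ˢ Finset.range M),
      e ((pairFreq q.1 + pairFreq q.2 : ℤ) * x)) / (M : ℂ) ^ 4 := by
  rw [Complex.ofReal_pow, ofReal_fejer, div_pow, ← pow_mul, sq (Finset.sum _ _),
    Finset.sum_mul_sum, Finset.sum_product (s := Finset.range M ×ˢ Finset.range M)]
  congr 1
  refine Finset.sum_congr rfl fun k _ => Finset.sum_congr rfl fun l _ => ?_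
  rw [← e_add]
  congr 1
  push_cast; ring

lemma abs_pairFreq_lt {M : ℕ} {p : ℕ × ℕ} (hp : p ∈ Finset.range M ×ˢ Finset.range M) :
    |pairFreq p| < M := by
  rw [Finset.mem_product, Finset.mem_range, Finset.mem_range] at hp
  unfold pairFreq
  rw [abs_lt]
  omega

lemma norm_sum_freq_sub_le {ι : Type*} (S : Finset ℕ) (w x : ℕ → ℝ) (T : Finset ι) (ν : ι → ℤ)
    {E : ℝ} (hE : ∀ i ∈ T, ν i ≠ 0 → ‖∑ n ∈ S, (w n : ℂ) * e ((ν i : ℤ) * x n)‖ ≤ E) :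
    ‖∑ n ∈ S, (w n : ℂ) * ∑ i ∈ T, e ((ν i : ℤ) * x n) -
      ((T.filter (fun i => ν i = 0)).card : ℂ) * ∑ n ∈ S, (w n : ℂ)‖ ≤
      ((T.filter (fun i => ¬ ν i = 0)).card : ℝ) * E := by
  have e1 : ∑ n ∈ S, (w n : ℂ) * ∑ i ∈ T, e ((ν i : ℤ) * x n) =
      ∑ i ∈ T, ∑ n ∈ S, (w n : ℂ) * e ((ν i : ℤ) * x n) := by
    rw [Finset.sum_comm]
    exact Finset.sum_congr rfl fun n _ => Finset.mul_sum _ _ _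
  have e2 : ∑ i ∈ T.filter (fun i => ν i = 0), ∑ n ∈ S, (w n : ℂ) * e ((ν i : ℤ) * x n) =
      ((T.filter (fun i => ν i = 0)).card : ℂ) * ∑ n ∈ S, (w n : ℂ) := by
    rw [← nsmul_eq_mul, ← Finset.sum_const]
    refine Finset.sum_congr rfl fun i hi => Finset.sum_congr rfl fun n _ => ?_
    rw [(Finset.mem_filter.1 hi).2]
    simp
  rw [e1, ← Finset.sum_filter_add_sum_filter_not T (fun i => ν i = 0), e2, add_sub_cancel_left,
    ← nsmul_eq_mul, ← Finset.sum_const]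
  refine norm_sum_le_of_le _ fun i hi => ?_
  rw [Finset.mem_filter] at hi
  exact hE i hi.1 hi.2

/-- Mass of a weight on the points whose phase is close to an integer. -/
theorem mass_near_integers (S : Finset ℕ) (w x : ℕ → ℝ) (hw : ∀ n ∈ S, 0 ≤ w n) {M : ℕ}
    (hM : 1 ≤ M) {ρ E : ℝ} (hρ : 4 ≤ 2 * M * ρ)
    (hE : ∀ ν : ℤ, ν ≠ 0 → |ν| < 2 * M → ‖∑ n ∈ S, (w n : ℂ) * e ((ν : ℤ) * x n)‖ ≤ E) :
    7 / 16 * (∑ n ∈ S, w n) / M - 2 * E ≤ ∑ n ∈ S with nd (x n) < ρ, w n := by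
  have hM0 : (0 : ℝ) < M := by exact_mod_cast hM
  have hE0 : 0 ≤ E := (norm_nonneg _).trans (hE 1 one_ne_zero (by rw [abs_one]; omega))
  set W := ∑ n ∈ S, w n with hW
  have hW0 : 0 ≤ W := Finset.sum_nonneg hw
  have hmin : ∑ n ∈ S, w n * (fejer M (x n) ^ 2 - 1 / 16 * fejer M (x n)) ≤
      ∑ n ∈ S with nd (x n) < ρ, w n := by
    rw [Finset.sum_filter]
    refine Finset.sum_le_sum fun n hn => ?_
    have h0 := fejer_nonneg M (x n)
    have h1 := fejer_le_one M (x n)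
    split_ifs with h
    · refine mul_le_of_le_one_right (hw n hn) ?_
      nlinarith
    · refine mul_nonpos_of_nonneg_of_nonpos (hw n hn) ?_
      have h2 := fejer_mul_sq_le M (x n)
      have h3 : 4 ≤ 2 * M * nd (x n) := hρ.trans (by gcongr; exact not_lt.1 h)
      have h4 : fejer M (x n) * 4 ^ 2 ≤ 1 := le_trans (by gcongr) h2
      nlinarith
  set T2 := (Finset.range M ×ˢ Finset.range M) ×ˢ (Finset.range M ×ˢ Finset.range M) with hT2
  set T1 := Finset.range M ×ˢ Finset.range M with hT1
  have hF1 := norm_sum_freq_sub_le S w x T1 pairFreq (E := E) (fun i hi h0 => hE _ h0 (by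
    have := abs_pairFreq_lt hi; omega))
  have hF2 := norm_sum_freq_sub_le S w x T2 (fun q => pairFreq q.1 + pairFreq q.2) (E := E)
    (fun i hi h0 => hE _ h0 (by
      rw [hT2, Finset.mem_product] at hi
      have h1 := abs_pairFreq_lt hi.1
      have h2 := abs_pairFreq_lt hi.2
      have h3 := abs_add_le (pairFreq i.1) (pairFreq i.2)
      omega))
  have hMc : (M : ℂ) ≠ 0 := by exact_mod_cast hM0.ne'
  have hWc : ∑ n ∈ S, (w n : ℂ) = (W : ℂ) := by rw [hW]; push_cast; rfl
  have e1 : ∑ n ∈ S, (w n : ℂ) * ∑ i ∈ T1, e ((pairFreq i : ℤ) * x n) =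
      (((M : ℝ) ^ 2 * ∑ n ∈ S, w n * fejer M (x n) : ℝ) : ℂ) := by
    push_cast
    rw [Finset.mul_sum]
    refine Finset.sum_congr rfl fun n _ => ?_
    rw [ofReal_fejer]
    generalize ∑ i ∈ T1, e ((pairFreq i : ℤ) * x n) = s
    field_simp
  have e2 : ∑ n ∈ S, (w n : ℂ) * ∑ i ∈ T2, e ((pairFreq i.1 + pairFreq i.2 : ℤ) * x n) =
      (((M : ℝ) ^ 4 * ∑ n ∈ S, w n * fejer M (x n) ^ 2 : ℝ) : ℂ) := by
    rw [Complex.ofReal_mul, Complex.ofReal_sum, Finset.mul_sum]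
    refine Finset.sum_congr rfl fun n _ => ?_
    rw [Complex.ofReal_mul, ofReal_fejer_sq]
    generalize ∑ i ∈ T2, e ((pairFreq i.1 + pairFreq i.2 : ℤ) * x n) = s
    push_cast
    field_simp
  have c1 : (T1.filter (fun p => pairFreq p = 0)).card = M := by
    have : T1.filter (fun p => pairFreq p = 0) = (Finset.range M).diag := by
      ext p
      simp only [Finset.mem_filter, hT1, Finset.mem_product, Finset.mem_diag, pairFreq]
      constructor
      · rintro ⟨h1, h2⟩; exact ⟨h1.1, by omega⟩
      · rintro ⟨h1, h2⟩; exact ⟨⟨h1, h2 ▸ h1⟩, by omega⟩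
    rw [this, Finset.diag_card, Finset.card_range]
  have c2 : (M : ℝ) ^ 3 / 2 ≤ ((T2.filter (fun q => pairFreq q.1 + pairFreq q.2 = 0)).card : ℝ) := by
    have h1 := Finset.card_sq_le_card_mul_addEnergy (Finset.range M) (Finset.range M)
      (Finset.range (2 * M))
    have h2 : (Finset.range M ×ˢ Finset.range M).filter
        (fun xy => xy.1 + xy.2 ∈ Finset.range (2 * M)) = Finset.range M ×ˢ Finset.range M := by
      refine Finset.filter_true_of_mem fun p hp => ?_
      simp only [Finset.mem_product, Finset.mem_range] at hp ⊢
      omega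
    have h3 : (Finset.range M).addEnergy (Finset.range M) =
        (T2.filter (fun q => pairFreq q.1 + pairFreq q.2 = 0)).card := by
      unfold Finset.addEnergy
      congr 1
      ext q
      simp only [Finset.mem_filter, pairFreq, hT2]
      constructor
      · rintro ⟨h, h'⟩; exact ⟨h, by omega⟩
      · rintro ⟨h, h'⟩; exact ⟨h, by omega⟩
    rw [h2, h3, Finset.card_product, Finset.card_range, Finset.card_range] at h1
    have h4 : ((M : ℝ) * M) ^ 2 ≤ 2 * M *
        ((T2.filter (fun q => pairFreq q.1 + pairFreq q.2 = 0)).card : ℝ) := by exact_mod_cast h1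
    nlinarith [mul_pos hM0 hM0]
  have d1 : ((T1.filter (fun p => ¬ pairFreq p = 0)).card : ℝ) ≤ (M : ℝ) ^ 2 := by
    have := Finset.card_filter_le T1 (fun p => ¬ pairFreq p = 0)
    rw [hT1, Finset.card_product, Finset.card_range] at this
    rw [sq]; exact_mod_cast this
  have d2 : ((T2.filter (fun q => ¬ pairFreq q.1 + pairFreq q.2 = 0)).card : ℝ) ≤ (M : ℝ) ^ 4 := by
    have := Finset.card_filter_le T2 (fun q => ¬ pairFreq q.1 + pairFreq q.2 = 0)
    rw [hT2, Finset.card_product, Finset.card_product, Finset.card_range] at this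
    calc _ ≤ ((M * M * (M * M) : ℕ) : ℝ) := by exact_mod_cast this
      _ = _ := by push_cast; ring
  rw [hWc, e1, c1, ← Complex.ofReal_natCast, ← Complex.ofReal_mul, ← Complex.ofReal_sub,
    Complex.norm_real, Real.norm_eq_abs] at hF1
  rw [hWc, e2, ← Complex.ofReal_natCast, ← Complex.ofReal_mul, ← Complex.ofReal_sub,
    Complex.norm_real, Real.norm_eq_abs] at hF2
  have g1 : ∑ n ∈ S, w n * fejer M (x n) ≤ W / M + E := by
    have h1 := (abs_le.1 hF1).2
    have h2 : (M : ℝ) ^ 2 * ∑ n ∈ S, w n * fejer M (x n) ≤ (M : ℝ) ^ 2 * (W / M + E) := by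
      have : (M : ℝ) ^ 2 * (W / M + E) = M * W + (M : ℝ) ^ 2 * E := by field_simp
      rw [this]
      have := mul_le_mul_of_nonneg_right d1 hE0
      linarith
    exact le_of_mul_le_mul_left h2 (by positivity)
  have g2 : W / (2 * M) - E ≤ ∑ n ∈ S, w n * fejer M (x n) ^ 2 := by
    have h1 := (abs_le.1 hF2).1
    have h2 : (M : ℝ) ^ 4 * (W / (2 * M) - E) ≤ (M : ℝ) ^ 4 * ∑ n ∈ S, w n * fejer M (x n) ^ 2 := by
      have : (M : ℝ) ^ 4 * (W / (2 * M) - E) = (M : ℝ) ^ 3 / 2 * W - (M : ℝ) ^ 4 * E := by field_simp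
      rw [this]
      have h3 := mul_le_mul_of_nonneg_right d2 hE0
      have h4 := mul_le_mul_of_nonneg_right c2 hW0
      linarith
    exact le_of_mul_le_mul_left h2 (by positivity)
  refine le_trans ?_ hmin
  have e3 : ∑ n ∈ S, w n * (fejer M (x n) ^ 2 - 1 / 16 * fejer M (x n)) =
      ∑ n ∈ S, w n * fejer M (x n) ^ 2 - 1 / 16 * ∑ n ∈ S, w n * fejer M (x n) := by
    rw [Finset.mul_sum, ← Finset.sum_sub_distrib]
    exact Finset.sum_congr rfl fun n _ => by ring
  rw [e3]
  have e4 : 7 / 16 * W / M = W / (2 * M) - 1 / 16 * (W / M) := by field_simp; ring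
  rw [e4]
  linarith

lemma eventually_const_mul_rpow_le (A : ℝ) {a b : ℝ} (hab : a < b) :
    ∀ᶠ N : ℕ in atTop, A * (N : ℝ) ^ a ≤ (N : ℝ) ^ b := by
  have h := (tendsto_rpow_atTop (sub_pos.2 hab)).comp (tendsto_natCast_atTop_atTop (R := ℝ))
  filter_upwards [h.eventually_ge_atTop A, eventually_ge_atTop 1] with N hA hN
  have hN' : (0 : ℝ) < N := by exact_mod_cast hN
  calc A * (N : ℝ) ^ a ≤ (N : ℝ) ^ (b - a) * (N : ℝ) ^ a := by gcongr; exact hA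
    _ = (N : ℝ) ^ b := by rw [← Real.rpow_add hN', sub_add_cancel]

open ArithmeticFunction in
lemma norm_sum_int_freq (S : Finset ℕ) (w f : ℕ → ℝ) (s : ℝ) (ν : ℤ) :
    ‖∑ n ∈ S, (w n : ℂ) * e ((ν : ℤ) * (f n + s))‖ =
      ‖∑ n ∈ S, (w n : ℂ) * e (((|ν| : ℤ) : ℝ) * f n)‖ := by
  have h1 : ∑ n ∈ S, (w n : ℂ) * e ((ν : ℤ) * (f n + s)) =
      e (ν * s) * ∑ n ∈ S, (w n : ℂ) * e ((ν : ℤ) * f n) := by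
    rw [Finset.mul_sum]
    refine Finset.sum_congr rfl fun n _ => ?_
    rw [mul_add, e_add]; ring
  rw [h1, norm_mul, norm_e, one_mul]
  rcases abs_choice ν with h | h
  · rw [h]
  · rw [h, ← Complex.norm_conj, map_sum]
    congr 1
    refine Finset.sum_congr rfl fun n _ => ?_
    rw [map_mul, conj_e, Complex.conj_ofReal]
    congr 2
    push_cast; ring

open ArithmeticFunction in
/-- Chebyshev's lower bound in the window `(N/4, N]`. -/
lemma eventually_psi_window : ∀ᶠ N : ℕ in atTop,
    3 / 10 * (N : ℝ) ≤ ∑ n ∈ Finset.Ioc (N / 4) N, Λ n := by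
  have h1 : (fun x : ℝ => √x * Real.log x) =o[atTop] fun x => x := by
    have h := isLittleO_log_rpow_atTop (r := 1 / 2) (by norm_num)
    have h2 := (Asymptotics.isBigO_refl (fun x : ℝ => √x) atTop).mul_isLittleO h
    refine h2.congr' EventuallyEq.rfl ?_
    filter_upwards [eventually_ge_atTop 0] with x hx
    rw [← Real.sqrt_eq_rpow, Real.mul_self_sqrt hx]
  have h3 : (fun x : ℝ => Real.log x) =o[atTop] fun x => x := Real.isLittleO_log_id_atTop
  have b1 := tendsto_natCast_atTop_atTop.eventually (h1.def (c := 1 / 1000) (by norm_num))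
  have b2 := tendsto_natCast_atTop_atTop.eventually (h3.def (c := 1 / 1000) (by norm_num))
  filter_upwards [b1, b2, eventually_ge_atTop 1000] with N b1 b2 hN
  have hN' : (1000 : ℝ) ≤ N := by exact_mod_cast hN
  have hl0 : 0 ≤ Real.log N := Real.log_nonneg (by linarith)
  rw [Real.norm_of_nonneg (by positivity), Real.norm_of_nonneg (by positivity)] at b1
  rw [Real.norm_of_nonneg hl0, Real.norm_of_nonneg (by positivity)] at b2
  have hsplit : Chebyshev.psi N = Chebyshev.psi ((N / 4 : ℕ) : ℝ) +
      ∑ n ∈ Finset.Ioc (N / 4) N, Λ n := by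
    unfold Chebyshev.psi
    rw [Nat.floor_natCast, Nat.floor_natCast]
    exact (Finset.sum_Ioc_consecutive _ (Nat.zero_le _) (Nat.div_le_self _ _)).symm
  have l1 := Chebyshev.psi_ge' (x := N) (by linarith)
  have hd1 : (1 : ℝ) ≤ ((N / 4 : ℕ) : ℝ) := by
    have : 1 ≤ N / 4 := by omega
    exact_mod_cast this
  have hd : ((N / 4 : ℕ) : ℝ) ≤ N / 4 := by
    have := Nat.cast_div_le (α := ℝ) (m := N) (n := 4); exact_mod_cast this
  have l2 := Chebyshev.psi_le hd1
  have l3 : 2 * √((N / 4 : ℕ) : ℝ) * Real.log ((N / 4 : ℕ) : ℝ) ≤ 2 * (√(N : ℝ) * Real.log N) := by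
    rw [mul_assoc]
    have : ((N / 4 : ℕ) : ℝ) ≤ N := by linarith
    have h0 := Real.log_nonneg hd1
    gcongr
  have l4 : Real.log (N + 2) ≤ Real.log 2 + Real.log N := by
    rw [← Real.log_mul (by norm_num) (by positivity)]
    exact Real.log_le_log (by positivity) (by linarith)
  have l5 : Real.log 4 = 2 * Real.log 2 := by
    rw [show (4 : ℝ) = 2 ^ 2 by norm_num, Real.log_pow]; norm_num
  have g1 := Real.log_two_gt_d9
  have g2 := Real.log_two_lt_d9
  rw [l5] at l2
  have l6 : 2 * Real.log 2 * ((N / 4 : ℕ) : ℝ) ≤ 2 * Real.log 2 * (N / 4) := by gcongr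
  nlinarith

open ArithmeticFunction in
/-- Lower bound for the number of primes `p` in a window such that `[f p, f (p + 1))` contains an
integer. -/
theorem card_primes_lower (C : ℝ) (hC : 1 ≤ C) : ∀ᶠ N : ℕ in atTop, ∀ (f : ℕ → ℝ) (lam δ : ℝ),
    PhaseCond f N lam C → (N : ℝ) ^ (-(61 / 60) : ℝ) ≤ lam → lam ≤ C / N →
    (N : ℝ) ^ (-(1 / 65) : ℝ) ≤ δ → δ ≤ 1 →
    (∀ n ∈ Finset.Ioc (N / 4) N, δ ≤ f (n + 1) - f n) →
    1 / 100 * (δ * N / Real.log N) ≤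
      (((Finset.Ioc (N / 4) N).filter
        (fun p => p.Prime ∧ ∃ m : ℤ, f p ≤ m ∧ (m : ℝ) < f (p + 1))).card : ℝ) := by
  have hsmall : ∀ᶠ N : ℕ in atTop, (10 : ℝ) * (N : ℝ) ^ (1 / 65 : ℝ) ≤ (N : ℝ) ^ (1 / 60 : ℝ) :=
    eventually_const_mul_rpow_le 10 (by norm_num)
  have hsmall2 : ∀ᶠ N : ℕ in atTop, (1000 : ℝ) * (N : ℝ) ^ (19 / 20 : ℝ) ≤ (N : ℝ) ^ (64 / 65 : ℝ) :=
    eventually_const_mul_rpow_le 1000 (by norm_num)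
  have hsmall3 : ∀ᶠ N : ℕ in atTop, 2 * √(N : ℝ) * Real.log N ≤ (N : ℝ) ^ (19 / 20 : ℝ) := by
    have h := isLittleO_log_rpow_atTop (r := 9 / 20) (by norm_num)
    have b := tendsto_natCast_atTop_atTop.eventually (h.def (c := 1 / 2) (by norm_num))
    filter_upwards [b, eventually_ge_atTop 1] with N b hN
    have hN' : (1 : ℝ) ≤ N := by exact_mod_cast hN
    rw [Real.norm_of_nonneg (Real.log_nonneg hN'), Real.norm_of_nonneg (by positivity)] at b
    have : (N : ℝ) ^ (19 / 20 : ℝ) = √(N : ℝ) * (N : ℝ) ^ (9 / 20 : ℝ) := by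
      rw [Real.sqrt_eq_rpow, ← Real.rpow_add (by linarith)]; norm_num
    rw [this]
    have h0 := Real.sqrt_nonneg (N : ℝ)
    nlinarith
  filter_upwards [hsmall, hsmall2, hsmall3, prime_sum_bound C hC, eventually_psi_window,
    eventually_ge_atTop 3] with N hs1 hs2 hs3 hprime hpsi hN f lam δ hph hlam1 hlam2 hδ1 hδ2 hδ3
  have hN' : (3 : ℝ) ≤ N := by exact_mod_cast hN
  have hlog : 0 < Real.log N := Real.log_pos (by linarith)
  have hδ0 : 0 < δ := lt_of_lt_of_le (by positivity) hδ1
  set M := ⌈4 / δ⌉₊ with hMdef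
  have hM1 : 1 ≤ M := Nat.ceil_pos.2 (by positivity)
  have hM0 : (0 : ℝ) < M := by exact_mod_cast hM1
  have hMl : 4 / δ ≤ M := Nat.le_ceil _
  have hMu : (M : ℝ) ≤ 5 / δ := by
    have h1 := (Nat.ceil_lt_add_one (show 0 ≤ 4 / δ by positivity)).le
    have h2 : 1 ≤ 1 / δ := by rw [le_div_iff₀ hδ0]; linarith
    calc (M : ℝ) ≤ 4 / δ + 1 := h1
      _ ≤ 4 / δ + 1 / δ := by gcongr
      _ = 5 / δ := by ring
  have hδinv : 1 / δ ≤ (N : ℝ) ^ (1 / 65 : ℝ) := by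
    rw [div_le_iff₀ hδ0]
    calc (1 : ℝ) = (N : ℝ) ^ (1 / 65 : ℝ) * (N : ℝ) ^ (-(1 / 65) : ℝ) := by
          rw [← Real.rpow_add (by linarith)]; norm_num
      _ ≤ _ := by gcongr
  have hM2 : (2 * M : ℝ) ≤ (N : ℝ) ^ (1 / 60 : ℝ) := by
    calc (2 * M : ℝ) ≤ 10 * (1 / δ) := by linarith [show 5 / δ = 5 * (1 / δ) by ring]
      _ ≤ 10 * (N : ℝ) ^ (1 / 65 : ℝ) := by gcongr
      _ ≤ _ := hs1
  have hmass := mass_near_integers (Finset.Ioc (N / 4) N) (fun n => Λ n)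
    (fun n => f n + δ / 2) (fun n _ => vonMangoldt_nonneg) hM1 (ρ := δ / 2)
    (E := (N : ℝ) ^ (19 / 20 : ℝ)) (by
      rw [div_le_iff₀ hδ0] at hMl; linarith) (by
      intro ν hν0 hν
      rw [norm_sum_int_freq]
      refine hprime f lam hph hlam1 hlam2 _ ?_ ?_
      · exact_mod_cast Int.one_le_abs hν0
      · refine le_trans ?_ hM2
        exact_mod_cast hν.le)
  set S := Finset.Ioc (N / 4) N with hS
  set G := S.filter (fun p => p.Prime ∧ ∃ m : ℤ, f p ≤ m ∧ (m : ℝ) < f (p + 1)) with hG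
  have hpp : ∑ n ∈ S with ¬ n.Prime, Λ n ≤ (N : ℝ) ^ (19 / 20 : ℝ) := by
    refine le_trans ?_ ((Chebyshev.psi_sub_theta_le (x := N) (by linarith)).trans hs3)
    rw [Chebyshev.psi_sub_theta_eq_sum_not_prime, Nat.floor_natCast]
    refine Finset.sum_le_sum_of_subset_of_nonneg ?_ (fun _ _ _ => vonMangoldt_nonneg)
    refine Finset.filter_subset_filter _ ?_
    exact Finset.Ioc_subset_Ioc_left (Nat.zero_le _)
  have hup : ∑ n ∈ S with nd (f n + δ / 2) < δ / 2, Λ n ≤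
      G.card * Real.log N + (N : ℝ) ^ (19 / 20 : ℝ) := by
    rw [← Finset.sum_filter_add_sum_filter_not _ (fun n => n.Prime)]
    refine add_le_add ?_ ?_
    · rw [← nsmul_eq_mul, ← Finset.sum_const]
      have hsub : (S.filter (fun n => nd (f n + δ / 2) < δ / 2)).filter (fun n => n.Prime) ⊆ G := by
        intro n hn
        rw [Finset.mem_filter, Finset.mem_filter] at hn
        obtain ⟨⟨hnS, hnd⟩, hnp⟩ := hn
        rw [hG, Finset.mem_filter]
        refine ⟨hnS, hnp, round (f n + δ / 2), ?_⟩
        have h3 := hδ3 n hnS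
        unfold nd at hnd
        rw [abs_lt] at hnd
        constructor <;> linarith
      refine (Finset.sum_le_sum_of_subset_of_nonneg hsub
        (fun _ _ _ => vonMangoldt_nonneg)).trans ?_
      refine Finset.sum_le_sum fun n hn => ?_
      have hnS := (Finset.mem_filter.1 hn).1
      have hnp := (Finset.mem_filter.1 hn).2.1
      rw [hS, Finset.mem_Ioc] at hnS
      rw [vonMangoldt_apply_prime hnp]
      exact Real.log_le_log (by exact_mod_cast hnp.pos) (by exact_mod_cast hnS.2)
    · refine le_trans (Finset.sum_le_sum_of_subset_of_nonneg ?_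
        (fun _ _ _ => vonMangoldt_nonneg)) hpp
      exact Finset.filter_subset_filter _ (Finset.filter_subset _ _)
  have hN64 : (N : ℝ) ^ (64 / 65 : ℝ) ≤ δ * N := by
    calc (N : ℝ) ^ (64 / 65 : ℝ) = (N : ℝ) ^ (-(1 / 65) : ℝ) * (N : ℝ) ^ (1 : ℝ) := by
          rw [← Real.rpow_add (by linarith)]; norm_num
      _ ≤ δ * N := by rw [Real.rpow_one]; gcongr
  have hmain : 21 / 800 * (δ * N) ≤ 7 / 16 * (∑ n ∈ S, Λ n) / M := by
    rw [le_div_iff₀ hM0]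
    rw [le_div_iff₀ hδ0] at hMu
    calc 21 / 800 * (δ * N) * M = 21 / 800 * N * (M * δ) := by ring
      _ ≤ 21 / 800 * N * 5 := by gcongr
      _ ≤ _ := by linarith
  rw [show 1 / 100 * (δ * N / Real.log N) = (1 / 100 * (δ * N)) / Real.log N by ring,
    div_le_iff₀ hlog]
  have : 0 < δ * N := by positivity
  linarith

/-- Analytic control on an inverse function `φ` with `φ' = φ₁`, `φ'' = -q` and `q' = q₁`. -/
structure PhiData (φ φ₁ q q₁ : ℝ → ℝ) (Y : ℝ) : Prop where
  one_le : 1 ≤ Y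
  d0 : ∀ y, Y ≤ y → HasDerivAt φ (φ₁ y) y
  d1 : ∀ y, Y ≤ y → HasDerivAt φ₁ (-q y) y
  d2 : ∀ y, Y ≤ y → HasDerivAt q (q₁ y) y
  pos : ∀ y, Y ≤ y → 0 < φ y
  qpos : ∀ y, Y ≤ y → 0 < q y
  lo0 : ∀ y, Y ≤ y → 71 / 72 * φ y ≤ y * φ₁ y
  hi0 : ∀ y, Y ≤ y → y * φ₁ y ≤ 101 / 100 * φ y
  lo2 : ∀ y, Y ≤ y → -(73 / 72) * q y ≤ y * q₁ y
  hi2 : ∀ y, Y ≤ y → y * q₁ y ≤ -(71 / 72) * q y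

section Construction

variable {c : ℝ} (F : Fc c)

lemma hasDerivAt_toFun {x : ℝ} (hx : F.x₀ < x) :
    HasDerivAt F.toFun (F.toFun x * (c + F.vth x) / x) x := by
  have hx0 : 0 < F.x₀ := lt_of_lt_of_le one_pos F.one_le_x₀
  have hxp : 0 < x := hx0.trans hx
  have hcont : ContinuousOn (fun t => F.vth t / t) (Set.Ici F.x₀) :=
    F.vth_contDiffOn.continuousOn.div continuousOn_id
      (fun t ht => (hx0.trans_le ht).ne')
  have hI : HasDerivAt (fun u => ∫ t in F.x₀..u, F.vth t / t) (F.vth x / x) x := by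
    refine intervalIntegral.integral_hasDerivAt_right ?_ ?_ ?_
    · refine (hcont.mono ?_).intervalIntegrable
      rw [Set.uIcc_of_le hx.le]
      exact fun t ht => ht.1
    · exact hcont.mono (Set.Ioi_subset_Ici le_rfl) |>.stronglyMeasurableAtFilter isOpen_Ioi x hx
    · exact hcont.continuousAt (Ici_mem_nhds hx)
  have h1 := ((Real.hasDerivAt_rpow_const (p := c) (Or.inl hxp.ne')).const_mul F.Ch).mul hI.exp
  refine (h1.congr_of_eventuallyEq ?_).congr_deriv ?_
  · filter_upwards [Ioi_mem_nhds hx] with u hu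
    exact F.eqn u (le_of_lt hu)
  · rw [F.eqn x hx.le, Real.rpow_sub_one hxp.ne']
    field_simp

lemma hasDerivAt_vth {x : ℝ} (hx : F.x₀ < x) : HasDerivAt F.vth (deriv F.vth x) x := by
  have h : ContDiffAt ℝ 2 F.vth x := F.vth_contDiffOn.contDiffAt (Ici_mem_nhds hx)
  exact (h.differentiableAt (by norm_num)).hasDerivAt

lemma hasDerivAt_deriv_vth {x : ℝ} (hx : F.x₀ < x) :
    HasDerivAt (deriv F.vth) (deriv (deriv F.vth) x) x := by
  have h : ContDiffOn ℝ 1 (deriv F.vth) (Set.Ioi F.x₀) :=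
    (F.vth_contDiffOn.mono Set.Ioi_subset_Ici_self).deriv_of_isOpen isOpen_Ioi (by norm_num)
  have h2 : ContDiffAt ℝ 1 (deriv F.vth) x := h.contDiffAt (Ioi_mem_nhds hx)
  exact (h2.differentiableAt (by norm_num)).hasDerivAt

/-- `x h'' / h'` in terms of the slowly varying exponent. -/
noncomputable def rOf (x : ℝ) : ℝ := c + F.vth x - 1 + x * deriv F.vth x / (c + F.vth x)

/-- The derivative of `rOf`. -/
noncomputable def rOf₁ (x : ℝ) : ℝ := deriv F.vth x +
  ((deriv F.vth x + x * deriv (deriv F.vth) x) * (c + F.vth x) - x * deriv F.vth x * deriv F.vth x)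
    / (c + F.vth x) ^ 2

lemma hasDerivAt_rOf {x : ℝ} (hx : F.x₀ < x) (ha : c + F.vth x ≠ 0) :
    HasDerivAt (rOf F) (rOf₁ F x) x := by
  have h1 := (hasDerivAt_vth F hx).const_add c
  have h2 := (hasDerivAt_id x).mul (hasDerivAt_deriv_vth F hx)
  have := (h1.sub_const 1).add (h2.div h1 ha)
  refine this.congr_deriv ?_
  simp [rOf₁]

lemma tendsto_vth (hc₁ : 1 ≤ c) : Tendsto F.vth atTop (nhds 0) := by
  rcases hc₁.eq_or_lt with h | h
  · exact (F.cond_eq h.symm).2.2.2.2.1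
  · exact (F.cond_gt h).1

lemma tendsto_x_deriv_vth (hc₁ : 1 ≤ c) :
    Tendsto (fun x => x * deriv F.vth x) atTop (nhds 0) := by
  rcases hc₁.eq_or_lt with h | h
  · have h1 := (F.cond_eq h.symm).2.2.2.2.2.1
    have h2 := h1.mul (tendsto_vth F hc₁)
    rw [mul_zero] at h2
    refine h2.congr' ?_
    filter_upwards [eventually_ge_atTop F.x₀] with x hx
    have := (F.cond_eq h.symm).1 x hx
    field_simp
  · exact (F.cond_gt h).2.1

lemma tendsto_rOf (hc₁ : 1 ≤ c) : Tendsto (rOf F) atTop (nhds (c - 1)) := by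
  have h0 : Tendsto (fun x => c + F.vth x) atTop (nhds c) := by
    simpa using (tendsto_vth F hc₁).const_add c
  have h1 := (h0.sub_const 1).add ((tendsto_x_deriv_vth F hc₁).div h0 (by linarith))
  rw [zero_div, add_zero] at h1
  exact h1

/-- `x r'/r → 0`, together with positivity of `r`. -/
lemma tendsto_rOf₁ (hc₁ : 1 ≤ c) :
    (∀ᶠ x in atTop, 0 < rOf F x) ∧ Tendsto (fun x => x * rOf₁ F x / rOf F x) atTop (nhds 0) := by
  have h0 : Tendsto (fun x => c + F.vth x) atTop (nhds c) := by
    simpa using (tendsto_vth F hc₁).const_add c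
  have hc0 : c ≠ 0 := by linarith
  have hx1 := tendsto_x_deriv_vth F hc₁
  rcases hc₁.eq_or_lt with h | h
  · obtain ⟨hpos, -, -, -, -, ht1, ht2⟩ := F.cond_eq h.symm
    have hv := tendsto_vth F hc₁
    have hr : Tendsto (fun x => rOf F x / F.vth x) atTop (nhds 1) := by
      have : Tendsto (fun x => 1 + (x * deriv F.vth x / F.vth x) / (c + F.vth x)) atTop
          (nhds (1 + 0 / c)) := (ht1.div h0 hc0).const_add 1
      rw [zero_div, add_zero] at this
      refine this.congr' ?_
      filter_upwards [eventually_ge_atTop F.x₀] with x hx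
      have := hpos x hx
      have h2 : c + F.vth x ≠ 0 := by linarith
      unfold rOf
      rw [show c + F.vth x - 1 = F.vth x by linarith]
      field_simp
    have hr1 : Tendsto (fun x => x * rOf₁ F x / F.vth x) atTop (nhds 0) := by
      have : Tendsto (fun x => x * deriv F.vth x / F.vth x +
          ((x * deriv F.vth x / F.vth x + x ^ 2 * deriv (deriv F.vth) x / F.vth x) * (c + F.vth x) -
            x * deriv F.vth x / F.vth x * (x * deriv F.vth x)) / (c + F.vth x) ^ 2) atTop
          (nhds (0 + ((0 + 0) * c - 0 * 0) / c ^ 2)) :=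
        ht1.add ((((ht1.add ht2).mul h0).sub (ht1.mul hx1)).div (h0.pow 2) (by positivity))
      simp only [add_zero, zero_mul, sub_zero, zero_div] at this
      refine this.congr' ?_
      filter_upwards [eventually_ge_atTop F.x₀] with x hx
      have := hpos x hx
      have h2 : c + F.vth x ≠ 0 := by linarith
      unfold rOf₁
      field_simp
    constructor
    · filter_upwards [hr.eventually (lt_mem_nhds one_pos), eventually_ge_atTop F.x₀] with x h1 hx
      have := hpos x hx
      exact (div_pos_iff_of_pos_right this).1 h1
    · have := hr1.div hr one_ne_zero
      rw [zero_div] at this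
      refine this.congr' ?_
      filter_upwards [eventually_ge_atTop F.x₀] with x hx
      have := hpos x hx
      simp only [Pi.div_apply]
      rw [div_div_div_cancel_right₀ this.ne']
  · obtain ⟨-, -, ht2⟩ := F.cond_gt h
    have hr := tendsto_rOf F hc₁
    have hr1 : Tendsto (fun x => x * rOf₁ F x) atTop (nhds 0) := by
      have : Tendsto (fun x => x * deriv F.vth x +
          ((x * deriv F.vth x + x ^ 2 * deriv (deriv F.vth) x) * (c + F.vth x) -
            x * deriv F.vth x * (x * deriv F.vth x)) / (c + F.vth x) ^ 2) atTop
          (nhds (0 + ((0 + 0) * c - 0 * 0) / c ^ 2)) :=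
        hx1.add ((((hx1.add ht2).mul h0).sub (hx1.mul hx1)).div (h0.pow 2) (by positivity))
      simp only [add_zero, zero_mul, sub_zero, zero_div] at this
      refine this.congr fun x => ?_
      unfold rOf₁
      ring
    refine ⟨hr.eventually (lt_mem_nhds (by linarith)), ?_⟩
    have := hr1.div hr (by linarith)
    rwa [zero_div] at this

lemma strictMonoOn_toFun : StrictMonoOn F.toFun (Set.Ici F.x₀) := by
  refine strictMonoOn_of_deriv_pos (convex_Ici _) F.contDiffOn.continuousOn fun x hx => ?_
  rw [interior_Ici] at hx
  exact F.deriv_pos x (le_of_lt hx)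

lemma tendsto_toFun (hc₁ : 1 ≤ c) : Tendsto F.toFun atTop atTop := by
  have hx0 : 0 < F.x₀ := lt_of_lt_of_le one_pos F.one_le_x₀
  have hv := (tendsto_vth F hc₁).eventually (lt_mem_nhds (show (-(1 / 2) : ℝ) < 0 by norm_num))
  obtain ⟨X, hX⟩ := eventually_atTop.1 hv
  set X1 := max X (F.x₀ + 1) with hX1
  have hX1x : F.x₀ < X1 := lt_of_lt_of_le (lt_add_one _) (le_max_right _ _)
  have hmono : MonotoneOn (fun x => F.toFun x * x ^ (-(1 / 2) : ℝ)) (Set.Ici X1) := by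
    have hd : ∀ x ∈ Set.Ici X1, HasDerivAt (fun x => F.toFun x * x ^ (-(1 / 2) : ℝ))
        (F.toFun x * (c + F.vth x) / x * x ^ (-(1 / 2) : ℝ) +
          F.toFun x * (-(1 / 2) * x ^ (-(1 / 2) - 1 : ℝ))) x := fun x hx =>
      (hasDerivAt_toFun F (hX1x.trans_le hx)).mul
        (Real.hasDerivAt_rpow_const (Or.inl (hx0.trans (hX1x.trans_le hx)).ne'))
    refine monotoneOn_of_hasDerivWithinAt_nonneg (convex_Ici _)
      (fun x hx => (hd x hx).continuousAt.continuousWithinAt)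
      (fun x hx => (hd x (interior_subset hx)).hasDerivWithinAt) fun x hx => ?_
    have hx := interior_subset hx
    have hxp : 0 < x := hx0.trans (hX1x.trans_le hx)
    have h1 := F.one_le x (hX1x.trans_le hx).le
    have h2 := hX x ((le_max_left _ _).trans hx)
    rw [Real.rpow_sub_one hxp.ne']
    have : F.toFun x * (c + F.vth x) / x * x ^ (-(1 / 2) : ℝ) +
          F.toFun x * (-(1 / 2) * (x ^ (-(1 / 2) : ℝ) / x)) =
        F.toFun x * x ^ (-(1 / 2) : ℝ) / x * (c + F.vth x - 1 / 2) := by ring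
    rw [this]
    have h3 : 0 ≤ c + F.vth x - 1 / 2 := by linarith
    have : 0 < x ^ (-(1 / 2) : ℝ) := by positivity
    positivity
  have hX1p : 0 < X1 := hx0.trans hX1x
  set K := F.toFun X1 * X1 ^ (-(1 / 2) : ℝ) with hK
  have hKp : 0 < K := by
    have h1 := F.one_le X1 hX1x.le
    have : 0 < X1 ^ (-(1 / 2) : ℝ) := by positivity
    positivity
  refine tendsto_atTop_mono' atTop ?_ ((tendsto_rpow_atTop (y := 1 / 2) (by norm_num)).const_mul_atTop hKp)
  filter_upwards [eventually_ge_atTop X1] with x hx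
  have hxp : 0 < x := hX1p.trans_le hx
  have h1 := hmono (Set.self_mem_Ici) hx hx
  calc K * x ^ (1 / 2 : ℝ) ≤ F.toFun x * x ^ (-(1 / 2) : ℝ) * x ^ (1 / 2 : ℝ) := by gcongr
    _ = F.toFun x := by rw [mul_assoc, ← Real.rpow_add hxp]; norm_num

lemma surjOn_toFun (hc₁ : 1 ≤ c) {y : ℝ} (hy : F.toFun F.x₀ ≤ y) :
    ∃ x, F.x₀ ≤ x ∧ F.toFun x = y := by
  obtain ⟨b, hb, hxb⟩ := ((tendsto_toFun F hc₁).eventually_ge_atTop y |>.and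
    (eventually_ge_atTop F.x₀)).exists
  have := intermediate_value_Icc hxb (F.contDiffOn.continuousOn.mono Set.Icc_subset_Ici_self)
  obtain ⟨x, hx, rfl⟩ := this ⟨hy, hb⟩
  exact ⟨x, hx.1, rfl⟩

/-- The inverse function of an element of the family. -/
noncomputable def phiOf : ℝ → ℝ := Function.invFunOn F.toFun (Set.Ici F.x₀)

lemma phiOf_spec (hc₁ : 1 ≤ c) {y : ℝ} (hy : F.toFun F.x₀ ≤ y) :
    F.x₀ ≤ phiOf F y ∧ F.toFun (phiOf F y) = y := by
  obtain ⟨x, hx, hxy⟩ := surjOn_toFun F hc₁ hy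
  exact ⟨Function.invFunOn_mem ⟨x, hx, hxy⟩, Function.invFunOn_eq ⟨x, hx, hxy⟩⟩

lemma phiOf_le_iff (hc₁ : 1 ≤ c) {y x : ℝ} (hy : F.toFun F.x₀ ≤ y) (hx : F.x₀ ≤ x) :
    phiOf F y ≤ x ↔ y ≤ F.toFun x := by
  obtain ⟨h1, h2⟩ := phiOf_spec F hc₁ hy
  conv_rhs => rw [← h2]
  exact ((strictMonoOn_toFun F).le_iff_le h1 hx).symm

lemma phiOf_toFun (hc₁ : 1 ≤ c) {x : ℝ} (hx : F.x₀ ≤ x) : phiOf F (F.toFun x) = x := by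
  have hm := (strictMonoOn_toFun F).monotoneOn Set.self_mem_Ici hx hx
  obtain ⟨h1, h2⟩ := phiOf_spec F hc₁ hm
  exact (strictMonoOn_toFun F).injOn h1 hx h2

lemma floor_eq_iff_phiOf (hc₁ : 1 ≤ c) {p : ℕ} (hp : F.toFun F.x₀ ≤ p) :
    (∃ n : ℕ, F.x₀ ≤ (n : ℝ) ∧ (p : ℤ) = ⌊F.toFun n⌋) ↔
      ∃ m : ℤ, phiOf F p ≤ m ∧ (m : ℝ) < phiOf F ((p : ℝ) + 1) := by
  have hp1 : F.toFun F.x₀ ≤ (p : ℝ) + 1 := by linarith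
  have hx0 : 0 < F.x₀ := lt_of_lt_of_le one_pos F.one_le_x₀
  constructor
  · rintro ⟨n, hn, hpn⟩
    have := (Int.floor_eq_iff.1 hpn.symm)
    push_cast at this
    refine ⟨n, ?_, ?_⟩
    · push_cast; exact (phiOf_le_iff F hc₁ hp hn).2 this.1
    · push_cast; exact lt_of_not_ge fun h => absurd ((phiOf_le_iff F hc₁ hp1 hn).1 h) (not_le.2 this.2)
  · rintro ⟨m, hm1, hm2⟩
    have hmx : F.x₀ ≤ m := (phiOf_spec F hc₁ hp).1.trans hm1
    have hm0 : 0 ≤ m := by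
      have : (0 : ℝ) ≤ m := by linarith
      exact_mod_cast this
    lift m to ℕ using hm0
    push_cast at hm1 hm2 hmx
    refine ⟨m, hmx, (Int.floor_eq_iff.2 ⟨?_, ?_⟩).symm⟩
    · push_cast; exact (phiOf_le_iff F hc₁ hp hmx).1 hm1
    · push_cast; exact lt_of_not_ge fun h => absurd ((phiOf_le_iff F hc₁ hp1 hmx).2 h) (not_le.2 hm2)

lemma hasDerivAt_phiOf (hc₁ : 1 ≤ c) {y : ℝ} (hy : F.toFun F.x₀ < y)
    (ha : c + F.vth (phiOf F y) ≠ 0) :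
    HasDerivAt (phiOf F) (phiOf F y / (y * (c + F.vth (phiOf F y)))) y := by
  obtain ⟨h1, h2⟩ := phiOf_spec F hc₁ hy.le
  have hx0 : 0 < F.x₀ := lt_of_lt_of_le one_pos F.one_le_x₀
  have h3 : F.x₀ < phiOf F y := lt_of_le_of_ne h1 fun h => by
    rw [← h] at h2; linarith
  have hy0 : 0 < y := lt_of_lt_of_le (by linarith [F.one_le F.x₀ le_rfl]) hy.le
  have hcont : ContinuousAt (phiOf F) y := by
    refine continuousAt_of_monotoneOn_of_image_mem_nhds (s := Set.Ici (F.toFun F.x₀)) ?_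
      (Ici_mem_nhds hy) ?_
    · intro u hu v hv huv
      rw [phiOf_le_iff F hc₁ hu (phiOf_spec F hc₁ hv).1, (phiOf_spec F hc₁ hv).2]
      exact huv
    · refine mem_of_superset (Ici_mem_nhds h3) fun x hx => ?_
      exact ⟨F.toFun x, (strictMonoOn_toFun F).monotoneOn Set.self_mem_Ici hx hx,
        phiOf_toFun F hc₁ hx⟩
  have hd := hasDerivAt_toFun F h3
  rw [h2] at hd
  have hp : phiOf F y ≠ 0 := (hx0.trans h3).ne'
  have := HasDerivAt.of_local_left_inverse hcont hd (by
    have := hy0.ne'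
    positivity) (by
    filter_upwards [Ioi_mem_nhds hy] with u hu
    exact (phiOf_spec F hc₁ (le_of_lt hu)).2)
  refine this.congr_deriv ?_
  rw [inv_div]

theorem exists_phiData (hc₁ : 1 ≤ c) (hc₂ : c < 72 / 71) :
    ∃ φ₁ q q₁ : ℝ → ℝ, ∃ Y : ℝ, F.toFun F.x₀ ≤ Y ∧ PhiData (phiOf F) φ₁ q q₁ Y := by
  have hc0 : 0 < c := by linarith
  have hx0 : 0 < F.x₀ := lt_of_lt_of_le one_pos F.one_le_x₀
  have h0 : Tendsto (fun x => c + F.vth x) atTop (nhds c) := by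
    simpa using (tendsto_vth F hc₁).const_add c
  have hlim : Tendsto (fun x => (x * rOf₁ F x / rOf F x - 2 * rOf F x - 1) / (c + F.vth x)) atTop
      (nhds ((0 - 2 * (c - 1) - 1) / c)) :=
    ((((tendsto_rOf₁ F hc₁).2.sub ((tendsto_rOf F hc₁).const_mul 2)).sub_const 1)).div h0 hc0.ne'
  have hl1 : -(73 / 72) < (0 - 2 * (c - 1) - 1) / c := by
    rw [lt_div_iff₀ hc0]; nlinarith
  have hl2 : (0 - 2 * (c - 1) - 1) / c < -(71 / 72) := by
    rw [div_lt_iff₀ hc0]; nlinarith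
  have hall := ((hlim.eventually (lt_mem_nhds hl1)).and (hlim.eventually (gt_mem_nhds hl2))).and
    ((tendsto_rOf₁ F hc₁).1.and ((h0.eventually (gt_mem_nhds hc₂)).and
      (h0.eventually (lt_mem_nhds (show (100 / 101 : ℝ) < c by linarith)))))
  obtain ⟨X, hX⟩ := eventually_atTop.1 hall
  set X1 := max X (F.x₀ + 1) with hX1
  have hX1x : F.x₀ < X1 := lt_of_lt_of_le (lt_add_one _) (le_max_right _ _)
  have hYlt : F.toFun F.x₀ < F.toFun X1 :=
    strictMonoOn_toFun F Set.self_mem_Ici hX1x.le hX1x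
  have hphi : ∀ y, F.toFun X1 ≤ y → X1 ≤ phiOf F y := by
    intro y hy
    obtain ⟨h1, h2⟩ := phiOf_spec F hc₁ (hYlt.le.trans hy)
    rw [← h2] at hy
    exact ((strictMonoOn_toFun F).le_iff_le hX1x.le h1).1 hy
  have hone : 1 ≤ F.toFun X1 := F.one_le _ hX1x.le
  set φ := phiOf F with hφ
  set φ₁ : ℝ → ℝ := fun y => φ y / (y * (c + F.vth (φ y))) with hφ₁
  set q : ℝ → ℝ := fun y => rOf F (φ y) * φ₁ y ^ 2 / φ y with hq
  set q₁ : ℝ → ℝ := fun y => ((rOf₁ F (φ y) * φ₁ y * φ₁ y ^ 2 + rOf F (φ y) * (2 * φ₁ y * -q y)) * φ y -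
    rOf F (φ y) * φ₁ y ^ 2 * φ₁ y) / φ y ^ 2 with hq₁
  have key : ∀ y, F.toFun X1 ≤ y → 0 < y ∧ F.x₀ < φ y ∧ 0 < φ y ∧ 0 < rOf F (φ y) ∧
      100 / 101 < c + F.vth (φ y) ∧ c + F.vth (φ y) < 72 / 71 ∧
      -(73 / 72) < (φ y * rOf₁ F (φ y) / rOf F (φ y) - 2 * rOf F (φ y) - 1) / (c + F.vth (φ y)) ∧
      (φ y * rOf₁ F (φ y) / rOf F (φ y) - 2 * rOf F (φ y) - 1) / (c + F.vth (φ y)) < -(71 / 72) := by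
    intro y hy
    have h1 := hphi y hy
    obtain ⟨⟨h2, h3⟩, h4, h5, h6⟩ := hX (φ y) ((le_max_left _ _).trans h1)
    exact ⟨by linarith, by linarith, by linarith, h4, h6, h5, h2, h3⟩
  have hd0 : ∀ y, F.toFun X1 ≤ y → HasDerivAt φ (φ₁ y) y := by
    intro y hy
    obtain ⟨hy0, k1, k2, k3, k4, -⟩ := key y hy
    exact hasDerivAt_phiOf F hc₁ (hYlt.trans_le hy) (by rw [← hφ]; linarith)
  have hd1 : ∀ y, F.toFun X1 ≤ y → HasDerivAt φ₁ (-q y) y := by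
    intro y hy
    obtain ⟨hy0, k1, k2, k3, k4, -⟩ := key y hy
    have hane : c + F.vth (φ y) ≠ 0 := by linarith
    have ha := ((hasDerivAt_vth F k1).comp y (hd0 y hy)).const_add c
    have hb := (hasDerivAt_id y).mul ha
    have hres := (hd0 y hy).div hb (by
      simp only [Pi.mul_apply, id, Function.comp_apply]; positivity)
    refine hres.congr_deriv ?_
    simp only [Pi.mul_apply, id, Function.comp_apply, hq, hφ₁, rOf]
    field_simp
    ring
  have hd2 : ∀ y, F.toFun X1 ≤ y → HasDerivAt q (q₁ y) y := by
    intro y hy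
    obtain ⟨hy0, k1, k2, k3, k4, -⟩ := key y hy
    have ha := (hasDerivAt_rOf F k1 (by linarith)).comp y (hd0 y hy)
    have hb := (ha.mul ((hd1 y hy).pow 2)).div (hd0 y hy) k2.ne'
    refine hb.congr_deriv ?_
    simp only [hq₁, Pi.pow_apply, Pi.mul_apply, Function.comp_apply]
    push_cast
    ring
  have hqpos : ∀ y, F.toFun X1 ≤ y → 0 < q y := by
    intro y hy
    obtain ⟨hy0, k1, k2, k3, k4, -⟩ := key y hy
    have : 0 < c + F.vth (φ y) := by linarith
    simp only [hq, hφ₁]; positivity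
  have hqq : ∀ y, F.toFun X1 ≤ y → y * q₁ y =
      (φ y * rOf₁ F (φ y) / rOf F (φ y) - 2 * rOf F (φ y) - 1) / (c + F.vth (φ y)) * q y := by
    intro y hy
    obtain ⟨hy0, k1, k2, k3, k4, -⟩ := key y hy
    have hane : 0 < c + F.vth (φ y) := by linarith
    simp only [hq₁, hq, hφ₁]
    generalize c + F.vth (φ y) = a at *
    generalize rOf₁ F (φ y) = s at *
    generalize rOf F (φ y) = r at *
    generalize φ y = x at *
    field_simp
    ring
  refine ⟨φ₁, q, q₁, F.toFun X1, hYlt.le, hone, hd0, hd1, hd2,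
    fun y hy => (key y hy).2.2.1, hqpos, ?_, ?_, ?_, ?_⟩
  · intro y hy
    obtain ⟨hy0, k1, k2, k3, k4, k5, -⟩ := key y hy
    have hane : 0 < c + F.vth (φ y) := by linarith
    have : y * φ₁ y = φ y / (c + F.vth (φ y)) := by simp only [hφ₁]; field_simp
    rw [this, le_div_iff₀ hane]
    nlinarith
  · intro y hy
    obtain ⟨hy0, k1, k2, k3, k4, k5, -⟩ := key y hy
    have hane : 0 < c + F.vth (φ y) := by linarith
    have : y * φ₁ y = φ y / (c + F.vth (φ y)) := by simp only [hφ₁]; field_simp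
    rw [this, div_le_iff₀ hane]
    nlinarith
  · intro y hy
    rw [hqq y hy]
    have := hqpos y hy
    gcongr
    exact (key y hy).2.2.2.2.2.2.1.le
  · intro y hy
    rw [hqq y hy]
    have := hqpos y hy
    gcongr
    exact (key y hy).2.2.2.2.2.2.2.le

end Construction

lemma mul_rpow_mono {u u₁ : ℝ → ℝ} {Y s : ℝ} (hY : 1 ≤ Y)
    (hd : ∀ y, Y ≤ y → HasDerivAt u (u₁ y) y) (hs : ∀ y, Y ≤ y → s * u y ≤ y * u₁ y)
    {y z : ℝ} (hy : Y ≤ y) (hyz : y ≤ z) : u y * y ^ (-s) ≤ u z * z ^ (-s) := by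
  have hd' : ∀ x ∈ Set.Ici Y, HasDerivAt (fun x => u x * x ^ (-s))
      (u₁ x * x ^ (-s) + u x * (-s * x ^ (-s - 1))) x := fun x hx =>
    (hd x hx).mul (Real.hasDerivAt_rpow_const (Or.inl (by
      have : Y ≤ x := hx
      linarith)))
  have hmono : MonotoneOn (fun x => u x * x ^ (-s)) (Set.Ici Y) := by
    refine monotoneOn_of_hasDerivWithinAt_nonneg (convex_Ici _)
      (fun x hx => (hd' x hx).continuousAt.continuousWithinAt)
      (fun x hx => (hd' x (interior_subset hx)).hasDerivWithinAt) fun x hx => ?_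
    have hx : Y ≤ x := interior_subset hx
    have hxp : 0 < x := by linarith
    rw [Real.rpow_sub_one hxp.ne']
    have : u₁ x * x ^ (-s) + u x * (-s * (x ^ (-s) / x)) =
        (x * u₁ x - s * u x) * (x ^ (-s) / x) := by field_simp; ring
    rw [this]
    have h1 := hs x hx
    have : 0 < x ^ (-s) := by positivity
    exact mul_nonneg (by linarith) (by positivity)
  exact hmono hy (hy.trans hyz) hyz

lemma mul_rpow_anti {u u₁ : ℝ → ℝ} {Y s : ℝ} (hY : 1 ≤ Y)
    (hd : ∀ y, Y ≤ y → HasDerivAt u (u₁ y) y) (hs : ∀ y, Y ≤ y → y * u₁ y ≤ s * u y)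
    {y z : ℝ} (hy : Y ≤ y) (hyz : y ≤ z) : u z * z ^ (-s) ≤ u y * y ^ (-s) := by
  have := mul_rpow_mono (u := fun y => -u y) (u₁ := fun y => -u₁ y) (s := s) hY
    (fun y hy => (hd y hy).neg) (fun y hy => by have := hs y hy; nlinarith) hy hyz
  linarith

lemma second_diff_mvt {D D₁ D₂ : ℝ → ℝ} {x u : ℝ} (hu : 0 < u)
    (h0 : ∀ t ∈ Set.Icc x (x + 2 * u), HasDerivAt D (D₁ t) t)
    (h1 : ∀ t ∈ Set.Icc x (x + 2 * u), HasDerivAt D₁ (D₂ t) t) :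
    ∃ ξ ∈ Set.Icc x (x + 2 * u), D (x + 2 * u) - 2 * D (x + u) + D x = D₂ ξ * u ^ 2 := by
  have hd : ∀ t ∈ Set.Icc x (x + u), HasDerivAt (fun t => D (t + u) - D t) (D₁ (t + u) - D₁ t) t := by
    intro t ht
    have a1 := (h0 (t + u) ⟨by linarith [ht.1], by linarith [ht.2]⟩).comp_add_const t u
    exact a1.sub (h0 t ⟨ht.1, by linarith [ht.2]⟩)
  obtain ⟨t, ht, ht'⟩ := exists_hasDerivAt_eq_slope (fun t => D (t + u) - D t)
    (fun t => D₁ (t + u) - D₁ t) (show x < x + u by linarith)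
    (fun t ht => (hd t ht).continuousAt.continuousWithinAt)
    (fun t ht => hd t (Set.Ioo_subset_Icc_self ht))
  have hsub : ∀ s ∈ Set.Icc t (t + u), s ∈ Set.Icc x (x + 2 * u) := fun s hs =>
    ⟨by linarith [hs.1, ht.1], by linarith [hs.2, ht.2]⟩
  obtain ⟨ξ, hξ, hξ'⟩ := exists_hasDerivAt_eq_slope D₁ D₂ (show t < t + u by linarith)
    (fun s hs => (h1 s (hsub s hs)).continuousAt.continuousWithinAt)
    (fun s hs => h1 s (hsub s (Set.Ioo_subset_Icc_self hs)))
  refine ⟨ξ, hsub ξ (Set.Ioo_subset_Icc_self hξ), ?_⟩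
  rw [show t + u - t = u by ring, eq_div_iff hu.ne'] at hξ'
  rw [show x + u - x = u by ring, eq_div_iff hu.ne', ← hξ',
    show x + u + u = x + 2 * u by ring] at ht'
  rw [sq, ← mul_assoc]
  linarith

namespace PhiData

variable {φ φ₁ q q₁ : ℝ → ℝ} {Y : ℝ}

lemma φ₁_pos (P : PhiData φ φ₁ q q₁ Y) {y : ℝ} (hy : Y ≤ y) : 0 < φ₁ y := by
  have h1 := P.lo0 y hy
  have h2 := P.pos y hy
  have hy0 : 0 < y := by linarith [P.one_le]
  by_contra h
  nlinarith

lemma φ_mono (P : PhiData φ φ₁ q q₁ Y) {y z : ℝ} (hy : Y ≤ y) (hyz : y ≤ z) : φ y ≤ φ z := by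
  have := mul_rpow_mono (s := 0) P.one_le P.d0
    (fun x hx => by
      have := P.φ₁_pos hx
      have := P.one_le
      nlinarith) hy hyz
  simpa using this

lemma φ₁_anti (P : PhiData φ φ₁ q q₁ Y) {y z : ℝ} (hy : Y ≤ y) (hyz : y ≤ z) : φ₁ z ≤ φ₁ y := by
  have := mul_rpow_anti (s := 0) P.one_le P.d1
    (fun x hx => by
      have := P.qpos x hx
      have := P.one_le
      nlinarith) hy hyz
  simpa using this

lemma q_anti (P : PhiData φ φ₁ q q₁ Y) {y z : ℝ} (hy : Y ≤ y) (hyz : y ≤ z) : q z ≤ q y := by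
  have := mul_rpow_anti (s := 0) P.one_le P.d2
    (fun x hx => by
      have := P.qpos x hx
      have := P.hi2 x hx
      linarith) hy hyz
  simpa using this

lemma q_le (P : PhiData φ φ₁ q q₁ Y)
    {N y : ℝ} (hN : Y ≤ N / 4) (hy : N / 4 ≤ y) (hyN : y ≤ N) : q y ≤ 16 * q N := by
  have h := mul_rpow_mono (s := -(73 / 72)) P.one_le P.d2 P.lo2 (hN.trans hy) hyN
  have h1 := P.one_le
  have hy0 : 0 < y := by linarith
  have hq := P.qpos N (by linarith)
  rw [neg_neg] at h
  have h2 : N ^ (73 / 72 : ℝ) ≤ 16 * y ^ (73 / 72 : ℝ) := by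
    calc N ^ (73 / 72 : ℝ) ≤ (4 * y) ^ (73 / 72 : ℝ) := by gcongr <;> linarith
      _ = 4 ^ (73 / 72 : ℝ) * y ^ (73 / 72 : ℝ) := Real.mul_rpow (by norm_num) hy0.le
      _ ≤ 4 ^ (2 : ℝ) * y ^ (73 / 72 : ℝ) := by
        gcongr
        · norm_num
        · norm_num
      _ = 16 * y ^ (73 / 72 : ℝ) := by norm_num
  have h3 : 0 < y ^ (73 / 72 : ℝ) := by positivity
  have h4 : q y * y ^ (73 / 72 : ℝ) ≤ 16 * q N * y ^ (73 / 72 : ℝ) := by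
    calc _ ≤ _ := h
      _ ≤ q N * (16 * y ^ (73 / 72 : ℝ)) := by gcongr
      _ = _ := by ring
  exact le_of_mul_le_mul_right h4 h3

lemma second_diff (P : PhiData φ φ₁ q q₁ Y)
    {N x u : ℝ} (hN : Y ≤ N / 4) (hx : N / 4 ≤ x) (hu : 0 < u)
    (hxu : x + 2 * u ≤ N) :
    q N * u ^ 2 ≤ -(φ (x + 2 * u) - 2 * φ (x + u) + φ x) ∧
      -(φ (x + 2 * u) - 2 * φ (x + u) + φ x) ≤ 16 * (q N * u ^ 2) := by
  obtain ⟨ξ, hξ, h⟩ := second_diff_mvt (D := φ) (D₁ := φ₁) (D₂ := fun t => -q t) (x := x) hu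
    (fun t ht => P.d0 t (by linarith [ht.1])) (fun t ht => P.d1 t (by linarith [ht.1]))
  rw [h, neg_mul, neg_neg]
  have h1 : q N ≤ q ξ := P.q_anti (by linarith [hξ.1]) (by linarith [hξ.2])
  have h2 : q ξ ≤ 16 * q N := P.q_le hN (by linarith [hξ.1]) (by linarith [hξ.2])
  rw [← mul_assoc]
  constructor <;> gcongr

lemma second_diff_sub (P : PhiData φ φ₁ q q₁ Y)
    {N k l m : ℝ} (hN : Y ≤ N / 4) (hk : 0 < k) (hkl : k < l) (hm : 0 < m)
    (hkm : N / 4 ≤ k * m) (hlm : l * (m + 2) ≤ N) :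
    (l - k) * k * q N ≤ 16 * ((φ (k * (m + 2)) - 2 * φ (k * (m + 1)) + φ (k * m)) -
      (φ (l * (m + 2)) - 2 * φ (l * (m + 1)) + φ (l * m))) ∧
    (φ (k * (m + 2)) - 2 * φ (k * (m + 1)) + φ (k * m)) -
      (φ (l * (m + 2)) - 2 * φ (l * (m + 1)) + φ (l * m)) ≤ 16 * ((l - k) * k * q N) := by
  have hY := P.one_le
  have hrange : ∀ t ∈ Set.Icc m (m + 2 * 1), ∀ j, k ≤ j → j ≤ l → N / 4 ≤ j * t ∧ j * t ≤ N := by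
    intro t ht j hj1 hj2
    constructor
    · refine hkm.trans ?_
      have := ht.1
      have : 0 < j := by linarith
      gcongr
    · refine le_trans ?_ hlm
      have := ht.2
      have : 0 < t := by linarith [ht.1]
      gcongr
      · linarith
      · linarith
  have hd0 : ∀ j, k ≤ j → j ≤ l → ∀ t ∈ Set.Icc m (m + 2 * 1),
      HasDerivAt (fun t => φ (j * t)) (j * φ₁ (j * t)) t := by
    intro j hj1 hj2 t ht
    have h := (P.d0 (j * t) (by linarith [(hrange t ht j hj1 hj2).1])).comp t
      ((hasDerivAt_id t).const_mul j)
    refine h.congr_deriv ?_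
    ring
  have hd1 : ∀ j, k ≤ j → j ≤ l → ∀ t ∈ Set.Icc m (m + 2 * 1),
      HasDerivAt (fun t => j * φ₁ (j * t)) (-(j ^ 2 * q (j * t))) t := by
    intro j hj1 hj2 t ht
    have h := ((P.d1 (j * t) (by linarith [(hrange t ht j hj1 hj2).1])).comp t
      ((hasDerivAt_id t).const_mul j)).const_mul j
    refine h.congr_deriv ?_
    ring
  obtain ⟨t, ht, h⟩ := second_diff_mvt (D := fun t => φ (k * t) - φ (l * t))
    (D₁ := fun t => k * φ₁ (k * t) - l * φ₁ (l * t))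
    (D₂ := fun t => -(k ^ 2 * q (k * t)) - -(l ^ 2 * q (l * t))) (x := m) one_pos
    (fun t ht => (hd0 k le_rfl hkl.le t ht).sub (hd0 l hkl.le le_rfl t ht))
    (fun t ht => (hd1 k le_rfl hkl.le t ht).sub (hd1 l hkl.le le_rfl t ht))
  have ht0 : 0 < t := by linarith [ht.1]
  obtain ⟨ξ, hξ, hslope⟩ := exists_hasDerivAt_eq_slope (fun j => j ^ 2 * q (j * t))
    (fun j => 2 * j * q (j * t) + j ^ 2 * (q₁ (j * t) * t)) hkl
    (fun j hj => by
      have := P.d2 (j * t) (by linarith [(hrange t ht j hj.1 hj.2).1])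
      exact (((hasDerivAt_id j).pow 2).mul (this.comp j
        ((hasDerivAt_id j).mul_const t))).continuousAt.continuousWithinAt)
    (fun j hj => by
      have := P.d2 (j * t) (by linarith [(hrange t ht j hj.1.le hj.2.le).1])
      refine (((hasDerivAt_id j).pow 2).mul (this.comp j
        ((hasDerivAt_id j).mul_const t))).congr_deriv ?_
      simp)
  rw [eq_div_iff (by linarith)] at hslope
  have hξr := hrange t ht ξ hξ.1.le hξ.2.le
  have hkr := hrange t ht k le_rfl hkl.le
  have hYξ : Y ≤ ξ * t := by linarith
  have hξ0 : 0 < ξ := hk.trans hξ.1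
  have g1 := P.lo2 (ξ * t) hYξ
  have g2 := P.hi2 (ξ * t) hYξ
  have hqN := P.qpos N (by linarith)
  have hqξ := P.qpos (ξ * t) hYξ
  have l1 : q N ≤ q (ξ * t) := P.q_anti hYξ hξr.2
  -- the product `y q(y)` is nearly constant
  have l2 : ξ * q (ξ * t) ≤ 8 * (k * q N) := by
    have hmono := mul_rpow_mono (s := -(73 / 72)) P.one_le P.d2 P.lo2 hYξ hξr.2
    rw [neg_neg, show (73 / 72 : ℝ) = 1 + 1 / 72 by norm_num, Real.rpow_add (by positivity),
      Real.rpow_add (by linarith), Real.rpow_one, Real.rpow_one] at hmono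
    have a1 : N ^ (1 / 72 : ℝ) ≤ 2 * (ξ * t) ^ (1 / 72 : ℝ) := by
      calc N ^ (1 / 72 : ℝ) ≤ (4 * (ξ * t)) ^ (1 / 72 : ℝ) := by gcongr <;> linarith
        _ = 4 ^ (1 / 72 : ℝ) * (ξ * t) ^ (1 / 72 : ℝ) := Real.mul_rpow (by norm_num) (by positivity)
        _ ≤ 4 ^ (1 / 2 : ℝ) * (ξ * t) ^ (1 / 72 : ℝ) := by
          gcongr
          · norm_num
          · norm_num
        _ = 2 * (ξ * t) ^ (1 / 72 : ℝ) := by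
          rw [← Real.sqrt_eq_rpow, show (4 : ℝ) = 2 ^ 2 by norm_num,
            Real.sqrt_sq (by norm_num)]
    have a2 : 0 < (ξ * t) ^ (1 / 72 : ℝ) := by positivity
    have a3 : q (ξ * t) * (ξ * t) * (ξ * t) ^ (1 / 72 : ℝ) ≤
        2 * (q N * N) * (ξ * t) ^ (1 / 72 : ℝ) := by
      calc _ = q (ξ * t) * ((ξ * t) * (ξ * t) ^ (1 / 72 : ℝ)) := by ring
        _ ≤ q N * (N * N ^ (1 / 72 : ℝ)) := hmono
        _ ≤ q N * (N * (2 * (ξ * t) ^ (1 / 72 : ℝ))) := by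
          have : 0 ≤ N := by linarith
          gcongr
        _ = _ := by ring
    have a4 := le_of_mul_le_mul_right a3 a2
    have a5 : (ξ * q (ξ * t)) * t ≤ (8 * (k * q N)) * t := by
      calc (ξ * q (ξ * t)) * t = q (ξ * t) * (ξ * t) := by ring
        _ ≤ 2 * (q N * N) := a4
        _ ≤ 2 * (q N * (4 * (k * t))) := by gcongr; linarith [hkr.1]
        _ = _ := by ring
    exact le_of_mul_le_mul_right a5 ht0
  have l3 : k * q N ≤ ξ * q (ξ * t) := by
    have := hξ.1.le
    gcongr
  have eD : (φ (k * (m + 2)) - 2 * φ (k * (m + 1)) + φ (k * m)) -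
      (φ (l * (m + 2)) - 2 * φ (l * (m + 1)) + φ (l * m)) =
      (2 * ξ * q (ξ * t) + ξ ^ 2 * (q₁ (ξ * t) * t)) * (l - k) := by
    rw [hslope]
    simp only [mul_one, one_pow] at h
    linarith
  rw [eD]
  have e2 : 2 * ξ * q (ξ * t) + ξ ^ 2 * (q₁ (ξ * t) * t) =
      ξ * (2 * q (ξ * t) + ξ * t * q₁ (ξ * t)) := by ring
  have b1 : 71 / 72 * (ξ * q (ξ * t)) ≤ ξ * (2 * q (ξ * t) + ξ * t * q₁ (ξ * t)) := by
    nlinarith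
  have b2 : ξ * (2 * q (ξ * t) + ξ * t * q₁ (ξ * t)) ≤ 73 / 72 * (ξ * q (ξ * t)) := by
    nlinarith
  rw [e2]
  have hkl0 : 0 < l - k := by linarith
  have hkq : 0 < k * q N := by positivity
  constructor
  · calc (l - k) * k * q N = (k * q N) * (l - k) := by ring
      _ ≤ (16 * (ξ * (2 * q (ξ * t) + ξ * t * q₁ (ξ * t)))) * (l - k) :=
          mul_le_mul_of_nonneg_right (by linarith) hkl0.le
      _ = _ := by ring
  · calc _ ≤ (16 * (k * q N)) * (l - k) :=
          mul_le_mul_of_nonneg_right (by linarith) hkl0.le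
      _ = _ := by ring

lemma phaseCond (P : PhiData φ φ₁ q q₁ Y) {N : ℕ} (hN : Y ≤ (N : ℝ) / 4) {C : ℝ} (hC : 16 ≤ C) :
    PhaseCond (fun n => φ n) N (q N) C := by
  have hY := P.one_le
  have hN0 : 0 < N := by
    rcases Nat.eq_zero_or_pos N with h | h
    · subst h; norm_num at hN; linarith
    · exact h
  have hq := P.qpos N (by linarith)
  have hfl : ∀ a : ℕ, N / 4 < a → (N : ℝ) / 4 ≤ a := by
    intro a ha
    have : N ≤ 4 * a := by omega
    have : (N : ℝ) ≤ 4 * a := by exact_mod_cast this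
    linarith
  have hpair : ∀ k m : ℕ, 1 ≤ k → N / 4 < k * m → k * (m + 2) ≤ N →
      q N * (k : ℝ) ^ 2 ≤ -(φ ((k * (m + 2) : ℕ) : ℝ) - 2 * φ ((k * (m + 1) : ℕ) : ℝ) +
        φ ((k * m : ℕ) : ℝ)) ∧
      -(φ ((k * (m + 2) : ℕ) : ℝ) - 2 * φ ((k * (m + 1) : ℕ) : ℝ) +
        φ ((k * m : ℕ) : ℝ)) ≤ 16 * (q N * (k : ℝ) ^ 2) := by
    intro k m hk h1 h2
    have h3 : ((k * (m + 2) : ℕ) : ℝ) ≤ N := by exact_mod_cast h2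
    have := P.second_diff (x := ((k * m : ℕ) : ℝ)) (u := k) hN (hfl _ h1) (by exact_mod_cast hk)
      (by push_cast at h3 ⊢; linarith)
    have e1 : ((k * (m + 2) : ℕ) : ℝ) = ((k * m : ℕ) : ℝ) + 2 * k := by push_cast; ring
    have e2 : ((k * (m + 1) : ℕ) : ℝ) = ((k * m : ℕ) : ℝ) + k := by push_cast; ring
    rw [e1, e2]
    exact this
  have hsub : ∀ k l m : ℕ, 1 ≤ k → k < l → N / 4 < k * m → l * (m + 2) ≤ N → _ :=
    fun k l m hk hkl h1 h2 => P.second_diff_sub (k := k) (l := l) (m := m) hN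
      (by exact_mod_cast hk) (by exact_mod_cast hkl)
      (by
        rcases Nat.eq_zero_or_pos m with h | h
        · subst h; omega
        · exact_mod_cast h)
      (by have := hfl _ h1; push_cast at this; exact this) (by exact_mod_cast h2)
  constructor
  · intro k m hk h1 h2
    exact (hpair k m hk h1 h2).1
  · intro k m hk h1 h2
    refine (hpair k m hk h1 h2).2.trans ?_
    gcongr
  · intro k l m hk hkl h1 h2
    have h := (hsub k l m hk hkl h1 h2).1
    have hpos : 0 ≤ ((l : ℝ) - k) * k * q N := by
      have : (k : ℝ) < l := by exact_mod_cast hkl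
      have : 0 < (l : ℝ) - k := by linarith
      positivity
    push_cast
    refine h.trans (mul_le_mul_of_nonneg_right hC ?_)
    linarith
  · intro k l m hk hkl h1 h2
    have h := (hsub k l m hk hkl h1 h2).2
    have hpos : 0 ≤ ((l : ℝ) - k) * k * q N := by
      have : (k : ℝ) < l := by exact_mod_cast hkl
      have : 0 < (l : ℝ) - k := by linarith
      positivity
    push_cast
    exact h.trans (mul_le_mul_of_nonneg_right hC hpos)

lemma q_mul_le (P : PhiData φ φ₁ q q₁ Y) {N : ℝ} (hN : Y ≤ N / 4) : q N ≤ 2 * φ₁ Y / N := by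
  have hY := P.one_le
  obtain ⟨ξ, hξ, h⟩ := exists_hasDerivAt_eq_slope φ₁ (fun t => -q t) (show N / 2 < N by linarith)
    (fun t ht => (P.d1 t (by linarith [ht.1])).continuousAt.continuousWithinAt)
    (fun t ht => P.d1 t (by linarith [ht.1]))
  rw [eq_div_iff (by linarith)] at h
  have h1 : q N ≤ q ξ := P.q_anti (by linarith [hξ.1]) hξ.2.le
  have h2 := P.φ₁_pos (y := N) (by linarith)
  have h3 := P.φ₁_anti (y := Y) (z := N / 2) le_rfl (by linarith)
  rw [le_div_iff₀ (by linarith)]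
  nlinarith

lemma eventually_le_q (P : PhiData φ φ₁ q q₁ Y) :
    ∀ᶠ N : ℕ in atTop, (N : ℝ) ^ (-(61 / 60) : ℝ) ≤ q N := by
  have hY := P.one_le
  have hK : 0 < q Y * Y ^ (73 / 72 : ℝ) := by
    have := P.qpos Y le_rfl
    positivity
  filter_upwards [eventually_const_mul_rpow_le (1 / (q Y * Y ^ (73 / 72 : ℝ)))
    (show (-(61 / 60) : ℝ) < -(73 / 72) by norm_num),
    (tendsto_natCast_atTop_atTop (R := ℝ)).eventually_ge_atTop Y] with N h1 hN
  have hN0 : (0 : ℝ) < N := by linarith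
  have h := mul_rpow_mono (s := -(73 / 72)) P.one_le P.d2 P.lo2 le_rfl hN
  rw [neg_neg] at h
  rw [one_div, inv_mul_le_iff₀ hK] at h1
  calc (N : ℝ) ^ (-(61 / 60) : ℝ) ≤ q Y * Y ^ (73 / 72 : ℝ) * (N : ℝ) ^ (-(73 / 72) : ℝ) := h1
    _ ≤ q N * (N : ℝ) ^ (73 / 72 : ℝ) * (N : ℝ) ^ (-(73 / 72) : ℝ) := by gcongr
    _ = q N := by rw [mul_assoc, ← Real.rpow_add hN0]; norm_num

lemma eventually_le_φ (P : PhiData φ φ₁ q q₁ Y) :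
    ∀ᶠ N : ℕ in atTop, (N : ℝ) ^ (70 / 71 : ℝ) ≤ φ N := by
  have hY := P.one_le
  have hK : 0 < φ Y * Y ^ (-(71 / 72) : ℝ) := by
    have := P.pos Y le_rfl
    positivity
  filter_upwards [eventually_const_mul_rpow_le (1 / (φ Y * Y ^ (-(71 / 72) : ℝ)))
    (show (70 / 71 : ℝ) < 71 / 72 by norm_num),
    (tendsto_natCast_atTop_atTop (R := ℝ)).eventually_ge_atTop Y] with N h1 hN
  have hN0 : (0 : ℝ) < N := by linarith
  have h := mul_rpow_mono (s := 71 / 72) P.one_le P.d0 P.lo0 le_rfl hN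
  rw [one_div, inv_mul_le_iff₀ hK] at h1
  calc (N : ℝ) ^ (70 / 71 : ℝ) ≤ φ Y * Y ^ (-(71 / 72) : ℝ) * (N : ℝ) ^ (71 / 72 : ℝ) := h1
    _ ≤ φ N * (N : ℝ) ^ (-(71 / 72) : ℝ) * (N : ℝ) ^ (71 / 72 : ℝ) := by gcongr
    _ = φ N := by rw [mul_assoc, ← Real.rpow_add hN0]; norm_num

lemma φ_le (P : PhiData φ φ₁ q q₁ Y) {y : ℝ} (hy : Y ≤ y) : φ y ≤ 2 * φ₁ Y * y := by
  have hY := P.one_le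
  have h1 := P.lo0 y hy
  have h2 := P.φ₁_anti le_rfl hy
  have h3 := P.φ₁_pos (y := Y) le_rfl
  have h4 := P.pos y hy
  have h5 : y * φ₁ y ≤ y * φ₁ Y := by
    have : 0 ≤ y := by linarith
    gcongr
  nlinarith

lemma φ_quarter (P : PhiData φ φ₁ q q₁ Y)
    {N y : ℝ} (hy : Y ≤ y) (hyN : y ≤ N / 4) : φ y ≤ φ N / 3 := by
  have hY := P.one_le
  have hN0 : 0 < N := by linarith
  have h := mul_rpow_mono (s := 71 / 72) P.one_le P.d0 P.lo0 (show Y ≤ N / 4 by linarith)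
    (show N / 4 ≤ N by linarith)
  have h0 := P.φ_mono hy hyN
  have hp := P.pos (N / 4) (by linarith)
  rw [Real.div_rpow hN0.le (by norm_num)] at h
  have h1 : (0 : ℝ) < N ^ (-(71 / 72) : ℝ) := by positivity
  have h2 : φ (N / 4) * (1 / 4 ^ (-(71 / 72) : ℝ)) ≤ φ N := by
    refine le_of_mul_le_mul_right ?_ h1
    calc _ = φ (N / 4) * (N ^ (-(71 / 72) : ℝ) / 4 ^ (-(71 / 72) : ℝ)) := by ring
      _ ≤ _ := h
  have h3 : (3 : ℝ) ≤ 1 / 4 ^ (-(71 / 72) : ℝ) := by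
    rw [Real.rpow_neg (by norm_num), one_div, inv_inv]
    have h5 : (3 : ℝ) ^ (1 : ℝ) ≤ 4 ^ (71 / 72 : ℝ) := by
      have h6 : ((3 : ℝ) ^ (1 : ℝ)) ^ (5 : ℕ) ≤ ((4 : ℝ) ^ (71 / 72 : ℝ)) ^ (5 : ℕ) := by
        rw [← Real.rpow_natCast ((4 : ℝ) ^ (71 / 72 : ℝ)), ← Real.rpow_mul (by norm_num)]
        calc ((3 : ℝ) ^ (1 : ℝ)) ^ (5 : ℕ) ≤ (4 : ℝ) ^ (4 : ℝ) := by norm_num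
          _ ≤ _ := Real.rpow_le_rpow_of_exponent_le (by norm_num) (by norm_num)
      exact le_of_pow_le_pow_left₀ (by norm_num) (by positivity) h6
    simpa using h5
  have h4 : φ (N / 4) * 3 ≤ φ (N / 4) * (1 / 4 ^ (-(71 / 72) : ℝ)) := by gcongr
  linarith

lemma incr_bounds (P : PhiData φ φ₁ q q₁ Y)
    {N y : ℝ} (hN : Y ≤ N / 4) (hy : N / 4 ≤ y) (hyN : y ≤ N) :
    2 / 5 * (φ N / N) ≤ φ (y + 1) - φ y ∧ φ (y + 1) - φ y ≤ 5 * (φ N / N) := by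
  have hY := P.one_le
  have hN0 : 0 < N := by linarith
  obtain ⟨ξ, hξ, h⟩ := exists_hasDerivAt_eq_slope φ φ₁ (show y < y + 1 by linarith)
    (fun t ht => (P.d0 t (by linarith [ht.1])).continuousAt.continuousWithinAt)
    (fun t ht => P.d0 t (by linarith [ht.1]))
  rw [add_sub_cancel_left, div_one] at h
  rw [← h]
  have hp := P.pos N (by linarith)
  constructor
  · have h1 : φ₁ (N + 1) ≤ φ₁ ξ := P.φ₁_anti (by linarith [hξ.1]) (by linarith [hξ.2])
    have h2 := P.lo0 (N + 1) (by linarith)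
    have h3 := P.φ_mono (y := N) (z := N + 1) (by linarith) (by linarith)
    have h5 := P.φ₁_pos (y := N + 1) (by linarith)
    refine le_trans ?_ h1
    rw [← mul_div_assoc, div_le_iff₀ hN0]
    nlinarith
  · have h1 : φ₁ ξ ≤ φ₁ (N / 4) := P.φ₁_anti hN (by linarith [hξ.1])
    have h2 := P.hi0 (N / 4) hN
    have h3 := P.φ_mono (y := N / 4) (z := N) hN (by linarith)
    refine h1.trans ?_
    rw [← mul_div_assoc, le_div_iff₀ hN0]
    nlinarith

end PhiData

/-- The elements of a set of naturals in the window `(N/4, N]`. -/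
noncomputable def window (A : Set ℕ) (N : ℕ) : Finset ℕ := (Finset.Ioc (N / 4) N).filter (· ∈ A)

lemma card_inter_Icc (A : Set ℕ) (N : ℕ) :
    Nat.card ↥(A ∩ Set.Icc 1 N) = ((Finset.Icc 1 N).filter (· ∈ A)).card := by
  rw [← Nat.card_eq_finsetCard]
  refine Nat.card_congr (Equiv.subtypeEquivRight fun n => ?_)
  simp [and_comm]

theorem card_window_Ph_lower {c : ℝ} (hc₁ : 1 ≤ c) (hc₂ : c < 72 / 71) (F : Fc c) :
    ∃ a > 0, ∀ᶠ N : ℕ in atTop,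
      a * (phiOf F N / Real.log N) ≤ ((window (Ph F) N).card : ℝ) := by
  obtain ⟨φ₁, q, q₁, Y, hFY, P⟩ := exists_phiData F hc₁ hc₂
  have hφ₁ := P.φ₁_pos le_rfl
  set κ : ℝ := min (2 / 5) (1 / (2 * φ₁ Y)) with hκ
  have hκ0 : 0 < κ := lt_min (by norm_num) (by positivity)
  set C : ℝ := max 16 (2 * φ₁ Y) with hC
  refine ⟨κ / 100, by positivity, ?_⟩
  filter_upwards [card_primes_lower C (le_trans (by norm_num) (le_max_left _ _)),
    P.eventually_le_q, P.eventually_le_φ,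
    eventually_const_mul_rpow_le (1 / κ) (show (-(1 / 65) : ℝ) < -(1 / 71) by norm_num),
    (tendsto_natCast_atTop_atTop (R := ℝ)).eventually_ge_atTop (4 * Y)] with N hN hq hφ hsm hY
  have hY4 : Y ≤ (N : ℝ) / 4 := by linarith
  have hY1 := P.one_le
  have hN0 : (0 : ℝ) < N := by linarith
  have hφpos := P.pos N (by linarith)
  have hmem : ∀ n ∈ Finset.Ioc (N / 4) N, (N : ℝ) / 4 ≤ n ∧ (n : ℝ) ≤ N := by
    intro n hn
    rw [Finset.mem_Ioc] at hn
    have h1 : N ≤ 4 * n := by omega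
    have h2 : (N : ℝ) ≤ 4 * n := by exact_mod_cast h1
    exact ⟨by linarith, by exact_mod_cast hn.2⟩
  have h := hN (fun n => phiOf F n) (q N) (κ * (phiOf F N / N)) (P.phaseCond hY4 (le_max_left _ _)) hq
    ((P.q_mul_le hY4).trans (by gcongr; exact le_max_right _ _)) ?_ ?_ ?_
  · have e1 : κ / 100 * (phiOf F N / Real.log N) =
        1 / 100 * (κ * (phiOf F N / N) * N / Real.log N) := by
      rw [mul_assoc κ, div_mul_cancel₀ _ hN0.ne']; ring
    rw [e1]
    refine h.trans ?_
    refine Nat.cast_le.2 (Finset.card_le_card ?_)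
    intro p hp
    rw [Finset.mem_filter] at hp
    rw [window, Finset.mem_filter]
    refine ⟨hp.1, hp.2.1, ?_⟩
    have := hp.2.2
    push_cast at this
    exact (floor_eq_iff_phiOf F hc₁ (by linarith [(hmem p hp.1).1])).2 this
  · rw [one_div, inv_mul_le_iff₀ hκ0] at hsm
    refine hsm.trans ?_
    gcongr
    rw [le_div_iff₀ hN0]
    refine le_trans (le_of_eq ?_) hφ
    rw [← Real.rpow_add_one hN0.ne']
    norm_num
  · have h1 := P.φ_le (y := N) (by linarith)
    calc κ * (phiOf F N / N) ≤ (1 / (2 * φ₁ Y)) * (phiOf F N / N) := by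
          gcongr; exact min_le_right _ _
      _ ≤ (1 / (2 * φ₁ Y)) * (2 * φ₁ Y * N / N) := by gcongr
      _ = 1 := by field_simp
  · intro n hn
    have := (P.incr_bounds hY4 (hmem n hn).1 (hmem n hn).2).1
    push_cast
    refine le_trans ?_ this
    gcongr
    exact min_le_left _ _

theorem exists_dense_block {c : ℝ} (hc₁ : 1 ≤ c) (hc₂ : c < 72 / 71) (F : Fc c)
    (A : Set ℕ) (hdens : 0 < Filter.limsup (fun N : ℕ =>
      (Nat.card ↥(A ∩ Set.Icc 1 N) : ℝ) / (Nat.card ↥(Ph F ∩ Set.Icc 1 N) : ℝ))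
      Filter.atTop) :
    ∃ a > 0, ∃ᶠ N : ℕ in atTop, a * (phiOf F N / Real.log N) ≤ ((window A N).card : ℝ) := by
  obtain ⟨φ₁, q, q₁, Y, hFY, P⟩ := exists_phiData F hc₁ hc₂
  obtain ⟨b, hb, hPh⟩ := card_window_Ph_lower hc₁ hc₂ F
  obtain ⟨α, hα0, hα⟩ := exists_between hdens
  have hfreq := frequently_lt_of_lt_limsup
    (isCoboundedUnder_le_of_le atTop (x := 0) fun N => by positivity) hα
  set a := α * b / 6 with ha
  have ha0 : 0 < a := by positivity
  refine ⟨a, ha0, ?_⟩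
  by_contra hcon
  rw [not_frequently] at hcon
  obtain ⟨N0, hN0⟩ := eventually_atTop.1 hcon
  set N1 := max (max N0 (20 : ℕ)) (⌈4 * Y⌉₊ + 4) with hN1
  set g : ℕ → ℝ := fun N => phiOf F N / Real.log N with hg
  have hY1 := P.one_le
  have hbig : ∀ N, N1 ≤ N → Y ≤ (N / 4 : ℕ) := by
    intro N hN
    have h1 : ⌈4 * Y⌉₊ + 4 ≤ N := (le_max_right _ _).trans hN
    have h2 : ⌈4 * Y⌉₊ ≤ 4 * (N / 4) := by omega
    have h3 := (Nat.le_ceil (4 * Y)).trans (Nat.cast_le.2 h2)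
    push_cast at h3
    linarith [show ((N / 4 : ℕ) : ℝ) = ((N / 4 : ℕ) : ℝ) from rfl]
  have hquart : ∀ N : ℕ, ((N / 4 : ℕ) : ℝ) ≤ (N : ℝ) / 4 := by
    intro N
    have := Nat.cast_div_le (α := ℝ) (m := N) (n := 4); exact_mod_cast this
  have hgpos : ∀ N, N1 ≤ N → 0 < g N := by
    intro N hN
    have h1 : 20 ≤ N := ((le_max_right _ _).trans (le_max_left _ _)).trans hN
    have h2 := hbig N hN
    have h3 := hquart N
    have : (20 : ℝ) ≤ N := by exact_mod_cast h1
    have h4 := P.pos N (by linarith)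
    exact div_pos h4 (Real.log_pos (by linarith))
  have hgq : ∀ N, N1 ≤ N → g (N / 4) ≤ 2 / 3 * g N := by
    intro N hN
    have h1 : 20 ≤ N := ((le_max_right _ _).trans (le_max_left _ _)).trans hN
    have h1r : (20 : ℝ) ≤ N := by exact_mod_cast h1
    have h2 := hbig N hN
    have h3 := hquart N
    have h4 := P.φ_quarter h2 h3
    have h5 := P.pos N (by linarith)
    have hl : 0 < Real.log N := Real.log_pos (by linarith)
    have hl2 : Real.log N / 2 ≤ Real.log ((N / 4 : ℕ) : ℝ) := by
      rw [div_le_iff₀ (by norm_num), mul_comm, ← Real.log_rpow (by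
        have : 0 < N / 4 := by omega
        exact_mod_cast this)]
      refine Real.log_le_log (by linarith) ?_
      have : N ≤ (N / 4) ^ 2 := by
        have h6 : 5 ≤ N / 4 := by omega
        nlinarith [Nat.div_add_mod N 4, Nat.mod_lt N (show 4 > 0 by norm_num)]
      exact_mod_cast this
    simp only [hg]
    calc phiOf F ((N / 4 : ℕ) : ℝ) / Real.log ((N / 4 : ℕ) : ℝ)
        ≤ (phiOf F N / 3) / (Real.log N / 2) := by gcongr
      _ = 2 / 3 * (phiOf F N / Real.log N) := by field_simp
  set B : ℕ → ℝ := fun N => (((Finset.Icc 1 N).filter (· ∈ A)).card : ℝ) with hB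
  have hBN : ∀ N, B N ≤ N := by
    intro N
    have := Finset.card_filter_le (Finset.Icc 1 N) (· ∈ A)
    rw [Nat.card_Icc, Nat.add_sub_cancel] at this
    exact Nat.cast_le.2 this
  have hind : ∀ N, N1 ≤ N → B N ≤ N1 + 3 * a * g N := by
    intro N
    induction N using Nat.strong_induction_on with
    | _ N ih =>
      intro hN
      have h1 : 20 ≤ N := ((le_max_right _ _).trans (le_max_left _ _)).trans hN
      have hg1 := hgpos N hN
      have hg2 := hgq N hN
      have hw := hN0 N (((le_max_left _ _).trans (le_max_left _ _)).trans hN)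
      rw [not_le] at hw
      have hsplit : B N ≤ B (N / 4) + ((window A N).card : ℝ) := by
        simp only [hB, window]
        rw [← Nat.cast_add, Nat.cast_le]
        refine le_trans (Finset.card_le_card ?_) (Finset.card_union_le _ _)
        intro n hn
        rw [Finset.mem_filter, Finset.mem_Icc] at hn
        rw [Finset.mem_union, Finset.mem_filter, Finset.mem_filter, Finset.mem_Icc, Finset.mem_Ioc]
        rcases le_or_gt n (N / 4) with h | h
        · exact Or.inl ⟨⟨hn.1.1, h⟩, hn.2⟩
        · exact Or.inr ⟨⟨h, hn.1.2⟩, hn.2⟩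
      have hq : B (N / 4) ≤ N1 + 2 * a * g N := by
        rcases le_or_gt N1 (N / 4) with h | h
        · have h2 := ih (N / 4) (by omega) h
          nlinarith
        · have h2 : ((N / 4 : ℕ) : ℝ) ≤ N1 := by exact_mod_cast h.le
          have := hBN (N / 4)
          have : 0 < a * g N := by positivity
          linarith
      simp only [hg] at hw hq ⊢
      linarith
  have hgt : Tendsto g atTop atTop := by
    have h1 : Tendsto (fun N : ℕ => (N : ℝ) ^ (1 / 2 : ℝ)) atTop atTop :=
      (tendsto_rpow_atTop (by norm_num)).comp tendsto_natCast_atTop_atTop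
    refine tendsto_atTop_mono' atTop ?_ h1
    have h2 := tendsto_natCast_atTop_atTop.eventually
      ((isLittleO_log_rpow_atTop (r := 1 / 3) (by norm_num)).def one_pos)
    filter_upwards [P.eventually_le_φ, h2, eventually_ge_atTop 3] with N h3 h4 h5
    have h5' : (3 : ℝ) ≤ N := by exact_mod_cast h5
    have hl : 0 < Real.log N := Real.log_pos (by linarith)
    rw [Real.norm_of_nonneg hl.le, Real.norm_of_nonneg (by positivity), one_mul] at h4
    simp only [hg]
    rw [le_div_iff₀ hl]
    calc (N : ℝ) ^ (1 / 2 : ℝ) * Real.log N ≤ (N : ℝ) ^ (1 / 2 : ℝ) * (N : ℝ) ^ (1 / 3 : ℝ) := by gcongr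
      _ = (N : ℝ) ^ (5 / 6 : ℝ) := by rw [← Real.rpow_add (by linarith)]; norm_num
      _ ≤ (N : ℝ) ^ (70 / 71 : ℝ) :=
        Real.rpow_le_rpow_of_exponent_le (by linarith) (by norm_num)
      _ ≤ _ := h3
  obtain ⟨N, hN, ⟨hN2, hN3⟩, hN4⟩ := (hfreq.and_eventually
    ((hPh.and (eventually_ge_atTop N1)).and (hgt.eventually_gt_atTop (2 * N1 / (α * b))))).exists
  have hNB := hind N hN3
  rw [card_inter_Icc, card_inter_Icc] at hN
  have hPN : b * g N ≤ (((Finset.Icc 1 N).filter (· ∈ Ph F)).card : ℝ) := by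
    refine hN2.trans (Nat.cast_le.2 (Finset.card_le_card ?_))
    refine Finset.filter_subset_filter _ fun n hn => ?_
    rw [Finset.mem_Ioc] at hn
    rw [Finset.mem_Icc]; omega
  have hgp := hgpos N hN3
  have hpos : 0 < (((Finset.Icc 1 N).filter (· ∈ Ph F)).card : ℝ) := lt_of_lt_of_le (by positivity) hPN
  rw [lt_div_iff₀ hpos] at hN
  rw [div_lt_iff₀ (by positivity)] at hN4
  have h1 : α * (b * g N) ≤ α * (((Finset.Icc 1 N).filter (· ∈ Ph F)).card : ℝ) := by gcongr
  have h2 : B N = (((Finset.Icc 1 N).filter (· ∈ A)).card : ℝ) := rfl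
  have h3 : 3 * a * g N = α * b * g N / 2 := by rw [ha]; ring
  nlinarith

/-! ### Fourier analysis on `ZMod M` -/

section Fourier

variable {M : ℕ} [NeZero M]

/-- The (unnormalised) Fourier transform of a real function on `ZMod M`. -/
noncomputable def ft (f : ZMod M → ℝ) (r : ZMod M) : ℂ :=
  ∑ x, (f x : ℂ) * ZMod.stdAddChar (r * x)

lemma sum_stdAddChar_mul (y : ZMod M) :
    ∑ r : ZMod M, (ZMod.stdAddChar (r * y) : ℂ) = if y = 0 then (M : ℂ) else 0 := by
  have := AddChar.sum_mulShift y (ZMod.isPrimitive_stdAddChar M)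
  rw [this]
  split_ifs <;> simp [ZMod.card]

lemma ft_inversion (f : ZMod M → ℝ) (x : ZMod M) :
    (M : ℂ) * f x = ∑ r, ft f r * ZMod.stdAddChar (-(r * x)) := by
  simp only [ft, Finset.sum_mul]
  rw [Finset.sum_comm]
  have h : ∀ y : ZMod M, ∑ r : ZMod M, (f y : ℂ) * (ZMod.stdAddChar (r * y) : ℂ)
      * ZMod.stdAddChar (-(r * x)) = if y = x then (M : ℂ) * f x else 0 := by
    intro y
    have : ∀ r : ZMod M, (f y : ℂ) * (ZMod.stdAddChar (r * y) : ℂ)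
      * ZMod.stdAddChar (-(r * x)) = f y * ZMod.stdAddChar (r * (y - x)) := by
      intro r
      rw [mul_assoc, ← AddChar.map_add_eq_mul]
      congr 2; ring
    simp only [this]
    rw [← Finset.mul_sum, sum_stdAddChar_mul]
    by_cases hxy : y = x
    · subst hxy; simp [mul_comm]
    · simp [hxy, sub_eq_zero]
  rw [Finset.sum_congr rfl fun y _ => h y]
  simp

/-- The number of three-term progressions weighted by `f`. -/
noncomputable def threeAP (f : ZMod M → ℝ) : ℝ := ∑ x, ∑ d, f x * f (x + d) * f (x + 2 * d)

lemma threeAP_eq_ft (f : ZMod M → ℝ) :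
    (M : ℂ) * (threeAP f : ℝ) = ∑ r, ft f r * ft f r * ft f (-2 * r) := by
  have h1 : ∀ r : ZMod M, ft f r * ft f r * ft f (-2 * r) =
      ∑ x, ∑ z, ∑ y, ((f x * f z * f y : ℝ) : ℂ) * ZMod.stdAddChar (r * (x + z - 2 * y)) := by
    intro r
    simp only [ft]
    rw [Finset.sum_mul_sum, Finset.sum_mul]
    refine Finset.sum_congr rfl fun x _ => ?_
    rw [Finset.sum_mul]
    refine Finset.sum_congr rfl fun z _ => ?_
    rw [Finset.mul_sum]
    refine Finset.sum_congr rfl fun y _ => ?_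
    have : r * (x + z - 2 * y) = r * x + r * z + -2 * r * y := by ring
    rw [this, AddChar.map_add_eq_mul, AddChar.map_add_eq_mul]
    push_cast; ring
  rw [Finset.sum_congr rfl fun r _ => h1 r, Finset.sum_comm]
  have h2 : ∀ x : ZMod M, ∑ r : ZMod M, ∑ z, ∑ y,
      ((f x * f z * f y : ℝ) : ℂ) * (ZMod.stdAddChar (r * (x + z - 2 * y)) : ℂ) =
      ∑ y, (M : ℂ) * ((f x * f y * f (2 * y - x) : ℝ) : ℂ) := by
    intro x
    rw [Finset.sum_comm]
    have h3 : ∀ z : ZMod M, ∑ r : ZMod M, ∑ y,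
      ((f x * f z * f y : ℝ) : ℂ) * (ZMod.stdAddChar (r * (x + z - 2 * y)) : ℂ) =
      ∑ y, if z = 2 * y - x then (M : ℂ) * ((f x * f y * f (2 * y - x) : ℝ) : ℂ) else 0 := by
      intro z
      rw [Finset.sum_comm]
      refine Finset.sum_congr rfl fun y _ => ?_
      rw [← Finset.mul_sum, sum_stdAddChar_mul]
      by_cases h : z = 2 * y - x
      · subst h
        simp
        ring
      · have : x + z - 2 * y ≠ 0 := by
          intro h'; apply h; linear_combination h'
        simp [h, this]
    rw [Finset.sum_congr rfl fun z _ => h3 z, Finset.sum_comm]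
    simp
  rw [Finset.sum_congr rfl fun x _ => h2 x]
  unfold threeAP
  push_cast
  rw [Finset.mul_sum]
  refine Finset.sum_congr rfl fun x _ => ?_
  rw [Finset.mul_sum]
  symm
  rw [← Equiv.sum_comp (Equiv.addLeft x)]
  refine Finset.sum_congr rfl fun d _ => ?_
  have : 2 * (x + d) - x = x + 2 * d := by ring
  simp only [Equiv.coe_addLeft, this]

lemma norm_stdAddChar (x : ZMod M) : ‖(ZMod.stdAddChar x : ℂ)‖ = 1 := AddChar.norm_apply _ _

lemma norm_ft_le {f : ZMod M → ℝ} (hf : ∀ x, 0 ≤ f x) (r : ZMod M) : ‖ft f r‖ ≤ ∑ x, f x := by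
  refine (norm_sum_le _ _).trans (Finset.sum_le_sum fun x _ => ?_)
  rw [norm_mul, norm_stdAddChar, mul_one, Complex.norm_real, Real.norm_of_nonneg (hf x)]

/-- The character sum over a set, normalised and squared. -/
noncomputable def wt (P : Finset (ZMod M)) (r : ZMod M) : ℝ :=
  ‖∑ b ∈ P, (ZMod.stdAddChar (r * b) : ℂ)‖ ^ 2 / (P.card : ℝ) ^ 2

/-- Averaging a function over the difference multiset of `P`. -/
noncomputable def smooth (P : Finset (ZMod M)) (f : ZMod M → ℝ) (x : ZMod M) : ℝ :=
  (∑ b ∈ P, ∑ b' ∈ P, f (x + b - b')) / (P.card : ℝ) ^ 2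

lemma ofReal_norm_charSum_sq (P : Finset (ZMod M)) (r : ZMod M) :
    ((‖∑ b ∈ P, (ZMod.stdAddChar (r * b) : ℂ)‖ ^ 2 : ℝ) : ℂ) =
      ∑ b ∈ P, ∑ b' ∈ P, (ZMod.stdAddChar (r * (b' - b)) : ℂ) := by
  rw [Complex.ofReal_pow, ← Complex.conj_mul', map_sum, Finset.sum_mul_sum]
  refine Finset.sum_congr rfl fun b _ => Finset.sum_congr rfl fun b' _ => ?_
  rw [← AddChar.map_neg_eq_conj, ← AddChar.map_add_eq_mul]
  congr 1; ring

lemma ft_smooth (P : Finset (ZMod M)) (f : ZMod M → ℝ) (r : ZMod M) :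
    ft (smooth P f) r = wt P r * ft f r := by
  unfold wt
  rw [Complex.ofReal_div, ofReal_norm_charSum_sq]
  simp only [ft, smooth]
  push_cast
  simp only [div_mul_eq_mul_div, Finset.sum_mul]
  rw [← Finset.sum_div, Finset.sum_comm]
  congr 1
  refine Finset.sum_congr rfl fun b _ => ?_
  rw [Finset.sum_comm]
  refine Finset.sum_congr rfl fun b' _ => ?_
  rw [Finset.mul_sum, ← Equiv.sum_comp (Equiv.addRight (b' - b))]
  refine Finset.sum_congr rfl fun y _ => ?_
  have h : r * (y + (b' - b)) = r * (b' - b) + r * y := by ring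
  have h2 : y + (b' - b) + b - b' = y := by ring
  simp only [Equiv.coe_addRight]
  rw [h, h2, AddChar.map_add_eq_mul]; ring

lemma sum_wt (P : Finset (ZMod M)) (hP : P.Nonempty) : ∑ r, wt P r = M / P.card := by
  have hc : (P.card : ℂ) ≠ 0 := by exact_mod_cast hP.card_pos.ne'
  have h : ((∑ r, wt P r : ℝ) : ℂ) = ((M / P.card : ℝ) : ℂ) := by
    unfold wt
    rw [← Finset.sum_div, Complex.ofReal_div, Complex.ofReal_sum]
    simp only [ofReal_norm_charSum_sq]
    rw [Finset.sum_comm]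
    have : ∀ b ∈ P, ∑ r : ZMod M, ∑ b' ∈ P, (ZMod.stdAddChar (r * (b' - b)) : ℂ) = M := by
      intro b hb
      rw [Finset.sum_comm]
      simp only [sum_stdAddChar_mul, sub_eq_zero]
      simp [hb]
    rw [Finset.sum_congr rfl this, Finset.sum_const, nsmul_eq_mul]
    push_cast
    field_simp
  exact_mod_cast h

lemma wt_nonneg (P : Finset (ZMod M)) (r : ZMod M) : 0 ≤ wt P r := by unfold wt; positivity

lemma wt_le_one (P : Finset (ZMod M)) (r : ZMod M) : wt P r ≤ 1 := by
  unfold wt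
  refine div_le_one_of_le₀ ?_ (by positivity)
  gcongr
  refine (norm_sum_le _ _).trans ?_
  simp

lemma one_sub_le_wt {P : Finset (ZMod M)} {b₀ : ZMod M} (hb₀ : b₀ ∈ P) {r : ZMod M} {δ : ℝ}
    (hδ : ∀ b ∈ P, ‖(ZMod.stdAddChar (r * b) : ℂ) - ZMod.stdAddChar (r * b₀)‖ ≤ δ) :
    1 - 2 * δ ≤ wt P r := by
  have hc : (0 : ℝ) < P.card := by exact_mod_cast Finset.card_pos.2 ⟨b₀, hb₀⟩
  rcases le_or_gt 1 δ with h | h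
  · have := wt_nonneg P r; linarith
  have h1 : (P.card : ℝ) * (1 - δ) ≤ ‖∑ b ∈ P, (ZMod.stdAddChar (r * b) : ℂ)‖ := by
    have h2 : ‖∑ b ∈ P, (ZMod.stdAddChar (r * b₀) : ℂ)‖ = P.card := by
      rw [Finset.sum_const, nsmul_eq_mul, norm_mul, norm_stdAddChar]; simp
    have h3 : ‖∑ b ∈ P, ((ZMod.stdAddChar (r * b) : ℂ) - ZMod.stdAddChar (r * b₀))‖
        ≤ P.card * δ := by
      refine (norm_sum_le_of_le _ hδ).trans ?_
      simp
    rw [Finset.sum_sub_distrib] at h3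
    have := norm_sub_norm_le (∑ b ∈ P, (ZMod.stdAddChar (r * b₀) : ℂ))
      (∑ b ∈ P, (ZMod.stdAddChar (r * b) : ℂ))
    rw [norm_sub_rev] at this
    linarith
  unfold wt
  rw [le_div_iff₀ (by positivity)]
  calc (1 - 2 * δ) * (P.card : ℝ) ^ 2 ≤ ((P.card : ℝ) * (1 - δ)) ^ 2 := by nlinarith [sq_nonneg (δ * P.card)]
    _ ≤ _ := by
      have : 0 ≤ (P.card : ℝ) * (1 - δ) := by apply mul_nonneg hc.le; linarith
      gcongr

lemma smooth_mono {M : ℕ} {P : Finset (ZMod M)} {f g : ZMod M → ℝ} (h : ∀ x, f x ≤ g x)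
    (x : ZMod M) : smooth P f x ≤ smooth P g x := by
  unfold smooth; gcongr; exact h _

lemma smooth_nonneg {M : ℕ} {P : Finset (ZMod M)} {f : ZMod M → ℝ} (h : ∀ x, 0 ≤ f x)
    (x : ZMod M) : 0 ≤ smooth P f x := by
  unfold smooth
  exact div_nonneg (Finset.sum_nonneg fun _ _ => Finset.sum_nonneg fun _ _ => h _) (by positivity)

lemma sum_smooth {P : Finset (ZMod M)} (hP : P.Nonempty) (f : ZMod M → ℝ) :
    ∑ x, smooth P f x = ∑ x, f x := by
  have hc : (P.card : ℝ) ≠ 0 := by exact_mod_cast hP.card_pos.ne'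
  unfold smooth
  rw [← Finset.sum_div, Finset.sum_comm, div_eq_iff (by positivity)]
  have : ∀ b ∈ P, ∑ x, ∑ b' ∈ P, f (x + b - b') = P.card * ∑ x, f x := by
    intro b _
    rw [Finset.sum_comm]
    have : ∀ b' ∈ P, ∑ x, f (x + b - b') = ∑ x, f x := by
      intro b' _
      rw [← Equiv.sum_comp (Equiv.addRight (b' - b))]
      refine Finset.sum_congr rfl fun y _ => ?_
      congr 1
      simp only [Equiv.coe_addRight]; ring
    rw [Finset.sum_congr rfl this]; simp
  rw [Finset.sum_congr rfl this]; simp; ring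

/-- A function dominated by one that is Fourier-close to a bounded one has bounded smoothing. -/
lemma smooth_le {P : Finset (ZMod M)} (hP : P.Nonempty) {f u : ZMod M → ℝ} {B τ : ℝ}
    (hu : ∀ x, u x ≤ B) (hfu : ∀ r, ‖ft f r - ft u r‖ ≤ τ) (x : ZMod M) :
    smooth P f x ≤ B + τ / P.card := by
  have hc : (0 : ℝ) < P.card := by exact_mod_cast hP.card_pos
  have hM : (0 : ℝ) < M := by exact_mod_cast Nat.pos_of_ne_zero (NeZero.ne M)
  have h1 : smooth P u x ≤ B := by
    unfold smooth
    rw [div_le_iff₀ (by positivity)]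
    calc ∑ b ∈ P, ∑ b' ∈ P, u (x + b - b') ≤ ∑ b ∈ P, ∑ b' ∈ P, B := by gcongr; exact hu _
      _ = _ := by simp; ring
  have h2 : (M : ℂ) * ((smooth P f x - smooth P u x : ℝ) : ℂ) =
      ∑ r, (wt P r * (ft f r - ft u r)) * ZMod.stdAddChar (-(r * x)) := by
    push_cast
    rw [mul_sub, ft_inversion, ft_inversion, ← Finset.sum_sub_distrib]
    refine Finset.sum_congr rfl fun r _ => ?_
    rw [ft_smooth, ft_smooth]; ring
  have h3 : M * |smooth P f x - smooth P u x| ≤ τ * (M / P.card) := by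
    have h4 := congrArg norm h2
    rw [norm_mul, Complex.norm_real, Complex.norm_natCast, Real.norm_eq_abs] at h4
    rw [h4, ← sum_wt P hP, Finset.mul_sum]
    refine norm_sum_le_of_le _ fun r _ => ?_
    rw [norm_mul, norm_stdAddChar, mul_one, norm_mul, Complex.norm_real,
      Real.norm_of_nonneg (wt_nonneg _ _), mul_comm]
    gcongr
    · exact wt_nonneg _ _
    · exact hfu r
  have h5 : |smooth P f x - smooth P u x| ≤ τ / P.card := by
    rw [show τ * (M / P.card) = M * (τ / P.card) by ring] at h3
    exact le_of_mul_le_mul_left h3 hM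
  linarith [le_abs_self (smooth P f x - smooth P u x)]

end Fourier

lemma norm_stdAddChar_sub_le {M : ℕ} [NeZero M] {k : ℕ} (hk : 0 < k) (x y : ZMod M)
    (h : k * x.val / M = k * y.val / M) :
    ‖(ZMod.stdAddChar x : ℂ) - ZMod.stdAddChar y‖ ≤ 2 * π / k := by
  have hM : 0 < M := Nat.pos_of_ne_zero (NeZero.ne M)
  have hMr : (0 : ℝ) < M := by exact_mod_cast hM
  have hkr : (0 : ℝ) < k := by exact_mod_cast hk
  have hx : (ZMod.stdAddChar x : ℂ) = ZMod.stdAddChar (((x.val : ℤ)) : ZMod M) := by simp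
  have hy : (ZMod.stdAddChar y : ℂ) = ZMod.stdAddChar (((y.val : ℤ)) : ZMod M) := by simp
  have e1 : (ZMod.stdAddChar x : ℂ) - ZMod.stdAddChar y =
      ZMod.stdAddChar y * (Complex.exp (Complex.I *
        ((2 * π * ((x.val : ℝ) - y.val) / M : ℝ) : ℂ)) - 1) := by
    rw [mul_sub, mul_one, hx, hy, ZMod.stdAddChar_coe, ZMod.stdAddChar_coe, ← Complex.exp_add]
    congr 2
    push_cast
    ring
  rw [e1, norm_mul, norm_stdAddChar, one_mul]
  refine (Real.norm_exp_I_mul_ofReal_sub_one_le).trans ?_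
  have h1 := Nat.div_add_mod (k * x.val) M
  have h2 := Nat.div_add_mod (k * y.val) M
  have h3 := Nat.mod_lt (k * x.val) hM
  have h4 := Nat.mod_lt (k * y.val) hM
  rw [h] at h1
  have h5 : |(k : ℝ) * x.val - k * y.val| ≤ M := by
    rw [abs_le]
    have h6 : k * x.val ≤ k * y.val + M := by omega
    have h7 : k * y.val ≤ k * x.val + M := by omega
    have h6' : (k : ℝ) * x.val ≤ k * y.val + M := by exact_mod_cast h6
    have h7' : (k : ℝ) * y.val ≤ k * x.val + M := by exact_mod_cast h7
    constructor <;> linarith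
  rw [← mul_sub, abs_mul, abs_of_pos hkr] at h5
  rw [Real.norm_eq_abs, abs_div, abs_mul, abs_of_pos hMr, abs_of_pos (by positivity : 0 < 2 * π),
    div_le_div_iff₀ hMr hkr]
  nlinarith [Real.pi_pos]

/-- Pigeonhole for simultaneous Diophantine approximation. -/
lemma exists_bohr_class {M : ℕ} [NeZero M] (S : Finset (ZMod M)) {k : ℕ} (hk : 0 < k) :
    ∃ P : Finset (ZMod M), (M : ℝ) ≤ (k : ℝ) ^ S.card * P.card ∧
      ∀ r ∈ S, ∀ b ∈ P, ∀ b' ∈ P,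
        ‖(ZMod.stdAddChar (r * b) : ℂ) - ZMod.stdAddChar (r * b')‖ ≤ 2 * π / k := by
  have hM : 0 < M := Nat.pos_of_ne_zero (NeZero.ne M)
  let F : ZMod M → (S → Fin k) := fun x r =>
    ⟨k * (r.1 * x).val / M, by
      rw [Nat.div_lt_iff_lt_mul hM]
      exact Nat.mul_lt_mul_of_pos_left (ZMod.val_lt _) hk⟩
  have hne : (Finset.univ : Finset (S → Fin k)).Nonempty := ⟨F 0, Finset.mem_univ _⟩
  obtain ⟨y, -, hy⟩ := Finset.exists_le_card_fiber_of_nsmul_le_card_of_maps_to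
    (s := (Finset.univ : Finset (ZMod M))) (t := (Finset.univ : Finset (S → Fin k))) (f := F)
    (b := (M : ℝ) / (k : ℝ) ^ S.card) (fun _ _ => Finset.mem_univ _) hne (by
      have hkr : (0 : ℝ) < k := by exact_mod_cast hk
      simp only [Finset.card_univ, Fintype.card_fun, Fintype.card_fin, Fintype.card_coe, ZMod.card,
        nsmul_eq_mul, Nat.cast_pow]
      rw [mul_div_cancel₀ _ (by positivity)])
  refine ⟨Finset.univ.filter fun x => F x = y, ?_, fun r hr b hb b' hb' => ?_⟩
  · have hkr : (0 : ℝ) < k := by exact_mod_cast hk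
    rw [div_le_iff₀ (by positivity)] at hy
    linarith
  · refine norm_stdAddChar_sub_le hk _ _ ?_
    rw [Finset.mem_filter] at hb hb'
    have := congrFun (hb.2.trans hb'.2.symm) ⟨r, hr⟩
    simpa [F] using this

/-- Varnavides' averaging: a dense subset of `ZMod M` contains many progressions. -/
lemma varnavides {M : ℕ} [Fact M.Prime] {β : ℝ} (hβ : 0 < β) {L : ℕ}
    (hL : cornersTheoremBound (β / 2 / 3) ≤ L) (hL0 : 0 < L) (hLM : L < M)
    (A : Finset (ZMod M)) (hA : β * M ≤ A.card) :
    β / 2 * (M : ℝ) ^ 2 / (L : ℝ) ^ 2 ≤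
      ((Finset.univ : Finset (ZMod M × ZMod M)).filter
        fun p => p.1 ∈ A ∧ p.1 + p.2 ∈ A ∧ p.1 + 2 * p.2 ∈ A).card := by
  have hLr : (0 : ℝ) < L := by exact_mod_cast hL0
  set S := (Finset.univ : Finset (ZMod M × ZMod M)).filter
        fun p => p.1 ∈ A ∧ p.1 + p.2 ∈ A ∧ p.1 + 2 * p.2 ∈ A with hS
  let cnt : ZMod M → ZMod M → Finset ℕ := fun x d =>
    (Finset.range L).filter fun i => x + i * d ∈ A
  set good := (Finset.univ : Finset (ZMod M × ZMod M)).filter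
    fun p => β / 2 * L ≤ (cnt p.1 p.2).card with hgood
  have hgoodcard : β / 2 * (M : ℝ) ^ 2 ≤ good.card := by
    have h1 : ∑ p : ZMod M × ZMod M, ((cnt p.1 p.2).card : ℝ) = M * (L * A.card) := by
      rw [Fintype.sum_prod_type, Finset.sum_comm]
      have : ∀ d : ZMod M, ∑ x : ZMod M, ((cnt x d).card : ℝ) = L * A.card := by
        intro d
        simp only [cnt, Finset.card_filter]
        push_cast
        rw [Finset.sum_comm]
        have : ∀ i ∈ Finset.range L,
            ∑ x : ZMod M, (if x + i * d ∈ A then (1 : ℝ) else 0) = A.card := by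
          intro i _
          rw [← Equiv.sum_comp (Equiv.addRight (-(i * d)))]
          simp
        rw [Finset.sum_congr rfl this]; simp
      rw [Finset.sum_congr rfl fun d _ => this d]; simp [ZMod.card]
    have h2 : ∑ p : ZMod M × ZMod M, ((cnt p.1 p.2).card : ℝ) ≤
        ∑ p : ZMod M × ZMod M, ((if p ∈ good then (L : ℝ) else 0) + β / 2 * L) := by
      refine Finset.sum_le_sum fun p _ => ?_
      have hle : ((cnt p.1 p.2).card : ℝ) ≤ L := by
        have := Finset.card_filter_le (Finset.range L) (fun i => p.1 + i * p.2 ∈ A)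
        rw [Finset.card_range] at this
        exact Nat.cast_le.2 this
      split_ifs with h
      · have : 0 ≤ β / 2 * L := by positivity
        linarith
      · simp only [hgood, Finset.mem_filter, Finset.mem_univ, true_and, not_le] at h
        linarith
    rw [h1, Finset.sum_add_distrib, Finset.sum_ite_mem] at h2
    simp only [Finset.univ_inter, Finset.sum_const, nsmul_eq_mul, Finset.card_univ,
      Fintype.card_prod, ZMod.card, Nat.cast_mul] at h2
    have h3 : (M : ℝ) * (L * (β * M)) ≤ M * (L * A.card) := by gcongr
    have h4 : L * (β / 2 * (M : ℝ) ^ 2) ≤ L * good.card := by nlinarith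
    exact le_of_mul_le_mul_left h4 hLr
  have hsub : good ⊆ (((Finset.range L) ×ˢ (Finset.range L)).filter fun i => i.1 ≠ i.2).biUnion
      fun i => Finset.univ.filter fun p : ZMod M × ZMod M =>
        (p.1 + i.1 * p.2, ((i.2 : ZMod M) - i.1) * p.2) ∈ S := by
    intro p hp
    simp only [hgood, Finset.mem_filter, Finset.mem_univ, true_and] at hp
    have := roth_3ap_theorem_nat (β / 2) (by positivity) hL (cnt p.1 p.2)
      (Finset.filter_subset _ _) hp
    rw [ThreeAPFree] at this
    push Not at this
    obtain ⟨i, hi, j, hj, l, hl, hijl, hne⟩ := this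
    simp only [cnt, Finset.coe_filter, Set.mem_ofPred_eq, Finset.mem_range] at hi hj hl
    simp only [Finset.mem_biUnion, Finset.mem_filter, Finset.mem_product, Finset.mem_range,
      Finset.mem_univ, true_and, hS]
    have hc : (i : ZMod M) + l = j + j := by exact_mod_cast congrArg (Nat.cast (R := ZMod M)) hijl
    refine ⟨(i, j), ⟨⟨hi.1, hj.1⟩, hne⟩, hi.2, ?_, ?_⟩
    · convert hj.2 using 1; ring
    · convert hl.2 using 1; linear_combination p.2 * (-hc)
  have hcard : good.card ≤ L * L * S.card := by
    refine (Finset.card_le_card hsub).trans ?_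
    refine (Finset.card_biUnion_le_card_mul _ _ S.card ?_).trans ?_
    · intro i hi
      simp only [Finset.mem_filter, Finset.mem_product, Finset.mem_range] at hi
      have hne : (i.2 : ZMod M) - i.1 ≠ 0 := by
        rw [sub_ne_zero]
        intro h
        rw [ZMod.natCast_eq_natCast_iff'] at h
        rw [Nat.mod_eq_of_lt (hi.1.2.trans hLM), Nat.mod_eq_of_lt (hi.1.1.trans hLM)] at h
        exact hi.2 h.symm
      refine Finset.card_le_card_of_injOn
        (fun p : ZMod M × ZMod M => (p.1 + i.1 * p.2, ((i.2 : ZMod M) - i.1) * p.2)) ?_ ?_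
      · intro p hp
        simpa using hp
      · intro p _ p' _ h
        simp only [Prod.mk.injEq] at h
        have h2 := mul_left_cancel₀ hne h.2
        have h1 := h.1
        rw [h2] at h1
        exact Prod.ext (add_right_cancel h1) h2
    · gcongr
      refine (Finset.card_filter_le _ _).trans ?_
      simp
  have hcr : (good.card : ℝ) ≤ L * L * S.card := by exact_mod_cast hcard
  rw [div_le_iff₀ (by positivity)]
  nlinarith

lemma sq_mul_le_sqrt_mul {a b u : ℝ} (ha : 0 ≤ a) (hb : 0 ≤ b) (hau : a ≤ u) :
    a ^ 2 * b ≤ √u * (a ^ (5 / 2 : ℝ) + b ^ (5 / 2 : ℝ)) := by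
  have hsq : ∀ x : ℝ, 0 ≤ x → x ^ (5 / 2 : ℝ) = √x * x ^ 2 := by
    intro x hx
    rw [Real.sqrt_eq_rpow, ← Real.rpow_natCast, ← Real.rpow_add_of_nonneg hx (by norm_num)
      (by norm_num)]
    norm_num
  rw [hsq a ha, hsq b hb]
  have h1 : √a ≤ √u := Real.sqrt_le_sqrt hau
  have h2 := Real.sqrt_nonneg a
  have h3 := Real.sqrt_nonneg b
  have h4 := Real.sq_sqrt ha
  have h5 := Real.sq_sqrt hb
  have key : a ^ 2 * b ≤ √a * (√a * a ^ 2 + √b * b ^ 2) := by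
    set s := √a
    set t := √b
    rw [← h4, ← h5]
    rcases le_total s t with h | h
    · have : s ^ 3 ≤ t ^ 3 := by gcongr
      have : 0 ≤ s * t ^ 2 * (t ^ 3 - s ^ 3) := by
        apply mul_nonneg (by positivity); linarith
      nlinarith [pow_nonneg h2 6]
    · have : t ^ 2 ≤ s ^ 2 := by gcongr
      have : 0 ≤ s ^ 4 * (s ^ 2 - t ^ 2) := by
        apply mul_nonneg (by positivity); linarith
      have : 0 ≤ s * t * t ^ 4 := by positivity
      nlinarith
  refine key.trans ?_
  gcongr

lemma abs_threeAP_sub_smooth_le {M : ℕ} [Fact M.Prime] (hM2 : M ≠ 2) {f : ZMod M → ℝ}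
    (P : Finset (ZMod M)) {Cr η u ρ : ℝ} (hη : 0 ≤ η) (hρ : 0 ≤ ρ) (hu : ∀ r, ‖ft f r‖ ≤ u * M)
    (hCr : ∑ r, ‖ft f r‖ ^ (5 / 2 : ℝ) ≤ Cr * (M : ℝ) ^ (5 / 2 : ℝ))
    (hw : ∀ r, η * M ≤ ‖ft f r‖ → 1 - ρ ≤ wt P r ^ 2 * wt P (-2 * r)) :
    |threeAP f - threeAP (smooth P f)| ≤ 2 * Cr * (√η + ρ * √u) * (M : ℝ) ^ 2 := by
  have hM : (0 : ℝ) < M := by exact_mod_cast (Fact.out : M.Prime).pos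
  have h2 : (-2 : ZMod M) ≠ 0 := by
    rw [neg_ne_zero]
    intro h
    have h' : ((2 : ℕ) : ZMod M) = 0 := by exact_mod_cast h
    rw [ZMod.natCast_eq_zero_iff] at h'
    exact hM2 ((Nat.prime_dvd_prime_iff_eq Fact.out Nat.prime_two).1 h')
  have hbij : ∑ r : ZMod M, ‖ft f (-2 * r)‖ ^ (5 / 2 : ℝ) = ∑ r, ‖ft f r‖ ^ (5 / 2 : ℝ) :=
    Equiv.sum_comp (Equiv.mulLeft₀ (-2 : ZMod M) h2) fun r => ‖ft f r‖ ^ (5 / 2 : ℝ)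
  have hid : (M : ℂ) * ((threeAP f - threeAP (smooth P f) : ℝ) : ℂ) =
      ∑ r, ((1 - wt P r ^ 2 * wt P (-2 * r) : ℝ) : ℂ) * (ft f r * ft f r * ft f (-2 * r)) := by
    push_cast
    rw [mul_sub, threeAP_eq_ft, threeAP_eq_ft, ← Finset.sum_sub_distrib]
    refine Finset.sum_congr rfl fun r _ => ?_
    rw [ft_smooth, ft_smooth]; ring
  have hn := congrArg norm hid
  rw [norm_mul, Complex.norm_real, Complex.norm_natCast, Real.norm_eq_abs] at hn
  have hterm : ∀ r : ZMod M, ‖((1 - wt P r ^ 2 * wt P (-2 * r) : ℝ) : ℂ) *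
      (ft f r * ft f r * ft f (-2 * r))‖ ≤
      (√η + ρ * √u) * √M * (‖ft f r‖ ^ (5 / 2 : ℝ) + ‖ft f (-2 * r)‖ ^ (5 / 2 : ℝ)) := by
    intro r
    have hw0 : 0 ≤ wt P r ^ 2 * wt P (-2 * r) := mul_nonneg (sq_nonneg _) (wt_nonneg _ _)
    have hw1 : wt P r ^ 2 * wt P (-2 * r) ≤ 1 :=
      mul_le_one₀ (pow_le_one₀ (wt_nonneg _ _) (wt_le_one _ _)) (wt_nonneg _ _) (wt_le_one _ _)
    rw [norm_mul, Complex.norm_real, Real.norm_of_nonneg (by linarith), norm_mul, norm_mul, ← sq]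
    set a := ‖ft f r‖
    set b := ‖ft f (-2 * r)‖
    have ha : 0 ≤ a := norm_nonneg _
    have hb : 0 ≤ b := norm_nonneg _
    have hs : 0 ≤ a ^ (5 / 2 : ℝ) + b ^ (5 / 2 : ℝ) := by positivity
    have hab : 0 ≤ a ^ 2 * b := by positivity
    rcases lt_or_ge a (η * M) with h | h
    · calc (1 - wt P r ^ 2 * wt P (-2 * r)) * (a ^ 2 * b) ≤ 1 * (a ^ 2 * b) := by gcongr; linarith
        _ ≤ √(η * M) * (a ^ (5 / 2 : ℝ) + b ^ (5 / 2 : ℝ)) := by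
          rw [one_mul]; exact sq_mul_le_sqrt_mul ha hb h.le
        _ = √η * √M * (a ^ (5 / 2 : ℝ) + b ^ (5 / 2 : ℝ)) := by rw [Real.sqrt_mul hη]
        _ ≤ _ := by
          gcongr
          have := mul_nonneg hρ (Real.sqrt_nonneg u)
          linarith
    · have hu0 : 0 ≤ u := by
        have := ha.trans (hu r)
        exact nonneg_of_mul_nonneg_left this hM
      calc (1 - wt P r ^ 2 * wt P (-2 * r)) * (a ^ 2 * b) ≤ ρ * (a ^ 2 * b) := by
            gcongr; linarith [hw r h]
        _ ≤ ρ * (√(u * M) * (a ^ (5 / 2 : ℝ) + b ^ (5 / 2 : ℝ))) := by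
          exact mul_le_mul_of_nonneg_left (sq_mul_le_sqrt_mul ha hb (hu r)) hρ
        _ = ρ * √u * √M * (a ^ (5 / 2 : ℝ) + b ^ (5 / 2 : ℝ)) := by rw [Real.sqrt_mul hu0]; ring
        _ ≤ _ := by
          gcongr
          have := Real.sqrt_nonneg η
          linarith
  have h3 : M * |threeAP f - threeAP (smooth P f)| ≤
      (√η + ρ * √u) * √M * (2 * (Cr * (M : ℝ) ^ (5 / 2 : ℝ))) := by
    rw [hn]
    refine (norm_sum_le_of_le _ fun r _ => hterm r).trans ?_
    rw [← Finset.mul_sum, Finset.sum_add_distrib, hbij, ← two_mul]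
    gcongr
  have h4 : √(M : ℝ) * (M : ℝ) ^ (5 / 2 : ℝ) = (M : ℝ) ^ 3 := by
    rw [Real.sqrt_eq_rpow, ← Real.rpow_natCast, ← Real.rpow_add hM]; norm_num
  refine le_of_mul_le_mul_left (h3.trans (le_of_eq ?_)) hM
  linear_combination (√η + ρ * √u) * 2 * Cr * h4

/-- Transference: a function dominated by a pseudorandom majorant, satisfying a restriction
estimate and having positive mean, has many weighted three-term progressions. -/
theorem transference {α Cr : ℝ} (hα : 0 < α) (hCr0 : 0 < Cr) :
    ∃ τ > 0, ∃ c > 0, ∃ M₀ : ℕ, ∀ M : ℕ, ∀ _ : Fact M.Prime, M₀ ≤ M →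
      ∀ f ν u : ZMod M → ℝ, (∀ x, 0 ≤ f x) → (∀ x, f x ≤ ν x) → (∀ x, u x ≤ 1) →
      (∀ r, ‖ft ν r - ft u r‖ ≤ τ * M) →
      ∑ r, ‖ft f r‖ ^ (5 / 2 : ℝ) ≤ Cr * (M : ℝ) ^ (5 / 2 : ℝ) →
      α * M ≤ ∑ x, f x → c * (M : ℝ) ^ 2 ≤ threeAP f := by
  set L := cornersTheoremBound (α / 4 / 2 / 3) + 1 with hL
  set c₀ : ℝ := (α / 2) ^ 3 * (α / 4 / 2 / (L : ℝ) ^ 2) with hc₀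
  have hLpos : (0 : ℝ) < L := by rw [hL]; positivity
  have hc₀pos : 0 < c₀ := by positivity
  set η : ℝ := (c₀ / (8 * Cr)) ^ 2 with hη
  have hηpos : 0 < η := by positivity
  obtain ⟨k, hk⟩ := exists_nat_gt (64 * Cr * (2 * π) * 2 / c₀)
  have hkr : (0 : ℝ) < k := lt_trans (by positivity) hk
  have hk0 : 0 < k := by exact_mod_cast hkr
  set S : ℕ := ⌈Cr / η ^ (5 / 2 : ℝ)⌉₊ with hS
  refine ⟨1 / (k : ℝ) ^ S, by positivity, c₀ / 2, by positivity, L + 3, ?_⟩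
  intro M hMp hM0 f ν u hf hfν hu hτ hCr hαM
  have hM : (0 : ℝ) < M := by exact_mod_cast hMp.out.pos
  have hk1 : (1 : ℝ) ≤ (k : ℝ) := by exact_mod_cast hk0
  have hτ1 : 1 / (k : ℝ) ^ S ≤ 1 := by
    rw [div_le_one (by positivity)]; exact one_le_pow₀ hk1
  have hsum : ∑ x, f x ≤ 2 * M := by
    have h1 := hτ 0
    have h2 : ft ν 0 - ft u 0 = ((∑ x, ν x - ∑ x, u x : ℝ) : ℂ) := by
      simp [ft]
    rw [h2, Complex.norm_real, Real.norm_eq_abs] at h1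
    have h3 := le_abs_self (∑ x, ν x - ∑ x, u x)
    have h4 : ∑ x, f x ≤ ∑ x, ν x := Finset.sum_le_sum fun x _ => hfν x
    have h5 : ∑ x, u x ≤ M := by
      refine (Finset.sum_le_sum fun x _ => hu x).trans ?_
      simp [ZMod.card]
    have h6 : 1 / (k : ℝ) ^ S * M ≤ 1 * M := by gcongr
    linarith
  set Sp := (Finset.univ : Finset (ZMod M)).filter fun r => η * M ≤ ‖ft f r‖ with hSp
  have hSpcard : Sp.card ≤ S := by
    have h1 : (Sp.card : ℝ) * (η * M) ^ (5 / 2 : ℝ) ≤ Cr * (M : ℝ) ^ (5 / 2 : ℝ) := by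
      refine le_trans ?_ hCr
      rw [← nsmul_eq_mul, ← Finset.sum_const]
      refine (Finset.sum_le_sum fun r hr => ?_).trans
        (Finset.sum_le_sum_of_subset_of_nonneg (Finset.subset_univ Sp) fun _ _ _ => by positivity)
      rw [hSp, Finset.mem_filter] at hr
      exact Real.rpow_le_rpow (by positivity) hr.2 (by norm_num)
    rw [Real.mul_rpow hηpos.le hM.le, ← mul_assoc] at h1
    have h2 := le_of_mul_le_mul_right h1 (by positivity)
    rw [← le_div_iff₀ (by positivity)] at h2
    exact Nat.cast_le.1 (h2.trans (Nat.le_ceil _))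
  obtain ⟨P, hPcard, hP⟩ := exists_bohr_class Sp hk0
  have hPne : P.Nonempty := by
    rw [Finset.nonempty_iff_ne_empty]
    rintro rfl
    simp at hPcard
    linarith
  have hPr : (0 : ℝ) < P.card := by exact_mod_cast hPne.card_pos
  obtain ⟨b₀, hb₀⟩ := hPne
  set δ : ℝ := 2 * π / k with hδ
  have hδ0 : 0 < δ := by positivity
  have hw : ∀ r, η * M ≤ ‖ft f r‖ → 1 - 8 * δ ≤ wt P r ^ 2 * wt P (-2 * r) := by
    intro r hr
    have hr' : r ∈ Sp := by rw [hSp, Finset.mem_filter]; exact ⟨Finset.mem_univ _, hr⟩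
    have h1 : 1 - 2 * δ ≤ wt P r := one_sub_le_wt hb₀ fun b hb => hP r hr' b hb b₀ hb₀
    have h2 : 1 - 2 * (2 * δ) ≤ wt P (-2 * r) := by
      refine one_sub_le_wt hb₀ fun b hb => ?_
      have e1 : ∀ b : ZMod M, (ZMod.stdAddChar (-2 * r * b) : ℂ) =
          (starRingEnd ℂ) (ZMod.stdAddChar (r * b) ^ 2) := by
        intro b
        rw [map_pow, ← AddChar.map_neg_eq_conj, sq, ← AddChar.map_add_eq_mul]
        congr 1; ring
      rw [e1, e1, ← map_sub, RCLike.norm_conj, sq_sub_sq, norm_mul]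
      refine mul_le_mul ((norm_add_le _ _).trans ?_) (hP r hr' b hb b₀ hb₀) (norm_nonneg _)
        (by norm_num)
      rw [norm_stdAddChar, norm_stdAddChar]; norm_num
    have h3 := wt_nonneg P r
    have h4 := wt_nonneg P (-2 * r)
    have h5 := wt_le_one P r
    have h6 := wt_le_one P (-2 * r)
    have h7 : 1 - 4 * δ ≤ wt P r ^ 2 := by nlinarith
    nlinarith [sq_nonneg (wt P r), pow_le_one₀ h3 h5 (n := 2)]
  have hdiff := abs_threeAP_sub_smooth_le (M := M) (by omega) P hηpos.le (by positivity : 0 ≤ 8 * δ)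
    (fun r => (norm_ft_le hf r).trans hsum) hCr hw
  have hg2 : ∀ x, smooth P f x ≤ 2 := by
    intro x
    refine (smooth_mono hfν x).trans ((smooth_le ⟨b₀, hb₀⟩ hu hτ x).trans ?_)
    have : 1 / (k : ℝ) ^ S * M / P.card ≤ 1 := by
      rw [div_le_one hPr, div_mul_eq_mul_div, one_mul, div_le_iff₀ (by positivity), mul_comm]
      refine hPcard.trans ?_
      gcongr
    linarith
  have hg0 := smooth_nonneg (P := P) hf
  have hgs := sum_smooth ⟨b₀, hb₀⟩ f
  set g := smooth P f with hg
  set A := (Finset.univ : Finset (ZMod M)).filter fun x => α / 2 ≤ g x with hA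
  have hAcard : α / 4 * M ≤ A.card := by
    have h1 : ∑ x, g x ≤ ∑ x : ZMod M, ((if x ∈ A then (2 : ℝ) else 0) + α / 2) := by
      refine Finset.sum_le_sum fun x _ => ?_
      split_ifs with h
      · linarith [hg2 x]
      · simp only [hA, Finset.mem_filter, Finset.mem_univ, true_and, not_le] at h
        linarith
    rw [hgs, Finset.sum_add_distrib, Finset.sum_ite_mem] at h1
    simp only [Finset.univ_inter, Finset.sum_const, nsmul_eq_mul, Finset.card_univ, ZMod.card] at h1
    linarith
  have hv := varnavides (β := α / 4) (by positivity) (L := L) (by omega) (by omega) (by omega) A hAcard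
  have hT : c₀ * (M : ℝ) ^ 2 ≤ threeAP g := by
    set Q := (Finset.univ : Finset (ZMod M × ZMod M)).filter
        fun p => p.1 ∈ A ∧ p.1 + p.2 ∈ A ∧ p.1 + 2 * p.2 ∈ A with hQ
    have h1 : (α / 2) ^ 3 * Q.card ≤ threeAP g := by
      unfold threeAP
      rw [← Fintype.sum_prod_type' (f := fun x d => g x * g (x + d) * g (x + 2 * d)),
        mul_comm, ← nsmul_eq_mul, ← Finset.sum_const]
      refine (Finset.sum_le_sum fun p hp => ?_).trans
        (Finset.sum_le_sum_of_subset_of_nonneg (Finset.subset_univ Q) fun p _ _ =>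
          mul_nonneg (mul_nonneg (hg0 _) (hg0 _)) (hg0 _))
      simp only [hQ, hA, Finset.mem_filter, Finset.mem_univ, true_and] at hp
      rw [pow_three']
      have h1 := hp.1
      have h2 := hp.2.1
      have h3 := hp.2.2
      have := hg0 p.1
      have := hg0 (p.1 + p.2)
      gcongr
    refine le_trans ?_ h1
    rw [hc₀, mul_assoc]
    gcongr
    refine le_trans (le_of_eq ?_) hv
    ring
  have hsη : √η = c₀ / (8 * Cr) := by rw [hη]; exact Real.sqrt_sq (by positivity)
  have hs2 : √2 ≤ (2 : ℝ) := by
    rw [Real.sqrt_le_left (by norm_num)]; norm_num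
  have hfin : 2 * Cr * (√η + 8 * δ * √2) ≤ c₀ / 2 := by
    have h1 : 64 * Cr * δ * 2 ≤ c₀ := by
      rw [hδ]
      rw [div_lt_iff₀ hc₀pos] at hk
      rw [show 64 * Cr * (2 * π / k) * 2 = 64 * Cr * (2 * π) * 2 / k by ring, div_le_iff₀ hkr]
      linarith
    have h2 : 2 * Cr * √η = c₀ / 4 := by rw [hsη]; field_simp; norm_num
    have h3 : 2 * Cr * (8 * δ * √2) ≤ 2 * Cr * (8 * δ * 2) := by gcongr
    nlinarith
  have hfin2 : 2 * Cr * (√η + 8 * δ * √2) * (M : ℝ) ^ 2 ≤ c₀ / 2 * (M : ℝ) ^ 2 := by gcongr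
  have := (abs_le.1 (hdiff.trans hfin2)).1
  linarith

/-! ### Restriction estimates on `ZMod M` -/

lemma sum_norm_ft_sq {M : ℕ} [NeZero M] (f : ZMod M → ℝ) :
    ∑ r, ‖ft f r‖ ^ 2 = M * ∑ x, f x ^ 2 := by
  have h : ((∑ r, ‖ft f r‖ ^ 2 : ℝ) : ℂ) = ((M * ∑ x, f x ^ 2 : ℝ) : ℂ) := by
    push_cast
    have h1 : ∀ r : ZMod M, ((‖ft f r‖ : ℂ)) ^ 2 =
        ∑ x, (f x : ℂ) * (ft f r * ZMod.stdAddChar (-(r * x))) := by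
      intro r
      rw [← Complex.mul_conj']
      conv_lhs => rw [show (starRingEnd ℂ) (ft f r) = ∑ x, (starRingEnd ℂ)
        ((f x : ℂ) * ZMod.stdAddChar (r * x)) by rw [ft, map_sum]]
      rw [Finset.mul_sum]
      refine Finset.sum_congr rfl fun x _ => ?_
      rw [map_mul, Complex.conj_ofReal, AddChar.map_neg_eq_conj]; ring
    rw [Finset.sum_congr rfl fun r _ => h1 r, Finset.sum_comm, Finset.mul_sum]
    refine Finset.sum_congr rfl fun x _ => ?_
    rw [← Finset.mul_sum, ← ft_inversion]; ring
  exact_mod_cast h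

/-- Large spectrum bound for functions with a pseudorandom majorant. -/
lemma card_large_spectrum {M : ℕ} [NeZero M] {f μ u : ZMod M → ℝ} {K σ ε : ℝ} (hε : 0 < ε)
    (hf : ∀ x, 0 ≤ f x) (hfμ : ∀ x, f x ≤ μ x) (hu : ∀ x, u x ≤ K) (hK : 0 ≤ K)
    (hμ : ∀ r, ‖ft μ r - ft u r‖ ≤ σ * M) (hsum : ∑ x, f x ≤ 2 * M) (hσ : 4 * σ ≤ ε ^ 2) :
    (((Finset.univ : Finset (ZMod M)).filter fun r => ε * M ≤ ‖ft f r‖).card : ℝ) ≤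
      4 * K / ε ^ 2 := by
  have hM : (0 : ℝ) < M := by exact_mod_cast Nat.pos_of_ne_zero (NeZero.ne M)
  set S := (Finset.univ : Finset (ZMod M)).filter fun r => ε * M ≤ ‖ft f r‖ with hS
  rcases Nat.eq_zero_or_pos S.card with h0 | h0
  · rw [h0, Nat.cast_zero]; positivity
  have hSr : (0 : ℝ) < S.card := by exact_mod_cast h0
  choose c hc1 hc2 using fun r : ZMod M => show ∃ c : ℂ, ‖c‖ = 1 ∧ c * ft f r = ‖ft f r‖ by
    by_cases h : ft f r = 0
    · exact ⟨1, by simp [h]⟩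
    · refine ⟨‖ft f r‖ / ft f r, ?_, by field_simp⟩
      rw [norm_div, Complex.norm_real, norm_norm, div_self (norm_ne_zero_iff.2 h)]
  set D : ZMod M → ℂ := fun x => ∑ r ∈ S, c r * ZMod.stdAddChar (r * x) with hD
  have hquad : ∀ v : ZMod M → ℝ, ((∑ x, v x * ‖D x‖ ^ 2 : ℝ) : ℂ) =
      ∑ r ∈ S, ∑ r' ∈ S, c r * (starRingEnd ℂ) (c r') * ft v (r - r') := by
    intro v
    push_cast
    simp only [← Complex.mul_conj', hD, map_sum, Finset.sum_mul_sum]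
    simp only [ft, Finset.mul_sum]
    rw [Finset.sum_comm]
    refine Finset.sum_congr rfl fun r _ => ?_
    rw [Finset.sum_comm]
    refine Finset.sum_congr rfl fun r' _ => Finset.sum_congr rfl fun x _ => ?_
    rw [map_mul (starRingEnd ℂ), ← AddChar.map_neg_eq_conj, sub_mul, sub_eq_add_neg, AddChar.map_add_eq_mul]
    ring
  have hpar : ∑ x, ‖D x‖ ^ 2 = M * S.card := by
    have h1 := hquad fun _ => 1
    have h2 : ∀ r : ZMod M, ft (fun _ : ZMod M => (1 : ℝ)) r = if r = 0 then (M : ℂ) else 0 := by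
      intro r
      rw [← sum_stdAddChar_mul r, ft]
      refine Finset.sum_congr rfl fun x _ => ?_
      rw [mul_comm x r]; simp
    have h3 : ∑ r ∈ S, ∑ r' ∈ S, c r * (starRingEnd ℂ) (c r') * ft (fun _ : ZMod M => (1 : ℝ)) (r - r')
        = ((M * S.card : ℝ) : ℂ) := by
      have : ∀ r ∈ S, ∑ r' ∈ S, c r * (starRingEnd ℂ) (c r') *
          ft (fun _ : ZMod M => (1 : ℝ)) (r - r') = M := by
        intro r hr
        rw [Finset.sum_eq_single r]
        · rw [h2, sub_self, if_pos rfl, Complex.mul_conj', hc1]; simp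
        · intro r' _ hne
          rw [h2, if_neg (sub_ne_zero.2 hne.symm), mul_zero]
        · exact fun h => absurd hr h
      rw [Finset.sum_congr rfl this]; simp; ring
    rw [h3] at h1
    have h4 := Complex.ofReal_injective h1
    simpa using h4
  have hmaj : ∑ x, μ x * ‖D x‖ ^ 2 ≤ K * (M * S.card) + σ * M * (S.card : ℝ) ^ 2 := by
    have h1 : ∑ x, u x * ‖D x‖ ^ 2 ≤ K * (M * S.card) := by
      rw [← hpar, Finset.mul_sum]
      gcongr with x _
      exact hu x
    have h2 : |∑ x, μ x * ‖D x‖ ^ 2 - ∑ x, u x * ‖D x‖ ^ 2| ≤ σ * M * (S.card : ℝ) ^ 2 := by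
      rw [← Real.norm_eq_abs, ← Complex.norm_real, Complex.ofReal_sub, hquad, hquad,
        ← Finset.sum_sub_distrib]
      have h3 : ∀ r ∈ S, ‖∑ r' ∈ S, c r * (starRingEnd ℂ) (c r') * ft μ (r - r') -
          ∑ r' ∈ S, c r * (starRingEnd ℂ) (c r') * ft u (r - r')‖ ≤ S.card * (σ * M) := by
        intro r _
        rw [← Finset.sum_sub_distrib]
        refine (norm_sum_le_of_le (f := _) (n := fun _ => σ * M) S fun r' _ => ?_).trans (by simp)
        rw [← mul_sub, norm_mul, norm_mul, RCLike.norm_conj, hc1, hc1, one_mul, one_mul]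
        exact hμ _
      refine (norm_sum_le_of_le S h3).trans (le_of_eq ?_)
      simp; ring
    linarith [(abs_le.1 h2).2]
  have hlow : ε * M * S.card ≤ ∑ x, f x * ‖D x‖ := by
    have h1 : ((∑ r ∈ S, ‖ft f r‖ : ℝ) : ℂ) = ∑ x, (f x : ℂ) * D x := by
      push_cast
      simp only [hD, Finset.mul_sum]
      rw [Finset.sum_comm]
      refine Finset.sum_congr rfl fun r _ => ?_
      rw [← hc2, ft, Finset.mul_sum]
      refine Finset.sum_congr rfl fun x _ => ?_
      ring
    have h2 : ε * M * S.card ≤ ∑ r ∈ S, ‖ft f r‖ := by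
      rw [mul_comm, ← nsmul_eq_mul, ← Finset.sum_const]
      refine Finset.sum_le_sum fun r hr => ?_
      rw [hS, Finset.mem_filter] at hr
      exact hr.2
    refine h2.trans ?_
    have h3 : ∑ r ∈ S, ‖ft f r‖ = ‖∑ x, (f x : ℂ) * D x‖ := by
      rw [← h1, Complex.norm_real, Real.norm_of_nonneg (Finset.sum_nonneg fun _ _ => norm_nonneg _)]
    rw [h3]
    refine norm_sum_le_of_le _ fun x _ => ?_
    rw [norm_mul, Complex.norm_real, Real.norm_of_nonneg (hf x)]
  have hcs : (∑ x, f x * ‖D x‖) ^ 2 ≤ (∑ x, f x) * ∑ x, f x * ‖D x‖ ^ 2 := by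
    have := Finset.sum_mul_sq_le_sq_mul_sq (Finset.univ : Finset (ZMod M)) (fun x => √(f x))
      (fun x => √(f x) * ‖D x‖)
    simp only [← mul_assoc, mul_pow, Real.mul_self_sqrt (hf _), Real.sq_sqrt (hf _)] at this
    exact this
  have h1 : (ε * M * S.card) ^ 2 ≤ 2 * M * (K * (M * S.card) + σ * M * (S.card : ℝ) ^ 2) := by
    calc (ε * M * S.card) ^ 2 ≤ (∑ x, f x * ‖D x‖) ^ 2 := by gcongr
      _ ≤ (∑ x, f x) * ∑ x, f x * ‖D x‖ ^ 2 := hcs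
      _ ≤ 2 * M * ∑ x, μ x * ‖D x‖ ^ 2 := by
        refine mul_le_mul hsum ?_ (Finset.sum_nonneg fun x _ => mul_nonneg (hf x) (by positivity))
          (by positivity)
        gcongr with x _
        exact hfμ x
      _ ≤ _ := by gcongr
  rw [le_div_iff₀ (by positivity)]
  have h2 : (M ^ 2 * S.card : ℝ) * (S.card * ε ^ 2) ≤ (M ^ 2 * S.card : ℝ) * (2 * K + 2 * σ * S.card) := by
    nlinarith
  have h3 := le_of_mul_le_mul_left h2 (by positivity)
  nlinarith

/-- Dyadic summation of level-set bounds into an `ℓ^{5/2}` restriction estimate. -/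
lemma restriction_of_level_sets {M : ℕ} [NeZero M] {f : ZMod M → ℝ} {B Fm : ℝ} {J : ℕ}
    (hf : ∀ x, 0 ≤ f x) (hsum : ∑ x, f x ≤ 2 * M) (hFm : ∀ x, f x ≤ Fm)
    (hJ : √((1 / 2 : ℝ) ^ J) * Fm ≤ 1) (hB : 0 ≤ B)
    (hcount : ∀ j ≤ J, (((Finset.univ : Finset (ZMod M)).filter
      fun r => (1 / 2 : ℝ) ^ j * M ≤ ‖ft f r‖).card : ℝ) ≤ B * ((2 : ℝ) ^ j) ^ (23 / 10 : ℝ)) :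
    ∑ r, ‖ft f r‖ ^ (5 / 2 : ℝ) ≤ (48 * B + 2) * (M : ℝ) ^ (5 / 2 : ℝ) := by
  have hM : (0 : ℝ) < M := by exact_mod_cast Nat.pos_of_ne_zero (NeZero.ne M)
  have hsq : ∀ x : ℝ, 0 ≤ x → x ^ (5 / 2 : ℝ) = √x * x ^ 2 := by
    intro x hx
    rw [Real.sqrt_eq_rpow, ← Real.rpow_natCast, ← Real.rpow_add_of_nonneg hx (by norm_num)
      (by norm_num)]
    norm_num
  have hpt : ∀ r : ZMod M, ‖ft f r‖ ^ (5 / 2 : ℝ) ≤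
      (∑ j ∈ Finset.range (J + 1), if (1 / 2 : ℝ) ^ j * M ≤ ‖ft f r‖ then
        (2 * ((1 / 2 : ℝ) ^ j * M)) ^ (5 / 2 : ℝ) else 0) +
      √((1 / 2 : ℝ) ^ J * M) * ‖ft f r‖ ^ 2 := by
    intro r
    set a := ‖ft f r‖ with ha
    have ha0 : 0 ≤ a := norm_nonneg _
    have hs0 : 0 ≤ ∑ j ∈ Finset.range (J + 1), if (1 / 2 : ℝ) ^ j * M ≤ a then
        (2 * ((1 / 2 : ℝ) ^ j * M)) ^ (5 / 2 : ℝ) else 0 :=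
      Finset.sum_nonneg fun j _ => by split_ifs <;> positivity
    rcases lt_or_ge a ((1 / 2 : ℝ) ^ J * M) with h | h
    · rw [hsq a ha0]
      have : √a * a ^ 2 ≤ √((1 / 2 : ℝ) ^ J * M) * a ^ 2 := by gcongr
      linarith
    · have hex : ∃ j, (1 / 2 : ℝ) ^ j * M ≤ a := ⟨J, h⟩
      have hj1 := Nat.find_spec hex
      have hj2 : Nat.find hex ≤ J := Nat.find_min' hex h
      have hj3 : a ≤ 2 * ((1 / 2 : ℝ) ^ Nat.find hex * M) := by
        rcases Nat.eq_zero_or_pos (Nat.find hex) with h0 | h0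
        · rw [h0, pow_zero, one_mul]; exact (norm_ft_le hf r).trans hsum
        · have := Nat.find_min hex (Nat.sub_lt h0 one_pos)
          rw [not_le] at this
          refine this.le.trans (le_of_eq ?_)
          conv_rhs => rw [← Nat.sub_add_cancel h0, pow_succ]
          ring_nf
      have h4 : a ^ (5 / 2 : ℝ) ≤ (2 * ((1 / 2 : ℝ) ^ Nat.find hex * M)) ^ (5 / 2 : ℝ) :=
        Real.rpow_le_rpow ha0 hj3 (by norm_num)
      have h5 := Finset.single_le_sum (f := fun j => if (1 / 2 : ℝ) ^ j * M ≤ a then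
        (2 * ((1 / 2 : ℝ) ^ j * M)) ^ (5 / 2 : ℝ) else 0)
        (fun j _ => by split_ifs <;> positivity)
        (Finset.mem_range.2 (Nat.lt_succ_of_le hj2))
      rw [if_pos hj1] at h5
      have h6 : 0 ≤ √((1 / 2 : ℝ) ^ J * M) * a ^ 2 := by positivity
      linarith
  refine (Finset.sum_le_sum fun r _ => hpt r).trans ?_
  rw [Finset.sum_add_distrib, ← Finset.mul_sum, sum_norm_ft_sq, Finset.sum_comm]
  have hlow : √((1 / 2 : ℝ) ^ J * M) * (M * ∑ x, f x ^ 2) ≤ 2 * (M : ℝ) ^ (5 / 2 : ℝ) := by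
    have h1 : ∑ x, f x ^ 2 ≤ Fm * (2 * M) := by
      have hFm0 : 0 ≤ Fm := (hf 0).trans (hFm 0)
      calc ∑ x, f x ^ 2 ≤ ∑ x, Fm * f x := by
            refine Finset.sum_le_sum fun x _ => ?_
            rw [sq]; exact mul_le_mul_of_nonneg_right (hFm x) (hf x)
        _ = Fm * ∑ x, f x := by rw [Finset.mul_sum]
        _ ≤ _ := by gcongr
    calc √((1 / 2 : ℝ) ^ J * M) * (M * ∑ x, f x ^ 2)
        ≤ √((1 / 2 : ℝ) ^ J * M) * (M * (Fm * (2 * M))) := by gcongr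
      _ = (√((1 / 2 : ℝ) ^ J) * Fm) * (2 * (√M * (M : ℝ) ^ 2)) := by
        rw [Real.sqrt_mul (by positivity)]; ring
      _ ≤ 1 * (2 * (√M * (M : ℝ) ^ 2)) := by gcongr
      _ = _ := by rw [hsq M hM.le, one_mul]
  have hlev : ∀ j ∈ Finset.range (J + 1), ∑ r : ZMod M, (if (1 / 2 : ℝ) ^ j * M ≤ ‖ft f r‖ then
        (2 * ((1 / 2 : ℝ) ^ j * M)) ^ (5 / 2 : ℝ) else 0) ≤
        6 * B * (M : ℝ) ^ (5 / 2 : ℝ) * (7 / 8 : ℝ) ^ j := by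
    intro j hj
    rw [← Finset.sum_filter, Finset.sum_const, nsmul_eq_mul]
    have h1 := hcount j (Nat.lt_succ_iff.1 (Finset.mem_range.1 hj))
    have h2 : (2 : ℝ) ^ (5 / 2 : ℝ) ≤ 6 := by
      rw [hsq 2 (by norm_num)]
      have : √2 ≤ (3 / 2 : ℝ) := by rw [Real.sqrt_le_left (by norm_num)]; norm_num
      linarith
    have h3 : ((2 : ℝ) ^ j) ^ (23 / 10 : ℝ) * ((1 / 2 : ℝ) ^ j) ^ (5 / 2 : ℝ) ≤ (7 / 8 : ℝ) ^ j := by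
      have e1 : ((2 : ℝ) ^ j) ^ (23 / 10 : ℝ) * ((1 / 2 : ℝ) ^ j) ^ (5 / 2 : ℝ) =
          ((2 : ℝ) ^ (-(1 / 5) : ℝ)) ^ j := by
        rw [one_div, inv_pow, Real.inv_rpow (by positivity), ← Real.rpow_natCast,
          ← Real.rpow_natCast (2 ^ (-(1 / 5) : ℝ)), ← Real.rpow_mul (by norm_num),
          ← Real.rpow_mul (by norm_num), ← Real.rpow_mul (by norm_num),
          ← Real.rpow_neg (by norm_num), ← Real.rpow_add (by norm_num)]
        congr 1; ring
      rw [e1]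
      have e2 : (2 : ℝ) ^ (-(1 / 5) : ℝ) ≤ 7 / 8 := by
        refine le_of_pow_le_pow_left₀ (n := 5) (by norm_num) (by norm_num) ?_
        rw [← Real.rpow_natCast, ← Real.rpow_mul (by norm_num)]
        norm_num
      gcongr
    rw [Real.mul_rpow (by norm_num) (by positivity), Real.mul_rpow (by positivity) hM.le]
    calc _ ≤ (B * ((2 : ℝ) ^ j) ^ (23 / 10 : ℝ)) * ((2 : ℝ) ^ (5 / 2 : ℝ) *
          (((1 / 2 : ℝ) ^ j) ^ (5 / 2 : ℝ) * (M : ℝ) ^ (5 / 2 : ℝ))) :=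
          mul_le_mul_of_nonneg_right h1 (by positivity)
      _ = (2 : ℝ) ^ (5 / 2 : ℝ) * B * (M : ℝ) ^ (5 / 2 : ℝ) *
          (((2 : ℝ) ^ j) ^ (23 / 10 : ℝ) * ((1 / 2 : ℝ) ^ j) ^ (5 / 2 : ℝ)) := by ring
      _ ≤ _ := by gcongr
  have hgeo : ∑ j ∈ Finset.range (J + 1), (7 / 8 : ℝ) ^ j ≤ 8 := by
    rw [geom_sum_eq (by norm_num)]
    have : 0 < (7 / 8 : ℝ) ^ (J + 1) := by positivity
    rw [div_le_iff_of_neg (by norm_num)]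
    linarith
  have hup : ∑ j ∈ Finset.range (J + 1), ∑ r : ZMod M, (if (1 / 2 : ℝ) ^ j * M ≤ ‖ft f r‖ then
        (2 * ((1 / 2 : ℝ) ^ j * M)) ^ (5 / 2 : ℝ) else 0) ≤ 48 * B * (M : ℝ) ^ (5 / 2 : ℝ) := by
    refine (Finset.sum_le_sum hlev).trans ?_
    rw [← Finset.mul_sum]
    have : 0 ≤ 6 * B * (M : ℝ) ^ (5 / 2 : ℝ) := by positivity
    nlinarith
  linarith

/-! ### Ramanujan sums -/

lemma e_eq_one_iff (t : ℝ) : e t = 1 ↔ ∃ k : ℤ, t = k := by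
  constructor
  · intro h
    unfold e at h
    rw [Complex.exp_eq_one_iff] at h
    obtain ⟨k, hk⟩ := h
    refine ⟨k, ?_⟩
    have h2 : (2 * π * Complex.I : ℂ) ≠ 0 := Complex.two_pi_I_ne_zero
    have h3 : (t : ℂ) = k := by
      apply mul_left_cancel₀ h2; rw [hk]; ring
    exact_mod_cast h3
  · rintro ⟨k, rfl⟩; exact e_int k

/-- The sum of `e(na/q)` over reduced residues `a` modulo `q`. -/
noncomputable def ramanujanSum (n q : ℕ) : ℂ :=
  ∑ a ∈ (Finset.range q).filter (Nat.Coprime · q), e (n * ((a : ℝ) / q))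

lemma sum_divisors_ramanujanSum (n : ℕ) {q : ℕ} (hq : 0 < q) :
    ∑ d ∈ q.divisors, ramanujanSum n d = ∑ a ∈ Finset.range q, e (n * ((a : ℝ) / q)) := by
  simp only [ramanujanSum]
  rw [Finset.sum_sigma']
  refine Finset.sum_bij' (fun x _ => x.2 * (q / x.1))
    (fun a _ => ⟨q / Nat.gcd a q, a / Nat.gcd a q⟩) ?_ ?_ ?_ ?_ ?_
  · rintro ⟨d, a⟩ h
    simp only [Finset.mem_sigma, Nat.mem_divisors, Finset.mem_filter, Finset.mem_range] at h ⊢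
    obtain ⟨⟨⟨m, rfl⟩, -⟩, had, -⟩ := h
    have hd : 0 < d := Nat.pos_of_mul_pos_right hq
    have hm : 0 < m := Nat.pos_of_mul_pos_left hq
    rw [Nat.mul_div_cancel_left _ hd]
    exact Nat.mul_lt_mul_of_pos_right had hm
  · intro a ha
    simp only [Finset.mem_sigma, Nat.mem_divisors, Finset.mem_filter, Finset.mem_range] at ha ⊢
    have hg : 0 < Nat.gcd a q := Nat.gcd_pos_of_pos_right _ hq
    refine ⟨⟨Nat.div_dvd_of_dvd (Nat.gcd_dvd_right _ _), hq.ne'⟩,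
      Nat.div_lt_div_of_lt_of_dvd (Nat.gcd_dvd_right _ _) ha, Nat.coprime_div_gcd_div_gcd hg⟩
  · rintro ⟨d, a⟩ h
    simp only [Finset.mem_sigma, Nat.mem_divisors, Finset.mem_filter, Finset.mem_range] at h ⊢
    obtain ⟨⟨⟨m, rfl⟩, -⟩, had, hco⟩ := h
    have hd : 0 < d := Nat.pos_of_mul_pos_right hq
    have hm : 0 < m := Nat.pos_of_mul_pos_left hq
    rw [Nat.mul_div_cancel_left _ hd, Nat.gcd_mul_right, hco.gcd_eq_one, one_mul,
      Nat.mul_div_cancel _ hm, Nat.mul_div_cancel _ hm]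
  · intro a ha
    dsimp only
    have hg : 0 < Nat.gcd a q := Nat.gcd_pos_of_pos_right _ hq
    rw [Nat.div_div_self (Nat.gcd_dvd_right _ _) hq.ne', Nat.div_mul_cancel (Nat.gcd_dvd_left _ _)]
  · rintro ⟨d, a⟩ h
    simp only [Finset.mem_sigma, Nat.mem_divisors, Finset.mem_filter, Finset.mem_range] at h ⊢
    obtain ⟨⟨⟨m, rfl⟩, -⟩, had, hco⟩ := h
    have hd : 0 < d := Nat.pos_of_mul_pos_right hq
    have hm : 0 < m := Nat.pos_of_mul_pos_left hq
    have hdr : (d : ℝ) ≠ 0 := by exact_mod_cast hd.ne'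
    have hmr : (m : ℝ) ≠ 0 := by exact_mod_cast hm.ne'
    rw [Nat.mul_div_cancel_left _ hd]
    congr 2
    push_cast
    rw [mul_div_mul_right _ _ hmr]

lemma sum_range_e_div {n q : ℕ} (hq : 0 < q) (hco : Nat.Coprime n q) :
    ∑ a ∈ Finset.range q, e (n * ((a : ℝ) / q)) = if q = 1 then 1 else 0 := by
  have hqr : (q : ℝ) ≠ 0 := by exact_mod_cast hq.ne'
  have h1 : ∀ a ∈ Finset.range q, e (n * ((a : ℝ) / q)) = e ((n : ℝ) / q) ^ a := by
    intro a _
    rw [← e_nat_mul]; congr 1; ring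
  rw [Finset.sum_congr rfl h1]
  split_ifs with h
  · subst h; simp
  · have h2 : e ((n : ℝ) / q) ≠ 1 := by
      rw [Ne, e_eq_one_iff]
      rintro ⟨k, hk⟩
      rw [div_eq_iff hqr] at hk
      have hk' : (n : ℤ) = k * q := by exact_mod_cast hk
      have : (q : ℤ) ∣ n := ⟨k, by rw [hk']; ring⟩
      have h3 := Nat.eq_one_of_dvd_coprimes hco (Int.natCast_dvd_natCast.1 this) dvd_rfl
      exact h h3
    have h3 := mul_geom_sum (e ((n : ℝ) / q)) q
    rw [← e_nat_mul, mul_div_cancel₀ _ hqr, e_nat, sub_self] at h3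
    exact (mul_eq_zero.1 h3).resolve_left (sub_ne_zero.2 h2)

open ArithmeticFunction in
lemma ramanujanSum_eq_moebius {n q : ℕ} (hq : 0 < q) (hco : Nat.Coprime n q) :
    ramanujanSum n q = (moebius q : ℤ) := by
  have h := (sum_eq_iff_sum_mul_moebius_eq_on (R := ℂ) (f := ramanujanSum n)
    (g := fun m => if m = 1 then 1 else 0) {m | Nat.Coprime n m}
    (fun a b hab hb => Nat.Coprime.coprime_dvd_right hab hb)).1
    (fun m hm hmc => by rw [sum_divisors_ramanujanSum n hm, sum_range_e_div hm hmc]) q hq hco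
  rw [← h, Finset.sum_eq_single (q, 1)]
  · simp
  · rintro ⟨a, b⟩ hab hne
    rw [Nat.mem_divisorsAntidiagonal] at hab
    have : b ≠ 1 := by
      rintro rfl
      exact hne (by rw [← hab.1]; simp)
    simp [this]
  · intro hq1; exact absurd (Nat.mem_divisorsAntidiagonal.2 ⟨by simp, hq.ne'⟩) hq1

/-! ### Sieve weights -/

/-- Squarefree moduli up to `R` all of whose prime factors exceed `z`. -/
noncomputable def sieveModuli (R z : ℕ) : Finset ℕ :=
  (Finset.Icc 1 R).filter fun q => Squarefree q ∧ ∀ p, p.Prime → p ∣ q → z < p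

lemma mem_sieveModuli {R z q : ℕ} : q ∈ sieveModuli R z ↔
    (1 ≤ q ∧ q ≤ R) ∧ Squarefree q ∧ ∀ p, p.Prime → p ∣ q → z < p := by
  rw [sieveModuli, Finset.mem_filter, Finset.mem_Icc]

/-- The sum of `1/q` over the sieve moduli. -/
noncomputable def sieveMass (R z : ℕ) : ℝ := ∑ q ∈ sieveModuli R z, 1 / (q : ℝ)

/-- The sum of `φ(q)/q²` over the sieve moduli. -/
noncomputable def sieveEnergy (R z : ℕ) : ℝ :=
  ∑ q ∈ sieveModuli R z, (Nat.totient q : ℝ) / (q : ℝ) ^ 2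

/-- Farey fractions `a/q`, encoded as pairs `(q, a)`, with sieve modulus denominators. -/
noncomputable def fareyPairs (R z : ℕ) : Finset (ℕ × ℕ) :=
  (sieveModuli R z ×ˢ Finset.range R).filter fun t => t.2 < t.1 ∧ Nat.Coprime t.2 t.1

lemma mem_fareyPairs {R z : ℕ} {t : ℕ × ℕ} : t ∈ fareyPairs R z ↔
    t.1 ∈ sieveModuli R z ∧ t.2 < t.1 ∧ Nat.Coprime t.2 t.1 := by
  rw [fareyPairs, Finset.mem_filter, Finset.mem_product, Finset.mem_range]
  constructor
  · rintro ⟨⟨h1, -⟩, h2⟩; exact ⟨h1, h2⟩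
  · rintro ⟨h1, h2⟩
    exact ⟨⟨h1, h2.1.trans_le (mem_sieveModuli.1 h1).1.2⟩, h2⟩

/-- The coefficient `μ(q)/q` attached to a Farey fraction. -/
noncomputable def fareyCoeff (t : ℕ × ℕ) : ℝ := (ArithmeticFunction.moebius t.1 : ℤ) / (t.1 : ℝ)

/-- The value of a Farey fraction. -/
noncomputable def fareyVal (t : ℕ × ℕ) : ℝ := (t.2 : ℝ) / t.1

/-- The sieve weight: a Farey-fraction trigonometric polynomial. -/
noncomputable def sieveWeight (R z n : ℕ) : ℂ :=
  ∑ t ∈ fareyPairs R z, (fareyCoeff t : ℂ) * e (n * fareyVal t)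

lemma sum_fareyPairs {α : Type*} [AddCommMonoid α] (R z : ℕ) (F : ℕ × ℕ → α) :
    ∑ t ∈ fareyPairs R z, F t = ∑ q ∈ sieveModuli R z,
      ∑ a ∈ (Finset.range q).filter (Nat.Coprime · q), F (q, a) := by
  rw [Finset.sum_sigma']
  refine Finset.sum_bij' (fun t _ => ⟨t.1, t.2⟩) (fun x _ => (x.1, x.2)) ?_ ?_ ?_ ?_ ?_
  · intro t ht
    rw [mem_fareyPairs] at ht
    simpa using ht
  · intro x hx
    rw [mem_fareyPairs]
    simpa using hx
  · intro t _; rfl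
  · intro x _; rfl
  · intro t _; rfl

lemma moebius_sq_cast {q : ℕ} (hq : Squarefree q) :
    ((ArithmeticFunction.moebius q : ℤ) : ℝ) ^ 2 = 1 := by
  have := ArithmeticFunction.moebius_sq_eq_one_of_squarefree hq
  exact_mod_cast this

lemma sieveWeight_eq {R z n : ℕ} (hn : ∀ q ∈ sieveModuli R z, Nat.Coprime n q) :
    sieveWeight R z n = (sieveMass R z : ℝ) := by
  unfold sieveWeight sieveMass
  rw [sum_fareyPairs]
  push_cast
  refine Finset.sum_congr rfl fun q hq => ?_
  have hq' := mem_sieveModuli.1 hq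
  have h1 := ramanujanSum_eq_moebius hq'.1.1 (hn q hq)
  have h2 := moebius_sq_cast hq'.2.1
  simp only [fareyVal, fareyCoeff]
  rw [← Finset.mul_sum]
  unfold ramanujanSum at h1
  rw [h1]
  have h3 : (((ArithmeticFunction.moebius q : ℤ) : ℝ) : ℂ) ^ 2 = 1 := by exact_mod_cast h2
  push_cast
  push_cast at h3
  rw [div_mul_eq_mul_div, ← sq, h3]

lemma fareyCoeff_sq {R z : ℕ} {t : ℕ × ℕ} (ht : t ∈ fareyPairs R z) :
    fareyCoeff t ^ 2 = 1 / (t.1 : ℝ) ^ 2 := by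
  have := (mem_sieveModuli.1 (mem_fareyPairs.1 ht).1).2.1
  rw [fareyCoeff, div_pow, moebius_sq_cast this]

lemma abs_fareyCoeff_le_one {R z : ℕ} {t : ℕ × ℕ} (ht : t ∈ fareyPairs R z) :
    |fareyCoeff t| ≤ 1 := by
  have h := fareyCoeff_sq ht
  have h1 : (1 : ℝ) ≤ t.1 := by
    exact_mod_cast (mem_sieveModuli.1 (mem_fareyPairs.1 ht).1).1.1
  rw [← sq_le_one_iff_abs_le_one, h, div_le_one (by positivity)]
  exact one_le_pow₀ h1

lemma card_coprime_range (q : ℕ) :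
    ((Finset.range q).filter (Nat.Coprime · q)).card = Nat.totient q := by
  rw [Nat.totient_eq_card_coprime]
  congr 1
  ext a; simp [Nat.coprime_comm]

lemma sum_fareyCoeff_sq (R z : ℕ) :
    ∑ t ∈ fareyPairs R z, fareyCoeff t ^ 2 = sieveEnergy R z := by
  rw [Finset.sum_congr rfl fun t ht => fareyCoeff_sq ht, sum_fareyPairs, sieveEnergy]
  refine Finset.sum_congr rfl fun q _ => ?_
  dsimp only
  rw [Finset.sum_const, card_coprime_range, nsmul_eq_mul]; ring

lemma sieveEnergy_le_sieveMass (R z : ℕ) : sieveEnergy R z ≤ sieveMass R z := by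
  unfold sieveEnergy sieveMass
  refine Finset.sum_le_sum fun q hq => ?_
  have h1 : (1 : ℝ) ≤ q := by exact_mod_cast (mem_sieveModuli.1 hq).1.1
  rw [div_le_div_iff₀ (by positivity) (by positivity)]
  have : (Nat.totient q : ℝ) ≤ q := by exact_mod_cast Nat.totient_le q
  nlinarith

lemma sieveEnergy_nonneg (R z : ℕ) : 0 ≤ sieveEnergy R z :=
  Finset.sum_nonneg fun _ _ => by positivity

lemma one_le_sieveMass {R : ℕ} (hR : 1 ≤ R) (z : ℕ) : 1 ≤ sieveMass R z := by
  have h1 : 1 ∈ sieveModuli R z := by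
    rw [mem_sieveModuli]
    refine ⟨⟨le_rfl, hR⟩, squarefree_one, fun p hp h => ?_⟩
    exact absurd (Nat.dvd_one.1 h) hp.one_lt.ne'
  have := Finset.single_le_sum (f := fun q : ℕ => 1 / (q : ℝ)) (fun q _ => by positivity) h1
  simpa [sieveMass] using this

lemma sieveMass_le (R z : ℕ) : sieveMass R z ≤ R := by
  unfold sieveMass
  refine (Finset.sum_le_sum (g := fun _ => (1 : ℝ)) fun q hq => ?_).trans ?_
  · have h1 : (1 : ℝ) ≤ q := by exact_mod_cast (mem_sieveModuli.1 hq).1.1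
    exact div_le_one_of_le₀ h1 (by positivity)
  · rw [Finset.sum_const, nsmul_eq_mul, mul_one]
    have := Finset.card_filter_le (Finset.Icc 1 R)
      fun q => Squarefree q ∧ ∀ p, p.Prime → p ∣ q → z < p
    rw [Nat.card_Icc, Nat.add_sub_cancel] at this
    exact Nat.cast_le.2 this

lemma card_fareyPairs_le (R z : ℕ) : (fareyPairs R z).card ≤ R ^ 2 := by
  refine (Finset.card_filter_le _ _).trans ?_
  rw [Finset.card_product, Finset.card_range, sq]
  refine Nat.mul_le_mul_right _ ?_
  refine (Finset.card_filter_le _ _).trans ?_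
  simp

/-- Moduli divisible by a fixed prime carry little of a submultiplicative mass. -/
lemma sum_moduli_dvd_le {R z p : ℕ} (hp : p.Prime) {g : ℕ → ℝ} {κ : ℝ} (hg : ∀ q, 0 ≤ g q)
    (hκ : 0 ≤ κ) (hmul : ∀ q, Nat.Coprime p q → g (p * q) ≤ κ * g q) :
    ∑ q ∈ (sieveModuli R z).filter (p ∣ ·), g q ≤
      κ * ∑ q ∈ (sieveModuli R z).filter (¬ p ∣ ·), g q := by
  have h1 : ∀ q ∈ (sieveModuli R z).filter (p ∣ ·), g q ≤ κ * g (q / p) ∧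
      q / p ∈ (sieveModuli R z).filter (¬ p ∣ ·) := by
    intro q hq
    rw [Finset.mem_filter, mem_sieveModuli] at hq
    obtain ⟨⟨⟨hq1, hqR⟩, hsq, hpr⟩, m, rfl⟩ := hq
    have hco : Nat.Coprime p m := (Nat.squarefree_mul_iff.1 hsq).1
    rw [Nat.mul_div_cancel_left _ hp.pos]
    refine ⟨hmul m hco, ?_⟩
    rw [Finset.mem_filter, mem_sieveModuli]
    refine ⟨⟨⟨Nat.pos_of_mul_pos_left hq1, le_trans (Nat.le_mul_of_pos_left _ hp.pos) hqR⟩,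
      (Nat.squarefree_mul_iff.1 hsq).2.2, fun p' hp' h => hpr p' hp' (h.mul_left _)⟩,
      (Nat.Prime.coprime_iff_not_dvd hp).1 hco⟩
  calc ∑ q ∈ (sieveModuli R z).filter (p ∣ ·), g q
      ≤ ∑ q ∈ (sieveModuli R z).filter (p ∣ ·), κ * g (q / p) :=
        Finset.sum_le_sum fun q hq => (h1 q hq).1
    _ = ∑ q ∈ ((sieveModuli R z).filter (p ∣ ·)).image (· / p), κ * g q := by
      rw [Finset.sum_image]
      intro a ha b hb hab
      rw [Finset.mem_coe, Finset.mem_filter] at ha hb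
      exact (Nat.div_left_inj ha.2 hb.2).1 hab
    _ ≤ ∑ q ∈ (sieveModuli R z).filter (¬ p ∣ ·), κ * g q := by
      refine Finset.sum_le_sum_of_subset_of_nonneg ?_ fun q _ _ => mul_nonneg hκ (hg q)
      intro q hq
      rw [Finset.mem_image] at hq
      obtain ⟨a, ha, rfl⟩ := hq
      exact (h1 a ha).2
    _ = _ := by rw [Finset.mul_sum]

lemma sum_fareyCoeff_sq_dvd_le {R z p : ℕ} (hp : p.Prime) :
    ∑ t ∈ (fareyPairs R z).filter (fun t => p ∣ t.1), fareyCoeff t ^ 2 ≤ sieveEnergy R z / p := by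
  have hpr : (0 : ℝ) < p := by exact_mod_cast hp.pos
  have h0 : ∑ t ∈ (fareyPairs R z).filter (fun t => p ∣ t.1), fareyCoeff t ^ 2 =
      ∑ q ∈ (sieveModuli R z).filter (p ∣ ·), (Nat.totient q : ℝ) / (q : ℝ) ^ 2 := by
    rw [Finset.sum_filter, sum_fareyPairs, Finset.sum_filter]
    refine Finset.sum_congr rfl fun q hq => ?_
    dsimp only
    split_ifs with h
    · have : ∀ a ∈ (Finset.range q).filter (Nat.Coprime · q),
          fareyCoeff (q, a) ^ 2 = 1 / (q : ℝ) ^ 2 := by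
        intro a ha
        rw [Finset.mem_filter, Finset.mem_range] at ha
        exact fareyCoeff_sq (mem_fareyPairs.2 ⟨hq, ha⟩)
      rw [Finset.sum_congr rfl this, Finset.sum_const, card_coprime_range, nsmul_eq_mul]; ring
    · simp
  rw [h0]
  refine (sum_moduli_dvd_le hp (κ := 1 / p) (fun q => by positivity) (by positivity) ?_).trans ?_
  · intro q hco
    rw [Nat.totient_mul hco, Nat.totient_prime hp]
    push_cast
    rw [mul_pow, mul_div_mul_comm]
    refine mul_le_mul_of_nonneg_right ?_ (by positivity)
    rw [div_le_div_iff₀ (by positivity) hpr]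
    have : ((p - 1 : ℕ) : ℝ) ≤ p := by exact_mod_cast Nat.sub_le _ _
    nlinarith
  · rw [div_mul_eq_mul_div, one_mul]
    gcongr
    exact Finset.sum_le_sum_of_subset_of_nonneg (Finset.filter_subset _ _) fun _ _ _ => by positivity

lemma sieveMass_le_succ (R z : ℕ) :
    sieveMass R z ≤ (if (z + 1).Prime then 1 + 1 / ((z + 1 : ℕ) : ℝ) else 1) *
      sieveMass R (z + 1) := by
  split_ifs with hp
  · have h1 := sum_moduli_dvd_le (R := R) (z := z) hp (g := fun q => 1 / (q : ℝ))
      (κ := 1 / ((z + 1 : ℕ) : ℝ)) (fun q => by positivity) (by positivity) (fun q _ => by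
        push_cast; rw [div_mul_div_comm, one_mul])
    have h2 : ∑ q ∈ (sieveModuli R z).filter (¬ (z + 1) ∣ ·), 1 / (q : ℝ) ≤
        sieveMass R (z + 1) := by
      refine Finset.sum_le_sum_of_subset_of_nonneg ?_ fun _ _ _ => by positivity
      intro q hq
      rw [Finset.mem_filter, mem_sieveModuli] at hq
      rw [mem_sieveModuli]
      refine ⟨hq.1.1, hq.1.2.1, fun p hp' hpq => ?_⟩
      refine lt_of_le_of_ne (hq.1.2.2 p hp' hpq) ?_
      rintro rfl
      exact hq.2 hpq
    have h3 := Finset.sum_filter_add_sum_filter_not (sieveModuli R z) (fun q => (z + 1) ∣ q)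
      fun q => 1 / (q : ℝ)
    rw [← sieveMass] at h3
    have h4 : 0 ≤ 1 / ((z + 1 : ℕ) : ℝ) := by positivity
    nlinarith
  · rw [one_mul]
    refine Finset.sum_le_sum_of_subset_of_nonneg ?_ fun _ _ _ => by positivity
    intro q hq
    rw [mem_sieveModuli] at hq ⊢
    refine ⟨hq.1, hq.2.1, fun p hp' hpq => ?_⟩
    refine lt_of_le_of_ne (hq.2.2 p hp' hpq) ?_
    rintro rfl
    exact hp hp'

lemma sum_Icc_inv_sq_le (R : ℕ) : ∑ m ∈ Finset.Icc 1 R, 1 / (m : ℝ) ^ 2 ≤ 2 := by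
  have h : ∀ n : ℕ, ∑ m ∈ Finset.Icc 1 (n + 1), 1 / (m : ℝ) ^ 2 ≤ 2 - 1 / ((n : ℝ) + 1) := by
    intro n
    induction n with
    | zero => norm_num
    | succ n ih =>
      rw [Finset.sum_Icc_succ_top (by omega)]
      have : 1 / ((n + 1 + 1 : ℕ) : ℝ) ^ 2 ≤ 1 / ((n : ℝ) + 1) - 1 / ((n : ℝ) + 1 + 1) := by
        push_cast
        rw [div_sub_div _ _ (by positivity) (by positivity),
          div_le_div_iff₀ (by positivity) (by positivity)]
        nlinarith
      push_cast at this ⊢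
      linarith
  rcases R with _ | n
  · simp
  · refine (h n).trans ?_
    have : 0 ≤ 1 / ((n : ℝ) + 1) := by positivity
    linarith

/-- The squarefree harmonic sum has logarithmic growth. -/
lemma log_le_sieveMass (R : ℕ) : Real.log R ≤ 2 * sieveMass R 0 := by
  have hsq : ∀ n : ℕ, ∃ x : ℕ × ℕ, 0 < n → 0 < x.1 ∧ 0 < x.2 ∧ x.2 ^ 2 * x.1 = n ∧
      Squarefree x.1 := by
    intro n
    rcases Nat.eq_zero_or_pos n with rfl | hn
    · exact ⟨(0, 0), fun h => absurd h (lt_irrefl _)⟩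
    · obtain ⟨a, b, h⟩ := Nat.sq_mul_squarefree_of_pos hn
      exact ⟨(a, b), fun _ => h⟩
  choose g hg using hsq
  have h1 : Real.log R ≤ ∑ n ∈ Finset.Icc 1 R, 1 / (n : ℝ) := by
    have h := log_add_one_le_harmonic R
    rw [harmonic_eq_sum_Icc] at h
    push_cast at h
    rcases Nat.eq_zero_or_pos R with rfl | hR
    · simp
    · have h2 : Real.log R ≤ Real.log (R + 1) := by
        apply Real.log_le_log
        · exact_mod_cast hR
        · linarith
      simp only [one_div]
      linarith
  have h2 : ∑ n ∈ Finset.Icc 1 R, 1 / (n : ℝ) ≤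
      ∑ x ∈ sieveModuli R 0 ×ˢ Finset.Icc 1 R, 1 / (x.1 : ℝ) * (1 / (x.2 : ℝ) ^ 2) := by
    have hinj : Set.InjOn g (Finset.Icc 1 R : Finset ℕ) := by
      intro a ha b hb hab
      rw [Finset.mem_coe, Finset.mem_Icc] at ha hb
      have h1 := (hg a ha.1).2.2.1
      have h2 := (hg b hb.1).2.2.1
      rw [← h1, ← h2, hab]
    calc ∑ n ∈ Finset.Icc 1 R, 1 / (n : ℝ)
        = ∑ n ∈ Finset.Icc 1 R, 1 / ((g n).1 : ℝ) * (1 / ((g n).2 : ℝ) ^ 2) := by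
          refine Finset.sum_congr rfl fun n hn => ?_
          rw [Finset.mem_Icc] at hn
          have h1 := (hg n hn.1).2.2.1
          conv_lhs => rw [← h1]
          push_cast
          rw [div_mul_div_comm, one_mul, mul_comm]
      _ = ∑ x ∈ (Finset.Icc 1 R).image g, 1 / (x.1 : ℝ) * (1 / (x.2 : ℝ) ^ 2) := by
          rw [Finset.sum_image hinj]
      _ ≤ _ := by
          refine Finset.sum_le_sum_of_subset_of_nonneg ?_ fun _ _ _ => by positivity
          intro x hx
          rw [Finset.mem_image] at hx
          obtain ⟨n, hn, rfl⟩ := hx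
          rw [Finset.mem_Icc] at hn
          obtain ⟨ha, hb, hab, hs⟩ := hg n hn.1
          rw [Finset.mem_product, mem_sieveModuli, Finset.mem_Icc]
          have ha' : (g n).1 ∣ n := ⟨_, by rw [mul_comm]; exact hab.symm⟩
          have hb' : (g n).2 ∣ n := (dvd_pow_self _ two_ne_zero).trans ⟨_, hab.symm⟩
          exact ⟨⟨⟨ha, (Nat.le_of_dvd hn.1 ha').trans hn.2⟩, hs, fun p hp _ => hp.pos⟩, hb,
            (Nat.le_of_dvd hn.1 hb').trans hn.2⟩
  rw [Finset.sum_product] at h2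
  dsimp only at h2
  rw [← Finset.sum_mul_sum] at h2
  have h3 := sum_Icc_inv_sq_le R
  have h4 : 0 ≤ sieveMass R 0 := Finset.sum_nonneg fun _ _ => by positivity
  change _ ≤ sieveMass R 0 * _ at h2
  nlinarith

lemma totient_primorial_mul_sieveMass_le (R w : ℕ) :
    (Nat.totient (primorial w) : ℝ) / primorial w * sieveMass R 0 ≤ sieveMass R w := by
  induction w with
  | zero =>
    have h0 : primorial 0 = 1 := rfl
    simp [h0]
  | succ w ih =>
    have h := sieveMass_le_succ R w
    split_ifs at h with hp
    · have hprim : primorial (w + 1) = (w + 1) * primorial w := by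
        unfold primorial
        rw [Finset.range_add_one, Finset.filter_insert, if_pos hp, Finset.prod_insert (by simp)]
      have hco : Nat.Coprime (w + 1) (primorial w) := by
        unfold primorial
        refine Nat.Coprime.prod_right fun p hp' => ?_
        rw [Finset.mem_filter, Finset.mem_range] at hp'
        exact (Nat.coprime_primes hp hp'.2).2 (by omega)
      rw [hprim, Nat.totient_mul hco, Nat.totient_prime hp, Nat.add_sub_cancel]
      have hP : (0 : ℝ) < primorial w := by exact_mod_cast primorial_pos w
      have hw : (0 : ℝ) < (w : ℝ) + 1 := by positivity
      push_cast at h ⊢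
      rw [mul_div_mul_comm, mul_assoc]
      have h5 : 0 ≤ sieveMass R (w + 1) := Finset.sum_nonneg fun _ _ => by positivity
      have h6 : (w : ℝ) / (w + 1) * (1 + 1 / (w + 1)) ≤ 1 := by
        rw [← sub_nonneg]
        have : 1 - (w : ℝ) / (w + 1) * (1 + 1 / (w + 1)) = 1 / (w + 1) ^ 2 := by
          field_simp; ring
        rw [this]; positivity
      calc (w : ℝ) / (w + 1) * (↑(primorial w).totient / ↑(primorial w) * sieveMass R 0)
          ≤ (w : ℝ) / (w + 1) * ((1 + 1 / (w + 1)) * sieveMass R (w + 1)) :=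
            mul_le_mul_of_nonneg_left (ih.trans h) (by positivity)
        _ = ((w : ℝ) / (w + 1) * (1 + 1 / (w + 1))) * sieveMass R (w + 1) := by ring
        _ ≤ 1 * sieveMass R (w + 1) := mul_le_mul_of_nonneg_right h6 h5
        _ = _ := one_mul _
    · have hprim : primorial (w + 1) = primorial w := by
        unfold primorial
        rw [Finset.range_add_one, Finset.filter_insert, if_neg hp]
      rw [hprim]
      linarith

lemma sieveMass_le_exp_mul (R y k : ℕ) :
    sieveMass R y ≤ Real.exp (∑ p ∈ (Finset.Ioc y (y + k)).filter Nat.Prime, 1 / (p : ℝ)) *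
      sieveMass R (y + k) := by
  induction k with
  | zero => simp
  | succ k ih =>
    have h := sieveMass_le_succ R (y + k)
    have hI : Finset.Ioc y (y + (k + 1)) = insert (y + k + 1) (Finset.Ioc y (y + k)) := by
      ext m; simp only [Finset.mem_Ioc, Finset.mem_insert]; omega
    have h5 : 0 ≤ sieveMass R (y + k + 1) := Finset.sum_nonneg fun _ _ => by positivity
    rw [hI, Finset.filter_insert, ← add_assoc]
    split_ifs at h ⊢ with hp
    · rw [Finset.sum_insert (by simp), Real.exp_add, mul_assoc, mul_left_comm]
      refine ih.trans ?_
      refine mul_le_mul_of_nonneg_left (h.trans ?_) (Real.exp_nonneg _)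
      refine mul_le_mul_of_nonneg_right ?_ h5
      rw [add_comm]
      exact Real.add_one_le_exp _
    · rw [one_mul] at h
      exact ih.trans (mul_le_mul_of_nonneg_left h (Real.exp_nonneg _))

lemma sum_inv_primes_dyadic_le {y : ℕ} (hy : Real.exp 80 ≤ y) :
    ∑ p ∈ (Finset.Ioc y (y + y)).filter Nat.Prime, 1 / (p : ℝ) ≤ Real.log 2 / 20 := by
  have hy0 : (0 : ℝ) < y := (Real.exp_pos _).trans_le hy
  have hlog : 80 ≤ Real.log y := (Real.le_log_iff_exp_le hy0).2 hy
  have h1 : ∑ p ∈ (Finset.Ioc y (y + y)).filter Nat.Prime, 1 / (p : ℝ) ≤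
      ∑ p ∈ (Finset.Ioc y (y + y)).filter Nat.Prime, Real.log p / (80 * y) := by
    refine Finset.sum_le_sum fun p hp => ?_
    rw [Finset.mem_filter, Finset.mem_Ioc] at hp
    have hp1 : (y : ℝ) ≤ p := by exact_mod_cast hp.1.1.le
    have hp0 : (0 : ℝ) < p := hy0.trans_le hp1
    have hl : Real.log y ≤ Real.log p := Real.log_le_log hy0 hp1
    rw [div_le_div_iff₀ hp0 (by positivity)]
    nlinarith
  have h2 : ∑ p ∈ (Finset.Ioc y (y + y)).filter Nat.Prime, Real.log p ≤
      Real.log 4 * ((y + y : ℕ) : ℝ) := by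
    refine le_trans ?_ (Chebyshev.theta_le_log4_mul_x (Nat.cast_nonneg _))
    unfold Chebyshev.theta
    rw [Nat.floor_natCast]
    refine Finset.sum_le_sum_of_subset_of_nonneg ?_ fun p _ _ => Real.log_natCast_nonneg p
    intro p hp
    rw [Finset.mem_filter, Finset.mem_Ioc] at hp ⊢
    exact ⟨⟨hp.2.pos, hp.1.2⟩, hp.2⟩
  rw [← Finset.sum_div] at h1
  refine h1.trans ?_
  have h4 : Real.log 4 = 2 * Real.log 2 := by
    rw [show (4 : ℝ) = 2 ^ 2 by norm_num, Real.log_pow]; norm_num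
  rw [div_le_div_iff₀ (by positivity) (by norm_num)]
  rw [h4] at h2
  push_cast at h2
  nlinarith

/-- Enlarging the sieving threshold loses little mass. -/
lemma sieveMass_le_mul_two_pow (R : ℕ) {w : ℕ} (hw : Real.exp 80 ≤ w) (i : ℕ) :
    sieveMass R w ≤ (2 : ℝ) ^ ((i : ℝ) / 20) * sieveMass R (w * 2 ^ i) := by
  induction i with
  | zero => simp
  | succ i ih =>
    have hy : Real.exp 80 ≤ ((w * 2 ^ i : ℕ) : ℝ) := by
      push_cast
      refine hw.trans (le_mul_of_one_le_right (Nat.cast_nonneg _) (one_le_pow₀ (by norm_num)))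
    have h := sieveMass_le_exp_mul R (w * 2 ^ i) (w * 2 ^ i)
    have h1 := sum_inv_primes_dyadic_le hy
    have h2 : w * 2 ^ (i + 1) = w * 2 ^ i + w * 2 ^ i := by ring
    rw [h2]
    have h5 : 0 ≤ sieveMass R (w * 2 ^ i + w * 2 ^ i) := Finset.sum_nonneg fun _ _ => by positivity
    refine ih.trans ?_
    rw [show (((i + 1 : ℕ) : ℝ) / 20) = (i : ℝ) / 20 + 1 / 20 by push_cast; ring,
      Real.rpow_add (by norm_num), mul_assoc]
    refine mul_le_mul_of_nonneg_left (h.trans ?_) (by positivity)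
    refine mul_le_mul_of_nonneg_right ?_ h5
    rw [Real.rpow_def_of_pos (by norm_num)]
    apply Real.exp_le_exp.2
    linarith

/-- The rational value of a Farey fraction. -/
def fareyRat (t : ℕ × ℕ) : ℚ := (t.2 : ℚ) / t.1

lemma fareyRat_cast (t : ℕ × ℕ) : ((fareyRat t : ℚ) : ℝ) = fareyVal t := by
  simp [fareyRat, fareyVal]

lemma pos_of_mem_fareyPairs {R z : ℕ} {t : ℕ × ℕ} (ht : t ∈ fareyPairs R z) : 0 < t.1 :=
  (mem_sieveModuli.1 (mem_fareyPairs.1 ht).1).1.1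

lemma fareyRat_den {R z : ℕ} {t : ℕ × ℕ} (ht : t ∈ fareyPairs R z) : (fareyRat t).den = t.1 := by
  have h := mem_fareyPairs.1 ht
  have h1 := Rat.den_div_eq_of_coprime (a := (t.2 : ℤ)) (b := (t.1 : ℤ))
    (by exact_mod_cast pos_of_mem_fareyPairs ht) (by simpa using h.2.2)
  have h2 : fareyRat t = ((t.2 : ℤ) : ℚ) / ((t.1 : ℤ) : ℚ) := by simp [fareyRat]
  rw [h2]; exact_mod_cast h1

lemma fareyRat_mem_Ico {R z : ℕ} {t : ℕ × ℕ} (ht : t ∈ fareyPairs R z) :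
    0 ≤ fareyRat t ∧ fareyRat t < 1 := by
  have h := mem_fareyPairs.1 ht
  have h1 : (0 : ℚ) < t.1 := by exact_mod_cast pos_of_mem_fareyPairs ht
  refine ⟨by unfold fareyRat; positivity, ?_⟩
  rw [fareyRat, div_lt_one h1]
  exact_mod_cast h.2.1

lemma eq_of_fareyRat_sub_eq_int {R z : ℕ} {t s : ℕ × ℕ} (ht : t ∈ fareyPairs R z)
    (hs : s ∈ fareyPairs R z) {k : ℤ} (h : fareyRat t - fareyRat s = k) : t = s := by
  have h1 := fareyRat_mem_Ico ht
  have h2 := fareyRat_mem_Ico hs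
  have hk : k = 0 := by
    have h3 : (k : ℚ) < 1 := by linarith
    have h4 : (-1 : ℚ) < k := by linarith
    have h3' : k < 1 := by exact_mod_cast h3
    have h4' : -1 < k := by exact_mod_cast h4
    omega
  rw [hk, Int.cast_zero, sub_eq_zero] at h
  have hd : t.1 = s.1 := by rw [← fareyRat_den ht, ← fareyRat_den hs, h]
  have hp : (s.1 : ℚ) ≠ 0 := by exact_mod_cast (pos_of_mem_fareyPairs hs).ne'
  unfold fareyRat at h
  rw [hd, div_left_inj' hp] at h
  exact Prod.ext hd (by exact_mod_cast h)

/-- A multiple of a rational with small denominator that is very close to an integer is one; the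
multiplier can be cancelled when it is coprime to the denominator. -/
lemma eq_int_of_near {W D : ℕ} (hD : 0 < D) (hco : Nat.Coprime W D) {r : ℚ} {k m : ℤ}
    (hr : r * D = k) (hm : |(W : ℝ) * (r : ℚ) - m| < 1 / D) : ∃ j : ℤ, r = j := by
  have hDr : (0 : ℝ) < D := by exact_mod_cast hD
  have hr' : ((r : ℚ) : ℝ) * D = k := by exact_mod_cast congrArg (fun x : ℚ => (x : ℝ)) hr
  have h1 : |((W : ℤ) * k - m * D : ℤ)| < 1 := by
    rw [lt_div_iff₀ hDr, ← abs_of_pos hDr, ← abs_mul] at hm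
    have : ((W : ℝ) * (r : ℚ) - m) * D = (((W : ℤ) * k - m * D : ℤ) : ℝ) := by
      push_cast; rw [← hr']; ring
    rw [this] at hm
    exact_mod_cast hm
  have h2 : (W : ℤ) * k - m * D = 0 := by rw [Int.abs_lt_one_iff] at h1; exact h1
  have h3 : (D : ℤ) ∣ W * k := ⟨m, by linarith⟩
  have h4 : (D : ℤ) ∣ k := by
    refine IsCoprime.dvd_of_dvd_mul_left ?_ h3
    exact Nat.isCoprime_iff_coprime.2 hco.symm
  obtain ⟨j, rfl⟩ := h4
  refine ⟨j, ?_⟩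
  have hDq : (D : ℚ) ≠ 0 := by exact_mod_cast hD.ne'
  apply mul_right_cancel₀ hDq
  rw [hr]; push_cast; ring

/-- Pairs of distinct Farey fractions whose shifted dilated difference is nearly an integer. -/
noncomputable def nearPairs (R z W : ℕ) (θ : ℝ) : Finset ((ℕ × ℕ) × (ℕ × ℕ)) :=
  (fareyPairs R z ×ˢ fareyPairs R z).filter fun x => x.1 ≠ x.2 ∧
    nd (θ + W * (fareyVal x.1 - fareyVal x.2)) * (2 * (R : ℝ) ^ 4) < 1

lemma coprime_of_mem_sieveModuli {R z W q : ℕ} (hW : ∀ p, p.Prime → p ∣ W → p ≤ z)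
    (hq : q ∈ sieveModuli R z) : Nat.Coprime W q := by
  rw [Nat.coprime_iff_gcd_eq_one]
  by_contra h
  obtain ⟨p, hp, hpd⟩ := Nat.exists_prime_and_dvd h
  have h1 := hW p hp (hpd.trans (Nat.gcd_dvd_left _ _))
  have h2 := (mem_sieveModuli.1 hq).2.2 p hp (hpd.trans (Nat.gcd_dvd_right _ _))
  omega

lemma sub_eq_int_of_mem_nearPairs {R z W : ℕ} (hW : ∀ p, p.Prime → p ∣ W → p ≤ z)
    {θ : ℝ} {x y : (ℕ × ℕ) × (ℕ × ℕ)} (hx : x ∈ nearPairs R z W θ) (hy : y ∈ nearPairs R z W θ) :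
    ∃ j : ℤ, (fareyRat x.1 - fareyRat x.2) - (fareyRat y.1 - fareyRat y.2) = j := by
  rw [nearPairs, Finset.mem_filter, Finset.mem_product] at hx hy
  obtain ⟨⟨hx1, hx2⟩, -, hx3⟩ := hx
  obtain ⟨⟨hy1, hy2⟩, -, hy3⟩ := hy
  have hR : ∀ t ∈ fareyPairs R z, t.1 ≤ R ∧ 0 < t.1 ∧ Nat.Coprime W t.1 := fun t ht =>
    ⟨(mem_sieveModuli.1 (mem_fareyPairs.1 ht).1).1.2, pos_of_mem_fareyPairs ht,
      coprime_of_mem_sieveModuli hW (mem_fareyPairs.1 ht).1⟩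
  obtain ⟨a1, a2, a3⟩ := hR _ hx1
  obtain ⟨b1, b2, b3⟩ := hR _ hx2
  obtain ⟨c1, c2, c3⟩ := hR _ hy1
  obtain ⟨d1, d2, d3⟩ := hR _ hy2
  have hRpos : (0 : ℝ) < R := by exact_mod_cast lt_of_lt_of_le a2 a1
  have hD : 0 < x.1.1 * x.2.1 * y.1.1 * y.2.1 := by positivity
  have hDle : x.1.1 * x.2.1 * y.1.1 * y.2.1 ≤ R ^ 4 := by
    calc x.1.1 * x.2.1 * y.1.1 * y.2.1 ≤ R * R * R * R := by gcongr
      _ = R ^ 4 := by ring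
  refine eq_int_of_near hD (((a3.mul_right b3).mul_right c3).mul_right d3)
    (k := x.1.2 * x.2.1 * y.1.1 * y.2.1 - x.2.2 * x.1.1 * y.1.1 * y.2.1 -
      y.1.2 * x.1.1 * x.2.1 * y.2.1 + y.2.2 * x.1.1 * x.2.1 * y.1.1)
    (m := round (θ + W * (fareyVal x.1 - fareyVal x.2)) -
      round (θ + W * (fareyVal y.1 - fareyVal y.2))) ?_ ?_
  · have a4 : (x.1.1 : ℚ) ≠ 0 := by exact_mod_cast a2.ne'
    have b4 : (x.2.1 : ℚ) ≠ 0 := by exact_mod_cast b2.ne'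
    have c4 : (y.1.1 : ℚ) ≠ 0 := by exact_mod_cast c2.ne'
    have d4 : (y.2.1 : ℚ) ≠ 0 := by exact_mod_cast d2.ne'
    simp only [fareyRat]
    push_cast
    field_simp
    ring
  · push_cast
    rw [fareyRat_cast, fareyRat_cast, fareyRat_cast, fareyRat_cast]
    have hle : 1 / (R : ℝ) ^ 4 ≤ 1 / ((x.1.1 * x.2.1 * y.1.1 * y.2.1 : ℕ) : ℝ) := by
      apply one_div_le_one_div_of_le (by exact_mod_cast hD)
      exact_mod_cast hDle
    push_cast at hle
    refine lt_of_lt_of_le ?_ hle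
    rw [← lt_div_iff₀ (by positivity)] at hx3 hy3
    unfold nd at hx3 hy3
    have htri := abs_sub (θ + W * (fareyVal x.1 - fareyVal x.2) -
      round (θ + W * (fareyVal x.1 - fareyVal x.2))) (θ + W * (fareyVal y.1 - fareyVal y.2) -
      round (θ + W * (fareyVal y.1 - fareyVal y.2)))
    have hsum : 1 / (2 * (R : ℝ) ^ 4) + 1 / (2 * (R : ℝ) ^ 4) = 1 / (R : ℝ) ^ 4 := by
      field_simp; norm_num
    refine lt_of_le_of_lt (le_of_eq_of_le ?_ htri) (by linarith)
    congr 1; ring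

lemma sum_le_of_injOn_fareyPairs {R z p : ℕ} (hp : p.Prime) (hz : z < p) (hz0 : 0 < z)
    {E : Finset ((ℕ × ℕ) × (ℕ × ℕ))} {f g : (ℕ × ℕ) × (ℕ × ℕ) → ℕ × ℕ}
    (hf : ∀ x ∈ E, f x ∈ fareyPairs R z ∧ p ∣ (f x).1) (hg : ∀ x ∈ E, g x ∈ fareyPairs R z)
    (hfi : Set.InjOn f E) (hgi : Set.InjOn g E) :
    ∑ x ∈ E, |fareyCoeff (f x)| * |fareyCoeff (g x)| ≤ sieveEnergy R z / √z := by
  have hE := sieveEnergy_nonneg R z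
  have h1 : ∑ x ∈ E, |fareyCoeff (f x)| ^ 2 ≤ sieveEnergy R z / p := by
    refine le_trans ?_ (sum_fareyCoeff_sq_dvd_le (R := R) (z := z) hp)
    simp only [sq_abs]
    rw [← Finset.sum_image (f := fun t => fareyCoeff t ^ 2) hfi]
    refine Finset.sum_le_sum_of_subset_of_nonneg ?_ fun _ _ _ => sq_nonneg _
    intro t ht
    rw [Finset.mem_image] at ht
    obtain ⟨x, hx, rfl⟩ := ht
    exact Finset.mem_filter.2 (hf x hx)
  have h2 : ∑ x ∈ E, |fareyCoeff (g x)| ^ 2 ≤ sieveEnergy R z := by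
    rw [← sum_fareyCoeff_sq]
    simp only [sq_abs]
    rw [← Finset.sum_image (f := fun t => fareyCoeff t ^ 2) hgi]
    refine Finset.sum_le_sum_of_subset_of_nonneg ?_ fun _ _ _ => sq_nonneg _
    intro t ht
    rw [Finset.mem_image] at ht
    obtain ⟨x, hx, rfl⟩ := ht
    exact hg x hx
  have hzr : (0 : ℝ) < z := by exact_mod_cast hz0
  have hzp : (z : ℝ) ≤ p := by exact_mod_cast hz.le
  calc ∑ x ∈ E, |fareyCoeff (f x)| * |fareyCoeff (g x)|
      ≤ √(∑ x ∈ E, |fareyCoeff (f x)| ^ 2) * √(∑ x ∈ E, |fareyCoeff (g x)| ^ 2) :=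
        Real.sum_mul_le_sqrt_mul_sqrt _ _ _
    _ ≤ √(sieveEnergy R z / z) * √(sieveEnergy R z) := by
        refine mul_le_mul (Real.sqrt_le_sqrt (h1.trans ?_)) (Real.sqrt_le_sqrt h2)
          (Real.sqrt_nonneg _) (Real.sqrt_nonneg _)
        exact div_le_div_of_nonneg_left hE hzr hzp
    _ = sieveEnergy R z / √z := by
        rw [Real.sqrt_div hE, div_mul_eq_mul_div, Real.mul_self_sqrt hE]

/-- The total coefficient of near-resonant pairs is small. -/
lemma sum_nearPairs_le {R z W : ℕ} (hz0 : 0 < z) (hW : ∀ p, p.Prime → p ∣ W → p ≤ z) (θ : ℝ) :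
    ∑ x ∈ nearPairs R z W θ, |fareyCoeff x.1| * |fareyCoeff x.2| ≤
      2 * (sieveEnergy R z / √z) := by
  rcases (nearPairs R z W θ).eq_empty_or_nonempty with h0 | ⟨s, hs⟩
  · rw [h0, Finset.sum_empty]
    have := sieveEnergy_nonneg R z
    positivity
  have hmem : ∀ x ∈ nearPairs R z W θ, x.1 ∈ fareyPairs R z ∧ x.2 ∈ fareyPairs R z ∧ x.1 ≠ x.2 := by
    intro x hx
    rw [nearPairs, Finset.mem_filter, Finset.mem_product] at hx
    exact ⟨hx.1.1, hx.1.2, hx.2.1⟩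
  have hi1 : Set.InjOn Prod.fst (nearPairs R z W θ : Set ((ℕ × ℕ) × (ℕ × ℕ))) := by
    intro x hx y hy hxy
    obtain ⟨j, hj⟩ := sub_eq_int_of_mem_nearPairs hW hx hy
    refine Prod.ext hxy (eq_of_fareyRat_sub_eq_int (hmem x hx).2.1 (hmem y hy).2.1 (k := -j) ?_)
    rw [hxy] at hj; push_cast; linarith
  have hi2 : Set.InjOn Prod.snd (nearPairs R z W θ : Set ((ℕ × ℕ) × (ℕ × ℕ))) := by
    intro x hx y hy hxy
    obtain ⟨j, hj⟩ := sub_eq_int_of_mem_nearPairs hW hx hy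
    refine Prod.ext (eq_of_fareyRat_sub_eq_int (hmem x hx).1 (hmem y hy).1 (k := j) ?_) hxy
    rw [hxy] at hj; linarith
  set r := fareyRat s.1 - fareyRat s.2 with hr
  have hden : r.den ≠ 1 := by
    intro h1
    have h2 : r = (r.num : ℤ) := (Rat.den_eq_one_iff r).1 h1 |>.symm
    exact (hmem s hs).2.2 (eq_of_fareyRat_sub_eq_int (hmem s hs).1 (hmem s hs).2.1 h2)
  set p := r.den.minFac with hp
  have hpp : p.Prime := Nat.minFac_prime hden
  have hdvd : ∀ x ∈ nearPairs R z W θ, p ∣ x.1.1 ∨ p ∣ x.2.1 := by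
    intro x hx
    obtain ⟨j, hj⟩ := sub_eq_int_of_mem_nearPairs hW hx hs
    have h1 : fareyRat x.1 - fareyRat x.2 = r + (j : ℤ) := by rw [hr]; linarith
    have h2 := Rat.sub_den_dvd (fareyRat x.1) (fareyRat x.2)
    rw [h1, Rat.add_intCast_den, fareyRat_den (hmem x hx).1, fareyRat_den (hmem x hx).2.1] at h2
    exact (Nat.Prime.dvd_mul hpp).1 ((Nat.minFac_dvd _).trans h2)
  have hzp : z < p := by
    rcases hdvd s hs with h | h
    · exact (mem_sieveModuli.1 (mem_fareyPairs.1 (hmem s hs).1).1).2.2 p hpp h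
    · exact (mem_sieveModuli.1 (mem_fareyPairs.1 (hmem s hs).2.1).1).2.2 p hpp h
  have h1 := sum_le_of_injOn_fareyPairs (R := R) hpp hzp hz0
    (E := (nearPairs R z W θ).filter fun x => p ∣ x.1.1) (f := Prod.fst) (g := Prod.snd)
    (fun x hx => ⟨(hmem x (Finset.mem_filter.1 hx).1).1, (Finset.mem_filter.1 hx).2⟩)
    (fun x hx => (hmem x (Finset.mem_filter.1 hx).1).2.1)
    (hi1.mono fun x hx => (Finset.mem_filter.1 hx).1)
    (hi2.mono fun x hx => (Finset.mem_filter.1 hx).1)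
  have h2 := sum_le_of_injOn_fareyPairs (R := R) hpp hzp hz0
    (E := (nearPairs R z W θ).filter fun x => ¬ p ∣ x.1.1) (f := Prod.snd) (g := Prod.fst)
    (fun x hx => ⟨(hmem x (Finset.mem_filter.1 hx).1).2.1,
      (hdvd x (Finset.mem_filter.1 hx).1).resolve_left (Finset.mem_filter.1 hx).2⟩)
    (fun x hx => (hmem x (Finset.mem_filter.1 hx).1).1)
    (hi2.mono fun x hx => (Finset.mem_filter.1 hx).1)
    (hi1.mono fun x hx => (Finset.mem_filter.1 hx).1)
  rw [← Finset.sum_filter_add_sum_filter_not (nearPairs R z W θ) (fun x => p ∣ x.1.1)]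
  simp only [mul_comm |fareyCoeff (Prod.snd _)|] at h2
  linarith

lemma card_pairFreq_eq_zero (J : ℕ) :
    ((Finset.range J ×ˢ Finset.range J).filter fun p => pairFreq p = 0).card = J := by
  have : (Finset.range J ×ˢ Finset.range J).filter (fun p => pairFreq p = 0) =
      (Finset.range J).image fun k => (k, k) := by
    ext p
    rw [Finset.mem_filter, Finset.mem_product, Finset.mem_range, Finset.mem_range, Finset.mem_image]
    constructor
    · rintro ⟨⟨h1, h2⟩, h3⟩
      unfold pairFreq at h3
      refine ⟨p.1, Finset.mem_range.2 h1, Prod.ext rfl (by dsimp only; omega)⟩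
    · rintro ⟨k, hk, rfl⟩
      exact ⟨⟨Finset.mem_range.1 hk, Finset.mem_range.1 hk⟩, by simp [pairFreq]⟩
  rw [this, Finset.card_image_of_injective _ fun a b h => (Prod.ext_iff.1 h).1, Finset.card_range]

/-- Replacing the Fejér weight by its mean in an exponential sum. -/
lemma norm_sum_fejer_sub_le {J : ℕ} (hJ : 1 ≤ J) (S : Finset ℕ) (x : ℕ → ℝ) {V : ℝ} (hV0 : 0 ≤ V)
    (ϑ : ℝ) (hV : ∀ f : ℤ, f ≠ 0 → |f| < J → ‖∑ n ∈ S, e (n * ϑ + f * x n)‖ ≤ V) :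
    ‖∑ n ∈ S, ((J * fejer J (x n) : ℝ) : ℂ) * e (n * ϑ) - ∑ n ∈ S, e (n * ϑ)‖ ≤ J * V := by
  have hJr : (0 : ℝ) < J := by exact_mod_cast hJ
  have hJc : (J : ℂ) ≠ 0 := by exact_mod_cast hJr.ne'
  set P := Finset.range J ×ˢ Finset.range J with hP
  have h1 : ∑ n ∈ S, ((J * fejer J (x n) : ℝ) : ℂ) * e (n * ϑ) =
      (∑ p ∈ P, ∑ n ∈ S, e (n * ϑ + (pairFreq p : ℤ) * x n)) / J := by
    rw [Finset.sum_comm, Finset.sum_div]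
    refine Finset.sum_congr rfl fun n _ => ?_
    rw [Complex.ofReal_mul, ofReal_fejer, Complex.ofReal_natCast]
    simp only [e_add]
    rw [← Finset.mul_sum]
    generalize (∑ p ∈ P, e ((pairFreq p : ℤ) * x n)) = A
    generalize e (n * ϑ) = B
    field_simp
  have h2 : ∑ p ∈ P.filter (fun p => pairFreq p = 0),
      ∑ n ∈ S, e (n * ϑ + (pairFreq p : ℤ) * x n) = J * ∑ n ∈ S, e (n * ϑ) := by
    rw [Finset.sum_congr rfl (g := fun _ => ∑ n ∈ S, e (n * ϑ)), Finset.sum_const,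
      card_pairFreq_eq_zero, nsmul_eq_mul]
    intro p hp
    rw [(Finset.mem_filter.1 hp).2]
    simp
  have h3 : ‖∑ p ∈ P.filter (fun p => ¬ pairFreq p = 0),
      ∑ n ∈ S, e (n * ϑ + (pairFreq p : ℤ) * x n)‖ ≤ (J : ℝ) ^ 2 * V := by
    have hb : ∀ p ∈ P.filter (fun p => ¬ pairFreq p = 0),
          ‖∑ n ∈ S, e (n * ϑ + (pairFreq p : ℤ) * x n)‖ ≤ V := fun p hp =>
        hV _ (Finset.mem_filter.1 hp).2 (abs_pairFreq_lt (Finset.mem_filter.1 hp).1)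
    refine (norm_sum_le_of_le _ hb).trans ?_
    rw [Finset.sum_const, nsmul_eq_mul]
    refine mul_le_mul_of_nonneg_right ?_ hV0
    have := Finset.card_filter_le P fun p => ¬ pairFreq p = 0
    rw [hP, Finset.card_product, Finset.card_range, ← sq] at this
    exact_mod_cast this
  rw [h1, ← Finset.sum_filter_add_sum_filter_not P (fun p => pairFreq p = 0), h2, add_div,
    mul_div_cancel_left₀ _ hJc, add_sub_cancel_left, norm_div, Complex.norm_natCast,
    div_le_iff₀ hJr]
  refine h3.trans (le_of_eq ?_)
  ring

lemma normSq_sieveWeight (R z m : ℕ) : ((‖sieveWeight R z m‖ ^ 2 : ℝ) : ℂ) =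
    ∑ x ∈ fareyPairs R z ×ˢ fareyPairs R z,
      ((fareyCoeff x.1 * fareyCoeff x.2 : ℝ) : ℂ) * e (m * (fareyVal x.1 - fareyVal x.2)) := by
  rw [Complex.ofReal_pow, ← Complex.mul_conj', sieveWeight, map_sum, Finset.sum_mul_sum,
    Finset.sum_product]
  refine Finset.sum_congr rfl fun t _ => Finset.sum_congr rfl fun s _ => ?_
  rw [map_mul (starRingEnd ℂ), conj_e, Complex.conj_ofReal, mul_sub, sub_eq_add_neg, e_add]
  push_cast; ring

lemma norm_geom_sum_le (ϑ : ℝ) (lo hi : ℕ) :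
    ‖∑ n ∈ Finset.Ico lo hi, e (n * ϑ)‖ ≤ (hi - lo : ℕ) := by
  refine (norm_sum_le _ _).trans ?_
  simp

/-- Fourier transform of the squared sieve weight times the Fejér weight. -/
theorem norm_sum_sieve_fejer_sub_le {R z W b J lo hi : ℕ} (hz0 : 0 < z)
    (hW : ∀ p, p.Prime → p ∣ W → p ≤ z) (hJ : 1 ≤ J) (x : ℕ → ℝ) {V : ℝ} (hV0 : 0 ≤ V)
    (hV : ∀ (ϑ : ℝ) (f : ℤ), f ≠ 0 → |f| < J →
      ‖∑ n ∈ Finset.Ico lo hi, e (n * ϑ + f * x n)‖ ≤ V) (θ : ℝ) :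
    ‖∑ n ∈ Finset.Ico lo hi,
        ((‖sieveWeight R z (W * n + b)‖ ^ 2 * (J * fejer J (x n)) : ℝ) : ℂ) * e (n * θ) -
      (sieveEnergy R z : ℂ) * ∑ n ∈ Finset.Ico lo hi, e (n * θ)‖ ≤
      2 * (sieveEnergy R z / √z) * (hi - lo : ℕ) + (R : ℝ) ^ 8 + (R : ℝ) ^ 4 * (J * V) := by
  set S := Finset.Ico lo hi with hS
  set T2 := fareyPairs R z ×ˢ fareyPairs R z with hT2
  set δ : (ℕ × ℕ) × (ℕ × ℕ) → ℝ := fun x => fareyVal x.1 - fareyVal x.2 with hδ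
  set G : ℝ → ℂ := fun ϑ => ∑ n ∈ S, ((J * fejer J (x n) : ℝ) : ℂ) * e (n * ϑ) with hG
  set L : ℝ → ℂ := fun ϑ => ∑ n ∈ S, e (n * ϑ) with hL
  set c : (ℕ × ℕ) × (ℕ × ℕ) → ℝ := fun x => fareyCoeff x.1 * fareyCoeff x.2 with hc
  have hcard : (T2.card : ℝ) ≤ (R : ℝ) ^ 4 := by
    have h1 := card_fareyPairs_le R z
    have h2 : T2.card ≤ R ^ 4 := by
      rw [hT2, Finset.card_product]
      calc _ ≤ R ^ 2 * R ^ 2 := Nat.mul_le_mul h1 h1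
        _ = R ^ 4 := by ring
    exact_mod_cast h2
  have hc1 : ∀ y ∈ T2, |c y| ≤ 1 := by
    intro y hy
    rw [hT2, Finset.mem_product] at hy
    rw [hc]; dsimp only
    rw [abs_mul]
    exact mul_le_one₀ (abs_fareyCoeff_le_one hy.1) (abs_nonneg _) (abs_fareyCoeff_le_one hy.2)
  have h1 : ∑ n ∈ S, ((‖sieveWeight R z (W * n + b)‖ ^ 2 * (J * fejer J (x n)) : ℝ) : ℂ) *
      e (n * θ) = ∑ y ∈ T2, ((c y : ℂ) * e (b * δ y)) * G (θ + W * δ y) := by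
    simp only [hG, Finset.mul_sum]
    rw [Finset.sum_comm]
    refine Finset.sum_congr rfl fun n _ => ?_
    rw [Complex.ofReal_mul, normSq_sieveWeight, Finset.sum_mul, Finset.sum_mul]
    refine Finset.sum_congr rfl fun y _ => ?_
    have h2 : e (((W * n + b : ℕ) : ℝ) * (fareyVal y.1 - fareyVal y.2)) * e (n * θ) =
        e (b * δ y) * e (n * (θ + W * δ y)) := by
      rw [← e_add, ← e_add]
      congr 1
      rw [hδ]; push_cast; ring
    calc _ = (c y : ℂ) * ((J * fejer J (x n) : ℝ) : ℂ) *
          (e (((W * n + b : ℕ) : ℝ) * (fareyVal y.1 - fareyVal y.2)) * e (n * θ)) := by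
          rw [hc]; ring
      _ = _ := by rw [h2]; ring
  have h2 : ‖∑ y ∈ T2, ((c y : ℂ) * e (b * δ y)) * G (θ + W * δ y) -
      ∑ y ∈ T2, ((c y : ℂ) * e (b * δ y)) * L (θ + W * δ y)‖ ≤ (R : ℝ) ^ 4 * (J * V) := by
    rw [← Finset.sum_sub_distrib]
    refine (norm_sum_le_of_le (f := fun y => _) T2 (n := fun _ => (J * V : ℝ)) fun y hy => ?_).trans ?_
    · rw [← mul_sub, norm_mul, norm_mul, norm_e, mul_one, Complex.norm_real, Real.norm_eq_abs]
      have h3 := norm_sum_fejer_sub_le hJ S x hV0 (θ + W * δ y) (fun f hf hf' => hV _ f hf hf')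
      have h4 := hc1 y hy
      calc |c y| * ‖G (θ + W * δ y) - L (θ + W * δ y)‖ ≤ 1 * (J * V) :=
            mul_le_mul h4 h3 (norm_nonneg _) zero_le_one
        _ = J * V := one_mul _
    · rw [Finset.sum_const, nsmul_eq_mul]
      exact mul_le_mul_of_nonneg_right hcard (by positivity)
  have hdiag : ∑ y ∈ T2.filter (fun y => y.1 = y.2), ((c y : ℂ) * e (b * δ y)) * L (θ + W * δ y) =
      (sieveEnergy R z : ℂ) * L θ := by
    rw [← sum_fareyCoeff_sq, Complex.ofReal_sum, Finset.sum_mul]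
    refine Finset.sum_bij' (fun y _ => y.1) (fun t _ => (t, t)) ?_ ?_ ?_ ?_ ?_
    · intro y hy
      rw [Finset.mem_filter, hT2, Finset.mem_product] at hy; exact hy.1.1
    · intro t ht
      rw [Finset.mem_filter, hT2, Finset.mem_product]; exact ⟨⟨ht, ht⟩, rfl⟩
    · intro y hy
      exact Prod.ext rfl (Finset.mem_filter.1 hy).2
    · intro t _; rfl
    · intro y hy
      have h0 := (Finset.mem_filter.1 hy).2
      simp only [hc, hδ, ← h0, sub_self, mul_zero, e_zero, mul_one, add_zero]
      push_cast; ring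
  have hnear : ‖∑ y ∈ nearPairs R z W θ, ((c y : ℂ) * e (b * δ y)) * L (θ + W * δ y)‖ ≤
      2 * (sieveEnergy R z / √z) * (hi - lo : ℕ) := by
    refine (norm_sum_le_of_le _ (n := fun y => |fareyCoeff y.1| * |fareyCoeff y.2| *
      ((hi - lo : ℕ) : ℝ)) fun y _ => ?_).trans ?_
    · rw [norm_mul, norm_mul, norm_e, mul_one, Complex.norm_real, Real.norm_eq_abs, hc, abs_mul]
      exact mul_le_mul_of_nonneg_left (norm_geom_sum_le _ _ _) (by positivity)
    · rw [← Finset.sum_mul]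
      exact mul_le_mul_of_nonneg_right (sum_nearPairs_le hz0 hW θ) (Nat.cast_nonneg _)
  set F := T2.filter (fun y => y.1 ≠ y.2 ∧ ¬ nd (θ + W * δ y) * (2 * (R : ℝ) ^ 4) < 1) with hF
  have hfar : ‖∑ y ∈ F, ((c y : ℂ) * e (b * δ y)) * L (θ + W * δ y)‖ ≤ (R : ℝ) ^ 8 := by
    refine (norm_sum_le_of_le _ (n := fun y => (R : ℝ) ^ 4) fun y hy => ?_).trans ?_
    · rw [hF, Finset.mem_filter] at hy
      rw [norm_mul, norm_mul, norm_e, mul_one, Complex.norm_real, Real.norm_eq_abs]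
      have h3 := norm_geom_sum_mul_le (θ + W * δ y) lo hi
      have h4 : 1 ≤ nd (θ + W * δ y) * (2 * (R : ℝ) ^ 4) := not_lt.1 hy.2.2
      have h5 := hc1 y hy.1
      have h6 : ‖L (θ + W * δ y)‖ ≤ (R : ℝ) ^ 4 := by
        calc ‖L (θ + W * δ y)‖ ≤ ‖L (θ + W * δ y)‖ * (nd (θ + W * δ y) * (2 * (R : ℝ) ^ 4)) :=
              le_mul_of_one_le_right (norm_nonneg _) h4
          _ = ‖L (θ + W * δ y)‖ * (2 * nd (θ + W * δ y)) * (R : ℝ) ^ 4 := by ring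
          _ ≤ 1 * (R : ℝ) ^ 4 := mul_le_mul_of_nonneg_right h3 (by positivity)
          _ = _ := one_mul _
      calc |c y| * ‖L (θ + W * δ y)‖ ≤ 1 * (R : ℝ) ^ 4 :=
            mul_le_mul h5 h6 (norm_nonneg _) zero_le_one
        _ = _ := one_mul _
    · rw [Finset.sum_const, nsmul_eq_mul]
      have : (F.card : ℝ) ≤ (R : ℝ) ^ 4 :=
        le_trans (Nat.cast_le.2 (Finset.card_filter_le _ _)) hcard
      calc (F.card : ℝ) * (R : ℝ) ^ 4 ≤ (R : ℝ) ^ 4 * (R : ℝ) ^ 4 :=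
            mul_le_mul_of_nonneg_right this (by positivity)
        _ = _ := by ring
  have hsplit : ∑ y ∈ T2, ((c y : ℂ) * e (b * δ y)) * L (θ + W * δ y) =
      (sieveEnergy R z : ℂ) * L θ +
      (∑ y ∈ nearPairs R z W θ, ((c y : ℂ) * e (b * δ y)) * L (θ + W * δ y) +
        ∑ y ∈ F, ((c y : ℂ) * e (b * δ y)) * L (θ + W * δ y)) := by
    rw [← hdiag, ← Finset.sum_filter_add_sum_filter_not T2 (fun y => y.1 = y.2)]
    congr 1
    rw [← Finset.sum_filter_add_sum_filter_not (T2.filter (fun y => ¬ y.1 = y.2))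
      (fun y => nd (θ + W * δ y) * (2 * (R : ℝ) ^ 4) < 1), Finset.filter_filter,
      Finset.filter_filter]
    rfl
  rw [h1]
  rw [hsplit] at h2
  calc _ = ‖(∑ y ∈ T2, ((c y : ℂ) * e (b * δ y)) * G (θ + W * δ y) -
        ((sieveEnergy R z : ℂ) * L θ +
        (∑ y ∈ nearPairs R z W θ, ((c y : ℂ) * e (b * δ y)) * L (θ + W * δ y) +
        ∑ y ∈ F, ((c y : ℂ) * e (b * δ y)) * L (θ + W * δ y)))) +
        (∑ y ∈ nearPairs R z W θ, ((c y : ℂ) * e (b * δ y)) * L (θ + W * δ y) +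
        ∑ y ∈ F, ((c y : ℂ) * e (b * δ y)) * L (θ + W * δ y))‖ := by
          congr 1; ring
    _ ≤ _ := by
      refine (norm_add_le _ _).trans ?_
      have := norm_add_le (∑ y ∈ nearPairs R z W θ, ((c y : ℂ) * e (b * δ y)) * L (θ + W * δ y))
        (∑ y ∈ F, ((c y : ℂ) * e (b * δ y)) * L (θ + W * δ y))
      linarith

/-- The function on `ZMod M` agreeing with `g` on `S` and vanishing elsewhere. -/
noncomputable def zmodLift (M : ℕ) (S : Finset ℕ) (g : ℕ → ℝ) (y : ZMod M) : ℝ :=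
  if y.val ∈ S then g y.val else 0

lemma sum_zmod_val {β : Type*} [AddCommMonoid β] {M : ℕ} [NeZero M] {S : Finset ℕ}
    (hS : ∀ n ∈ S, n < M) (h : ℕ → β) :
    ∑ y : ZMod M, (if y.val ∈ S then h y.val else 0) = ∑ n ∈ S, h n := by
  rw [← Finset.sum_filter]
  refine Finset.sum_bij' (fun y _ => y.val) (fun n _ => (n : ZMod M)) ?_ ?_ ?_ ?_ ?_
  · intro y hy; exact (Finset.mem_filter.1 hy).2
  · intro n hn
    rw [Finset.mem_filter, ZMod.val_natCast_of_lt (hS n hn)]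
    exact ⟨Finset.mem_univ _, hn⟩
  · intro y _; exact ZMod.natCast_zmod_val y
  · intro n hn; exact ZMod.val_natCast_of_lt (hS n hn)
  · intro y _; rfl

lemma sum_zmodLift {M : ℕ} [NeZero M] {S : Finset ℕ} (hS : ∀ n ∈ S, n < M) (g : ℕ → ℝ) :
    ∑ y, zmodLift M S g y = ∑ n ∈ S, g n := sum_zmod_val hS g

lemma ft_zmodLift {M : ℕ} [NeZero M] {S : Finset ℕ} (hS : ∀ n ∈ S, n < M) (g : ℕ → ℝ)
    (r : ZMod M) :
    ft (zmodLift M S g) r = ∑ n ∈ S, (g n : ℂ) * e (n * ((r.val : ℝ) / M)) := by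
  rw [← sum_zmod_val hS]
  unfold ft zmodLift
  refine Finset.sum_congr rfl fun y _ => ?_
  split_ifs with h
  · congr 1
    have h1 : r * y = ((r.val * y.val : ℤ) : ZMod M) := by simp
    rw [h1, ZMod.stdAddChar_coe, e]
    congr 1
    push_cast; ring
  · simp

/-- The normalised majorant built from the sieve weight and the Fejér weight. -/
noncomputable def majorant (R w z W b J : ℕ) (x : ℕ → ℝ) (n : ℕ) : ℝ :=
  sieveMass R w / sieveMass R z ^ 2 *
    (‖sieveWeight R z (W * n + b)‖ ^ 2 * (J * fejer J (x n)))

/-- The mean value of the majorant. -/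
noncomputable def majorantMean (R w z : ℕ) : ℝ :=
  sieveMass R w / sieveMass R z ^ 2 * sieveEnergy R z

lemma majorantMean_nonneg (R w z : ℕ) : 0 ≤ majorantMean R w z := by
  have h1 := sieveEnergy_nonneg R z
  have h2 : 0 ≤ sieveMass R w := Finset.sum_nonneg fun _ _ => by positivity
  unfold majorantMean
  positivity

lemma majorantMean_le {R w z : ℕ} (hR : 1 ≤ R) :
    majorantMean R w z ≤ sieveMass R w / sieveMass R z := by
  have h1 := one_le_sieveMass hR z
  have h2 := one_le_sieveMass hR w
  have h3 := sieveEnergy_le_sieveMass R z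
  unfold majorantMean
  calc sieveMass R w / sieveMass R z ^ 2 * sieveEnergy R z
      ≤ sieveMass R w / sieveMass R z ^ 2 * sieveMass R z :=
        mul_le_mul_of_nonneg_left h3 (by positivity)
    _ = _ := by field_simp

lemma majorant_nonneg (R w z W b J : ℕ) (x : ℕ → ℝ) (n : ℕ) : 0 ≤ majorant R w z W b J x n := by
  have h2 : 0 ≤ sieveMass R w := Finset.sum_nonneg fun _ _ => by positivity
  have h3 := fejer_nonneg J (x n)
  unfold majorant
  positivity

lemma norm_ft_majorant_sub_le {R w z W b J lo hi M : ℕ} [NeZero M] (hR : 1 ≤ R) (hz0 : 0 < z)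
    (hW : ∀ p, p.Prime → p ∣ W → p ≤ z) (hJ : 1 ≤ J) (hM : 2 * hi < M)
    (x : ℕ → ℝ) {V : ℝ} (hV0 : 0 ≤ V)
    (hV : ∀ (ϑ : ℝ) (f : ℤ), f ≠ 0 → |f| < J →
      ‖∑ n ∈ Finset.Ico lo hi, e (n * ϑ + f * x n)‖ ≤ V) (r : ZMod M) :
    ‖ft (zmodLift M (Finset.Ico lo hi) (majorant R w z W b J x)) r -
      ft (zmodLift M (Finset.Ico lo hi) fun _ => majorantMean R w z) r‖ ≤
    (majorantMean R w z / √z + ((R : ℝ) ^ 9 + (R : ℝ) ^ 5 * (J * V)) / M) * M := by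
  have hS : ∀ n ∈ Finset.Ico lo hi, n < M := fun n hn => by
    have := (Finset.mem_Ico.1 hn).2; omega
  have hMr : (0 : ℝ) < M := by exact_mod_cast Nat.pos_of_ne_zero (NeZero.ne M)
  rw [ft_zmodLift hS, ft_zmodLift hS]
  have h := norm_sum_sieve_fejer_sub_le (R := R) (b := b) hz0 hW hJ x hV0 hV ((r.val : ℝ) / M)
  set θ := (r.val : ℝ) / M with hθ
  set C := sieveMass R w / sieveMass R z ^ 2 with hC
  have h1 := one_le_sieveMass hR z
  have h2 := one_le_sieveMass hR w
  have h3 := sieveMass_le R w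
  have hC0 : 0 ≤ C := by positivity
  have hCR : C ≤ R := by
    rw [hC]
    refine (div_le_self (by linarith) (one_le_pow₀ h1)).trans h3
  have e1 : ∑ n ∈ Finset.Ico lo hi, ((majorant R w z W b J x n : ℝ) : ℂ) * e (n * θ) -
      ∑ n ∈ Finset.Ico lo hi, ((majorantMean R w z : ℝ) : ℂ) * e (n * θ) =
      (C : ℂ) * (∑ n ∈ Finset.Ico lo hi,
        ((‖sieveWeight R z (W * n + b)‖ ^ 2 * (J * fejer J (x n)) : ℝ) : ℂ) * e (n * θ) -
      (sieveEnergy R z : ℂ) * ∑ n ∈ Finset.Ico lo hi, e (n * θ)) := by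
    rw [mul_sub, Finset.mul_sum, ← mul_assoc, ← Finset.mul_sum]
    congr 1
    · refine Finset.sum_congr rfl fun n _ => ?_
      rw [majorant, Complex.ofReal_mul, mul_assoc]
    · rw [majorantMean, Complex.ofReal_mul]
  rw [e1, norm_mul, Complex.norm_real, Real.norm_of_nonneg hC0]
  refine (mul_le_mul_of_nonneg_left h hC0).trans ?_
  have hlen : 2 * ((hi - lo : ℕ) : ℝ) ≤ M := by
    have : 2 * (hi - lo) ≤ M := by omega
    exact_mod_cast this
  have hE := sieveEnergy_nonneg R z
  rw [add_mul, div_mul_cancel₀ _ hMr.ne', add_assoc, mul_add]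
  refine add_le_add ?_ ?_
  · calc C * (2 * (sieveEnergy R z / √z) * ((hi - lo : ℕ) : ℝ))
        = C * sieveEnergy R z / √z * (2 * ((hi - lo : ℕ) : ℝ)) := by ring
      _ ≤ C * sieveEnergy R z / √z * M := mul_le_mul_of_nonneg_left hlen (by positivity)
  · calc C * ((R : ℝ) ^ 8 + (R : ℝ) ^ 4 * (J * V)) ≤ R * ((R : ℝ) ^ 8 + (R : ℝ) ^ 4 * (J * V)) :=
        mul_le_mul_of_nonneg_right hCR (by positivity)
      _ = _ := by ring

lemma zmodLift_le {M : ℕ} {S : Finset ℕ} {g : ℕ → ℝ} {K : ℝ} (hK : 0 ≤ K) (hg : ∀ n ∈ S, g n ≤ K)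
    (y : ZMod M) : zmodLift M S g y ≤ K := by
  unfold zmodLift
  split_ifs with h
  · exact hg _ h
  · exact hK

lemma zmodLift_nonneg {M : ℕ} {S : Finset ℕ} {g : ℕ → ℝ} (hg : ∀ n ∈ S, 0 ≤ g n)
    (y : ZMod M) : 0 ≤ zmodLift M S g y := by
  unfold zmodLift
  split_ifs with h
  · exact hg _ h
  · exact le_rfl

lemma zmodLift_le_zmodLift {M : ℕ} {S T : Finset ℕ} (hST : S ⊆ T) {g h : ℕ → ℝ}
    (hgh : ∀ n ∈ S, g n ≤ h n) (hh : ∀ n ∈ T, 0 ≤ h n) (y : ZMod M) :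
    zmodLift M S g y ≤ zmodLift M T h y := by
  by_cases hy : y.val ∈ S
  · rw [zmodLift, zmodLift, if_pos hy, if_pos (hST hy)]; exact hgh _ hy
  · rw [zmodLift, if_neg hy]; exact zmodLift_nonneg hh y

/-- A function on `ZMod M` with many weighted progressions and controlled sup norm has a
nontrivial progression in its support. -/
lemma exists_nontrivial_of_threeAP {M : ℕ} [NeZero M] {f : ZMod M → ℝ} {Fm c : ℝ}
    (hf : ∀ x, 0 ≤ f x) (hFm : ∀ x, f x ≤ Fm) (hsum : ∑ x, f x ≤ 2 * M)
    (hsmall : 2 * Fm ^ 2 < c * M) (h : c * (M : ℝ) ^ 2 ≤ threeAP f) :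
    ∃ x d, d ≠ 0 ∧ f x ≠ 0 ∧ f (x + d) ≠ 0 ∧ f (x + 2 * d) ≠ 0 := by
  have hM : (0 : ℝ) < M := by exact_mod_cast Nat.pos_of_ne_zero (NeZero.ne M)
  by_contra hcon
  have h0 : ∀ x d, d ≠ 0 → f x * f (x + d) * f (x + 2 * d) = 0 := by
    intro x d hd
    by_contra h1
    exact hcon ⟨x, d, hd, fun h2 => h1 (by rw [h2]; ring), fun h2 => h1 (by rw [h2]; ring),
      fun h2 => h1 (by rw [h2]; ring)⟩
  have h1 : threeAP f = ∑ x, f x ^ 3 := by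
    unfold threeAP
    refine Finset.sum_congr rfl fun x _ => ?_
    rw [Finset.sum_eq_single 0 (fun d _ hd => h0 x d hd) (by simp)]
    simp; ring
  have h2 : ∑ x, f x ^ 3 ≤ ∑ x, Fm ^ 2 * f x := by
    refine Finset.sum_le_sum fun x _ => ?_
    have := pow_le_pow_left₀ (hf x) (hFm x) 2
    nlinarith [hf x]
  rw [← Finset.mul_sum] at h2
  nlinarith [sq_nonneg Fm]

/-- Lifting a progression modulo `M` to the integers. -/
lemma add_eq_two_mul_of_zmod {M : ℕ} [NeZero M] {X : ℕ} (hM : 2 * X < M) {y d : ZMod M}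
    (h1 : y.val ≤ X) (h2 : (y + d).val ≤ X) (h3 : (y + 2 * d).val ≤ X) :
    y.val + (y + 2 * d).val = 2 * (y + d).val := by
  have h : ((y.val + (y + 2 * d).val : ℕ) : ZMod M) = ((2 * (y + d).val : ℕ) : ZMod M) := by
    push_cast
    rw [ZMod.natCast_zmod_val, ZMod.natCast_zmod_val, ZMod.natCast_zmod_val]; ring
  rw [ZMod.natCast_eq_natCast_iff'] at h
  rwa [Nat.mod_eq_of_lt (by omega), Nat.mod_eq_of_lt (by omega)] at h

/-- Restriction estimate for functions bounded by all the majorants. -/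
lemma restriction_of_majorants {R w W b J lo hi M : ℕ} [NeZero M] (hR : 1 ≤ R)
    (hw : Real.exp 80 ≤ w) (hW : ∀ p, p.Prime → p ∣ W → p ≤ w) (hJ : 1 ≤ J) (hM : 2 * hi < M)
    (x : ℕ → ℝ) {V : ℝ} (hV0 : 0 ≤ V)
    (hV : ∀ (ϑ : ℝ) (f : ℤ), f ≠ 0 → |f| < J →
      ‖∑ n ∈ Finset.Ico lo hi, e (n * ϑ + f * x n)‖ ≤ V)
    (hκ : 32 * ((R : ℝ) * J) ^ 4 * (((R : ℝ) ^ 9 + (R : ℝ) ^ 5 * (J * V)) / M) ≤ 1)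
    {f : ZMod M → ℝ} (hf : ∀ y, 0 ≤ f y) (hsum : ∑ y, f y ≤ 2 * M) (hFm : ∀ y, f y ≤ R * J)
    (hmaj : ∀ z, w ≤ z → ∀ y,
      f y ≤ zmodLift M (Finset.Ico lo hi) (majorant R w z W b J x) y) :
    ∑ r, ‖ft f r‖ ^ (5 / 2 : ℝ) ≤ 194 * (M : ℝ) ^ (5 / 2 : ℝ) := by
  have hMr : (0 : ℝ) < M := by exact_mod_cast Nat.pos_of_ne_zero (NeZero.ne M)
  have hw0 : 0 < w := by
    have : (0 : ℝ) < w := (Real.exp_pos _).trans_le hw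
    exact_mod_cast this
  have hsqw : 8 ≤ √(w : ℝ) := by
    rw [Real.le_sqrt (by norm_num) (Nat.cast_nonneg _)]
    have := Real.add_one_le_exp (80 : ℝ)
    have h8 : (8 : ℝ) ^ 2 = 64 := by norm_num
    rw [h8]; linarith
  set κ := ((R : ℝ) ^ 9 + (R : ℝ) ^ 5 * (J * V)) / M with hκdef
  have hκ0 : 0 ≤ κ := by rw [hκdef]; positivity
  have hRJ : 1 ≤ R * J := Nat.mul_pos hR hJ
  set L := Nat.log 2 ((R * J) ^ 2) + 1 with hL
  have hL1 : ((R : ℝ) * J) ^ 2 ≤ 2 ^ L := by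
    have := (Nat.lt_pow_succ_log_self (b := 2) (by norm_num) ((R * J) ^ 2)).le
    exact_mod_cast this
  have hL2 : (2 : ℝ) ^ L ≤ 2 * ((R : ℝ) * J) ^ 2 := by
    have := Nat.pow_log_le_self 2 (x := (R * J) ^ 2) (by positivity)
    have h2 : 2 ^ L ≤ 2 * (R * J) ^ 2 := by rw [hL, pow_succ]; omega
    exact_mod_cast h2
  have hRJr : (1 : ℝ) ≤ (R : ℝ) * J := by exact_mod_cast hRJ
  have hκL : 8 * (4 : ℝ) ^ L * κ ≤ 1 := by
    have h4 : (4 : ℝ) ^ L = (2 ^ L) ^ 2 := by rw [← pow_mul, mul_comm, pow_mul]; norm_num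
    have h5 : (4 : ℝ) ^ L ≤ 4 * ((R : ℝ) * J) ^ 4 := by
      rw [h4]
      calc ((2 : ℝ) ^ L) ^ 2 ≤ (2 * ((R : ℝ) * J) ^ 2) ^ 2 := pow_le_pow_left₀ (by positivity) hL2 2
        _ = _ := by ring
    refine le_trans (mul_le_mul_of_nonneg_right ?_ hκ0) hκ
    linarith
  have hres := restriction_of_level_sets (f := f) (B := 4) (Fm := R * J) (J := L) hf hsum hFm ?_
    (by norm_num) ?_
  · norm_num at hres ⊢; exact hres
  · have : √((1 / 2 : ℝ) ^ L) ≤ 1 / ((R : ℝ) * J) := by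
      rw [Real.sqrt_le_left (by positivity), div_pow, one_pow, div_pow, one_pow]
      exact one_div_le_one_div_of_le (by positivity) hL1
    calc √((1 / 2 : ℝ) ^ L) * (R * J) ≤ 1 / ((R : ℝ) * J) * (R * J) :=
          mul_le_mul_of_nonneg_right this (by positivity)
      _ = 1 := div_mul_cancel₀ _ (by positivity)
  · intro j hj
    set z := w * 2 ^ (6 * j) with hz
    have hwz : w ≤ z := Nat.le_mul_of_pos_right _ (by positivity)
    have hmean : majorantMean R w z ≤ (2 : ℝ) ^ ((3 * j : ℝ) / 10) := by
      refine (majorantMean_le hR).trans ?_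
      have h1 := one_le_sieveMass hR z
      rw [div_le_iff₀ (by linarith)]
      have h2 := sieveMass_le_mul_two_pow R hw (6 * j)
      refine h2.trans (le_of_eq ?_)
      congr 2
      push_cast; ring
    have hmean2 : (2 : ℝ) ^ ((3 * j : ℝ) / 10) ≤ 2 ^ j := by
      rw [← Real.rpow_natCast 2 j]
      apply Real.rpow_le_rpow_of_exponent_le (by norm_num)
      have : (0 : ℝ) ≤ j := Nat.cast_nonneg _
      linarith
    have hsqz : √(z : ℝ) = √(w : ℝ) * 8 ^ j := by
      rw [hz]; push_cast
      rw [Real.sqrt_mul (Nat.cast_nonneg _)]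
      congr 1
      rw [Real.sqrt_eq_iff_mul_self_eq (by positivity) (by positivity), ← mul_pow, pow_mul]
      norm_num
    have hσ : 4 * (majorantMean R w z / √z + κ) ≤ ((1 / 2 : ℝ) ^ j) ^ 2 := by
      have h1 : majorantMean R w z / √z ≤ 1 / (8 * 4 ^ j) := by
        rw [hsqz, div_le_div_iff₀ (by positivity) (by positivity), one_mul]
        have h8 : (8 : ℝ) ^ j = 2 ^ j * 4 ^ j := by rw [← mul_pow]; norm_num
        have h2 := hmean.trans hmean2
        calc majorantMean R w z * (8 * 4 ^ j) ≤ 2 ^ j * (8 * 4 ^ j) :=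
              mul_le_mul_of_nonneg_right h2 (by positivity)
          _ = 8 * 8 ^ j := by rw [h8]; ring
          _ ≤ _ := mul_le_mul_of_nonneg_right hsqw (by positivity)
      have h2 : κ ≤ 1 / (8 * 4 ^ j) := by
        rw [le_div_iff₀ (by positivity)]
        have : (4 : ℝ) ^ j ≤ 4 ^ L := pow_le_pow_right₀ (by norm_num) hj
        have h3 : 8 * (4 : ℝ) ^ j * κ ≤ 8 * 4 ^ L * κ :=
          mul_le_mul_of_nonneg_right (by linarith) hκ0
        linarith
      have h3 : ((1 / 2 : ℝ) ^ j) ^ 2 = 8 * (1 / (8 * 4 ^ j)) := by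
        rw [← pow_mul, mul_comm j 2, pow_mul, div_pow, div_pow]
        norm_num
        ring
      rw [h3]; linarith
    have hcl := card_large_spectrum (f := f) (ε := (1 / 2 : ℝ) ^ j) (K := majorantMean R w z)
      (u := zmodLift M (Finset.Ico lo hi) fun _ => majorantMean R w z)
      (by positivity) hf (hmaj z hwz) (zmodLift_le (majorantMean_nonneg R w z) fun _ _ => le_rfl)
      (majorantMean_nonneg R w z)
      (norm_ft_majorant_sub_le hR (hw0.trans_le hwz) (fun p hp h => (hW p hp h).trans hwz) hJ hM x
        hV0 hV) hsum hσ
    refine hcl.trans ?_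
    have h5 : ((2 : ℝ) ^ j) ^ (23 / 10 : ℝ) = (2 : ℝ) ^ ((3 * j : ℝ) / 10) * 4 ^ j := by
      rw [← Real.rpow_natCast 2 j, ← Real.rpow_mul (by norm_num), ← Real.rpow_natCast 4 j,
        show (4 : ℝ) = 2 ^ (2 : ℝ) by norm_num, ← Real.rpow_mul (by norm_num),
        ← Real.rpow_add (by norm_num)]
      congr 1; ring
    have h6 : 1 / ((1 / 2 : ℝ) ^ j) ^ 2 = 4 ^ j := by
      rw [← pow_mul, mul_comm j 2, pow_mul, ← one_div_pow]; norm_num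
    rw [div_eq_mul_one_div, h6, h5, mul_assoc]
    exact mul_le_mul_of_nonneg_left (mul_le_mul_of_nonneg_right hmean (by positivity)) (by norm_num)

/-- Three-term progressions in a set of integers with small prime factors avoided and with phases
close to integers, given equidistribution of the phases. -/
theorem exists_progression {α : ℝ} (hα : 0 < α) :
    ∃ τ > 0, ∃ c > 0, ∃ M₀ : ℕ, ∀ (R w W b J lo hi M : ℕ) (x : ℕ → ℝ) (V : ℝ) (B : Finset ℕ),
      M.Prime → M₀ ≤ M → 1 ≤ R → Real.exp 80 ≤ w → (∀ p, p.Prime → p ∣ W → p ≤ w) → 1 ≤ J →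
      2 * hi < M → 0 ≤ V →
      (∀ (ϑ : ℝ) (f : ℤ), f ≠ 0 → |f| < J →
        ‖∑ n ∈ Finset.Ico lo hi, e (n * ϑ + f * x n)‖ ≤ V) →
      B ⊆ Finset.Ico lo hi →
      (∀ n ∈ B, ∀ q, 1 ≤ q → q ≤ R → Nat.Coprime (W * n + b) q) →
      (∀ n ∈ B, nd (x n) * (2 * J) ≤ 1) →
      1 / √w + ((R : ℝ) ^ 9 + (R : ℝ) ^ 5 * (J * V)) / M ≤ τ →
      32 * ((R : ℝ) * J) ^ 4 * (((R : ℝ) ^ 9 + (R : ℝ) ^ 5 * (J * V)) / M) ≤ 1 →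
      2 * ((R : ℝ) * J) ^ 2 < c * M →
      α * M ≤ 4 / π ^ 2 * sieveMass R w * J * B.card →
      ∃ n₁ ∈ B, ∃ n₂ ∈ B, ∃ n₃ ∈ B, n₁ + n₃ = 2 * n₂ ∧ n₁ ≠ n₂ := by
  obtain ⟨τ, hτ, c, hc, M₀, H⟩ := transference hα (Cr := 194) (by norm_num)
  refine ⟨min τ 1, lt_min hτ one_pos, c, hc, M₀, ?_⟩
  intro R w W b J lo hi M x V B hMp hM₀ hR hw hW hJ hM hV0 hV hB hco hnd hτ' hκ hsmall hmass
  have : Fact M.Prime := ⟨hMp⟩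
  have hMr : (0 : ℝ) < M := by exact_mod_cast hMp.pos
  have hw0 : 0 < w := by
    have : (0 : ℝ) < w := (Real.exp_pos _).trans_le hw
    exact_mod_cast this
  have hS : ∀ n ∈ Finset.Ico lo hi, n < M := fun n hn => by
    have := (Finset.mem_Ico.1 hn).2; omega
  have hG := one_le_sieveMass hR w
  have hpi : 4 / π ^ 2 ≤ 1 := by
    rw [div_le_one (by positivity)]
    nlinarith [Real.pi_gt_three]
  have hv0 : (0 : ℝ) ≤ 4 / π ^ 2 * sieveMass R w * J := by positivity
  set f := zmodLift M B fun _ => 4 / π ^ 2 * sieveMass R w * J with hf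
  have hf0 : ∀ y, 0 ≤ f y := zmodLift_nonneg fun _ _ => hv0
  have hmaj : ∀ z, w ≤ z → ∀ y,
      f y ≤ zmodLift M (Finset.Ico lo hi) (majorant R w z W b J x) y := by
    intro z hz
    refine zmodLift_le_zmodLift hB (fun n hn => ?_) fun n _ => majorant_nonneg _ _ _ _ _ _ _ _
    have h1 : sieveWeight R z (W * n + b) = (sieveMass R z : ℝ) :=
      sieveWeight_eq fun q hq => hco n hn q (mem_sieveModuli.1 hq).1.1 (mem_sieveModuli.1 hq).1.2
    have h2 := one_le_sieveMass hR z
    have h3 := le_fejer hJ (hnd n hn)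
    rw [majorant, h1, Complex.norm_real, Real.norm_of_nonneg (by linarith)]
    have h4 : sieveMass R w / sieveMass R z ^ 2 * (sieveMass R z ^ 2 * (J * fejer J (x n))) =
        fejer J (x n) * (sieveMass R w * J) := by
      have : sieveMass R z ^ 2 ≠ 0 := by positivity
      generalize fejer J (x n) = G
      field_simp
    rw [h4, mul_assoc]
    exact mul_le_mul_of_nonneg_right h3 (by positivity)
  have hFm : ∀ y, f y ≤ R * J := by
    refine zmodLift_le (by positivity) fun n _ => ?_
    refine mul_le_mul_of_nonneg_right ?_ (Nat.cast_nonneg _)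
    calc 4 / π ^ 2 * sieveMass R w ≤ 1 * sieveMass R w :=
          mul_le_mul_of_nonneg_right hpi (by linarith)
      _ ≤ R := by rw [one_mul]; exact sieveMass_le R w
  have hmean : majorantMean R w w ≤ 1 := by
    refine (majorantMean_le hR).trans (le_of_eq (div_self (by linarith)))
  have hft : ∀ r, ‖ft (zmodLift M (Finset.Ico lo hi) (majorant R w w W b J x)) r -
      ft (zmodLift M (Finset.Ico lo hi) fun _ => majorantMean R w w) r‖ ≤ min τ 1 * M := by
    intro r
    refine (norm_ft_majorant_sub_le hR hw0 hW hJ hM x hV0 hV r).trans ?_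
    refine mul_le_mul_of_nonneg_right (le_trans ?_ hτ') hMr.le
    gcongr
  have hsum : ∑ y, f y ≤ 2 * M := by
    have h1 : ∑ y, f y ≤ ∑ y, zmodLift M (Finset.Ico lo hi) (majorant R w w W b J x) y :=
      Finset.sum_le_sum fun y _ => hmaj w le_rfl y
    have h2 : ∀ g : ZMod M → ℝ, ft g 0 = ((∑ y, g y : ℝ) : ℂ) := by
      intro g; unfold ft; push_cast
      refine Finset.sum_congr rfl fun y _ => ?_
      rw [zero_mul, AddChar.map_zero_eq_one, mul_one]
    have h3 := hft 0
    rw [h2, h2, ← Complex.ofReal_sub, Complex.norm_real, Real.norm_eq_abs] at h3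
    have h4 := (le_abs_self _).trans h3
    have h5 : ∑ y : ZMod M, zmodLift M (Finset.Ico lo hi) (fun _ => majorantMean R w w) y ≤ M := by
      refine (Finset.sum_le_sum (g := fun _ => (1 : ℝ)) fun y _ =>
        zmodLift_le zero_le_one (fun _ _ => hmean) y).trans ?_
      simp [ZMod.card]
    have h6 : min τ 1 * (M : ℝ) ≤ 1 * M := mul_le_mul_of_nonneg_right (min_le_right _ _) hMr.le
    linarith
  have hres := restriction_of_majorants hR hw hW hJ hM x hV0 hV hκ hf0 hsum hFm hmaj
  have hAP := H M inferInstance hM₀ f _ _ hf0 (hmaj w le_rfl)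
    (zmodLift_le zero_le_one fun _ _ => hmean) (fun r => (hft r).trans
      (mul_le_mul_of_nonneg_right (min_le_left _ _) hMr.le)) hres (by
      rw [hf, sum_zmodLift fun n hn => hS n (hB hn), Finset.sum_const, nsmul_eq_mul]
      linarith)
  obtain ⟨y, d, hd, h1, h2, h3⟩ := exists_nontrivial_of_threeAP hf0 hFm hsum hsmall hAP
  have hmem : ∀ y, f y ≠ 0 → y.val ∈ B := by
    intro y hy
    by_contra h
    exact hy (by rw [hf, zmodLift, if_neg h])
  have hle : ∀ n ∈ B, n ≤ hi := fun n hn => (Finset.mem_Ico.1 (hB hn)).2.le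
  refine ⟨y.val, hmem _ h1, (y + d).val, hmem _ h2, (y + 2 * d).val, hmem _ h3,
    add_eq_two_mul_of_zmod hM (hle _ (hmem _ h1)) (hle _ (hmem _ h2)) (hle _ (hmem _ h3)), ?_⟩
  intro h
  have := ZMod.val_injective M h
  exact hd (by simpa using this.symm)

lemma norm_sum_e_neg (S : Finset ℕ) (u : ℕ → ℝ) :
    ‖∑ n ∈ S, e (-u n)‖ = ‖∑ n ∈ S, e (u n)‖ := by
  rw [← Complex.norm_conj, map_sum]
  congr 1
  refine Finset.sum_congr rfl fun n _ => ?_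
  rw [conj_e, neg_neg]

/-- Van der Corput bound for the twisted phase `nϑ + f (φ(Wn + b) + s)` on a block inside
`[N/4, N]`. -/
lemma PhiData.norm_twisted_sum_le {φ φ₁ q q₁ : ℝ → ℝ} {Y : ℝ} (P : PhiData φ φ₁ q q₁ Y)
    {N W b lo hi : ℕ} (hN : Y ≤ (N : ℝ) / 4) (hW : 0 < W)
    (hlo1 : 1 ≤ lo) (hlo : (N : ℝ) / 4 ≤ W * lo + b) (hhi : ∀ n < hi, W * n + b ≤ N)
    {J : ℝ} (hJ : J * q N * (W : ℝ) ^ 2 ≤ 1) (ϑ s : ℝ) {f : ℤ} (hf : f ≠ 0)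
    (hfJ : ((|f| : ℤ) : ℝ) ≤ J) :
    ‖∑ n ∈ Finset.Ico lo hi, e (n * ϑ + f * (φ ((W * n + b : ℕ) : ℝ) + s))‖ ≤
      256 * √(J * q N) * N + 16 / √(q N) := by
  have hY := P.one_le
  have hqN : 0 < q N := P.qpos N (by linarith)
  have hN0 : (0 : ℝ) < N := by linarith
  have hWr : (1 : ℝ) ≤ W := by exact_mod_cast hW
  have hf1 : (1 : ℝ) ≤ ((|f| : ℤ) : ℝ) := by exact_mod_cast Int.one_le_abs hf
  set F : ℝ := ((|f| : ℤ) : ℝ) with hF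
  have hJ0 : 0 < J := by linarith
  set lam : ℝ := F * q N * (W : ℝ) ^ 2 with hlam
  have hlam0 : 0 < lam := by positivity
  have hlam1 : lam ≤ 1 := le_trans (by rw [hlam]; gcongr) hJ
  have hdiff : ∀ n : ℕ, lo ≤ n → n + 2 < hi →
      lam ≤ -F * (φ ((W * (n + 2) + b : ℕ) : ℝ) - 2 * φ ((W * (n + 1) + b : ℕ) : ℝ)
        + φ ((W * n + b : ℕ) : ℝ)) ∧
      -F * (φ ((W * (n + 2) + b : ℕ) : ℝ) - 2 * φ ((W * (n + 1) + b : ℕ) : ℝ)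
        + φ ((W * n + b : ℕ) : ℝ)) ≤ 16 * lam := by
    intro n hn hn2
    have hnr : (lo : ℝ) ≤ n := by exact_mod_cast hn
    have h1 : (N : ℝ) / 4 ≤ ((W * n + b : ℕ) : ℝ) := by
      push_cast
      have : (W : ℝ) * lo ≤ W * n := mul_le_mul_of_nonneg_left hnr (by linarith)
      linarith
    have e1 : ((W * (n + 2) + b : ℕ) : ℝ) = ((W * n + b : ℕ) : ℝ) + 2 * W := by push_cast; ring
    have e2 : ((W * (n + 1) + b : ℕ) : ℝ) = ((W * n + b : ℕ) : ℝ) + W := by push_cast; ring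
    have h2 : ((W * (n + 2) + b : ℕ) : ℝ) ≤ N := by exact_mod_cast hhi _ hn2
    rw [e1] at h2
    have h := P.second_diff hN h1 (show (0 : ℝ) < W by linarith) h2
    rw [e1, e2]
    generalize φ (((W * n + b : ℕ) : ℝ) + 2 * W) - 2 * φ (((W * n + b : ℕ) : ℝ) + W)
      + φ ((W * n + b : ℕ) : ℝ) = Z at h ⊢
    rw [hlam]
    have h3 := mul_le_mul_of_nonneg_left h.1 (by linarith : 0 ≤ F)
    have h4 := mul_le_mul_of_nonneg_left h.2 (by linarith : 0 ≤ F)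
    constructor <;> linarith
  have key : ∀ ϑ' : ℝ, ‖∑ n ∈ Finset.Ico lo hi,
      e (n * ϑ' + -F * (φ ((W * n + b : ℕ) : ℝ) + s))‖ ≤
      16 * (16 * lam * (hi - lo : ℕ) + 1) / √lam := by
    intro ϑ'
    refine second_derivative_test
      (fun n : ℕ => (n : ℝ) * ϑ' + -F * (φ ((W * n + b : ℕ) : ℝ) + s)) lo hi hlam0 hlam1
      (fun n h1 h2 => ?_) (fun n h1 h2 => ?_) (by norm_num)
    · have h := (hdiff n h1 h2).1
      have e1 : ((n + 2 : ℕ) : ℝ) = n + 2 := by push_cast; ring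
      have e2 : ((n + 1 : ℕ) : ℝ) = n + 1 := by push_cast; ring
      simp only [e1, e2]; linarith
    · have h := (hdiff n h1 h2).2
      have e1 : ((n + 2 : ℕ) : ℝ) = n + 2 := by push_cast; ring
      have e2 : ((n + 1 : ℕ) : ℝ) = n + 1 := by push_cast; ring
      simp only [e1, e2]; linarith
  have hkey : ‖∑ n ∈ Finset.Ico lo hi, e (n * ϑ + f * (φ ((W * n + b : ℕ) : ℝ) + s))‖ ≤
      16 * (16 * lam * (hi - lo : ℕ) + 1) / √lam := by
    rcases abs_choice f with h | h
    · rw [← norm_sum_e_neg]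
      refine le_trans (le_of_eq ?_) (key (-ϑ))
      congr 1
      refine Finset.sum_congr rfl fun n _ => ?_
      rw [hF, h]; ring_nf
    · refine le_trans (le_of_eq ?_) (key ϑ)
      congr 1
      refine Finset.sum_congr rfl fun n _ => ?_
      rw [hF, h, Int.cast_neg, neg_neg]
  refine hkey.trans ?_
  have hs : 0 < √lam := Real.sqrt_pos.2 hlam0
  have hsplit : 16 * (16 * lam * (hi - lo : ℕ) + 1) / √lam
      = 256 * (√lam * (hi - lo : ℕ)) + 16 / √lam := by
    have : lam = √lam * √lam := (Real.mul_self_sqrt hlam0.le).symm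
    field_simp
    rw [Real.sq_sqrt hlam0.le]
    ring
  rw [hsplit]
  have hWL : (W : ℝ) * (hi - lo : ℕ) ≤ N := by
    rcases Nat.eq_zero_or_pos (hi - lo) with h | h
    · rw [h]; simp
    · have h1 := hhi (hi - 1) (by omega)
      have h2 : W * (hi - lo) ≤ W * (hi - 1) := Nat.mul_le_mul_left _ (by omega)
      exact_mod_cast (by omega : W * (hi - lo) ≤ N)
  have h1 : √lam * (hi - lo : ℕ) ≤ √(J * q N) * N := by
    have : √lam ≤ √(J * q N) * W := by
      rw [hlam, Real.sqrt_mul (by positivity), Real.sqrt_sq (by linarith)]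
      gcongr
    calc √lam * (hi - lo : ℕ) ≤ √(J * q N) * W * (hi - lo : ℕ) := by gcongr
      _ = √(J * q N) * (W * (hi - lo : ℕ)) := by ring
      _ ≤ _ := by gcongr
  have h2 : 16 / √lam ≤ 16 / √(q N) := by
    have : q N ≤ lam := by
      rw [hlam]
      have h3 : 1 ≤ F * (W : ℝ) ^ 2 := one_le_mul_of_one_le_of_one_le hf1 (one_le_pow₀ hWr)
      nlinarith
    have h4 := Real.sqrt_le_sqrt this
    have h5 : 0 < √(q N) := Real.sqrt_pos.2 hqN
    gcongr
  linarith

/-- Pigeonhole over reduced residue classes. -/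
lemma exists_dense_residue {W : ℕ} (hW : 0 < W) {S : Finset ℕ} (hS : ∀ p ∈ S, W.Coprime p) :
    ∃ b < W, S.card ≤ W.totient * (S.filter fun p => p % W = b).card := by
  by_contra hcon
  push Not at hcon
  have hmaps : ∀ p ∈ S, p % W ∈ (Finset.range W).filter W.Coprime := by
    intro p hp
    rw [Finset.mem_filter, Finset.mem_range]
    refine ⟨Nat.mod_lt _ hW, ?_⟩
    have := hS p hp
    rwa [Nat.Coprime, Nat.gcd_comm, ← Nat.gcd_rec]
  have hcard : S.card = ∑ b ∈ (Finset.range W).filter W.Coprime,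
      (S.filter fun p => p % W = b).card := Finset.card_eq_sum_card_fiberwise hmaps
  have htot : ((Finset.range W).filter W.Coprime).card = W.totient := rfl
  have hpos := Nat.totient_pos.2 hW
  have hsum : ∑ b ∈ (Finset.range W).filter W.Coprime,
      W.totient * (S.filter fun p => p % W = b).card <
      ∑ _b ∈ (Finset.range W).filter W.Coprime, S.card := by
    refine Finset.sum_lt_sum_of_nonempty (Finset.card_pos.1 (htot ▸ hpos)) fun b hb => ?_
    exact hcon b (Finset.mem_range.1 (Finset.mem_filter.1 hb).1)
  rw [← Finset.mul_sum, ← hcard, Finset.sum_const, htot, smul_eq_mul] at hsum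
  exact lt_irrefl _ hsum

/-- Passing from a residue class to the interior of the block of quotients loses at most two
elements. -/
lemma card_residue_le {W b N : ℕ} {S : Finset ℕ} (hS : S ⊆ Finset.Ioc (N / 4) N) :
    (S.filter fun p => p % W = b).card ≤
      ((Finset.Ico (N / 4 / W + 1) (N / W)).filter fun n => W * n + b ∈ S).card + 2 := by
  set B := (Finset.Ico (N / 4 / W + 1) (N / W)).filter fun n => W * n + b ∈ S with hB
  have h1 : (S.filter fun p => p % W = b).card ≤
      (insert (N / 4 / W) (insert (N / W) B)).card := by
    refine Finset.card_le_card_of_injOn (fun p => p / W) ?_ ?_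
    · intro p hp
      have hp' := Finset.mem_filter.1 (Finset.mem_coe.1 hp)
      have hp2 := Finset.mem_Ioc.1 (hS hp'.1)
      have hl : N / 4 / W ≤ p / W := Nat.div_le_div_right hp2.1.le
      have hu : p / W ≤ N / W := Nat.div_le_div_right hp2.2
      have hpe : W * (p / W) + b = p := by rw [← hp'.2]; exact Nat.div_add_mod p W
      rw [Finset.mem_coe, Finset.mem_insert, Finset.mem_insert, hB, Finset.mem_filter,
        Finset.mem_Ico]
      beta_reduce
      rw [hpe]
      by_cases h3 : p / W = N / 4 / W
      · exact Or.inl h3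
      by_cases h4 : p / W = N / W
      · exact Or.inr (Or.inl h4)
      · exact Or.inr (Or.inr ⟨⟨by omega, by omega⟩, hp'.1⟩)
    · intro p hp p' hp' h
      have hp1 := (Finset.mem_filter.1 (Finset.mem_coe.1 hp)).2
      have hp2 := (Finset.mem_filter.1 (Finset.mem_coe.1 hp')).2
      have h' : p / W = p' / W := h
      rw [← Nat.div_add_mod p W, ← Nat.div_add_mod p' W, h', hp1, hp2]
  have h2 := Finset.card_insert_le (N / 4 / W) (insert (N / W) B)
  have h3 := Finset.card_insert_le (N / W) B
  omega

/-- The smallness conditions of the transference argument hold for power-size parameters. -/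
lemma eventually_parameters {τ c W : ℝ} (hτ : 0 < τ) (hc : 0 < c) (hW : 0 < W) :
    ∀ᶠ N : ℕ in atTop, ∀ R J M : ℝ, 0 ≤ R → R ≤ (N : ℝ) ^ (1 / 100 : ℝ) → 0 ≤ J →
      J ≤ (N : ℝ) ^ (1 / 65 : ℝ) → N / W ≤ M →
      (R ^ 9 + R ^ 5 * (J * (N : ℝ) ^ (13 / 25 : ℝ))) / M ≤ τ ∧
      32 * (R * J) ^ 4 * ((R ^ 9 + R ^ 5 * (J * (N : ℝ) ^ (13 / 25 : ℝ))) / M) ≤ 1 ∧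
      2 * (R * J) ^ 2 < c * M := by
  filter_upwards [eventually_const_mul_rpow_le (2 * W / τ) (show (3 / 5 : ℝ) < 1 by norm_num),
    eventually_const_mul_rpow_le (64 * W) (show (1 / 9 + 3 / 5 : ℝ) < 1 by norm_num),
    eventually_const_mul_rpow_le (4 * W / c) (show (1 / 9 : ℝ) < 1 by norm_num),
    eventually_ge_atTop 1] with N h1 h2 h3 hN1 R J M hR0 hR hJ0 hJ hM
  have hN : (1 : ℝ) ≤ N := by exact_mod_cast hN1
  have hN0 : (0 : ℝ) < N := by linarith
  rw [Real.rpow_one] at h1 h2 h3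
  have hM0 : 0 < M := lt_of_lt_of_le (by positivity) hM
  rw [div_le_iff₀ hW] at hM
  have hpow : ∀ (t : ℝ) (k : ℕ), ((N : ℝ) ^ t) ^ k = (N : ℝ) ^ (t * k) := fun t k => by
    rw [Real.rpow_mul hN0.le, Real.rpow_natCast]
  have hle : ∀ {s t : ℝ}, s ≤ t → (N : ℝ) ^ s ≤ (N : ℝ) ^ t := fun h =>
    Real.rpow_le_rpow_of_exponent_le hN h
  have hT : R ^ 9 + R ^ 5 * (J * (N : ℝ) ^ (13 / 25 : ℝ)) ≤ 2 * (N : ℝ) ^ (3 / 5 : ℝ) := by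
    have a1 : R ^ 9 ≤ (N : ℝ) ^ (3 / 5 : ℝ) :=
      (pow_le_pow_left₀ hR0 hR 9).trans (by rw [hpow]; exact hle (by norm_num))
    have a2 : R ^ 5 * (J * (N : ℝ) ^ (13 / 25 : ℝ)) ≤ (N : ℝ) ^ (3 / 5 : ℝ) := by
      calc R ^ 5 * (J * (N : ℝ) ^ (13 / 25 : ℝ))
          ≤ ((N : ℝ) ^ (1 / 100 : ℝ)) ^ 5 * ((N : ℝ) ^ (1 / 65 : ℝ) * (N : ℝ) ^ (13 / 25 : ℝ)) := by
            gcongr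
        _ ≤ _ := by
            rw [hpow, ← Real.rpow_add hN0, ← Real.rpow_add hN0]
            exact hle (by norm_num)
    linarith
  have hT0 : 0 ≤ R ^ 9 + R ^ 5 * (J * (N : ℝ) ^ (13 / 25 : ℝ)) := by positivity
  have hRJ : R * J ≤ (N : ℝ) ^ (1 / 100 + 1 / 65 : ℝ) := by
    rw [Real.rpow_add hN0]; gcongr
  have hRJ0 : 0 ≤ R * J := by positivity
  have hRJ4 : (R * J) ^ 4 ≤ (N : ℝ) ^ (1 / 9 : ℝ) :=
    (pow_le_pow_left₀ hRJ0 hRJ 4).trans (by rw [hpow]; exact hle (by norm_num))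
  have hRJ2 : (R * J) ^ 2 ≤ (N : ℝ) ^ (1 / 9 : ℝ) :=
    (pow_le_pow_left₀ hRJ0 hRJ 2).trans (by rw [hpow]; exact hle (by norm_num))
  generalize R ^ 9 + R ^ 5 * (J * (N : ℝ) ^ (13 / 25 : ℝ)) = T at *
  refine ⟨?_, ?_, ?_⟩
  · rw [div_le_iff₀ hM0]
    rw [div_mul_eq_mul_div, div_le_iff₀ hτ] at h1
    have : W * T ≤ W * (τ * M) := by nlinarith
    exact le_of_mul_le_mul_left this hW
  · rw [← mul_div_assoc, div_le_one hM0]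
    have a : 32 * (R * J) ^ 4 * T ≤ 32 * (N : ℝ) ^ (1 / 9 : ℝ) * (2 * (N : ℝ) ^ (3 / 5 : ℝ)) := by
      gcongr
    rw [Real.rpow_add hN0] at h2
    have : W * (32 * (R * J) ^ 4 * T) ≤ W * M := by nlinarith
    exact le_of_mul_le_mul_left this hW
  · rw [div_mul_eq_mul_div, div_le_iff₀ hc] at h3
    have hp : 0 < (N : ℝ) ^ (1 / 9 : ℝ) := by positivity
    have : W * (2 * (R * J) ^ 2) < W * (c * M) := by nlinarith
    exact lt_of_mul_lt_mul_left this hW.le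

lemma one_le_two_mul_floor {D : ℝ} (hD : 0 < D) :
    1 ≤ 2 * D * ((max 1 ⌊1 / D⌋₊ : ℕ) : ℝ) := by
  have h1 : ((1 : ℕ) : ℝ) ≤ ((max 1 ⌊1 / D⌋₊ : ℕ) : ℝ) := Nat.cast_le.2 (le_max_left _ _)
  have h2 : ((⌊1 / D⌋₊ : ℕ) : ℝ) ≤ ((max 1 ⌊1 / D⌋₊ : ℕ) : ℝ) := Nat.cast_le.2 (le_max_right _ _)
  have h3 := Nat.lt_floor_add_one (1 / D)
  rw [Nat.cast_one] at h1
  rw [div_lt_iff₀ hD] at h3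
  nlinarith

lemma nd_mul_floor_le {D t : ℝ} (hD : 0 < D) (ht : nd t ≤ D / 2) :
    nd t * (2 * ((max 1 ⌊1 / D⌋₊ : ℕ) : ℝ)) ≤ 1 := by
  have h0 := nd_nonneg t
  rcases le_total ⌊1 / D⌋₊ 1 with h | h
  · rw [max_eq_left h, Nat.cast_one]
    linarith [nd_le_half t]
  · rw [max_eq_right h]
    have h3 := Nat.floor_le (show 0 ≤ 1 / D by positivity)
    rw [le_div_iff₀ hD] at h3
    have h4 : (0 : ℝ) ≤ ⌊1 / D⌋₊ := Nat.cast_nonneg _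
    nlinarith

lemma floor_max_le {D : ℝ} (hD : 0 < D) : ((max 1 ⌊1 / D⌋₊ : ℕ) : ℝ) ≤ 1 + 1 / D := by
  have h3 := Nat.floor_le (show 0 ≤ 1 / D by positivity)
  have : (0 : ℝ) < 1 / D := by positivity
  rw [Nat.cast_max, Nat.cast_one]
  exact max_le (by linarith) (by linarith)

/-- Members of `P_h` in the window have `φ(p) + D/2` close to an integer. -/
lemma nd_phiOf_le {c : ℝ} (hc₁ : 1 ≤ c) (F : Fc c) {φ₁ q q₁ : ℝ → ℝ} {Y : ℝ}
    (hY : F.toFun F.x₀ ≤ Y) (P : PhiData (phiOf F) φ₁ q q₁ Y) {N p : ℕ}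
    (hN : Y ≤ (N : ℝ) / 4) (hp : p ∈ Ph F) (h1 : (N : ℝ) / 4 ≤ p) (h2 : p ≤ N) :
    nd (phiOf F p + 5 * (phiOf F N / N) / 2) ≤ 5 * (phiOf F N / N) / 2 := by
  obtain ⟨m, hm1, hm2⟩ := (floor_eq_iff_phiOf F hc₁ (p := p) (by linarith)).1 hp.2
  have h3 := (P.incr_bounds hN h1 (by exact_mod_cast h2)).2
  refine (nd_le _ m).trans ?_
  rw [abs_le]
  constructor <;> linarith

lemma PhiData.eventually_sizes {φ φ₁ q q₁ : ℝ → ℝ} {Y : ℝ} (P : PhiData φ φ₁ q q₁ Y) (W : ℝ) :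
    ∀ᶠ N : ℕ in atTop, ∀ J : ℝ, 1 ≤ J → J ≤ 1 + 1 / (5 * (φ N / N)) →
      J ≤ (N : ℝ) ^ (1 / 65 : ℝ) ∧ J * q N * W ^ 2 ≤ 1 ∧
        256 * √(J * q N) * N + 16 / √(q N) ≤ (N : ℝ) ^ (13 / 25 : ℝ) := by
  have hY := P.one_le
  filter_upwards [P.eventually_le_q, P.eventually_le_φ,
    eventually_const_mul_rpow_le 2 (show (1 / 71 : ℝ) < 1 / 65 by norm_num),
    eventually_const_mul_rpow_le (2 * φ₁ Y) (show (-64 / 65 : ℝ) < -97 / 100 by norm_num),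
    eventually_const_mul_rpow_le (W ^ 2) (show (-97 / 100 : ℝ) < 0 by norm_num),
    eventually_const_mul_rpow_le 512 (show (103 / 200 : ℝ) < 13 / 25 by norm_num),
    eventually_const_mul_rpow_le 32 (show (61 / 120 : ℝ) < 13 / 25 by norm_num),
    (tendsto_natCast_atTop_atTop (R := ℝ)).eventually_ge_atTop (4 * Y)]
    with N hq hφ h1 h2 h3 h4 h5 hNY J hJ1 hJ
  have hN : (1 : ℝ) ≤ N := by linarith
  have hN0 : (0 : ℝ) < N := by linarith
  have hNY' : Y ≤ (N : ℝ) / 4 := by linarith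
  have hqN : 0 < q N := P.qpos N (by linarith)
  have hφN : 0 < φ N := P.pos N (by linarith)
  have hJ65 : J ≤ (N : ℝ) ^ (1 / 65 : ℝ) := by
    have a1 : 1 / (5 * (φ N / N)) ≤ (N : ℝ) ^ (1 / 71 : ℝ) := by
      rw [div_le_iff₀ (by positivity)]
      have a2 : (N : ℝ) ^ (1 / 71 : ℝ) * (N : ℝ) ^ (70 / 71 : ℝ) = N := by
        rw [← Real.rpow_add hN0]; norm_num
      have a3 : (N : ℝ) ≤ (N : ℝ) ^ (1 / 71 : ℝ) * φ N := by
        have := mul_le_mul_of_nonneg_left hφ (show 0 ≤ (N : ℝ) ^ (1 / 71 : ℝ) by positivity)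
        rwa [a2] at this
      have a4 : 1 ≤ (N : ℝ) ^ (1 / 71 : ℝ) * (φ N / N) := by
        rw [← mul_div_assoc, le_div_iff₀ hN0, one_mul]; exact a3
      linarith
    have a5 : 1 ≤ (N : ℝ) ^ (1 / 71 : ℝ) := Real.one_le_rpow hN (by norm_num)
    linarith
  have hJq : J * q N ≤ (N : ℝ) ^ (-97 / 100 : ℝ) := by
    refine le_trans ?_ h2
    calc J * q N ≤ (N : ℝ) ^ (1 / 65 : ℝ) * (2 * φ₁ Y / N) :=
          mul_le_mul hJ65 (P.q_mul_le hNY') hqN.le (by positivity)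
      _ = 2 * φ₁ Y * ((N : ℝ) ^ (1 / 65 : ℝ) * (N : ℝ) ^ (-1 : ℝ)) := by
          rw [Real.rpow_neg_one]; ring
      _ = _ := by rw [← Real.rpow_add hN0]; norm_num
  refine ⟨hJ65, ?_, ?_⟩
  · rw [Real.rpow_zero] at h3
    exact (mul_le_mul_of_nonneg_right hJq (sq_nonneg W)).trans (by linarith)
  · have hs1 : √(J * q N) * N ≤ (N : ℝ) ^ (103 / 200 : ℝ) := by
      have a1 : √(J * q N) ≤ (N : ℝ) ^ (-97 / 200 : ℝ) := by
        refine Real.sqrt_le_iff.2 ⟨by positivity, ?_⟩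
        rw [← Real.rpow_natCast, ← Real.rpow_mul hN0.le]
        refine hJq.trans (le_of_eq ?_)
        norm_num
      calc √(J * q N) * N ≤ (N : ℝ) ^ (-97 / 200 : ℝ) * (N : ℝ) ^ (1 : ℝ) := by
            rw [Real.rpow_one]; exact mul_le_mul_of_nonneg_right a1 hN0.le
        _ = _ := by rw [← Real.rpow_add hN0]; norm_num
    have hs2 : 16 / √(q N) ≤ 16 * (N : ℝ) ^ (61 / 120 : ℝ) := by
      have a1 : (N : ℝ) ^ (-(61 / 120) : ℝ) ≤ √(q N) := by
        refine Real.le_sqrt_of_sq_le ?_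
        rw [← Real.rpow_natCast, ← Real.rpow_mul hN0.le]
        refine le_trans (le_of_eq ?_) hq
        norm_num
      have a2 : 0 < √(q N) := Real.sqrt_pos.2 hqN
      rw [div_le_iff₀ a2]
      have a3 : (N : ℝ) ^ (61 / 120 : ℝ) * (N : ℝ) ^ (-(61 / 120) : ℝ) = 1 := by
        rw [← Real.rpow_add hN0]; norm_num
      have a4 := mul_le_mul_of_nonneg_left a1 (show 0 ≤ (N : ℝ) ^ (61 / 120 : ℝ) by positivity)
      linarith
    linarith

/-- The sieve level `⌊N^{1/100}⌋`. -/
lemma eventually_sieve_level : ∀ᶠ N : ℕ in atTop,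
    1 ≤ ⌊(N : ℝ) ^ (1 / 100 : ℝ)⌋₊ ∧ Real.log N ≤ 200 * Real.log ⌊(N : ℝ) ^ (1 / 100 : ℝ)⌋₊ ∧
      ⌊(N : ℝ) ^ (1 / 100 : ℝ)⌋₊ ≤ N / 4 := by
  filter_upwards [eventually_const_mul_rpow_le 2 (show (1 / 200 : ℝ) < 1 / 100 by norm_num),
    eventually_const_mul_rpow_le 4 (show (1 / 100 : ℝ) < 1 by norm_num),
    eventually_ge_atTop 1] with N h1 h2 hN1
  have hN : (1 : ℝ) ≤ N := by exact_mod_cast hN1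
  have hN0 : (0 : ℝ) < N := by linarith
  have a1 : 1 ≤ (N : ℝ) ^ (1 / 200 : ℝ) := Real.one_le_rpow hN (by norm_num)
  have a2 := Nat.lt_floor_add_one ((N : ℝ) ^ (1 / 100 : ℝ))
  have a3 := Nat.floor_le (show 0 ≤ (N : ℝ) ^ (1 / 100 : ℝ) by positivity)
  have a4 : (N : ℝ) ^ (1 / 200 : ℝ) ≤ ⌊(N : ℝ) ^ (1 / 100 : ℝ)⌋₊ := by linarith
  refine ⟨?_, ?_, ?_⟩
  · exact_mod_cast a1.trans a4
  · have := Real.log_le_log (by positivity) a4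
    rw [Real.log_rpow hN0] at this
    linarith
  · rw [Nat.le_div_iff_mul_le (by norm_num)]
    rw [Real.rpow_one] at h2
    have : (⌊(N : ℝ) ^ (1 / 100 : ℝ)⌋₊ : ℝ) * 4 ≤ N := by linarith
    exact_mod_cast this

lemma PhiData.eventually_le_div_log {φ φ₁ q q₁ : ℝ → ℝ} {Y : ℝ} (P : PhiData φ φ₁ q q₁ Y)
    (C : ℝ) : ∀ᶠ N : ℕ in atTop, C ≤ φ N / Real.log N := by
  have h2 := tendsto_natCast_atTop_atTop.eventually
    ((isLittleO_log_rpow_atTop (r := 1 / 3) (by norm_num)).def one_pos)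
  filter_upwards [P.eventually_le_φ, h2, eventually_ge_atTop 3,
    eventually_const_mul_rpow_le C (show (1 / 3 : ℝ) < 70 / 71 by norm_num),
    eventually_const_mul_rpow_le 1 (show (1 / 3 : ℝ) < 70 / 71 by norm_num)] with N h3 h4 h5 h6 h7
  have h5' : (3 : ℝ) ≤ N := by exact_mod_cast h5
  have hl : 0 < Real.log N := Real.log_pos (by linarith)
  rw [Real.norm_of_nonneg hl.le, Real.norm_of_nonneg (by positivity), one_mul] at h4
  rw [le_div_iff₀ hl]
  rcases le_total C 0 with hC | hC
  · have : 0 ≤ (N : ℝ) ^ (70 / 71 : ℝ) := by positivity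
    nlinarith
  · exact (mul_le_mul_of_nonneg_left h4 hC).trans (h6.trans h3)

lemma mass_chain {a M W N φN J t B l s : ℝ} (ha : 0 ≤ a) (hJ : 0 ≤ J) (hB : 0 ≤ B)
    (h1 : M * W ≤ 4 * N) (h2 : N ≤ 10 * φN * J) (h3 : a * φN ≤ 2 * (t * B) * l)
    (h4 : l * t ≤ 400 * (s * W)) : a * M * W ≤ 32000 * (s * J * B) * W :=
  calc a * M * W = a * (M * W) := by ring
    _ ≤ a * (4 * N) := mul_le_mul_of_nonneg_left h1 ha
    _ ≤ a * (4 * (10 * φN * J)) := mul_le_mul_of_nonneg_left (by linarith) ha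
    _ = 40 * J * (a * φN) := by ring
    _ ≤ 40 * J * (2 * (t * B) * l) := mul_le_mul_of_nonneg_left h3 (by positivity)
    _ = 80 * J * B * (l * t) := by ring
    _ ≤ 80 * J * B * (400 * (s * W)) := mul_le_mul_of_nonneg_left h4 (by positivity)
    _ = _ := by ring

/-- A solution of `n₁ + n₃ = 2n₂` lifts to a progression in the residue class. -/
lemma exists_progression_of_quotients {A : Set ℕ} {W b n₁ n₂ n₃ : ℕ} (hW : 0 < W)
    (h₁ : W * n₁ + b ∈ A) (h₂ : W * n₂ + b ∈ A) (h₃ : W * n₃ + b ∈ A)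
    (hsum : n₁ + n₃ = 2 * n₂) (hne : n₁ ≠ n₂) :
    ∃ a ∈ A, ∃ d : ℕ, d ≠ 0 ∧ a + d ∈ A ∧ a + 2 * d ∈ A := by
  wlog h : n₁ < n₂ generalizing n₁ n₃
  · exact this h₃ h₁ (by omega) (by omega) (by omega)
  obtain ⟨k, rfl⟩ := Nat.exists_eq_add_of_lt h
  obtain rfl : n₃ = n₁ + 2 * (k + 1) := by omega
  refine ⟨W * n₁ + b, h₁, W * (k + 1), (Nat.mul_pos hW k.succ_pos).ne', ?_, ?_⟩
  · convert h₂ using 1; ring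
  · convert h₃ using 1; ring

end RothPh

open RothPh in
/-- **Roth's theorem in the primes `P_h`** (Theorem 1.2 of the paper).
For `c ∈ [1, 72/71)` and `h ∈ F_c`, every `A ⊆ P_h` with positive relative upper
density contains a nontrivial three-term arithmetic progression. -/
theorem roth_in_Ph {c : ℝ} (hc₁ : 1 ≤ c) (hc₂ : c < 72 / 71) (F : Fc c)
    (A : Set ℕ) (hA : A ⊆ Ph F)
    (hdens : 0 < Filter.limsup (fun N : ℕ =>
      (Nat.card ↥(A ∩ Set.Icc 1 N) : ℝ) / (Nat.card ↥(Ph F ∩ Set.Icc 1 N) : ℝ))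
      Filter.atTop) :
    ∃ a ∈ A, ∃ d : ℕ, d ≠ 0 ∧ a + d ∈ A ∧ a + 2 * d ∈ A := by
  obtain ⟨a, ha, hfreq⟩ := exists_dense_block hc₁ hc₂ F A hdens
  obtain ⟨φ₁, q, q₁, Y, hY, P⟩ := exists_phiData F hc₁ hc₂
  have hY1 := P.one_le
  set κ : ℝ := 4 / π ^ 2 with hκ
  have hκ0 : 0 < κ := by positivity
  obtain ⟨τ, hτ, c', hc', M₀, hprog⟩ :=
    exists_progression (α := κ * (a / 32000)) (by positivity)
  obtain ⟨w, hw⟩ := exists_nat_ge (max (Real.exp 80) ((2 / τ) ^ 2))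
  have hw80 : Real.exp 80 ≤ w := (le_max_left _ _).trans hw
  have hwτ : 1 / √(w : ℝ) ≤ τ / 2 := by
    have h1 : 2 / τ ≤ √(w : ℝ) := Real.le_sqrt_of_sq_le ((le_max_right _ _).trans hw)
    have h2 : 0 < 2 / τ := by positivity
    calc 1 / √(w : ℝ) ≤ 1 / (2 / τ) := one_div_le_one_div_of_le h2 h1
      _ = τ / 2 := by rw [one_div_div]
  set W := primorial w with hWdef
  have hW0 : 0 < W := primorial_pos w
  have hWr : (0 : ℝ) < W := by exact_mod_cast hW0
  have hWp : ∀ p, p.Prime → p ∣ W → p ≤ w := fun p hp h => hp.dvd_primorial_iff.1 h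
  have htot : (0 : ℝ) < W.totient := by exact_mod_cast Nat.totient_pos.2 hW0
  have hev : ∀ᶠ N : ℕ in atTop, 4 * Y ≤ (N : ℝ) ∧ 4 * w ≤ N ∧ W ≤ N ∧ W * M₀ ≤ N ∧ 3 ≤ N :=
    (tendsto_natCast_atTop_atTop.eventually_ge_atTop (4 * Y)).and
      ((eventually_ge_atTop _).and ((eventually_ge_atTop _).and
        ((eventually_ge_atTop _).and (eventually_ge_atTop _))))
  obtain ⟨N, hdense, ⟨hNY, hNw, hNW, hNM, hN3⟩, hpar, hsize, ⟨hR1, hlogR, hR4⟩, hlog⟩ :=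
    (hfreq.and_eventually (hev.and ((eventually_parameters (half_pos hτ) hc' hWr).and
      ((P.eventually_sizes W).and (eventually_sieve_level.and
        (P.eventually_le_div_log (4 * W.totient / a))))))).exists
  have hNY' : Y ≤ (N : ℝ) / 4 := by linarith
  have hN0 : (0 : ℝ) < N := by linarith
  have hφN : 0 < phiOf F N := P.pos N (by linarith)
  have hlN : 0 < Real.log N := Real.log_pos (by
    have : (3 : ℝ) ≤ N := by exact_mod_cast hN3
    linarith)
  set R := ⌊(N : ℝ) ^ (1 / 100 : ℝ)⌋₊ with hR
  have hRle : (R : ℝ) ≤ (N : ℝ) ^ (1 / 100 : ℝ) := Nat.floor_le (by positivity)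
  set D : ℝ := 5 * (phiOf F N / N) with hD
  have hD0 : 0 < D := by positivity
  set J := max 1 ⌊1 / D⌋₊ with hJ
  have hJ1 : 1 ≤ J := le_max_left _ _
  obtain ⟨hJ65, hJq, hVle⟩ := hsize J (by exact_mod_cast hJ1) (floor_max_le hD0)
  set S := window A N with hS
  have hSsub : S ⊆ Finset.Ioc (N / 4) N := Finset.filter_subset _ _
  have hSA : ∀ p ∈ S, p ∈ A := fun p hp => (Finset.mem_filter.1 hp).2
  have hSprime : ∀ p ∈ S, p.Prime := fun p hp => (hA (hSA p hp)).1
  have hSlow : ∀ p ∈ S, N / 4 < p := fun p hp => (Finset.mem_Ioc.1 (hSsub hp)).1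
  have hSlowr : ∀ p : ℕ, N / 4 < p → (N : ℝ) / 4 ≤ p := fun p hp => by
    have : N ≤ 4 * p := by omega
    have : (N : ℝ) ≤ 4 * p := by exact_mod_cast this
    linarith
  obtain ⟨b, hb, hcard⟩ := exists_dense_residue hW0 (S := S) fun p hp => by
    refine ((hSprime p hp).coprime_iff_not_dvd.2 fun h => ?_).symm
    have h1 := hWp p (hSprime p hp) h
    have h2 := hSlow p hp
    omega
  set lo := N / 4 / W + 1 with hlo
  set hi := N / W with hhi
  set B := (Finset.Ico lo hi).filter fun n => W * n + b ∈ S with hB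
  have hcardB : (S.filter fun p => p % W = b).card ≤ B.card + 2 := card_residue_le hSsub
  have hBS : ∀ n ∈ B, W * n + b ∈ S := fun n hn => (Finset.mem_filter.1 hn).2
  have hhi1 : 1 ≤ hi := (Nat.one_le_div_iff hW0).2 hNW
  obtain ⟨M, hMp, hM1, hM2⟩ := Nat.exists_prime_lt_and_le_two_mul (2 * hi) (by omega)
  have hWhi : (W : ℝ) * hi ≤ N := by exact_mod_cast Nat.mul_div_le N W
  have hMlo : (N : ℝ) / W ≤ M := by
    rw [div_le_iff₀ hWr]
    have h1 : N < W * (hi + 1) := Nat.lt_mul_div_succ N hW0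
    have h2 : W * (hi + 1) ≤ W * M := Nat.mul_le_mul_left _ (by omega)
    have h3 : N ≤ M * W := by rw [mul_comm]; omega
    exact_mod_cast h3
  obtain ⟨hp1, hp2, hp3⟩ := hpar R J M (Nat.cast_nonneg _) hRle (Nat.cast_nonneg _) hJ65 hMlo
  have hM0 : M₀ ≤ M := by
    have h1 : M₀ ≤ hi := (Nat.le_div_iff_mul_le hW0).2 (by rw [mul_comm]; exact hNM)
    omega
  have hBcard : a * (phiOf F N / Real.log N) ≤ 2 * (W.totient * B.card) := by
    have h1 : (S.card : ℝ) ≤ W.totient * (B.card + 2) := by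
      exact_mod_cast hcard.trans (Nat.mul_le_mul_left _ hcardB)
    rw [div_le_iff₀ ha] at hlog
    linarith
  have hmass : κ * (a / 32000) * M ≤ κ * sieveMass R w * J * B.card := by
    have h1 := totient_primorial_mul_sieveMass_le R w
    rw [← hWdef, div_mul_eq_mul_div, div_le_iff₀ hWr] at h1
    have h2 := log_le_sieveMass R
    have h3 := one_le_two_mul_floor hD0
    rw [← hJ, hD] at h3
    have hM4 : (M : ℝ) * W ≤ 4 * N := by
      have : (M : ℝ) ≤ 4 * hi := by exact_mod_cast (by omega : M ≤ 4 * hi)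
      have := mul_le_mul_of_nonneg_right this hWr.le
      linarith
    have hJN : (N : ℝ) ≤ 10 * phiOf F N * J := by
      have e1 : 2 * (5 * (phiOf F N / N)) * (J : ℝ) = 10 * phiOf F N * J / N := by ring
      rw [e1, le_div_iff₀ hN0] at h3
      linarith
    have hBc : a * phiOf F N ≤ 2 * (W.totient * B.card) * Real.log N := by
      rw [← mul_div_assoc, div_le_iff₀ hlN] at hBcard
      exact hBcard
    have hlogs : Real.log N * W.totient ≤ 400 * (sieveMass R w * W) := by
      have := mul_le_mul_of_nonneg_right (hlogR.trans (mul_le_mul_of_nonneg_left h2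
        (by norm_num : (0 : ℝ) ≤ 200))) htot.le
      linarith
    have hfin : a * M * W ≤ 32000 * (sieveMass R w * J * B.card) * W :=
      mass_chain ha.le (Nat.cast_nonneg _) (Nat.cast_nonneg _) hM4 hJN hBc hlogs
    have hfin' := le_of_mul_le_mul_right hfin hWr
    have h5 := mul_le_mul_of_nonneg_left hfin' (show 0 ≤ κ / 32000 by positivity)
    linarith
  have hloN : N / 4 < W * lo + b := by
    have := Nat.lt_mul_div_succ (N / 4) hW0
    rw [hlo]; omega
  obtain ⟨n₁, h₁, n₂, h₂, n₃, h₃, hsum, hne⟩ := hprog R w W b J lo hi M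
    (fun n => phiOf F ((W * n + b : ℕ) : ℝ) + D / 2) ((N : ℝ) ^ (13 / 25 : ℝ)) B hMp hM0 hR1 hw80
    hWp hJ1 hM1 (by positivity)
    (fun ϑ f hf hfJ => (P.norm_twisted_sum_le hNY' hW0 (Nat.le_add_left 1 _)
      (by exact_mod_cast hSlowr _ hloN)
      (fun n hn => by
        have h1 : W * (n + 1) ≤ W * hi := Nat.mul_le_mul_left _ hn
        have h2 : W * hi ≤ N := Nat.mul_div_le N W
        rw [mul_add] at h1
        omega)
      hJq ϑ (D / 2) hf (by exact_mod_cast hfJ.le)).trans hVle)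
    (Finset.filter_subset _ _)
    (fun n hn m hm1 hmR => by
      have hp := hBS n hn
      refine (hSprime _ hp).coprime_iff_not_dvd.2 fun h => ?_
      have h1 := Nat.le_of_dvd hm1 h
      have h2 := hSlow _ hp
      omega)
    (fun n hn => by
      have hp := hBS n hn
      exact nd_mul_floor_le hD0 (nd_phiOf_le hc₁ F hY P hNY' (hA (hSA _ hp))
        (hSlowr _ (hSlow _ hp)) (Finset.mem_Ioc.1 (hSsub hp)).2))
    (by linarith) hp2 hp3 hmass
  exact exists_progression_of_quotients hW0 (hSA _ (hBS _ h₁)) (hSA _ (hBS _ h₂))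
    (hSA _ (hBS _ h₃)) hsum hne
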